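/- Suppose Assumption (H) holds and, in addition, Assumption (A) holds: there exists a constant K > 0 such that |k(ρ)| ≤ K|P(ρ) − P(ρ*)| for all ρ > 0. Then for every R > 0, S ≥ 0 and every r ≥ RK/2 there exist constants M > 0 and σ > 0 (depending only on ρ*, R, K and S) such that: for every classical solution of the two-piston system with the normalization ∫_{a(t)}^{b(t)} ρ(t,x)dx = 1 for all t ≥ 0, with input given by the friction-like feedback law u(t) = −R v(t,a(t)) for t > 0, and with initial Lyapunov value V(a(0), b(0), ρ[0], v[0]) ≤ S, the estimate N(t) ≤ M exp(−σ t) N(0) holds for all t ≥ 0. -/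

import Mathlib

open MeasureTheory Set Filter

/-- `Q(ρ) = ρ ∫_{ρ*}^{ρ} P(τ)/τ² dτ − (P(ρ*)/ρ*)ρ + P(ρ*)`. -/
noncomputable def Qf (P : ℝ → ℝ) (ρs x : ℝ) : ℝ :=
  x * (∫ τ in ρs..x, P τ / τ ^ 2) - (P ρs / ρs) * x + P ρs

/-- `k(ρ) = ∫_{ρ*}^{ρ} μ(τ)/τ dτ`. -/
noncomputable def kf (μ : ℝ → ℝ) (ρs x : ℝ) : ℝ :=
  ∫ τ in ρs..x, μ τ / τ

/-- `G(ρ) = ∫_{ρ*}^{ρ} μ(l) l^{-3/2} √(Q(l)) dl`. -/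
noncomputable def Gf (P μ : ℝ → ℝ) (ρs x : ℝ) : ℝ :=
  ∫ l in ρs..x, μ l / l ^ ((3 : ℝ) / 2) * Real.sqrt (Qf P ρs l)

/-- Assumption (H): `G(ρ) → +∞` as `ρ → +∞`, `G(ρ) → −∞` as `ρ → 0⁺`,
and `k(ρ) → +∞` as `ρ → +∞`. -/
def AssumpH (P μ : ℝ → ℝ) (ρs : ℝ) : Prop :=
  Tendsto (Gf P μ ρs) atTop atTop ∧
  Tendsto (Gf P μ ρs) (nhdsWithin 0 (Ioi 0)) atBot ∧
  Tendsto (kf μ ρs) atTop atTop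

/-- Potential energy `U(a,b,ρ) = ∫_a^b Q(ρ(x)) dx`. -/
noncomputable def Uf (P : ℝ → ℝ) (ρs a b : ℝ) (ρ : ℝ → ℝ) : ℝ :=
  ∫ x in a..b, Qf P ρs (ρ x)

/-- Total mechanical energy `E`. -/
noncomputable def Ef (P : ℝ → ℝ) (ρs a b : ℝ) (ρ v : ℝ → ℝ) : ℝ :=
  (v a) ^ 2 / 2 + (v b) ^ 2 / 2 + (1 / 2) * (∫ x in a..b, ρ x * (v x) ^ 2)
    + Uf P ρs a b ρ

/-- Transformed energy `W`. -/
noncomputable def Wf (P μ : ℝ → ℝ) (ρs a b : ℝ) (ρ ρx v : ℝ → ℝ) : ℝ :=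
  (1 / 2) * (∫ x in a..b, (ρ x)⁻¹ * (ρ x * v x + μ (ρ x) * (ρ x)⁻¹ * ρx x) ^ 2)
    + (1 / 2) * (v b - kf μ ρs (ρ b)) ^ 2
    + (1 / 2) * (v a + kf μ ρs (ρ a)) ^ 2
    + Uf P ρs a b ρ

/-- Control Lyapunov functional `V = W + r E`. -/
noncomputable def Vf (P μ : ℝ → ℝ) (ρs r a b : ℝ) (ρ ρx v : ℝ → ℝ) : ℝ :=
  Wf P μ ρs a b ρ ρx v + r * Ef P ρs a b ρ v

/-- `f ∈ H¹(a,b)` with weak derivative `f'`:  `f' ∈ L¹ ∩ L²(a,b)` and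
`f(x) = f(a) + ∫_a^x f'(s) ds` on `[a,b]`. -/
def H1On (a b : ℝ) (f f' : ℝ → ℝ) : Prop :=
  IntervalIntegrable f' volume a b ∧
  IntervalIntegrable (fun s => (f' s) ^ 2) volume a b ∧
  ∀ x ∈ Icc a b, f x = f a + ∫ s in a..x, f' s

/-- A classical solution of the two-piston system (2.1)-(2.5) with boundary input `u`:
piston positions `a < b` (with velocities `a'`, `b'` and accelerations `a''`, `b''`),
gas density `ρ > 0` and velocity `v` on the moving domain `{(t,x) : a(t) ≤ x ≤ b(t)}`,
with the indicated partial derivatives, satisfying mass conservation, the momentum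
(Navier–Stokes) equation, the kinematic boundary conditions, and Newton's law for the
two pistons. -/
structure PistonSol (P μ : ℝ → ℝ) (Pext : ℝ) where
  /-- position of the left piston -/
  a : ℝ → ℝ
  /-- position of the right piston -/
  b : ℝ → ℝ
  a' : ℝ → ℝ
  b' : ℝ → ℝ
  a'' : ℝ → ℝ
  b'' : ℝ → ℝ
  /-- boundary control input -/
  u : ℝ → ℝ
  /-- gas density -/
  ρ : ℝ → ℝ → ℝ
  /-- gas velocity -/
  v : ℝ → ℝ → ℝ
  ρt : ℝ → ℝ → ℝ
  ρx : ℝ → ℝ → ℝ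
  vt : ℝ → ℝ → ℝ
  vx : ℝ → ℝ → ℝ
  u_cont : ContinuousOn u (Ici 0)
  hab : ∀ t, 0 ≤ t → a t < b t
  ha' : ∀ t, 0 ≤ t → HasDerivWithinAt a (a' t) (Ici 0) t
  hb' : ∀ t, 0 ≤ t → HasDerivWithinAt b (b' t) (Ici 0) t
  ha'_cont : ContinuousOn a' (Ici 0)
  hb'_cont : ContinuousOn b' (Ici 0)
  ha'' : ∀ t, 0 < t → HasDerivAt a' (a'' t) t
  hb'' : ∀ t, 0 < t → HasDerivAt b' (b'' t) t
  ρ_pos : ∀ t, 0 ≤ t → ∀ x ∈ Icc (a t) (b t), 0 < ρ t x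
  ρ_cont : ContinuousOn (fun p : ℝ × ℝ => ρ p.1 p.2)
    {p : ℝ × ℝ | 0 ≤ p.1 ∧ p.2 ∈ Icc (a p.1) (b p.1)}
  v_cont : ContinuousOn (fun p : ℝ × ℝ => v p.1 p.2)
    {p : ℝ × ℝ | 0 ≤ p.1 ∧ p.2 ∈ Icc (a p.1) (b p.1)}
  hρt : ∀ t, 0 < t → ∀ x ∈ Icc (a t) (b t), HasDerivAt (fun s => ρ s x) (ρt t x) t
  hρx : ∀ t, 0 ≤ t → ∀ x ∈ Icc (a t) (b t), HasDerivAt (fun y => ρ t y) (ρx t x) x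
  hvt : ∀ t, 0 < t → ∀ x ∈ Icc (a t) (b t), HasDerivAt (fun s => v s x) (vt t x) t
  hvx : ∀ t, 0 < t → ∀ x ∈ Icc (a t) (b t), HasDerivAt (fun y => v t y) (vx t x) x
  ρx_cont : ∀ t, 0 ≤ t → ContinuousOn (ρx t) (Icc (a t) (b t))
  vx_cont : ∀ t, 0 < t → ContinuousOn (vx t) (Icc (a t) (b t))
  /-- mass conservation `ρ_t + (ρ v)_x = 0` on `[a(t), b(t)]` -/
  mass_eq : ∀ t, 0 < t → ∀ x ∈ Icc (a t) (b t),
    ρt t x + (ρx t x * v t x + ρ t x * vx t x) = 0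
  /-- momentum equation `ρ(v_t + v v_x) = (μ(ρ) v_x − P(ρ))_x` on `(a(t), b(t))` -/
  momentum_eq : ∀ t, 0 < t → ∀ x ∈ Ioo (a t) (b t),
    HasDerivAt (fun y => μ (ρ t y) * vx t y - P (ρ t y))
      (ρ t x * (vt t x + v t x * vx t x)) x
  /-- `v(t, a(t)) = a'(t)` -/
  bc_a : ∀ t, 0 ≤ t → v t (a t) = a' t
  /-- `v(t, b(t)) = b'(t)` -/
  bc_b : ∀ t, 0 ≤ t → v t (b t) = b' t
  /-- Newton's law for the right piston -/
  newton_b : ∀ t, 0 < t →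
    b'' t = P (ρ t (b t)) - μ (ρ t (b t)) * vx t (b t) - Pext
  /-- Newton's law for the left (actuated) piston -/
  newton_a : ∀ t, 0 < t →
    a'' t = u t + Pext - P (ρ t (a t)) + μ (ρ t (a t)) * vx t (a t)

/-- The quantity `N(t)` measuring the deviation of the solution from the set of
equilibria. -/
noncomputable def Npiston {P μ : ℝ → ℝ} {Pext : ℝ} (ρs : ℝ)
    (sol : PistonSol P μ Pext) (t : ℝ) : ℝ :=
  Real.sqrt ((sol.v t (sol.a t)) ^ 2 + (sol.v t (sol.b t)) ^ 2)
  + sSup ((fun x => |sol.ρ t x - ρs|) '' Icc (sol.a t) (sol.b t))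
  + Real.sqrt ((sol.b t - sol.a t)⁻¹ * ∫ x in sol.a t..sol.b t, (sol.v t x) ^ 2)
  + Real.sqrt ((sol.b t - sol.a t) * ∫ x in sol.a t..sol.b t, (sol.ρx t x) ^ 2)
open MeasureTheory Set Filter Topology
open intervalIntegral (integral_interval_sub_left norm_integral_le_of_norm_le_const integral_hasDerivAt_right integral_eq_sub_of_hasDerivAt tendsto_integral_filter_of_dominated_convergence continuous_parametric_intervalIntegral_of_continuous' continuous_primitive integral_same integral_mono_on integral_congr)
open Real (norm_eq_abs dist_eq coe_toNNReal)

section PA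
lemma sd_tendsto {f f' : ℝ → ℝ} {x f'' : ℝ} (h1 : ∀ᶠ y in 𝓝 x, HasDerivAt f (f' y) y)
    (h2 : HasDerivAt f' f'' x) :
    Tendsto (fun h => (f (x + h) + f (x - h) - 2 * f x) / h ^ 2) (𝓝[>] 0) (𝓝 f'') := by
  rw [Metric.tendsto_nhds]
  intro ε hε
  have h3 := (hasDerivAt_iff_isLittleO.1 h2).def (half_pos (half_pos hε))
  obtain ⟨d1, hd1, H1⟩ := Metric.eventually_nhds_iff.1 h1
  obtain ⟨d2, hd2, H2⟩ := Metric.eventually_nhds_iff.1 h3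
  have hd : 0 < min d1 d2 := lt_min hd1 hd2
  filter_upwards [Ioo_mem_nhdsGT hd] with h hh
  have hhd1 : h < d1 := hh.2.trans_le (min_le_left _ _)
  have hhd2 : h < d2 := hh.2.trans_le (min_le_right _ _)
  have key := Convex.norm_image_sub_le_of_norm_hasDerivWithin_le (s := Icc 0 h)
    (f := fun s => f (x + s) + f (x - s) - 2 * f x - f'' * s ^ 2)
    (f' := fun s => f' (x + s) - f' (x - s) - 2 * f'' * s) (C := ε / 2 * h) (x := 0) (y := h) ?_ ?_
    (convex_Icc 0 h) (by simp [hh.1.le]) (by simp [hh.1.le])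
  · have e1 : (f (x + h) + f (x - h) - 2 * f x) / h ^ 2 - f''
        = (f (x + h) + f (x - h) - 2 * f x - f'' * h ^ 2) / h ^ 2 := by
      have := hh.1.ne'; field_simp
    have e2 : f (x + 0) + f (x - 0) - 2 * f x - f'' * 0 ^ 2 = 0 := by simp; ring
    simp only [e2, norm_eq_abs] at key
    rw [sub_zero, sub_zero] at key
    rw [dist_eq, e1, abs_div, abs_of_pos (pow_pos hh.1 2), div_lt_iff₀ (pow_pos hh.1 2)]
    rw [abs_of_pos hh.1] at key
    have := pow_pos hh.1 2
    nlinarith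
  · intro s hs
    have a1 : HasDerivAt (fun s => f (x + s)) (f' (x + s)) s := by
      have := (H1 (y := x + s) (by rw [dist_eq]; simp; rw [abs_of_nonneg hs.1]; linarith [hs.2]))
      exact this.comp_const_add x s
    have a2 : HasDerivAt (fun s => f (x - s)) (-f' (x - s)) s := by
      have := (H1 (y := x - s) (by rw [dist_eq]; simp; rw [abs_of_nonneg hs.1]; linarith [hs.2]))
      exact this.comp_const_sub x s
    have a3 : HasDerivAt (fun s : ℝ => f'' * s ^ 2) (2 * f'' * s) s := by
      exact ((hasDerivAt_pow 2 s).const_mul f'').congr_deriv (by norm_num; ring)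
    exact (((a1.fun_add a2).sub_const (2 * f x)).fun_sub a3).hasDerivWithinAt.congr_deriv (by ring)
  · intro s hs
    have b1 := H2 (y := x + s) (by rw [dist_eq]; simp; rw [abs_of_nonneg hs.1]; linarith [hs.2])
    have b2 := H2 (y := x - s) (by rw [dist_eq]; simp; rw [abs_of_nonneg hs.1]; linarith [hs.2])
    simp only [smul_eq_mul, norm_eq_abs] at b1 b2 ⊢
    have e : f' (x + s) - f' (x - s) - 2 * f'' * s
      = (f' (x + s) - f' x - (x + s - x) * f'') - (f' (x - s) - f' x - (x - s - x) * f'') := by ring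
    rw [e]
    have e1 : |x + s - x| = s := by simp [abs_of_nonneg hs.1]
    have e2 : |x - s - x| = s := by simp [abs_of_nonneg hs.1]
    rw [e1] at b1; rw [e2] at b2
    have := abs_sub (f' (x + s) - f' x - (x + s - x) * f'') (f' (x - s) - f' x - (x - s - x) * f'')
    have h5 := hs.2
    nlinarith
lemma convexOn_of_symm {g : ℝ → ℝ} {p q : ℝ} (hg : ContinuousOn g (Icc p q))
    (H : ∀ x ∈ Ioo p q, ∀ η > 0, ∀ᶠ h in 𝓝[>] 0, -η * h ^ 2 ≤ g (x + h) + g (x - h) - 2 * g x) :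
    ConvexOn ℝ (Icc p q) g := by
  have key : ∀ y ∈ Icc p q, ∀ z ∈ Icc p q, y < z → ∀ η > 0, ∀ w ∈ Icc y z,
      g w - (g y + (g z - g y) / (z - y) * (w - y)) - η * ((w - y) * (z - w)) ≤ 0 := by
    intro y hy z hz hyz η hη w hw
    set F : ℝ → ℝ := fun w => g w - (g y + (g z - g y) / (z - y) * (w - y)) - η * ((w - y) * (z - w)) with hF
    have hsub : Icc y z ⊆ Icc p q := Icc_subset_Icc hy.1 hz.2
    have hFc : ContinuousOn F (Icc y z) := by
      refine ((hg.mono hsub).sub ?_).sub ?_ <;> fun_prop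
    obtain ⟨m, hm, hmax⟩ := isCompact_Icc.exists_isMaxOn ⟨y, left_mem_Icc.2 hyz.le⟩ hFc
    have hFy : F y = 0 := by simp [hF]
    have hFz : F z = 0 := by
      have : z - y ≠ 0 := by linarith
      simp only [hF]; field_simp; ring
    refine (hmax hw : F w ≤ F m).trans ?_
    rcases eq_or_lt_of_le hm.1 with h | h
    · rw [← h, hFy]
    rcases eq_or_lt_of_le hm.2 with h' | h'
    · rw [h', hFz]
    exfalso
    have hh := H m ⟨by linarith [hy.1], by linarith [hz.2]⟩ η hη
    have hd : 0 < min (m - y) (z - m) := lt_min (by linarith) (by linarith)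
    obtain ⟨s, hs1, hs2⟩ := (hh.and (Ioo_mem_nhdsGT hd)).exists
    have l1 := hs2.2.trans_le (min_le_left _ _)
    have l2 := hs2.2.trans_le (min_le_right _ _)
    have m1 : F (m + s) ≤ F m := hmax ⟨by linarith [hs2.1], by linarith⟩
    have m2 : F (m - s) ≤ F m := hmax ⟨by linarith, by linarith [hs2.1]⟩
    simp only [hF] at m1 m2
    have := mul_pos hη (pow_pos hs2.1 2)
    nlinarith
  have key2 : ∀ y ∈ Icc p q, ∀ z ∈ Icc p q, y < z → ∀ w ∈ Icc y z,
      g w ≤ g y + (g z - g y) / (z - y) * (w - y) := by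
    intro y hy z hz hyz w hw
    refine le_of_forall_pos_le_add fun e he => ?_
    have hpos : 0 ≤ (w - y) * (z - w) := mul_nonneg (by linarith [hw.1]) (by linarith [hw.2])
    have := key y hy z hz hyz (e / ((w - y) * (z - w) + 1)) (by positivity) w hw
    have h2 : e / ((w - y) * (z - w) + 1) * ((w - y) * (z - w)) ≤ e := by
      rw [div_mul_eq_mul_div, div_le_iff₀ (by positivity)]; nlinarith
    linarith
  refine LinearOrder.convexOn_of_lt (convex_Icc p q) fun y hy z hz hyz α β hα hβ hαβ => ?_
  have hz' : z - y ≠ 0 := by linarith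
  have hβ' : α = 1 - β := by linarith
  have := key2 y hy z hz hyz (α • y + β • z) ⟨by simp; subst hβ'; nlinarith, by simp; subst hβ'; nlinarith⟩
  refine this.trans (le_of_eq ?_)
  simp only [smul_eq_mul]; subst hβ'; field_simp; ring
lemma convexOn_of_symm_l {g l : ℝ → ℝ} {p q : ℝ} (hg : ContinuousOn g (Icc p q)) (hl : Continuous l)
    (H : ∀ x ∈ Ioo p q, ∀ η > 0, ∀ᶠ h in 𝓝[>] 0, (l x - η) * h ^ 2 ≤ g (x + h) + g (x - h) - 2 * g x) :
    ConvexOn ℝ (Icc p q) (fun x => g x - ∫ y in p..x, ∫ z in p..y, l z) := by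
  have d1 : ∀ x, HasDerivAt (fun y => ∫ z in p..y, l z) (l x) x := fun x =>
    integral_hasDerivAt_right (hl.intervalIntegrable _ _)
      (hl.stronglyMeasurableAtFilter _ _) hl.continuousAt
  have c1 : Continuous (fun y => ∫ z in p..y, l z) :=
    continuous_iff_continuousAt.2 fun x => (d1 x).continuousAt
  have d2 : ∀ x, HasDerivAt (fun x => ∫ y in p..x, ∫ z in p..y, l z) (∫ z in p..x, l z) x :=
    fun x => integral_hasDerivAt_right (c1.intervalIntegrable _ _)
      (c1.stronglyMeasurableAtFilter _ _) c1.continuousAt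
  have c2 : Continuous (fun x => ∫ y in p..x, ∫ z in p..y, l z) :=
    continuous_iff_continuousAt.2 fun x => (d2 x).continuousAt
  refine convexOn_of_symm (hg.sub c2.continuousOn) fun x hx η hη => ?_
  have t := sd_tendsto (Eventually.of_forall d2) (d1 x)
  have t2 := t.eventually_lt_const (show l x < l x + η / 2 by linarith)
  filter_upwards [H x hx (η / 2) (half_pos hη), t2,
    self_mem_nhdsWithin] with h h1 h2 h3
  rw [div_lt_iff₀ (pow_pos h3 2)] at h2
  nlinarith
end PA
section PA
structure SC (v vt vxx β : ℝ → ℝ → ℝ) (s1 s2 x1 x2 C L B M : ℝ) : Prop where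
  vc : Continuous (Function.uncurry v)
  bc : Continuous (Function.uncurry β)
  hs : s1 < s2
  hx : x1 < x2
  hL : 0 ≤ L
  hB : ∀ s ∈ Icc s1 s2, ∀ x ∈ Icc x1 x2, |β s x| ≤ B
  hM : ∀ s ∈ Icc s1 s2, ∀ x ∈ Icc x1 x2, |v s x| ≤ M
  hLip : ∀ s ∈ Icc s1 s2, ∀ s' ∈ Icc s1 s2, ∀ x ∈ Icc x1 x2, |β s x - β s' x| ≤ L * |s - s'|
  dt : ∀ s ∈ Ioo s1 s2, ∀ x ∈ Ioo x1 x2, HasDerivAt (fun s => v s x) (vt s x) s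
  dxx : ∀ s ∈ Ioo s1 s2, ∀ x ∈ Ioo x1 x2,
    Tendsto (fun h => (v s (x + h) + v s (x - h) - 2 * v s x) / h ^ 2) (𝓝[>] 0) (𝓝 (vxx s x))
  ineq : ∀ s ∈ Ioo s1 s2, ∀ x ∈ Ioo x1 x2, β s x * vt s x - C ≤ vxx s x
noncomputable def sconv (v : ℝ → ℝ → ℝ) (s1 s2 e t x : ℝ) : ℝ :=
  sSup ((fun s => v s x - (s - t) ^ 2 / (2 * e)) '' Icc s1 s2)
namespace SC
variable {v vt vxx β : ℝ → ℝ → ℝ} {s1 s2 x1 x2 C L B M : ℝ}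
local notation "SC0" => SC v vt vxx β s1 s2 x1 x2 C L B M
lemma sc_cont (h : SC0) (e : ℝ) :
    Continuous (fun p : ℝ × ℝ => sconv v s1 s2 e p.1 p.2) := by
  have hvc := h.vc
  refine isCompact_Icc.continuous_sSup (f := fun (p : ℝ × ℝ) s => v s p.2 - (s - p.1) ^ 2 / (2 * e)) ?_
  have : Continuous (fun q : (ℝ × ℝ) × ℝ => v q.2 q.1.2) :=
    hvc.comp (continuous_snd.prodMk (continuous_snd.comp continuous_fst))
  exact this.sub (by fun_prop)
lemma sc_max (h : SC0) (e t x : ℝ) :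
    ∃ s ∈ Icc s1 s2, sconv v s1 s2 e t x = v s x - (s - t) ^ 2 / (2 * e) := by
  have hvc := h.vc
  have hc : ContinuousOn (fun s => v s x - (s - t) ^ 2 / (2 * e)) (Icc s1 s2) := by
    have : Continuous (fun s => v s x) := hvc.uncurry_right x
    exact (this.sub (by fun_prop)).continuousOn
  obtain ⟨s, hs, h1, -⟩ := isCompact_Icc.exists_sSup_image_eq_and_ge (nonempty_Icc.2 h.hs.le) hc
  exact ⟨s, hs, h1⟩
lemma sc_le (h : SC0) (e t x : ℝ) {s : ℝ} (hs : s ∈ Icc s1 s2) :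
    v s x - (s - t) ^ 2 / (2 * e) ≤ sconv v s1 s2 e t x := by
  have hvc := h.vc
  have hc : ContinuousOn (fun s => v s x - (s - t) ^ 2 / (2 * e)) (Icc s1 s2) := by
    have : Continuous (fun s => v s x) := hvc.uncurry_right x
    exact (this.sub (by fun_prop)).continuousOn
  exact le_csSup (isCompact_Icc.image_of_continuousOn hc).bddAbove ⟨s, hs, rfl⟩
lemma sc_close (h : SC0) {e t x s : ℝ} (he : 0 < e) (ht : t ∈ Icc s1 s2)
    (hx : x ∈ Icc x1 x2) (hs : s ∈ Icc s1 s2)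
    (hm : sconv v s1 s2 e t x = v s x - (s - t) ^ 2 / (2 * e)) : (s - t) ^ 2 ≤ 4 * M * e := by
  have h1 := h.sc_le e t x ht
  have h2 := abs_le.1 (h.hM s hs x hx)
  have h3 := abs_le.1 (h.hM t ht x hx)
  rw [hm] at h1
  simp only [sub_self, ne_eq, OfNat.ofNat_ne_zero, not_false_eq_true, zero_pow, zero_div, sub_zero] at h1
  have : (s - t) ^ 2 / (2 * e) ≤ 2 * M := by linarith
  rw [div_le_iff₀ (by positivity)] at this
  linarith
lemma sc_bd (h : SC0) {e t x : ℝ} (he : 0 < e) (ht : t ∈ Icc s1 s2)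
    (hx : x ∈ Icc x1 x2) : |sconv v s1 s2 e t x| ≤ M := by
  obtain ⟨s, hs, hm⟩ := h.sc_max e t x
  have h1 := h.sc_le e t x ht
  have h2 := abs_le.1 (h.hM s hs x hx)
  have h3 := abs_le.1 (h.hM t ht x hx)
  simp only [sub_self, ne_eq, OfNat.ofNat_ne_zero, not_false_eq_true, zero_pow, zero_div, sub_zero] at h1
  have : 0 ≤ (s - t) ^ 2 / (2 * e) := by positivity
  rw [abs_le]; constructor <;> linarith
lemma sc_lip (h : SC0) {e x : ℝ} (he : 0 < e) {t t' : ℝ}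
    (ht : t ∈ Icc s1 s2) (ht' : t' ∈ Icc s1 s2) :
    |sconv v s1 s2 e t x - sconv v s1 s2 e t' x| ≤ (s2 - s1) / e * |t - t'| := by
  have key : ∀ t ∈ Icc s1 s2, ∀ t' ∈ Icc s1 s2,
      sconv v s1 s2 e t x - sconv v s1 s2 e t' x ≤ (s2 - s1) / e * |t - t'| := by
    intro t ht t' ht'
    obtain ⟨s, hs, hm⟩ := h.sc_max e t x
    have h1 := h.sc_le e t' x hs
    have : (s - t') ^ 2 / (2 * e) - (s - t) ^ 2 / (2 * e) ≤ (s2 - s1) / e * |t - t'| := by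
      rw [← sub_div, div_mul_eq_mul_div, div_le_div_iff₀ (by positivity) he]
      have e1 : (s - t') ^ 2 - (s - t) ^ 2 = (t - t') * (2 * s - t - t') := by ring
      have e2 : |2 * s - t - t'| ≤ 2 * (s2 - s1) := by
        rw [abs_le]; constructor <;> linarith [hs.1, hs.2, ht.1, ht.2, ht'.1, ht'.2]
      have e3 : (t - t') * (2 * s - t - t') ≤ |t - t'| * (2 * (s2 - s1)) :=
        (le_abs_self _).trans (by rw [abs_mul]; gcongr)
      rw [e1]; nlinarith
    linarith
  rw [abs_le]
  have := key t ht t' ht'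
  have h2 := key t' ht' t ht
  rw [abs_sub_comm] at h2
  constructor <;> linarith
lemma sc_sd (h : SC0) {e t x : ℝ} (he : 0 < e) (ht : t ∈ Icc s1 s2)
    (hx : x ∈ Ioo x1 x2) (hs' : ∀ s ∈ Icc s1 s2, (s - t) ^ 2 ≤ 4 * M * e → s ∈ Ioo s1 s2) :
    ∃ p, |p| ≤ (s2 - s1) / e ∧
      (DifferentiableAt ℝ (fun t => sconv v s1 s2 e t x) t → deriv (fun t => sconv v s1 s2 e t x) t = p) ∧
      ∀ η > 0, ∀ᶠ k in 𝓝[>] 0, (β t x * p - (C + 4 * L * M) - η) * k ^ 2 ≤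
        sconv v s1 s2 e t (x + k) + sconv v s1 s2 e t (x - k) - 2 * sconv v s1 s2 e t x := by
  have hxI := Ioo_subset_Icc_self hx
  obtain ⟨s, hs, hm⟩ := h.sc_max e t x
  have hcl := h.sc_close he ht hxI hs hm
  have hsI := hs' s hs hcl
  refine ⟨(s - t) / e, ?_, ?_, ?_⟩
  · rw [abs_div, abs_of_pos he]; gcongr
    rw [abs_le]; constructor <;> linarith [hs.1, hs.2, ht.1, ht.2]
  · intro hd
    have hmin : IsLocalMin (fun t' => sconv v s1 s2 e t' x - (v s x - (s - t') ^ 2 / (2 * e))) t := by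
      refine Eventually.of_forall fun t' => ?_
      have := h.sc_le e t' x hs
      simp only; linarith
    have d1 : HasDerivAt (fun t' : ℝ => v s x - (s - t') ^ 2 / (2 * e)) ((s - t) / e) t := by
      have := ((((hasDerivAt_id t).const_sub s).pow 2).div_const (2 * e)).const_sub (v s x)
      exact this.congr_deriv (by norm_num; field_simp)
    have := hmin.hasDerivAt_eq_zero (hd.hasDerivAt.sub d1)
    linarith
  · intro η hη
    have hvt : vt s x = (s - t) / e := by
      have d1 : HasDerivAt (fun s' : ℝ => (s' - t) ^ 2 / (2 * e)) ((s - t) / e) s := by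
        have := (((hasDerivAt_id s).sub_const t).pow 2).div_const (2 * e)
        exact this.congr_deriv (by norm_num; field_simp)
      have hmax : IsLocalMax (fun s' => v s' x - (s' - t) ^ 2 / (2 * e)) s := by
        filter_upwards [Ioo_mem_nhds hsI.1 hsI.2] with s' h'
        rw [← hm]; exact h.sc_le e t x (Ioo_subset_Icc_self h')
      have := hmax.hasDerivAt_eq_zero ((h.dt s hsI x hx).sub d1)
      linarith
    have hi := h.ineq s hsI x hx
    rw [hvt] at hi
    have h5 : β t x * ((s - t) / e) - 4 * L * M ≤ β s x * ((s - t) / e) := by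
      have a1 := h.hLip t ht s hs x hxI
      have a2 : (β t x - β s x) * ((s - t) / e) ≤ 4 * L * M := by
        refine (le_abs_self _).trans ?_
        rw [abs_mul, abs_div, abs_of_pos he]
        calc |β t x - β s x| * (|s - t| / e) ≤ (L * |t - s|) * (|s - t| / e) := by gcongr
          _ = L * ((s - t) ^ 2 / e) := by rw [abs_sub_comm t s, ← sq_abs (s - t)]; ring
          _ ≤ L * (4 * M) := by
            refine mul_le_mul_of_nonneg_left ?_ h.hL
            rw [div_le_iff₀ he]; exact hcl
          _ = _ := by ring
      linarith
    have hlt : β t x * ((s - t) / e) - (C + 4 * L * M) - η < vxx s x := by linarith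
    filter_upwards [(h.dxx s hsI x hx).eventually_const_lt hlt, self_mem_nhdsWithin] with k hk hk0
    rw [lt_div_iff₀ (pow_pos hk0 2)] at hk
    have b1 := h.sc_le e t (x + k) hs
    have b2 := h.sc_le e t (x - k) hs
    rw [hm]; linarith
lemma sc_semi (h : SC0) {e t : ℝ} (he : 0 < e) (ht : t ∈ Icc s1 s2)
    (hs' : ∀ s ∈ Icc s1 s2, (s - t) ^ 2 ≤ 4 * M * e → s ∈ Ioo s1 s2) {x k : ℝ} (hk : 0 ≤ k)
    (h1 : x1 ≤ x - k) (h2 : x + k ≤ x2) :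
    -(B * ((s2 - s1) / e) + (C + 4 * L * M)) * k ^ 2 ≤
      sconv v s1 s2 e t (x + k) + sconv v s1 s2 e t (x - k) - 2 * sconv v s1 s2 e t x := by
  set D := B * ((s2 - s1) / e) + (C + 4 * L * M)
  have hc : Continuous (fun x => sconv v s1 s2 e t x) :=
    (h.sc_cont e).comp (by fun_prop : Continuous fun x : ℝ => (t, x))
  have := convexOn_of_symm (g := fun x => sconv v s1 s2 e t x + D / 2 * x ^ 2) (p := x1) (q := x2)
    (by fun_prop) ?_
  · have hx1 : x + k ∈ Icc x1 x2 := ⟨by linarith, h2⟩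
    have hx2 : x - k ∈ Icc x1 x2 := ⟨h1, by linarith⟩
    have := this.2 hx1 hx2 (by norm_num : (0:ℝ) ≤ 1 / 2) (by norm_num : (0:ℝ) ≤ 1 / 2) (by norm_num)
    simp only [smul_eq_mul] at this
    have e1 : 1 / 2 * (x + k) + 1 / 2 * (x - k) = x := by ring
    rw [e1] at this
    nlinarith
  · intro x hx η hη
    obtain ⟨p, hp, -, H⟩ := h.sc_sd he ht hx hs'
    filter_upwards [H η hη] with k hk
    have hb := h.hB t ht x (Ioo_subset_Icc_self hx)
    have : -(B * ((s2 - s1) / e)) ≤ β t x * p := by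
      refine neg_le_of_abs_le ?_
      rw [abs_mul]
      exact mul_le_mul hb hp (abs_nonneg _) ((abs_nonneg _).trans hb)
    nlinarith [mul_le_mul_of_nonneg_right this (sq_nonneg k)]
end SC
end PA
section PA
namespace SC
variable {v vt vxx β : ℝ → ℝ → ℝ} {s1 s2 x1 x2 C L B M : ℝ}
local notation "SC0" => SC v vt vxx β s1 s2 x1 x2 C L B M
lemma sc_convex (h : SC0) {e t d : ℝ} (he : 0 < e) (hd : 0 < d)
    (ht : s1 < t) (ht2 : t + d < s2)
    (hs' : ∀ τ ∈ Icc t (t + d), ∀ s ∈ Icc s1 s2, (s - τ) ^ 2 ≤ 4 * M * e → s ∈ Ioo s1 s2) :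
    ConvexOn ℝ (Icc x1 x2) (fun x => (∫ τ in t..t + d, sconv v s1 s2 e τ x) -
      ∫ y in x1..x, ∫ z in x1..y, (β (t + d) z * (sconv v s1 s2 e (t + d) z - sconv v s1 s2 e t z)
        - (C + 6 * L * M) * d)) := by
  set W := sconv v s1 s2 e
  have hWc : Continuous (Function.uncurry W) := h.sc_cont e
  have hbc := h.bc
  have htd : t ≤ t + d := by linarith
  have hI : ∀ τ ∈ Icc t (t + d), τ ∈ Icc s1 s2 := fun τ hτ => ⟨by linarith [hτ.1], by linarith [hτ.2]⟩
  have hWt : ∀ x, Continuous (fun τ => W τ x) := fun x => hWc.uncurry_right x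
  have hWx : ∀ x, Continuous (fun z => W x z) := fun x => hWc.uncurry_left x
  have hbt : ∀ x, Continuous (fun τ => β τ x) := fun x => hbc.uncurry_right x
  have hbx : ∀ x, Continuous (fun z => β x z) := fun x => hbc.uncurry_left x
  refine convexOn_of_symm_l ?_ ?_ ?_
  · exact (continuous_parametric_intervalIntegral_of_continuous'
      (f := fun x τ => W τ x) (hWc.comp continuous_swap) t (t + d)).continuousOn
  · exact ((hbx _).mul ((hWx _).sub (hWx _))).sub continuous_const
  intro x hx η hη
  have hxI := Ioo_subset_Icc_self hx
  have hM0 : 0 ≤ M := (abs_nonneg _).trans (h.hM s1 (left_mem_Icc.2 h.hs.le) x hxI)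
  set p : ℝ → ℝ := deriv (fun t => W t x) with hp
  have hlipW : LipschitzOnWith (Real.toNNReal ((s2 - s1) / e)) (fun t => W t x) (Icc s1 s2) := by
    refine LipschitzOnWith.of_dist_le_mul fun y hy z hz => ?_
    rw [coe_toNNReal _ (div_nonneg (by linarith [h.hs]) he.le)]
    exact h.sc_lip he hy hz
  have hlipb : LipschitzOnWith (Real.toNNReal L) (fun t => β t x) (Icc s1 s2) := by
    refine LipschitzOnWith.of_dist_le_mul fun y hy z hz => ?_
    rw [coe_toNNReal _ h.hL]
    exact h.hLip y hy z hz x hxI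
  have hsub : uIcc t (t + d) ⊆ Icc s1 s2 := by rw [uIcc_of_le htd]; exact hI
  have acW := (hlipW.mono hsub).absolutelyContinuousOnInterval
  have acb := (hlipb.mono hsub).absolutelyContinuousOnInterval
  have acG : AbsolutelyContinuousOnInterval (fun τ => W τ x - W t x) t (t + d) := by
    refine LipschitzOnWith.absolutelyContinuousOnInterval (K := Real.toNNReal ((s2 - s1) / e)) ?_
    refine LipschitzOnWith.of_dist_le_mul fun y hy z hz => ?_
    have := (hlipW.mono hsub).dist_le_mul y hy z hz
    simpa using this
  have hparts : β (t + d) x * (W (t + d) x - W t x) - 2 * L * M * d ≤ ∫ τ in t..t + d, β τ x * p τ := by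
    have e1 := acb.integral_mul_deriv_eq_deriv_mul acG
    have e2 : (deriv fun τ => W τ x - W t x) = p := by ext τ; simp [hp]
    rw [e2] at e1
    rw [e1]
    simp only [sub_self, mul_zero, sub_zero]
    have : ‖∫ τ in t..t + d, deriv (fun τ => β τ x) τ * (W τ x - W t x)‖ ≤ (L * (2 * M)) * |t + d - t| := by
      refine norm_integral_le_of_norm_le_const fun τ hτ => ?_
      rw [uIoc_of_le htd] at hτ
      have hτI := hI τ (Ioc_subset_Icc_self hτ)
      rw [norm_mul]
      refine mul_le_mul ?_ ?_ (norm_nonneg _) h.hL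
      · have := norm_deriv_le_of_lipschitzOn (Icc_mem_nhds (by linarith [hτ.1] : s1 < τ) (by linarith [hτ.2] : τ < s2)) hlipb
        rwa [coe_toNNReal _ h.hL] at this
      · have b1 := abs_le.1 (h.sc_bd he hτI hxI)
        have b2 := abs_le.1 (h.sc_bd he (hI t (left_mem_Icc.2 htd)) hxI)
        rw [norm_eq_abs, abs_le]; constructor <;> linarith
    rw [add_sub_cancel_left, abs_of_pos hd] at this
    have := (abs_le.1 (norm_eq_abs _ ▸ this)).2
    linarith
  set q : ℝ → ℝ := fun τ => β τ x * p τ - (C + 4 * L * M) with hq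
  set Δ : ℝ → ℝ → ℝ := fun k τ => (W τ (x + k) + W τ (x - k) - 2 * W τ x) / k ^ 2 with hΔ
  have hpi : IntervalIntegrable p volume t (t + d) := acW.intervalIntegrable_deriv
  have hqi : IntervalIntegrable q volume t (t + d) :=
    (hpi.continuousOn_mul (hbt x).continuousOn).sub intervalIntegrable_const
  set D := B * ((s2 - s1) / e) + (C + 4 * L * M)
  have hΔc : ∀ k, Continuous (Δ k) := fun k => by
    simp only [hΔ]; exact (((hWt _).add (hWt _)).sub (continuous_const.mul (hWt _))).div_const _
  have hlim : Tendsto (fun k => ∫ τ in t..t + d, min (Δ k τ) (q τ)) (𝓝[>] 0) (𝓝 (∫ τ in t..t + d, q τ)) := by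
    refine tendsto_integral_filter_of_dominated_convergence (fun τ => |D| + |q τ|) ?_ ?_ ?_ ?_
    · refine Eventually.of_forall fun k => ?_
      exact (hΔc k).aestronglyMeasurable.inf (hqi.def'.aestronglyMeasurable)
    · have hd : 0 < min (x - x1) (x2 - x) := lt_min (by linarith [hx.1]) (by linarith [hx.2])
      filter_upwards [Ioo_mem_nhdsGT hd] with k hk
      refine Eventually.of_forall fun τ hτ => ?_
      rw [uIoc_of_le htd] at hτ
      have l1 := hk.2.trans_le (min_le_left _ _)
      have l2 := hk.2.trans_le (min_le_right _ _)
      have := h.sc_semi he (hI τ (Ioc_subset_Icc_self hτ)) (hs' τ (Ioc_subset_Icc_self hτ)) hk.1.le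
        (by linarith : x1 ≤ x - k) (by linarith)
      have h1 : -D ≤ Δ k τ := by
        simp only [hΔ]; rw [le_div_iff₀ (pow_pos hk.1 2)]; exact this
      rw [norm_eq_abs, abs_le]
      constructor
      · refine le_min ?_ ?_
        · linarith [le_abs_self D, abs_nonneg (q τ)]
        · linarith [neg_abs_le (q τ), abs_nonneg D]
      · exact (min_le_right _ _).trans (by linarith [le_abs_self (q τ), abs_nonneg D])
    · exact intervalIntegrable_const.add hqi.abs
    · filter_upwards [acW.ae_differentiableAt] with τ hτ1 hτ
      have hτ2 := hτ1 (uIoc_subset_uIcc hτ)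
      rw [uIoc_of_le htd] at hτ
      obtain ⟨p', hp', hpd, H⟩ := h.sc_sd he (hI τ (Ioc_subset_Icc_self hτ)) hx (hs' τ (Ioc_subset_Icc_self hτ))
      have hpp : p τ = p' := hpd hτ2
      rw [Metric.tendsto_nhds]
      intro ε hε
      filter_upwards [H (ε / 2) (half_pos hε), self_mem_nhdsWithin] with k hk hk0
      rw [dist_eq, abs_lt]
      have h1 : q τ - ε / 2 ≤ Δ k τ := by
        simp only [hΔ, hq, hpp]; rw [le_div_iff₀ (pow_pos hk0 2)]; exact hk
      have h2 : q τ - ε / 2 ≤ min (Δ k τ) (q τ) := le_min h1 (by linarith)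
      constructor
      · linarith
      · linarith [min_le_right (Δ k τ) (q τ)]
  have hqint : ∫ τ in t..t + d, q τ = (∫ τ in t..t + d, β τ x * p τ) - (C + 4 * L * M) * d := by
    simp only [hq]
    rw [intervalIntegral.integral_sub (hpi.continuousOn_mul (hbt x).continuousOn) intervalIntegrable_const]
    simp; ring
  have hlt : β (t + d) x * (W (t + d) x - W t x) - (C + 6 * L * M) * d - η < ∫ τ in t..t + d, q τ := by
    rw [hqint]; nlinarith
  filter_upwards [hlim.eventually_const_lt hlt, self_mem_nhdsWithin] with k hk hk0
  have hmono : ∫ τ in t..t + d, min (Δ k τ) (q τ) ≤ ∫ τ in t..t + d, Δ k τ := by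
    refine integral_mono_on htd ?_ ((hΔc k).intervalIntegrable _ _) fun τ _ => min_le_left _ _
    exact ⟨((hΔc k).intervalIntegrable _ _).1.inf hqi.1, ((hΔc k).intervalIntegrable _ _).2.inf hqi.2⟩
  have hint : ∫ τ in t..t + d, Δ k τ = ((∫ τ in t..t + d, W τ (x + k)) + (∫ τ in t..t + d, W τ (x - k))
      - 2 * ∫ τ in t..t + d, W τ x) / k ^ 2 := by
    simp only [hΔ]
    rw [intervalIntegral.integral_div, intervalIntegral.integral_sub, intervalIntegral.integral_add,
      intervalIntegral.integral_const_mul]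
    · exact (hWt _).intervalIntegrable _ _
    · exact (hWt _).intervalIntegrable _ _
    · exact ((hWt _).add (hWt _)).intervalIntegrable _ _
    · exact (continuous_const.mul (hWt _)).intervalIntegrable _ _
  rw [hint] at hmono
  have := hk.le.trans hmono
  rwa [le_div_iff₀ (pow_pos hk0 2)] at this
lemma convex_lim (h : SC0) {t d : ℝ} (hd : 0 < d)
    (ht : s1 < t) (ht2 : t + d < s2) :
    ConvexOn ℝ (Icc x1 x2) (fun x => (∫ τ in t..t + d, v τ x) -
      ∫ y in x1..x, ∫ z in x1..y, (β (t + d) z * (v (t + d) z - v t z) - (C + 6 * L * M) * d)) := by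
  have htd : t ≤ t + d := by linarith
  have hvc := h.vc
  have hbc := h.bc
  have hI : ∀ τ ∈ Icc t (t + d), τ ∈ Icc s1 s2 := fun τ hτ => ⟨by linarith [hτ.1], by linarith [hτ.2]⟩
  have hlv : ∀ τ ∈ Icc t (t + d), ∀ x ∈ Icc x1 x2,
      Tendsto (fun e => sconv v s1 s2 e τ x) (𝓝[>] 0) (𝓝 (v τ x)) := by
    intro τ hτ x hx
    rw [Metric.tendsto_nhds]
    intro ε hε
    have hvt : Continuous (fun τ => v τ x) := hvc.uncurry_right x
    obtain ⟨r, hr, hr2⟩ := Metric.continuousAt_iff.1 (hvt.continuousAt (x := τ)) ε hε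
    have : Tendsto (fun e : ℝ => 4 * M * e) (𝓝[>] 0) (𝓝 0) := by
      have : Tendsto (fun e : ℝ => 4 * M * e) (𝓝 0) (𝓝 (4 * M * 0)) := (by fun_prop : Continuous fun e : ℝ => 4 * M * e).tendsto 0
      rw [mul_zero] at this; exact this.mono_left nhdsWithin_le_nhds
    filter_upwards [this.eventually_lt_const (pow_pos hr 2), self_mem_nhdsWithin] with e he he0
    obtain ⟨s, hs, hm⟩ := h.sc_max e τ x
    have h1 := h.sc_le e τ x (hI τ hτ)
    have h2 := h.sc_close he0 (hI τ hτ) hx hs hm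
    have h3 : |s - τ| < r := abs_lt_of_sq_lt_sq (by linarith) hr.le
    have h4 := hr2 (x := s) h3
    rw [dist_eq, abs_lt] at h4 ⊢
    have h5 : 0 ≤ (s - τ) ^ 2 / (2 * e) := div_nonneg (sq_nonneg _) (by linarith [mem_Ioi.1 he0])
    simp only [sub_self, ne_eq, OfNat.ofNat_ne_zero, not_false_eq_true, zero_pow, zero_div, sub_zero] at h1
    constructor <;> linarith
  have hcW : ∀ e, Continuous (Function.uncurry (sconv v s1 s2 e)) := fun e => h.sc_cont e
  have hWt : ∀ e x, Continuous (fun τ => sconv v s1 s2 e τ x) := fun e x => (hcW e).uncurry_right x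
  have hWx : ∀ e t, Continuous (fun x => sconv v s1 s2 e t x) := fun e t => (hcW e).uncurry_left t
  have hbx : ∀ x, Continuous (fun z => β x z) := fun x => hbc.uncurry_left x
  have mt := left_mem_Icc.2 htd
  have mtd := right_mem_Icc.2 htd
  set le : ℝ → ℝ → ℝ := fun e z => β (t + d) z * (sconv v s1 s2 e (t + d) z - sconv v s1 s2 e t z)
        - (C + 6 * L * M) * d with hle
  have hlec : ∀ e, Continuous (le e) := fun e => ((hbx _).mul ((hWx e _).sub (hWx e _))).sub continuous_const
  set K := B * (2 * M) + |(C + 6 * L * M) * d|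
  have hleb : ∀ e > 0, ∀ z ∈ Icc x1 x2, ‖le e z‖ ≤ K := by
    intro e he z hz
    have b1 := h.sc_bd he (hI _ mt) hz
    have b2 := h.sc_bd he (hI _ mtd) hz
    have b3 := h.hB _ (hI _ mtd) z hz
    refine (norm_sub_le _ _).trans (add_le_add ?_ le_rfl)
    rw [norm_mul]
    refine mul_le_mul b3 ?_ (norm_nonneg _) ((abs_nonneg _).trans b3)
    refine (norm_sub_le _ _).trans ?_
    rw [norm_eq_abs, norm_eq_abs]; linarith
  have hl1 : ∀ y ∈ Icc x1 x2, Tendsto (fun e => ∫ z in x1..y, le e z) (𝓝[>] 0)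
      (𝓝 (∫ z in x1..y, (β (t + d) z * (v (t + d) z - v t z) - (C + 6 * L * M) * d))) := by
    intro y hy
    refine tendsto_integral_filter_of_dominated_convergence (fun _ => K) ?_ ?_ ?_ ?_
    · exact Eventually.of_forall fun e => (hlec e).aestronglyMeasurable
    · filter_upwards [self_mem_nhdsWithin] with e he
      refine Eventually.of_forall fun z hz => hleb e he z ?_
      rw [uIoc_of_le hy.1] at hz; exact ⟨hz.1.le, hz.2.trans hy.2⟩
    · exact intervalIntegrable_const
    · refine Eventually.of_forall fun z hz => ?_
      rw [uIoc_of_le hy.1] at hz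
      have hz' : z ∈ Icc x1 x2 := ⟨hz.1.le, hz.2.trans hy.2⟩
      exact (((hlv _ mtd z hz').sub (hlv _ mt z hz')).const_mul _).sub_const _
  have hl2 : ∀ x ∈ Icc x1 x2, Tendsto (fun e => (∫ τ in t..t + d, sconv v s1 s2 e τ x) -
      ∫ y in x1..x, ∫ z in x1..y, le e z) (𝓝[>] 0) (𝓝 ((∫ τ in t..t + d, v τ x) -
      ∫ y in x1..x, ∫ z in x1..y, (β (t + d) z * (v (t + d) z - v t z) - (C + 6 * L * M) * d))) := by
    intro x hx
    refine Tendsto.sub ?_ ?_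
    · refine tendsto_integral_filter_of_dominated_convergence (fun _ => M) ?_ ?_ ?_ ?_
      · exact Eventually.of_forall fun e => (hWt e x).aestronglyMeasurable
      · filter_upwards [self_mem_nhdsWithin] with e he
        refine Eventually.of_forall fun τ hτ => ?_
        rw [uIoc_of_le htd] at hτ
        exact h.sc_bd he (hI τ (Ioc_subset_Icc_self hτ)) hx
      · exact intervalIntegrable_const
      · refine Eventually.of_forall fun τ hτ => ?_
        rw [uIoc_of_le htd] at hτ
        exact hlv τ (Ioc_subset_Icc_self hτ) x hx
    · refine tendsto_integral_filter_of_dominated_convergence (fun _ => K * (x2 - x1)) ?_ ?_ ?_ ?_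
      · refine Eventually.of_forall fun e => Continuous.aestronglyMeasurable ?_
        exact continuous_primitive (fun a b => (hlec e).intervalIntegrable a b) x1
      · filter_upwards [self_mem_nhdsWithin] with e he
        refine Eventually.of_forall fun y hy => ?_
        rw [uIoc_of_le hx.1] at hy
        have := norm_integral_le_of_norm_le_const (a := x1) (b := y) (f := le e) (C := K)
          (fun z hz => hleb e he z (by rw [uIoc_of_le hy.1.le] at hz; exact ⟨hz.1.le, hz.2.trans (hy.2.trans hx.2)⟩))
        refine this.trans ?_
        have hK : 0 ≤ K := (norm_nonneg _).trans (hleb e he x hx)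
        rw [abs_of_pos (by linarith [hy.1])]
        exact mul_le_mul_of_nonneg_left (by linarith [hy.2, hx.2]) hK
      · exact intervalIntegrable_const
      · refine Eventually.of_forall fun y hy => ?_
        rw [uIoc_of_le hx.1] at hy
        exact hl1 y ⟨hy.1.le, hy.2.trans hx.2⟩
  have hev : ∀ᶠ e in 𝓝[>] 0, ConvexOn ℝ (Icc x1 x2) (fun x => (∫ τ in t..t + d, sconv v s1 s2 e τ x) -
      ∫ y in x1..x, ∫ z in x1..y, le e z) := by
    set r := min (t - s1) (s2 - (t + d))
    have hr : 0 < r := lt_min (by linarith) (by linarith)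
    have : Tendsto (fun e : ℝ => 4 * M * e) (𝓝[>] 0) (𝓝 0) := by
      have : Tendsto (fun e : ℝ => 4 * M * e) (𝓝 0) (𝓝 (4 * M * 0)) := (by fun_prop : Continuous fun e : ℝ => 4 * M * e).tendsto 0
      rw [mul_zero] at this; exact this.mono_left nhdsWithin_le_nhds
    filter_upwards [this.eventually_lt_const (pow_pos hr 2), self_mem_nhdsWithin] with e he he0
    refine h.sc_convex he0 hd ht ht2 fun τ hτ s hs hsq => ?_
    have h3 := abs_lt.1 (abs_lt_of_sq_lt_sq (lt_of_le_of_lt hsq he) hr.le)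
    have r1 := min_le_left (t - s1) (s2 - (t + d))
    have r2 := min_le_right (t - s1) (s2 - (t + d))
    exact ⟨by linarith [hτ.1], by linarith [hτ.2]⟩
  refine ⟨convex_Icc _ _, fun x hx y hy a b ha hb hab => ?_⟩
  have hz := convex_Icc x1 x2 hx hy ha hb hab
  refine le_of_tendsto_of_tendsto (hl2 _ hz) (((hl2 x hx).const_smul a).add ((hl2 y hy).const_smul b)) ?_
  filter_upwards [hev] with e he
  exact he.2 hx hy ha hb hab
end SC
end PA
section PA
lemma convex_deriv_mono {f : ℝ → ℝ} {S : Set ℝ} (hf : ConvexOn ℝ S f) {x y a b : ℝ} (hx : x ∈ S) (hy : y ∈ S)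
    (hxy : x < y) (h1 : HasDerivAt f a x) (h2 : HasDerivAt f b y) : a ≤ b :=
  (hf.le_slope_of_hasDerivAt hx hy hxy h1).trans (hf.slope_le_of_hasDerivAt hx hy hxy h2)
lemma SC.bw_one {v vt vxx β : ℝ → ℝ → ℝ} {s1 s2 x1 x2 C L B M : ℝ}
    (h : SC v vt vxx β s1 s2 x1 x2 C L B M) {t d : ℝ} (hd : 0 < d)
    (ht : s1 < t) (ht2 : t + d < s2) {x y gx gy : ℝ} (hx : x ∈ Ioo x1 x2) (hy : y ∈ Ioo x1 x2) (hxy : x < y)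
    (h1 : HasDerivAt (fun x => ∫ τ in t..t + d, v τ x) gx x)
    (h2 : HasDerivAt (fun x => ∫ τ in t..t + d, v τ x) gy y) :
    (∫ z in x..y, β (t + d) z * (v (t + d) z - v t z)) - (C + 6 * L * M) * d * (y - x) ≤ gy - gx := by
  have hvc := h.vc
  have hbc := h.bc
  have hl : Continuous (fun z => β (t + d) z * (v (t + d) z - v t z) - (C + 6 * L * M) * d) := by
    have e1 : Continuous (fun z => β (t+d) z) := hbc.comp (by fun_prop : Continuous fun z : ℝ => (t + d, z))
    have e2 : Continuous (fun z => v (t+d) z) := hvc.comp (by fun_prop : Continuous fun z : ℝ => (t + d, z))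
    have e3 : Continuous (fun z => v t z) := hvc.uncurry_left t
    fun_prop
  have hl2 : Continuous (fun y => ∫ z in x1..y, (β (t + d) z * (v (t + d) z - v t z) - (C + 6 * L * M) * d)) :=
    continuous_primitive (fun a b => hl.intervalIntegrable _ _) _
  have hD : ∀ x, HasDerivAt (fun x => ∫ y in x1..x, ∫ z in x1..y, (β (t + d) z * (v (t + d) z - v t z) - (C + 6 * L * M) * d))
      (∫ z in x1..x, (β (t + d) z * (v (t + d) z - v t z) - (C + 6 * L * M) * d)) x := fun x =>
    integral_hasDerivAt_right (hl2.intervalIntegrable _ _)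
      (hl2.stronglyMeasurableAtFilter _ _) hl2.continuousAt
  have key := convex_deriv_mono (h.convex_lim hd ht ht2) (Ioo_subset_Icc_self hx) (Ioo_subset_Icc_self hy) hxy
    (h1.fun_sub (hD x)) (h2.fun_sub (hD y))
  have e : (∫ z in x1..y, (β (t + d) z * (v (t + d) z - v t z) - (C + 6 * L * M) * d)) -
     (∫ z in x1..x, (β (t + d) z * (v (t + d) z - v t z) - (C + 6 * L * M) * d)) =
     (∫ z in x..y, β (t + d) z * (v (t + d) z - v t z)) - (C + 6 * L * M) * d * (y - x) := by
    rw [integral_interval_sub_left (hl.intervalIntegrable _ _) (hl.intervalIntegrable _ _),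
      intervalIntegral.integral_sub]
    · simp; ring
    · have : Continuous (fun z => (β (t + d) z * (v (t + d) z - v t z) - (C + 6 * L * M) * d) + (C + 6 * L * M) * d) :=
        hl.add continuous_const
      simp only [sub_add_cancel] at this
      exact this.intervalIntegrable _ _
    · simp
  linarith
structure PB (v vt vx vxx β : ℝ → ℝ → ℝ) (s1 s2 x1 x2 C L B M n b0 : ℝ) : Prop where
  vc : Continuous (Function.uncurry v)
  bc : Continuous (Function.uncurry β)
  hs : s1 < s2
  hx : x1 < x2
  hL : 0 ≤ L
  hb0 : 0 < b0
  hb : ∀ s ∈ Icc s1 s2, ∀ x ∈ Icc x1 x2, b0 ≤ β s x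
  hB : ∀ s ∈ Icc s1 s2, ∀ x ∈ Icc x1 x2, |β s x| ≤ B
  hM : ∀ s ∈ Icc s1 s2, ∀ x ∈ Icc x1 x2, |v s x| ≤ M
  hLip : ∀ s ∈ Icc s1 s2, ∀ s' ∈ Icc s1 s2, ∀ x ∈ Icc x1 x2, |β s x - β s' x| ≤ L * |s - s'|
  hLipx : ∀ s ∈ Icc s1 s2, ∀ x ∈ Icc x1 x2, ∀ y ∈ Icc x1 x2, |β s x - β s y| ≤ L * |x - y|
  dt : ∀ s ∈ Ioo s1 s2, ∀ x ∈ Ioo x1 x2, HasDerivAt (fun s => v s x) (vt s x) s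
  dx : ∀ s ∈ Ioo s1 s2, ∀ x ∈ Ioo x1 x2, HasDerivAt (fun y => v s y) (vx s x) x
  dxx : ∀ s ∈ Ioo s1 s2, ∀ x ∈ Ioo x1 x2, HasDerivAt (fun y => vx s y) (vxx s x) x
  hn : ∀ s ∈ Ioo s1 s2, ∀ x ∈ Ioo x1 x2, |vx s x| ≤ n
  ineq : ∀ s ∈ Ioo s1 s2, ∀ x ∈ Ioo x1 x2, |β s x * vt s x - vxx s x| ≤ C
namespace PB
variable {v vt vx vxx β : ℝ → ℝ → ℝ} {s1 s2 x1 x2 C L B M n b0 : ℝ}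
local notation "PB0" => PB v vt vx vxx β s1 s2 x1 x2 C L B M n b0
lemma sc1 (h : PB0) : SC v vt vxx β s1 s2 x1 x2 C L B M where
  vc := h.vc
  bc := h.bc
  hs := h.hs
  hx := h.hx
  hL := h.hL
  hB := h.hB
  hM := h.hM
  hLip := h.hLip
  dt := h.dt
  dxx := fun s hs x hx => sd_tendsto
    (by filter_upwards [Ioo_mem_nhds hx.1 hx.2] with y hy using h.dx s hs y hy) (h.dxx s hs x hx)
  ineq := fun s hs x hx => by linarith [(abs_le.1 (h.ineq s hs x hx)).2]
lemma neg (h : PB0) :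
    PB (fun s x => - v s x) (fun s x => - vt s x) (fun s x => - vx s x) (fun s x => - vxx s x) β s1 s2 x1 x2 C L B M n b0 where
  vc := h.vc.neg
  bc := h.bc
  hs := h.hs
  hx := h.hx
  hL := h.hL
  hb0 := h.hb0
  hb := h.hb
  hB := h.hB
  hM := by simpa using h.hM
  hLip := h.hLip
  hLipx := h.hLipx
  dt := fun s hs x hx => (h.dt s hs x hx).fun_neg
  dx := fun s hs x hx => (h.dx s hs x hx).fun_neg
  dxx := fun s hs x hx => (h.dxx s hs x hx).fun_neg
  hn := by simpa using h.hn
  ineq := fun s hs x hx => by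
    have := h.ineq s hs x hx
    rw [abs_sub_comm] at this
    convert this using 2
    ring
lemma n0 (h : PB0) : 0 ≤ n := by
  have h1 : (s1 + s2) / 2 ∈ Ioo s1 s2 := ⟨by linarith [h.hs], by linarith [h.hs]⟩
  have h2 : (x1 + x2) / 2 ∈ Ioo x1 x2 := ⟨by linarith [h.hx], by linarith [h.hx]⟩
  exact (abs_nonneg _).trans (h.hn _ h1 _ h2)
lemma M0 (h : PB0) : 0 ≤ M := 
  (abs_nonneg _).trans (h.hM s1 (left_mem_Icc.2 h.hs.le) x1 (left_mem_Icc.2 h.hx.le))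
lemma C0 (h : PB0) : 0 ≤ C := by
  have h1 : (s1 + s2) / 2 ∈ Ioo s1 s2 := ⟨by linarith [h.hs], by linarith [h.hs]⟩
  have h2 : (x1 + x2) / 2 ∈ Ioo x1 x2 := ⟨by linarith [h.hx], by linarith [h.hx]⟩
  exact (abs_nonneg _).trans (h.ineq _ h1 _ h2)
lemma cx (h : PB0) (t : ℝ) : Continuous (v t) :=
  h.vc.uncurry_left t
lemma ct (h : PB0) (x : ℝ) : Continuous (fun t => v t x) :=
  h.vc.uncurry_right x
lemma lipx (h : PB0) {s x y : ℝ} (hs : s ∈ Ioo s1 s2) (hx : x ∈ Ioo x1 x2)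
    (hy : y ∈ Ioo x1 x2) : |v s y - v s x| ≤ n * |y - x| := by
  have := Convex.norm_image_sub_le_of_norm_hasDerivWithin_le (s := Ioo x1 x2) (f := v s) (f' := vx s) (C := n)
    (fun z hz => (h.dx s hs z hz).hasDerivWithinAt) (fun z hz => h.hn s hs z hz) (convex_Ioo _ _) hx hy
  simpa using this
lemma gder (h : PB0) {t d : ℝ} (hd : 0 < d)
    (ht : s1 < t) (ht2 : t + d < s2) {x : ℝ} (hx : x ∈ Ioo x1 x2) :
    HasDerivAt (fun x => ∫ τ in t..t + d, v τ x) (∫ τ in t..t + d, vx τ x) x := by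
  have hI : ∀ τ ∈ uIoc t (t + d), τ ∈ Ioo s1 s2 := by
    intro τ hτ
    rw [uIoc_of_le (by linarith)] at hτ
    exact ⟨by linarith [hτ.1], by linarith [hτ.2]⟩
  refine (intervalIntegral.hasDerivAt_integral_of_dominated_loc_of_deriv_le (s := Ioo x1 x2)
    (F := fun x τ => v τ x) (F' := fun x τ => vx τ x) (bound := fun _ => n)
    (Ioo_mem_nhds hx.1 hx.2) (Eventually.of_forall fun y => (h.ct y).aestronglyMeasurable) ((h.ct x).intervalIntegrable _ _) ?_ ?_ ?_ ?_).2
  · have hseq : Tendsto (fun j : ℕ => (1 / ((j:ℝ) + 1))) atTop (𝓝[≠] 0) := by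
      rw [tendsto_nhdsWithin_iff]
      exact ⟨tendsto_one_div_add_atTop_nhds_zero_nat, Eventually.of_forall fun j => by
        have : (0:ℝ) < 1 / ((j:ℝ) + 1) := by positivity
        exact this.ne'⟩
    refine aestronglyMeasurable_of_tendsto_ae atTop (f := fun (j : ℕ) τ => (1 / ((j:ℝ) + 1))⁻¹ • (v τ (x + 1 / ((j:ℝ) + 1)) - v τ x)) ?_ ?_
    · intro j
      exact (((h.ct _).sub (h.ct _)).const_smul ((1 / ((j:ℝ) + 1))⁻¹ : ℝ)).aestronglyMeasurable
    · filter_upwards [ae_restrict_mem measurableSet_uIoc] with τ hτ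
      exact (h.dx τ (hI τ hτ) x hx).tendsto_slope_zero.comp hseq
  · exact Eventually.of_forall fun τ hτ y hy => h.hn τ (hI τ hτ) y hy
  · simp
  · exact Eventually.of_forall fun τ hτ y hy => h.dx τ (hI τ hτ) y hy
lemma bw (h : PB0) {t d : ℝ} (hd : 0 < d)
    (ht : s1 < t) (ht2 : t + d < s2) {x y : ℝ} (hx : x ∈ Ioo x1 x2) (hy : y ∈ Ioo x1 x2) (hxy : x < y) :
    |(∫ τ in t..t + d, vx τ y) - (∫ τ in t..t + d, vx τ x) - ∫ z in x..y, β (t + d) z * (v (t + d) z - v t z)|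
      ≤ (C + 6 * L * M) * d * (y - x) := by
  have h1 := h.sc1.bw_one hd ht ht2 hx hy hxy (h.gder hd ht ht2 hx) (h.gder hd ht ht2 hy)
  have h2 := h.neg.sc1.bw_one hd ht ht2 hx hy hxy (h.neg.gder hd ht ht2 hx) (h.neg.gder hd ht ht2 hy)
  have e : (∫ z in x..y, β (t + d) z * (-v (t + d) z - -v t z)) = - ∫ z in x..y, β (t + d) z * (v (t + d) z - v t z) := by
    rw [← intervalIntegral.integral_neg]
    congr 1; ext z; ring
  simp only [intervalIntegral.integral_neg] at h2
  rw [e] at h2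
  rw [abs_le]
  constructor <;> linarith
end PB
end PA
section PA
noncomputable def eW (v : ℝ → ℝ → ℝ) (δ κ t x : ℝ) : ℝ := (δ * κ)⁻¹ * ∫ y in x..x + κ, (v (t + δ) y - v t y)
noncomputable def eWx (v : ℝ → ℝ → ℝ) (δ κ t x : ℝ) : ℝ :=
  (δ * κ)⁻¹ * ((v (t + δ) (x + κ) - v t (x + κ)) - (v (t + δ) x - v t x))
noncomputable def eZ (v : ℝ → ℝ → ℝ) (δ κ t x : ℝ) : ℝ := (δ * κ)⁻¹ * ∫ τ in t..t + δ, (v τ (x + κ) - v τ x)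
lemma hasDerivAt_window {f : ℝ → ℝ} (hf : Continuous f) (k x : ℝ) :
    HasDerivAt (fun x => ∫ y in x..x + k, f y) (f (x + k) - f x) x := by
  have h0 : ∀ x, HasDerivAt (fun x => ∫ y in 0..x, f y) (f x) x := fun x =>
    integral_hasDerivAt_right (hf.intervalIntegrable _ _)
      (hf.stronglyMeasurableAtFilter _ _) hf.continuousAt
  have e : (fun x => ∫ y in x..x + k, f y) = fun x => (∫ y in 0..(x + k), f y) - ∫ y in 0..x, f y := by
    ext x
    rw [integral_interval_sub_left (hf.intervalIntegrable _ _) (hf.intervalIntegrable _ _)]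
  rw [e]
  exact ((h0 (x + k)).comp_add_const x k).fun_sub (h0 x)
section
variable {v : ℝ → ℝ → ℝ} (hv : Continuous (Function.uncurry v)) (δ κ : ℝ)
include hv
lemma eWx_cont : Continuous (Function.uncurry (eWx v δ κ)) := by
  have h (f g : ℝ × ℝ → ℝ) (hf : Continuous f) (hg : Continuous g) : Continuous (fun p => v (f p) (g p)) :=
    hv.comp (hf.prodMk hg)
  unfold eWx
  simp only [Function.uncurry_def]
  have h1 := h (fun p => p.1 + δ) (fun p => p.2 + κ) (by fun_prop) (by fun_prop)
  have h2 := h (fun p => p.1) (fun p => p.2 + κ) (by fun_prop) (by fun_prop)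
  have h3 := h (fun p => p.1 + δ) (fun p => p.2) (by fun_prop) (by fun_prop)
  have h4 := h (fun p => p.1) (fun p => p.2) (by fun_prop) (by fun_prop)
  fun_prop
lemma eW_cont : Continuous (Function.uncurry (eW v δ κ)) := by
  have e : Function.uncurry (eW v δ κ) = fun p : ℝ × ℝ => (δ * κ)⁻¹ * ∫ y in 0..κ, (v (p.1 + δ) (p.2 + y) - v p.1 (p.2 + y)) := by
    ext ⟨t, x⟩
    simp only [Function.uncurry, eW]
    congr 1
    have := intervalIntegral.integral_comp_add_left (a := 0) (b := κ) (fun y => v (t + δ) y - v t y) x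
    rw [this]; simp
  rw [e]
  refine continuous_const.mul ?_
  refine continuous_parametric_intervalIntegral_of_continuous' (f := fun (p : ℝ × ℝ) y => v (p.1 + δ) (p.2 + y) - v p.1 (p.2 + y)) ?_ 0 κ
  have h (f g : (ℝ × ℝ) × ℝ → ℝ) (hf : Continuous f) (hg : Continuous g) : Continuous (fun p => v (f p) (g p)) :=
    hv.comp (hf.prodMk hg)
  exact (h (fun p => p.1.1 + δ) (fun p => p.1.2 + p.2) (by fun_prop) (by fun_prop)).sub
    (h (fun p => p.1.1) (fun p => p.1.2 + p.2) (by fun_prop) (by fun_prop))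
omit hv in
lemma eZ_eq (t x : ℝ) : eZ v δ κ t x = eW (fun x t => v t x) κ δ x t := by
  unfold eZ eW; rw [mul_comm δ κ]
lemma eZ_cont : Continuous (Function.uncurry (eZ v δ κ)) := by
  have := eW_cont (v := fun x t => v t x) (hv.comp continuous_swap) κ δ
  have e : Function.uncurry (eZ v δ κ) = Function.uncurry (eW (fun x t => v t x) κ δ) ∘ Prod.swap := by
    ext ⟨t, x⟩
    simp [Function.uncurry, eZ_eq]
  rw [e]; exact this.comp continuous_swap
lemma eW_dx (t x : ℝ) : HasDerivAt (eW v δ κ t) (eWx v δ κ t x) x := by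
  have c (t : ℝ) : Continuous (v t) := hv.uncurry_left t
  exact (hasDerivAt_window ((c (t + δ)).sub (c t)) κ x).const_mul _
lemma eZ_dt (t x : ℝ) : HasDerivAt (fun t => eZ v δ κ t x) (eWx v δ κ t x) t := by
  have c (x : ℝ) : Continuous (fun t => v t x) := hv.uncurry_right x
  refine ((hasDerivAt_window ((c (x + κ)).sub (c x)) δ t).const_mul (δ * κ)⁻¹).congr_deriv ?_
  unfold eWx
  simp only [Pi.sub_apply]
  ring
end
namespace PB
variable {v vt vx vxx β : ℝ → ℝ → ℝ} {s1 s2 x1 x2 C L B M n b0 : ℝ}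
local notation "PB0" => PB v vt vx vxx β s1 s2 x1 x2 C L B M n b0
lemma eZ_bd (h : PB0) {δ κ t x : ℝ} (hδ : 0 < δ) (hκ : 0 < κ)
    (ht : s1 < t) (ht2 : t + δ < s2) (hx : x1 < x) (hx2 : x + κ < x2) : |eZ v δ κ t x| ≤ n := by
  unfold eZ
  have : ‖∫ τ in t..t + δ, (v τ (x + κ) - v τ x)‖ ≤ (n * κ) * |t + δ - t| := by
    refine norm_integral_le_of_norm_le_const fun τ hτ => ?_
    rw [uIoc_of_le (by linarith)] at hτ
    have := h.lipx (s := τ) ⟨by linarith [hτ.1], by linarith [hτ.2]⟩ (x := x) ⟨hx, by linarith⟩ (y := x + κ) ⟨by linarith, hx2⟩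
    simpa [abs_of_pos hκ] using this
  rw [abs_mul, abs_inv, abs_of_pos (by positivity : 0 < δ * κ), inv_mul_le_iff₀ (by positivity)]
  rw [add_sub_cancel_left, abs_of_pos hδ, norm_eq_abs] at this
  linarith
lemma eW_close (h : PB0) {δ t x : ℝ} (hδ : 0 < δ)
    (ht : s1 < t) (ht2 : t + δ < s2) (hx : x1 < x) (hx2 : x + δ ^ 2 < x2) :
    |eW v δ (δ ^ 2) t x - δ⁻¹ * (v (t + δ) x - v t x)| ≤ 2 * n * δ := by
  have hκ : 0 < δ ^ 2 := by positivity
  have e : eW v δ (δ ^ 2) t x - δ⁻¹ * (v (t + δ) x - v t x) =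
      (δ * δ ^ 2)⁻¹ * ∫ y in x..x + δ ^ 2, ((v (t + δ) y - v t y) - (v (t + δ) x - v t x)) := by
    have c1 := h.cx (t + δ)
    have c2 := h.cx t
    rw [intervalIntegral.integral_sub (Continuous.intervalIntegrable (by fun_prop) _ _)
      (Continuous.intervalIntegrable (by fun_prop) _ _)]
    unfold eW
    simp
    field_simp
  rw [e, abs_mul, abs_inv, abs_of_pos (by positivity : 0 < δ * δ ^ 2), inv_mul_le_iff₀ (by positivity)]
  have : ‖∫ y in x..x + δ ^ 2, ((v (t + δ) y - v t y) - (v (t + δ) x - v t x))‖ ≤ (2 * n * δ ^ 2) * |x + δ ^ 2 - x| := by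
    refine norm_integral_le_of_norm_le_const fun y hy => ?_
    rw [uIoc_of_le (by linarith)] at hy
    have hxx : x ∈ Ioo x1 x2 := ⟨hx, by linarith⟩
    have hyy : y ∈ Ioo x1 x2 := ⟨by linarith [hy.1], by linarith [hy.2]⟩
    have a1 := h.lipx (s := t + δ) ⟨by linarith, ht2⟩ hxx hyy
    have a2 := h.lipx (s := t) ⟨by linarith, by linarith⟩ hxx hyy
    have a3 : |y - x| ≤ δ ^ 2 := by rw [abs_of_pos (by linarith [hy.1])]; linarith [hy.2]
    have a4 := mul_le_mul_of_nonneg_left a3 h.n0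
    have e2 : (v (t + δ) y - v t y) - (v (t + δ) x - v t x) = (v (t + δ) y - v (t+δ) x) - (v t y - v t x) := by ring
    rw [e2, norm_eq_abs]
    have := abs_sub (v (t + δ) y - v (t+δ) x) (v t y - v t x)
    linarith
  rw [add_sub_cancel_left, abs_of_pos hκ, norm_eq_abs] at this
  refine this.trans (le_of_eq (by ring))
lemma eZ_dx (h : PB0) {δ κ t x : ℝ} (hδ : 0 < δ) (hκ : 0 < κ)
    (ht : s1 < t) (ht2 : t + δ < s2) (hx : x1 < x) (hx2 : x + κ < x2) :
    HasDerivAt (eZ v δ κ t) ((δ * κ)⁻¹ * ((∫ τ in t..t + δ, vx τ (x + κ)) - ∫ τ in t..t + δ, vx τ x)) x := by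
  have h1 := (h.gder hδ ht ht2 (x := x + κ) ⟨by linarith, hx2⟩).comp_add_const x κ
  have h2 := h.gder hδ ht ht2 (x := x) ⟨hx, by linarith⟩
  refine ((h1.fun_sub h2).const_mul (δ * κ)⁻¹).congr_of_eventuallyEq (Eventually.of_forall fun y => ?_)
  unfold eZ
  dsimp only
  rw [intervalIntegral.integral_sub ((h.ct _).intervalIntegrable _ _) ((h.ct _).intervalIntegrable _ _)]
lemma gp_cont (h : PB0) {t d : ℝ} (hd : 0 < d)
    (ht : s1 < t) (ht2 : t + d < s2) :
    ContinuousOn (fun x => ∫ τ in t..t + d, vx τ x) (Ioo x1 x2) := by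
  have key : ∀ x ∈ Ioo x1 x2, ∀ y ∈ Ioo x1 x2, x < y →
     |(∫ τ in t..t + d, vx τ y) - (∫ τ in t..t + d, vx τ x)| ≤ ((C + 6 * L * M) * d + B * (2 * M)) * (y - x) := by
    intro x hx y hy hxy
    have h1 := h.bw hd ht ht2 hx hy hxy
    have h2 : ‖∫ z in x..y, β (t + d) z * (v (t + d) z - v t z)‖ ≤ (B * (2 * M)) * |y - x| := by
      refine norm_integral_le_of_norm_le_const fun z hz => ?_
      rw [uIoc_of_le hxy.le] at hz
      have hz' : z ∈ Icc x1 x2 := ⟨by linarith [hz.1, hx.1], by linarith [hz.2, hy.2]⟩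
      have b1 := h.hB (t + d) ⟨by linarith, by linarith⟩ z hz'
      have b2 := h.hM (t + d) ⟨by linarith, by linarith⟩ z hz'
      have b3 := h.hM t ⟨by linarith, by linarith⟩ z hz'
      rw [norm_eq_abs, abs_mul]
      have := abs_sub (v (t+d) z) (v t z)
      exact mul_le_mul b1 (by linarith) (abs_nonneg _) ((abs_nonneg _).trans b1)
    rw [abs_of_pos (by linarith : 0 < y - x), norm_eq_abs] at h2
    rw [abs_le] at *
    constructor <;> linarith
  have : LipschitzOnWith (Real.toNNReal ((C + 6 * L * M) * d + B * (2 * M))) (fun x => ∫ τ in t..t + d, vx τ x) (Ioo x1 x2) := by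
    refine LipschitzOnWith.of_dist_le_mul fun x hx y hy => ?_
    have hc := Real.le_coe_toNNReal ((C + 6 * L * M) * d + B * (2 * M))
    rw [dist_eq, dist_eq]
    rcases lt_trichotomy x y with hxy | hxy | hxy
    · rw [abs_sub_comm, abs_sub_comm x y, abs_of_pos (by linarith : 0 < y - x)]
      exact (key x hx y hy hxy).trans (mul_le_mul_of_nonneg_right hc (by linarith))
    · simp [hxy]
    · rw [abs_of_pos (by linarith : 0 < x - y)]
      exact (key y hy x hx hxy).trans (mul_le_mul_of_nonneg_right hc (by linarith))
  exact this.continuousOn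
lemma xi_close (h : PB0) {δ t x : ℝ} (hδ : 0 < δ) (hδ1 : δ ≤ 1)
    (ht : s1 < t) (ht2 : t + δ < s2) (hx : x1 < x) (hx2 : x + δ ^ 2 < x2) :
    |(δ * δ ^ 2)⁻¹ * ((∫ τ in t..t + δ, vx τ (x + δ ^ 2)) - ∫ τ in t..t + δ, vx τ x) - β (t + δ) x * eW v δ (δ ^ 2) t x|
      ≤ C + 6 * L * M + 2 * L * M := by
  have hκ : 0 < δ ^ 2 := by positivity
  have h1 := h.bw hδ ht ht2 (x := x) (y := x + δ ^ 2) ⟨hx, by linarith⟩ ⟨by linarith, hx2⟩ (by linarith)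
  have hbx : Continuous (β (t + δ)) := h.bc.comp (by fun_prop : Continuous fun z : ℝ => (t + δ, z))
  have hM := h.M0
  have hL := h.hL
  have h2 : ‖∫ z in x..x + δ ^ 2, (β (t + δ) z - β (t + δ) x) * (v (t + δ) z - v t z)‖ ≤ (L * δ ^ 2 * (2 * M)) * |x + δ ^ 2 - x| := by
    refine norm_integral_le_of_norm_le_const fun z hz => ?_
    rw [uIoc_of_le (by linarith)] at hz
    have hz' : z ∈ Icc x1 x2 := ⟨by linarith [hz.1], by linarith [hz.2]⟩
    have b1 := h.hLipx (t + δ) ⟨by linarith, by linarith⟩ z hz' x ⟨by linarith, by linarith⟩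
    have b2 := h.hM (t + δ) ⟨by linarith, by linarith⟩ z hz'
    have b3 := h.hM t ⟨by linarith, by linarith⟩ z hz'
    have a3 : |z - x| ≤ δ ^ 2 := by rw [abs_of_pos (by linarith [hz.1])]; linarith [hz.2]
    have a4 := mul_le_mul_of_nonneg_left a3 hL
    rw [norm_eq_abs, abs_mul]
    have := abs_sub (v (t+δ) z) (v t z)
    exact mul_le_mul (b1.trans a4) (by linarith) (abs_nonneg _) (by positivity)
  have e : (∫ z in x..x + δ ^ 2, (β (t + δ) z - β (t + δ) x) * (v (t + δ) z - v t z)) =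
     (∫ z in x..x + δ ^ 2, β (t + δ) z * (v (t + δ) z - v t z)) - β (t + δ) x * ∫ z in x..x + δ ^ 2, (v (t + δ) z - v t z) := by
    have c1 := h.cx (t + δ)
    have c2 := h.cx t
    rw [← intervalIntegral.integral_const_mul, ← intervalIntegral.integral_sub
      (Continuous.intervalIntegrable (by fun_prop) _ _)
      (Continuous.intervalIntegrable (by fun_prop) _ _)]
    congr 1; ext z; ring
  rw [e, norm_eq_abs, add_sub_cancel_left, abs_of_pos hκ] at h2
  rw [add_sub_cancel_left] at h1
  unfold eW
  set I1 := (∫ τ in t..t + δ, vx τ (x + δ ^ 2)) - ∫ τ in t..t + δ, vx τ x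
  set I2 := ∫ z in x..x + δ ^ 2, β (t + δ) z * (v (t + δ) z - v t z)
  set I3 := ∫ z in x..x + δ ^ 2, (v (t + δ) z - v t z)
  have e3 : (δ * δ ^ 2)⁻¹ * I1 - β (t + δ) x * ((δ * δ ^ 2)⁻¹ * I3) = (δ * δ ^ 2)⁻¹ * ((I1 - I2) + (I2 - β (t + δ) x * I3)) := by ring
  rw [e3, abs_mul, abs_inv, abs_of_pos (by positivity : 0 < δ * δ ^ 2), inv_mul_le_iff₀ (by positivity)]
  refine (abs_add_le _ _).trans ?_
  have : L * δ ^ 2 * (2 * M) * δ ^ 2 ≤ δ * δ ^ 2 * (2 * L * M) := by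
    have : L * δ ^ 2 * (2 * M) * δ ^ 2 = δ * (δ * δ ^ 2 * (2 * L * M)) := by ring
    rw [this]
    have h0 : 0 ≤ δ * δ ^ 2 * (2 * L * M) := by positivity
    nlinarith
  linarith
end PB
end PA
section PA
namespace PB
variable {v vt vx vxx β : ℝ → ℝ → ℝ} {s1 s2 x1 x2 C L B M n b0 : ℝ}
local notation "PB0" => PB v vt vx vxx β s1 s2 x1 x2 C L B M n b0
lemma step (h : PB0) {δ t y1 y2 : ℝ} (hδ : 0 < δ) (hδ1 : δ ≤ 1)
    (ht : s1 < t) (ht2 : t + δ < s2) (hy : y1 < y2) (hx : x1 < y1) (hx2 : y2 + δ ^ 2 < x2) :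
    (∫ x in y1..y2, (b0 / 2 * (((x - y1) * (y2 - x)) ^ 2 * eW v δ (δ ^ 2) t x ^ 2) +
      ((x - y1) * (y2 - x)) ^ 2 * (eWx v δ (δ ^ 2) t x * eZ v δ (δ ^ 2) t x)))
      ≤ (4 / b0 * ((y2 - y1) ^ 2 * n ^ 2) + (C + 6 * L * M + 2 * L * M) ^ 2 * (y2 - y1) ^ 4 / b0) * (y2 - y1) := by
  have hκ : 0 < δ ^ 2 := by positivity
  have hb0 := h.hb0
  set w := eW v δ (δ ^ 2) t
  set wx := eWx v δ (δ ^ 2) t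
  set ζ := eZ v δ (δ ^ 2) t
  set ξ : ℝ → ℝ := fun x => (δ * δ ^ 2)⁻¹ * ((∫ τ in t..t + δ, vx τ (x + δ ^ 2)) - ∫ τ in t..t + δ, vx τ x) with hξ
  set C3 := C + 6 * L * M + 2 * L * M with hC3
  set K1 := 4 / b0 * ((y2 - y1) ^ 2 * n ^ 2) + C3 ^ 2 * (y2 - y1) ^ 4 / b0 with hK1
  have cw : Continuous w := (eW_cont h.vc δ (δ ^ 2)).uncurry_left t
  have cwx : Continuous wx := (eWx_cont h.vc δ (δ ^ 2)).uncurry_left t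
  have cz : Continuous ζ := (eZ_cont h.vc δ (δ ^ 2)).uncurry_left t
  have cξ : ContinuousOn ξ (uIcc y1 y2) := by
    rw [uIcc_of_le hy.le]
    refine continuousOn_const.mul (ContinuousOn.sub ?_ ?_)
    · refine (h.gp_cont hδ ht ht2).comp (f := fun x => x + δ ^ 2) (by fun_prop) fun x hx' => ⟨?_, ?_⟩ <;> simp only [] <;> linarith [hx'.1, hx'.2]
    · exact (h.gp_cont hδ ht ht2).mono fun x hx' => ⟨by linarith [hx'.1], by linarith [hx'.2]⟩
  have hdw : ∀ x, HasDerivAt (fun x => ((x - y1) * (y2 - x)) ^ 2 * w x)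
      (2 * ((x - y1) * (y2 - x)) * (y1 + y2 - 2 * x) * w x + ((x - y1) * (y2 - x)) ^ 2 * wx x) x := by
    intro x
    have h1 : HasDerivAt (fun x => ((x - y1) * (y2 - x)) ^ 2) (2 * ((x - y1) * (y2 - x)) * (y1 + y2 - 2 * x)) x := by
      have a1 : HasDerivAt (fun x => x - y1) 1 x := (hasDerivAt_id x).sub_const y1
      have a2 : HasDerivAt (fun x => y2 - x) (-1) x := (hasDerivAt_id x).const_sub y2
      refine ((a1.fun_mul a2).fun_pow 2).congr_deriv ?_
      push_cast; ring
    exact h1.fun_mul (eW_dx h.vc δ (δ ^ 2) t x)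
  have ibp := intervalIntegral.integral_deriv_mul_eq_sub (a := y1) (b := y2) (u := fun x => ((x - y1) * (y2 - x)) ^ 2 * w x) (v := ζ)
    (v' := ξ) (fun x _ => hdw x) (fun x hx' => by
      rw [uIcc_of_le hy.le] at hx'
      exact h.eZ_dx hδ hκ ht ht2 (by linarith [hx'.1]) (by linarith [hx'.2]))
    (Continuous.intervalIntegrable (by fun_prop) _ _) cξ.intervalIntegrable
  simp only [sub_self, zero_mul, mul_zero, ne_eq, OfNat.ofNat_ne_zero, not_false_eq_true, zero_pow] at ibp
  have hmono := integral_mono_on (a := y1) (b := y2) (μ := volume)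
    (f := fun x => (b0 / 2 * (((x - y1) * (y2 - x)) ^ 2 * w x ^ 2) + ((x - y1) * (y2 - x)) ^ 2 * (wx x * ζ x)) - K1)
    (g := fun x => (2 * ((x - y1) * (y2 - x)) * (y1 + y2 - 2 * x) * w x + ((x - y1) * (y2 - x)) ^ 2 * wx x) * ζ x +
      ((x - y1) * (y2 - x)) ^ 2 * w x * ξ x) hy.le (Continuous.intervalIntegrable (by fun_prop) _ _)
      (ContinuousOn.intervalIntegrable (by
        refine ContinuousOn.add (Continuous.continuousOn (by fun_prop)) (ContinuousOn.mul (Continuous.continuousOn (by fun_prop)) cξ))) ?_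
  · rw [ibp, intervalIntegral.integral_sub (Continuous.intervalIntegrable (by fun_prop) _ _) (Continuous.intervalIntegrable (by fun_prop) _ _)] at hmono
    simp only [intervalIntegral.integral_const, smul_eq_mul] at hmono
    linarith
  · intro x hx'
    have f1 := h.xi_close hδ hδ1 ht ht2 (x := x) (by linarith [hx'.1]) (by linarith [hx'.2])
    have f2 := h.eZ_bd hδ hκ ht ht2 (x := x) (by linarith [hx'.1]) (by linarith [hx'.2])
    have f3 := h.hb (t + δ) ⟨by linarith, by linarith⟩ x ⟨by linarith [hx'.1], by linarith [hx'.2]⟩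
    change |ξ x - β (t + δ) x * w x| ≤ C3 at f1
    change |ζ x| ≤ n at f2
    generalize hψ : (x - y1) * (y2 - x) = ψ
    generalize hψ' : y1 + y2 - 2 * x = ψ'
    have hψ0 : 0 ≤ ψ := hψ ▸ mul_nonneg (by linarith [hx'.1]) (by linarith [hx'.2])
    have hψ1 : ψ ≤ (y2 - y1) ^ 2 := by rw [← hψ]; nlinarith [hx'.1, hx'.2]
    have hψ2 : ψ' ^ 2 ≤ (y2 - y1) ^ 2 := by rw [← hψ']; nlinarith [hx'.1, hx'.2]
    generalize ξ x = X at *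
    generalize ζ x = Z at *
    generalize w x = W at *
    generalize wx x = Wx at *
    generalize β (t + δ) x = b at *
    have g1 : b0 * (ψ ^ 2 * W ^ 2) ≤ ψ ^ 2 * W * X + C3 * (ψ ^ 2 * |W|) := by
      have : ψ ^ 2 * W * (b * W - X) ≤ ψ ^ 2 * |W| * C3 := by
        refine (le_abs_self _).trans ?_
        rw [abs_mul, abs_mul, abs_of_nonneg (sq_nonneg ψ), abs_sub_comm]
        exact mul_le_mul_of_nonneg_left f1 (by positivity)
      have h4 : b0 * (ψ ^ 2 * W ^ 2) ≤ b * (ψ ^ 2 * W ^ 2) := mul_le_mul_of_nonneg_right f3 (by positivity)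
      have e : ψ ^ 2 * W * (b * W - X) = b * (ψ ^ 2 * W ^ 2) - ψ ^ 2 * W * X := by ring
      rw [e] at this
      linarith
    have g2 : C3 * (ψ ^ 2 * |W|) ≤ b0 / 4 * (ψ ^ 2 * W ^ 2) + C3 ^ 2 * (y2 - y1) ^ 4 / b0 := by
      have e1 : C3 * |W| ≤ b0 / 4 * W ^ 2 + C3 ^ 2 / b0 := by
        have := sq_nonneg (b0 / 2 * |W| - C3)
        have e : b0 / 4 * W ^ 2 + C3 ^ 2 / b0 - C3 * |W| = (b0 / 2 * |W| - C3) ^ 2 / b0 := by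
          field_simp
          rw [← sq_abs W]; ring
        have : 0 ≤ (b0 / 2 * |W| - C3) ^ 2 / b0 := by positivity
        linarith
      have e2 : ψ ^ 2 ≤ (y2 - y1) ^ 4 := by
        have := pow_le_pow_left₀ hψ0 hψ1 2
        calc _ ≤ _ := this
          _ = _ := by ring
      have e3 := mul_le_mul_of_nonneg_left e1 (sq_nonneg ψ)
      have e4 := mul_le_mul_of_nonneg_left e2 (by positivity : 0 ≤ C3 ^ 2 / b0)
      have : C3 ^ 2 * (y2 - y1) ^ 4 / b0 = C3 ^ 2 / b0 * (y2 - y1) ^ 4 := by ring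
      rw [this]
      have e5 : ψ ^ 2 * (C3 * |W|) = C3 * (ψ ^ 2 * |W|) := by ring
      have e6 : ψ ^ 2 * (b0 / 4 * W ^ 2 + C3 ^ 2 / b0) = b0 / 4 * (ψ ^ 2 * W ^ 2) + C3 ^ 2 / b0 * ψ ^ 2 := by ring
      linarith
    have g3 : - (2 * ψ * ψ' * W * Z) ≤ b0 / 4 * (ψ ^ 2 * W ^ 2) + 4 / b0 * ((y2 - y1) ^ 2 * n ^ 2) := by
      have e : b0 / 4 * (ψ ^ 2 * W ^ 2) + 4 / b0 * (ψ' ^ 2 * Z ^ 2) + (2 * ψ * ψ' * W * Z) = (b0 / 2 * (ψ * W) + 2 * (ψ' * Z)) ^ 2 / b0 := by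
        field_simp; ring
      have : 0 ≤ (b0 / 2 * (ψ * W) + 2 * (ψ' * Z)) ^ 2 / b0 := by positivity
      have hZ : Z ^ 2 ≤ n ^ 2 := by rw [← sq_abs Z]; exact pow_le_pow_left₀ (abs_nonneg _) f2 2
      have := mul_le_mul_of_nonneg_left (mul_le_mul hψ2 hZ (sq_nonneg _) (sq_nonneg _)) (by positivity : 0 ≤ 4 / b0)
      linarith
    rw [hK1]
    have e : (2 * ψ * ψ' * W + ψ ^ 2 * Wx) * Z + ψ ^ 2 * W * X = 2 * ψ * ψ' * W * Z + ψ ^ 2 * (Wx * Z) + ψ ^ 2 * W * X := by ring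
    rw [e]
    linarith
lemma energy (h : PB0) {y1 y2 t1 t2 : ℝ}
    (hy : y1 < y2) (hx : x1 < y1) (ht : t1 < t2) (hst : s1 < t1) : ∃ K : ℝ, ∀ δ : ℝ, 0 < δ → δ ≤ 1 → t2 + δ < s2 → y2 + δ ^ 2 < x2 →
     ∫ t in t1..t2, ∫ x in y1..y2, (((x - y1) * (y2 - x)) ^ 2 * eW v δ (δ ^ 2) t x ^ 2) ≤ K := by
  have hb0 := h.hb0
  set K1 := (4 / b0 * ((y2 - y1) ^ 2 * n ^ 2) + (C + 6 * L * M + 2 * L * M) ^ 2 * (y2 - y1) ^ 4 / b0) * (y2 - y1) with hK1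
  refine ⟨2 / b0 * (K1 * (t2 - t1) + (1 / 2 * ((y2 - y1) ^ 4 * n ^ 2)) * (y2 - y1)), fun δ hδ hδ1 ht2 hx2 => ?_⟩
  have hκ : 0 < δ ^ 2 := by positivity
  have cw : Continuous (fun p : ℝ × ℝ => eW v δ (δ ^ 2) p.1 p.2) := eW_cont h.vc δ (δ ^ 2)
  have cwx : Continuous (fun p : ℝ × ℝ => eWx v δ (δ ^ 2) p.1 p.2) := eWx_cont h.vc δ (δ ^ 2)
  have cz : Continuous (fun p : ℝ × ℝ => eZ v δ (δ ^ 2) p.1 p.2) := eZ_cont h.vc δ (δ ^ 2)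
  have c1 : Continuous (fun p : ℝ × ℝ => ((p.2 - y1) * (y2 - p.2)) ^ 2 * eW v δ (δ ^ 2) p.1 p.2 ^ 2) := by fun_prop
  have c2 : Continuous (fun p : ℝ × ℝ => ((p.2 - y1) * (y2 - p.2)) ^ 2 * (eWx v δ (δ ^ 2) p.1 p.2 * eZ v δ (δ ^ 2) p.1 p.2)) := by fun_prop
  have i1 : Continuous (fun t => ∫ x in y1..y2, ((x - y1) * (y2 - x)) ^ 2 * eW v δ (δ ^ 2) t x ^ 2) :=
    continuous_parametric_intervalIntegral_of_continuous' (f := fun t x => ((x - y1) * (y2 - x)) ^ 2 * eW v δ (δ ^ 2) t x ^ 2) c1 _ _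
  have i2 : Continuous (fun t => ∫ x in y1..y2, ((x - y1) * (y2 - x)) ^ 2 * (eWx v δ (δ ^ 2) t x * eZ v δ (δ ^ 2) t x)) :=
    continuous_parametric_intervalIntegral_of_continuous' (f := fun t x => ((x - y1) * (y2 - x)) ^ 2 * (eWx v δ (δ ^ 2) t x * eZ v δ (δ ^ 2) t x)) c2 _ _
  have hstep : ∀ t ∈ Icc t1 t2, b0 / 2 * (∫ x in y1..y2, ((x - y1) * (y2 - x)) ^ 2 * eW v δ (δ ^ 2) t x ^ 2)
      + (∫ x in y1..y2, ((x - y1) * (y2 - x)) ^ 2 * (eWx v δ (δ ^ 2) t x * eZ v δ (δ ^ 2) t x)) ≤ K1 := by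
    intro t ht'
    have := h.step hδ hδ1 (t := t) (by linarith [ht'.1]) (by linarith [ht'.2]) hy hx hx2
    have d1 : Continuous (fun x => ((x - y1) * (y2 - x)) ^ 2 * eW v δ (δ ^ 2) t x ^ 2) := c1.comp (by fun_prop : Continuous fun z : ℝ => (t, z))
    have d2 : Continuous (fun x => ((x - y1) * (y2 - x)) ^ 2 * (eWx v δ (δ ^ 2) t x * eZ v δ (δ ^ 2) t x)) := c2.comp (by fun_prop : Continuous fun z : ℝ => (t, z))
    rwa [intervalIntegral.integral_add ((d1.intervalIntegrable _ _).const_mul (b0 / 2)) (d2.intervalIntegrable _ _), intervalIntegral.integral_const_mul] at this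
  have hint := integral_mono_on (a := t1) (b := t2) (μ := volume) ht.le
    (Continuous.intervalIntegrable (by fun_prop) _ _) (Continuous.intervalIntegrable (by fun_prop) _ _) hstep
  rw [intervalIntegral.integral_add ((i1.intervalIntegrable _ _).const_mul (b0 / 2)) (i2.intervalIntegrable _ _),
    intervalIntegral.integral_const_mul] at hint
  simp only [intervalIntegral.integral_const, smul_eq_mul] at hint
  have hsw : (∫ t in t1..t2, ∫ x in y1..y2, ((x - y1) * (y2 - x)) ^ 2 * (eWx v δ (δ ^ 2) t x * eZ v δ (δ ^ 2) t x)) =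
     ∫ x in y1..y2, ∫ t in t1..t2, ((x - y1) * (y2 - x)) ^ 2 * (eWx v δ (δ ^ 2) t x * eZ v δ (δ ^ 2) t x) := by
    refine MeasureTheory.intervalIntegral_intervalIntegral_swap ?_
    refine IntegrableOn.mono_set (t := Icc t1 t2 ×ˢ Icc y1 y2) ?_ ?_
    · exact c2.continuousOn.integrableOn_compact (isCompact_Icc.prod isCompact_Icc)
    · rw [uIoc_of_le ht.le, uIoc_of_le hy.le]
      exact prod_mono Ioc_subset_Icc_self Ioc_subset_Icc_self
  have hlow : - ((1 / 2 * ((y2 - y1) ^ 4 * n ^ 2)) * (y2 - y1)) ≤ ∫ x in y1..y2, ∫ t in t1..t2, ((x - y1) * (y2 - x)) ^ 2 * (eWx v δ (δ ^ 2) t x * eZ v δ (δ ^ 2) t x) := by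
    have hin : ∀ x, (∫ t in t1..t2, ((x - y1) * (y2 - x)) ^ 2 * (eWx v δ (δ ^ 2) t x * eZ v δ (δ ^ 2) t x)) =
       ((x - y1) * (y2 - x)) ^ 2 * (1 / 2 * eZ v δ (δ ^ 2) t2 x ^ 2) - ((x - y1) * (y2 - x)) ^ 2 * (1 / 2 * eZ v δ (δ ^ 2) t1 x ^ 2) := by
      intro x
      refine integral_eq_sub_of_hasDerivAt (f := fun t => ((x - y1) * (y2 - x)) ^ 2 * (1 / 2 * eZ v δ (δ ^ 2) t x ^ 2)) (fun t _ => ?_) ?_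
      · refine ((((eZ_dt h.vc δ (δ ^ 2) t x).fun_pow 2).const_mul (1 / 2)).const_mul _).congr_deriv ?_
        push_cast; ring
      · exact (c2.comp (by fun_prop : Continuous fun z : ℝ => (z, x))).intervalIntegrable _ _
    simp only [hin]
    have ez (t : ℝ) : Continuous (eZ v δ (δ ^ 2) t) := cz.uncurry_left t
    have e1 := ez t1
    have e2 := ez t2
    have := integral_mono_on (a := y1) (b := y2) (μ := volume) (f := fun _ => - (1 / 2 * ((y2 - y1) ^ 4 * n ^ 2)))
      (g := fun x => ((x - y1) * (y2 - x)) ^ 2 * (1 / 2 * eZ v δ (δ ^ 2) t2 x ^ 2) - ((x - y1) * (y2 - x)) ^ 2 * (1 / 2 * eZ v δ (δ ^ 2) t1 x ^ 2)) hy.le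
      (Continuous.intervalIntegrable (by fun_prop) _ _) (Continuous.intervalIntegrable (by fun_prop) _ _) ?_
    · simp only [intervalIntegral.integral_const, smul_eq_mul] at this
      refine le_trans (le_of_eq (by ring)) this
    · intro x hx'
      have f2 := h.eZ_bd hδ hκ hst (x := x) (by linarith) (by linarith [hx'.1]) (by linarith [hx'.2])
      have hZ : eZ v δ (δ ^ 2) t1 x ^ 2 ≤ n ^ 2 := by rw [← sq_abs]; exact pow_le_pow_left₀ (abs_nonneg _) f2 2
      have hψ0 : 0 ≤ (x - y1) * (y2 - x) := mul_nonneg (by linarith [hx'.1]) (by linarith [hx'.2])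
      have hψ1 : (x - y1) * (y2 - x) ≤ (y2 - y1) ^ 2 := by nlinarith [hx'.1, hx'.2]
      have e2 : ((x - y1) * (y2 - x)) ^ 2 ≤ (y2 - y1) ^ 4 := by
        have := pow_le_pow_left₀ hψ0 hψ1 2
        calc _ ≤ _ := this
          _ = _ := by ring
      have := mul_le_mul e2 hZ (sq_nonneg _) (by positivity)
      have : 0 ≤ ((x - y1) * (y2 - x)) ^ 2 * (1 / 2 * eZ v δ (δ ^ 2) t2 x ^ 2) := by positivity
      linarith
  rw [hsw] at hint
  have : b0 / 2 * (∫ t in t1..t2, ∫ x in y1..y2, ((x - y1) * (y2 - x)) ^ 2 * eW v δ (δ ^ 2) t x ^ 2) ≤ K1 * (t2 - t1) + (1 / 2 * ((y2 - y1) ^ 4 * n ^ 2)) * (y2 - y1) := by linarith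
  rw [div_mul_eq_mul_div, le_div_iff₀ hb0]
  linarith
lemma vt_int (h : PB0) {y1 y2 t1 t2 : ℝ}
    (hy : y1 < y2) (hx : x1 < y1) (hx2 : y2 < x2) (ht : t1 < t2) (hst : s1 < t1) (hst2 : t2 < s2) :
    IntegrableOn (Function.uncurry vt) (Icc t1 t2 ×ˢ Icc y1 y2) := by
  set z1 := (x1 + y1) / 2
  set z2 := (y2 + x2) / 2
  have hz1 : x1 < z1 := by simp only [z1]; linarith
  have hz1' : z1 < y1 := by simp only [z1]; linarith
  have hz2 : z2 < x2 := by simp only [z2]; linarith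
  have hz2' : y2 < z2 := by simp only [z2]; linarith
  obtain ⟨K, hK⟩ := h.energy (y1 := z1) (y2 := z2) (by linarith) hz1 ht hst
  have hd : ∃ d : ℕ → ℝ, (∀ j, 0 < d j ∧ d j ≤ 1 ∧ t2 + d j < s2 ∧ z2 + d j ^ 2 < x2) ∧ Tendsto d atTop (𝓝 0) := by
    set m := min 1 (min ((s2 - t2) / 2) ((x2 - z2) / 2))
    have hm : 0 < m := lt_min one_pos (lt_min (by linarith) (by linarith))
    have hm1 : m ≤ 1 := min_le_left _ _
    have hm2 : m ≤ (s2 - t2) / 2 := (min_le_right _ _).trans (min_le_left _ _)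
    have hm3 : m ≤ (x2 - z2) / 2 := (min_le_right _ _).trans (min_le_right _ _)
    refine ⟨fun j => m * (1 / ((j:ℝ) + 1)), fun j => ?_, by simpa using tendsto_one_div_add_atTop_nhds_zero_nat.const_mul m⟩
    have h1 : (0:ℝ) < 1 / ((j:ℝ) + 1) := by positivity
    have h2 : 1 / ((j:ℝ) + 1) ≤ 1 := by
      rw [div_le_one (by positivity)]; linarith [(Nat.cast_nonneg j : (0:ℝ) ≤ j)]
    have h3 : m * (1 / ((j:ℝ) + 1)) ≤ m := by nlinarith
    have h4 : 0 < m * (1 / ((j:ℝ) + 1)) := by positivity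
    refine ⟨h4, by linarith, by linarith, ?_⟩
    nlinarith
  obtain ⟨d, hd, hd0⟩ := hd
  set Rz : Set (ℝ × ℝ) := Icc t1 t2 ×ˢ Icc z1 z2
  have hlim : ∀ p ∈ Rz, Tendsto (fun j => eW v (d j) (d j ^ 2) p.1 p.2) atTop (𝓝 (vt p.1 p.2)) := by
    rintro ⟨t, x⟩ ⟨hp1, hp2⟩
    simp only at hp1 hp2 ⊢
    have hdn : Tendsto d atTop (𝓝[≠] 0) := tendsto_nhdsWithin_iff.2 ⟨hd0, Eventually.of_forall fun j => (hd j).1.ne'⟩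
    have a1 := (h.dt t ⟨by linarith [hp1.1], by linarith [hp1.2]⟩ x ⟨by linarith [hp2.1], by linarith [hp2.2]⟩).tendsto_slope_zero.comp hdn
    have a2 : Tendsto (fun j => eW v (d j) (d j ^ 2) t x - (d j)⁻¹ * (v (t + d j) x - v t x)) atTop (𝓝 0) := by
      refine squeeze_zero_norm (a := fun j => 2 * n * d j) (fun j => ?_) (by simpa using hd0.const_mul (2 * n))
      exact h.eW_close (hd j).1 (by linarith [hp1.1]) (by linarith [hp1.2, (hd j).2.2.1]) (by linarith [hp2.1]) (by linarith [hp2.2, (hd j).2.2.2])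
    simpa using a2.add a1
  have cw (j : ℕ) : Continuous (fun p : ℝ × ℝ => eW v (d j) (d j ^ 2) p.1 p.2) := eW_cont h.vc (d j) (d j ^ 2)
  have hmeasR : MeasurableSet Rz := measurableSet_Icc.prod measurableSet_Icc
  have hvm : AEStronglyMeasurable (Function.uncurry vt) (volume.restrict Rz) := by
    refine aestronglyMeasurable_of_tendsto_ae atTop (f := fun j (p : ℝ × ℝ) => eW v (d j) (d j ^ 2) p.1 p.2) (fun j => (cw j).aestronglyMeasurable) ?_
    filter_upwards [ae_restrict_mem hmeasR] with p hp using hlim p hp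
  set φ : ℝ × ℝ → ℝ := fun p => ((p.2 - z1) * (z2 - p.2)) ^ 2
  have cφ : Continuous φ := by fun_prop
  have hbd : ∀ j, ∫⁻ p in Rz, ENNReal.ofReal (φ p * eW v (d j) (d j ^ 2) p.1 p.2 ^ 2) ≤ ENNReal.ofReal K := by
    intro j
    have cj : Continuous (fun p => φ p * eW v (d j) (d j ^ 2) p.1 p.2 ^ 2) := by have := cw j; fun_prop
    have hi : IntegrableOn (fun p => φ p * eW v (d j) (d j ^ 2) p.1 p.2 ^ 2) Rz :=
      cj.continuousOn.integrableOn_compact (isCompact_Icc.prod isCompact_Icc)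
    rw [← ofReal_integral_eq_lintegral_ofReal hi (Eventually.of_forall fun p => by simp only [φ]; positivity)]
    refine ENNReal.ofReal_le_ofReal ?_
    have e1 : (∫ p in Rz, φ p * eW v (d j) (d j ^ 2) p.1 p.2 ^ 2) = ∫ t in Icc t1 t2, ∫ x in Icc z1 z2, φ (t, x) * eW v (d j) (d j ^ 2) t x ^ 2 := by
      have := setIntegral_prod (μ := (volume : Measure ℝ)) (ν := (volume : Measure ℝ)) (fun p => φ p * eW v (d j) (d j ^ 2) p.1 p.2 ^ 2) hi
      exact this
    rw [e1]
    have := hK (d j) (hd j).1 (hd j).2.1 (hd j).2.2.1 (hd j).2.2.2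
    simp only [intervalIntegral.integral_of_le ht.le, intervalIntegral.integral_of_le (by linarith : z1 ≤ z2)] at this
    simpa only [integral_Icc_eq_integral_Ioc, φ] using this
  have hfat : ∫⁻ p in Rz, ENNReal.ofReal (φ p * vt p.1 p.2 ^ 2) ≤ ENNReal.ofReal K := by
    have e1 : ∫⁻ p in Rz, ENNReal.ofReal (φ p * vt p.1 p.2 ^ 2) = ∫⁻ p in Rz, liminf (fun j => ENNReal.ofReal (φ p * eW v (d j) (d j ^ 2) p.1 p.2 ^ 2)) atTop := by
      refine setLIntegral_congr_fun hmeasR fun p hp => ?_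
      have : Tendsto (fun j => ENNReal.ofReal (φ p * eW v (d j) (d j ^ 2) p.1 p.2 ^ 2)) atTop (𝓝 (ENNReal.ofReal (φ p * vt p.1 p.2 ^ 2))) :=
        ENNReal.tendsto_ofReal (((hlim p hp).pow 2).const_mul _)
      exact this.liminf_eq.symm
    rw [e1]
    refine (lintegral_liminf_le' fun j => ?_).trans ?_
    · have := cw j
      have c : Continuous (fun p => φ p * eW v (d j) (d j ^ 2) p.1 p.2 ^ 2) := by fun_prop
      exact c.measurable.ennreal_ofReal.aemeasurable
    · refine (liminf_le_liminf (v := fun _ => ENNReal.ofReal K) (Eventually.of_forall hbd)).trans ?_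
      simp
  have hsub : Icc t1 t2 ×ˢ Icc y1 y2 ⊆ Rz := prod_mono_right (Icc_subset_Icc hz1'.le hz2'.le)
  have hI2 : IntegrableOn (fun p => φ p * vt p.1 p.2 ^ 2) Rz := by
    refine ⟨?_, ?_⟩
    · exact cφ.aestronglyMeasurable.mul (hvm.pow 2)
    · rw [hasFiniteIntegral_iff_ofReal (Eventually.of_forall fun p => by simp only [φ]; positivity)]
      exact hfat.trans_lt ENNReal.ofReal_lt_top
  set c0 := ((y1 - z1) * (z2 - y2)) ^ 2
  have hc0 : 0 < c0 := by have : 0 < (y1 - z1) * (z2 - y2) := mul_pos (by linarith) (by linarith)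
                          positivity
  have hI3 : IntegrableOn (fun p => 1 + c0⁻¹ * (φ p * vt p.1 p.2 ^ 2)) (Icc t1 t2 ×ˢ Icc y1 y2) := by
    refine Integrable.add ?_ ((hI2.mono_set hsub).const_mul _)
    exact continuous_const.continuousOn.integrableOn_compact (isCompact_Icc.prod isCompact_Icc)
  refine Integrable.mono' hI3 (hvm.mono_measure (Measure.restrict_mono hsub le_rfl)) ?_
  filter_upwards [ae_restrict_mem (measurableSet_Icc.prod measurableSet_Icc)] with p hp
  obtain ⟨hp1, hp2⟩ := hp
  have e1 : c0 ≤ φ p := by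
    have q1 : y1 - z1 ≤ p.2 - z1 := by linarith [hp2.1]
    have q2 : z2 - y2 ≤ z2 - p.2 := by linarith [hp2.2]
    exact pow_le_pow_left₀ (mul_nonneg (by linarith) (by linarith)) (mul_le_mul q1 q2 (by linarith) (by linarith)) 2
  have e2 : vt p.1 p.2 ^ 2 ≤ c0⁻¹ * (φ p * vt p.1 p.2 ^ 2) := by
    rw [le_inv_mul_iff₀ hc0]
    exact mul_le_mul_of_nonneg_right e1 (sq_nonneg _)
  have e3 : |vt p.1 p.2| ≤ 1 + vt p.1 p.2 ^ 2 := by rw [← sq_abs]; nlinarith [sq_nonneg (|vt p.1 p.2| - 1), abs_nonneg (vt p.1 p.2)]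
  exact e3.trans (by linarith)
end PB
end PA
section PB1
namespace PistonSol
variable {P μ : ℝ → ℝ} {Pext : ℝ} (S : PistonSol P μ Pext)
noncomputable def A (t : ℝ) : ℝ := S.a (max t 0)
noncomputable def B (t : ℝ) : ℝ := S.b (max t 0)
noncomputable def cl (t x : ℝ) : ℝ := max (S.A t) (min (S.B t) x)
noncomputable def R (t x : ℝ) : ℝ := S.ρ (max t 0) (S.cl t x)
noncomputable def W (t x : ℝ) : ℝ := S.v (max t 0) (S.cl t x)
lemma A_eq {t : ℝ} (ht : 0 ≤ t) : S.A t = S.a t := by simp [A, ht]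
lemma B_eq {t : ℝ} (ht : 0 ≤ t) : S.B t = S.b t := by simp [B, ht]
lemma AB (t : ℝ) : S.A t < S.B t := S.hab _ (le_max_right _ _)
lemma a_cont : ContinuousOn S.a (Ici 0) := fun t ht => (S.ha' t ht).continuousWithinAt
lemma b_cont : ContinuousOn S.b (Ici 0) := fun t ht => (S.hb' t ht).continuousWithinAt
lemma A_cont : Continuous S.A := S.a_cont.comp_continuous (by fun_prop) fun t => mem_Ici.2 (le_max_right _ _)
lemma B_cont : Continuous S.B := S.b_cont.comp_continuous (by fun_prop) fun t => mem_Ici.2 (le_max_right _ _)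
lemma cl_mem (t x : ℝ) : S.cl t x ∈ Icc (S.A t) (S.B t) :=
  ⟨le_max_left _ _, max_le (S.AB t).le (min_le_left _ _)⟩
lemma cl_eq {t x : ℝ} (hx : x ∈ Icc (S.A t) (S.B t)) : S.cl t x = x := by
  simp [cl, hx.1, hx.2]
lemma cl_cont : Continuous (Function.uncurry S.cl) := by
  have h1 := S.A_cont
  have h2 := S.B_cont
  simp only [Function.uncurry_def, cl]
  fun_prop
lemma R_cont : Continuous (Function.uncurry S.R) := by
  have h1 : Continuous (fun p : ℝ × ℝ => S.cl p.1 p.2) := S.cl_cont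
  exact S.ρ_cont.comp_continuous (f := fun p : ℝ × ℝ => (max p.1 0, S.cl p.1 p.2)) (by fun_prop)
    fun p => ⟨le_max_right _ _, S.cl_mem _ _⟩
lemma W_cont : Continuous (Function.uncurry S.W) := by
  have h1 : Continuous (fun p : ℝ × ℝ => S.cl p.1 p.2) := S.cl_cont
  exact S.v_cont.comp_continuous (f := fun p : ℝ × ℝ => (max p.1 0, S.cl p.1 p.2)) (by fun_prop)
    fun p => ⟨le_max_right _ _, S.cl_mem _ _⟩
lemma R_pos (t x : ℝ) : 0 < S.R t x := S.ρ_pos _ (le_max_right _ _) _ (S.cl_mem t x)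
lemma R_eq {t x : ℝ} (ht : 0 ≤ t) (hx : x ∈ Icc (S.a t) (S.b t)) : S.R t x = S.ρ t x := by
  rw [R, S.cl_eq (by rwa [S.A_eq ht, S.B_eq ht]), max_eq_left ht]
lemma W_eq {t x : ℝ} (ht : 0 ≤ t) (hx : x ∈ Icc (S.a t) (S.b t)) : S.W t x = S.v t x := by
  rw [W, S.cl_eq (by rwa [S.A_eq ht, S.B_eq ht]), max_eq_left ht]
lemma Rx_cont (t : ℝ) : Continuous (S.R t) := S.R_cont.uncurry_left t
lemma Wx_cont (t : ℝ) : Continuous (S.W t) := S.W_cont.uncurry_left t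
lemma Rt_cont (x : ℝ) : Continuous (fun t => S.R t x) := S.R_cont.uncurry_right x
lemma Wt_cont (x : ℝ) : Continuous (fun t => S.W t x) := S.W_cont.uncurry_right x
lemma R_cl (t x : ℝ) : S.R t (S.cl t x) = S.R t x := by
  rw [R, R, S.cl_eq (S.cl_mem t x)]
noncomputable def M (t x : ℝ) : ℝ := ∫ y in S.A t..x, S.R t y
lemma M_cont : Continuous (Function.uncurry S.M) := by
  have e : Function.uncurry S.M = fun p : ℝ × ℝ => (∫ y in 0..p.2, S.R p.1 y) - ∫ y in 0..S.A p.1, S.R p.1 y := by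
    ext ⟨t, x⟩
    simp only [Function.uncurry, M]
    rw [integral_interval_sub_left ((S.Rx_cont t).intervalIntegrable _ _) ((S.Rx_cont t).intervalIntegrable _ _)]
  have hR := S.R_cont
  have h1 := S.A_cont
  have c : Continuous (fun q : (ℝ × ℝ) × ℝ => S.R q.1.1 q.2) := hR.comp (by fun_prop : Continuous fun q : (ℝ × ℝ) × ℝ => (q.1.1, q.2))
  rw [e]
  refine Continuous.sub ?_ ?_
  · exact intervalIntegral.continuous_parametric_intervalIntegral_of_continuous (f := fun (p : ℝ × ℝ) y => S.R p.1 y) c continuous_snd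
  · exact intervalIntegral.continuous_parametric_intervalIntegral_of_continuous (f := fun (p : ℝ × ℝ) y => S.R p.1 y) c (h1.comp continuous_fst)
lemma M_dx (t x : ℝ) : HasDerivAt (S.M t) (S.R t x) x :=
  integral_hasDerivAt_right ((S.Rx_cont t).intervalIntegrable _ _)
      ((S.Rx_cont t).stronglyMeasurableAtFilter _ _) (S.Rx_cont t).continuousAt
lemma M_mono (t : ℝ) : StrictMono (S.M t) :=
  strictMono_of_hasDerivAt_pos (S.M_dx t) (S.R_pos t)
lemma R_lower (t : ℝ) : ∃ c > 0, ∀ x, c ≤ S.R t x := by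
  obtain ⟨x0, -, h⟩ := isCompact_Icc.exists_isMinOn (nonempty_Icc.2 (S.AB t).le) (S.Rx_cont t).continuousOn
  refine ⟨S.R t x0, S.R_pos _ _, fun x => ?_⟩
  rw [← S.R_cl t x]
  exact h (S.cl_mem t x)
lemma M_surj (t : ℝ) : Function.Surjective (S.M t) := by
  obtain ⟨c, hc, h⟩ := S.R_lower t
  have hmono : Monotone (fun x => S.M t x - c * x) := by
    refine monotone_of_hasDerivAt_nonneg (f' := fun x => S.R t x - c) (fun x => ?_) (fun x => sub_nonneg.2 (h x))
    exact ((S.M_dx t x).fun_sub ((hasDerivAt_id x).const_mul c)).congr_deriv (by ring)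
  refine Continuous.surjective (continuous_iff_continuousAt.2 fun x => (S.M_dx t x).continuousAt) ?_ ?_
  · refine tendsto_atTop_mono' atTop (f₁ := fun x => c * x + (S.M t 0)) ?_ ?_
    · filter_upwards [eventually_ge_atTop 0] with x hx
      have := hmono hx
      simp only [mul_zero, sub_zero] at this; linarith
    · exact tendsto_atTop_add_const_right _ _ (tendsto_id.const_mul_atTop hc)
  · refine tendsto_atBot_mono' atBot (f₁ := fun x => c * x + (S.M t 0)) ?_ ?_
    · filter_upwards [eventually_le_atBot 0] with x hx
      have := hmono hx
      simp only [mul_zero, sub_zero] at this; linarith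
    · exact tendsto_atBot_add_const_right _ _ (tendsto_id.const_mul_atBot hc)
noncomputable def X (t m : ℝ) : ℝ := Function.surjInv (S.M_surj t) m
lemma MX (t m : ℝ) : S.M t (S.X t m) = m := Function.surjInv_eq _ m
lemma XM (t x : ℝ) : S.X t (S.M t x) = x := (S.M_mono t).injective (S.MX _ _)
lemma X_mono (t : ℝ) : StrictMono (S.X t) := fun m m' h => by
  rw [← (S.M_mono t).lt_iff_lt, S.MX, S.MX]; exact h
lemma X_cont : Continuous (Function.uncurry S.X) := by
  rw [continuous_iff_continuousAt]
  rintro ⟨t, m⟩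
  have hM := S.M_cont
  refine tendsto_order.2 ⟨fun x hx => ?_, fun x hx => ?_⟩
  · have h1 : S.M t x < m := by rw [← S.MX t m]; exact S.M_mono t hx
    have c1 : Continuous (fun p : ℝ × ℝ => S.M p.1 x) := hM.comp (by fun_prop : Continuous fun p : ℝ × ℝ => (p.1, x))
    filter_upwards [(c1.continuousAt (x := (t, m))).eventually_lt continuous_snd.continuousAt h1] with p hp
    rw [← (S.M_mono p.1).lt_iff_lt]
    simpa [Function.uncurry, S.MX] using hp
  · have h1 : m < S.M t x := by rw [← S.MX t m]; exact S.M_mono t hx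
    have c1 : Continuous (fun p : ℝ × ℝ => S.M p.1 x) := hM.comp (by fun_prop : Continuous fun p : ℝ × ℝ => (p.1, x))
    filter_upwards [(continuous_snd.continuousAt (x := (t, m))).eventually_lt c1.continuousAt h1] with p hp
    rw [← (S.M_mono p.1).lt_iff_lt]
    simpa [Function.uncurry, S.MX] using hp
lemma X0 (t : ℝ) : S.X t 0 = S.A t := by
  rw [← (S.M_mono t).injective.eq_iff, S.MX]; simp [M]
lemma Xt_cont (m : ℝ) : Continuous (fun t => S.X t m) := S.X_cont.uncurry_right m
lemma Xm_cont (t : ℝ) : Continuous (S.X t) := S.X_cont.uncurry_left t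
lemma X_dm (t m : ℝ) : HasDerivAt (S.X t) (S.R t (S.X t m))⁻¹ m :=
  HasDerivAt.of_local_left_inverse (S.Xm_cont t).continuousAt (S.M_dx t _) (S.R_pos _ _).ne'
    (Eventually.of_forall fun m => S.MX t m)
noncomputable def rL (t m : ℝ) : ℝ := S.R t (S.X t m)
noncomputable def vL (t m : ℝ) : ℝ := S.W t (S.X t m)
lemma rL_pos (t m : ℝ) : 0 < S.rL t m := S.R_pos _ _
lemma rL_cont : Continuous (Function.uncurry S.rL) := by
  have h : Continuous (fun p : ℝ × ℝ => S.X p.1 p.2) := S.X_cont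
  exact S.R_cont.comp (by fun_prop : Continuous fun p : ℝ × ℝ => (p.1, S.X p.1 p.2))
lemma vL_cont : Continuous (Function.uncurry S.vL) := by
  have h : Continuous (fun p : ℝ × ℝ => S.X p.1 p.2) := S.X_cont
  exact S.W_cont.comp (by fun_prop : Continuous fun p : ℝ × ℝ => (p.1, S.X p.1 p.2))
def Unit1 : Prop := ∀ t, 0 ≤ t → (∫ x in S.a t..S.b t, S.ρ t x) = 1
variable {S}
lemma X1 (h : S.Unit1) {t : ℝ} (ht : 0 ≤ t) : S.X t 1 = S.b t := by
  rw [← (S.M_mono t).injective.eq_iff, S.MX, M, S.A_eq ht, ← h t ht]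
  refine integral_congr fun x hx => ?_
  rw [uIcc_of_le (S.hab t ht).le] at hx
  exact (S.R_eq ht hx).symm
lemma X0' {t : ℝ} (ht : 0 ≤ t) : S.X t 0 = S.a t := by rw [S.X0, S.A_eq ht]
lemma X_mem (h : S.Unit1) {t m : ℝ} (ht : 0 ≤ t) (hm : m ∈ Icc 0 1) : S.X t m ∈ Icc (S.a t) (S.b t) := by
  rw [← X1 h ht, ← X0' ht]
  exact ⟨(S.X_mono t).monotone hm.1, (S.X_mono t).monotone hm.2⟩
lemma X_mem' (h : S.Unit1) {t m : ℝ} (ht : 0 ≤ t) (hm : m ∈ Ioo (0:ℝ) 1) : S.X t m ∈ Ioo (S.a t) (S.b t) := by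
  rw [← X1 h ht, ← X0' ht]
  exact ⟨S.X_mono t hm.1, S.X_mono t hm.2⟩
lemma rL_eq (h : S.Unit1) {t m : ℝ} (ht : 0 ≤ t) (hm : m ∈ Icc 0 1) : S.rL t m = S.ρ t (S.X t m) :=
  S.R_eq ht (X_mem h ht hm)
lemma vL_eq (h : S.Unit1) {t m : ℝ} (ht : 0 ≤ t) (hm : m ∈ Icc 0 1) : S.vL t m = S.v t (S.X t m) :=
  S.W_eq ht (X_mem h ht hm)
lemma M_mem (h : S.Unit1) {t x : ℝ} (ht : 0 ≤ t) (hx : x ∈ Icc (S.a t) (S.b t)) : S.M t x ∈ Icc 0 1 := by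
  constructor
  · rw [← (S.X_mono t).le_iff_le, S.XM, X0' ht]; exact hx.1
  · rw [← (S.X_mono t).le_iff_le, S.XM, X1 h ht]; exact hx.2
end PistonSol
end PB1
section PB2
lemma chain_int {η g F F' : ℝ → ℝ} {s t C : ℝ} (hst : s ≤ t)
    (hg : IntervalIntegrable g volume s t) (hgC : ∀ τ ∈ Icc s t, |g τ| ≤ C)
    (hη : ∀ τ ∈ Icc s t, η τ - η s = ∫ r in s..τ, g r)
    (hpos : ∀ τ ∈ Icc s t, 0 < η τ)
    (hF : ∀ x, 0 < x → HasDerivAt F (F' x) x) (hF' : ContinuousOn F' (Ioi 0)) :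
    F (η t) - F (η s) = ∫ τ in s..t, F' (η τ) * g τ := by
  have hsub : ∀ x ∈ Icc s t, ∀ y ∈ Icc s t, η x - η y = ∫ r in y..x, g r := by
    intro x hx y hy
    rw [← integral_interval_sub_left (a := s) (hg.mono_set ?_) (hg.mono_set ?_), ← hη x hx, ← hη y hy]
    · ring
    · rw [uIcc_of_le hx.1, uIcc_of_le hst]; exact Icc_subset_Icc le_rfl hx.2
    · rw [uIcc_of_le hy.1, uIcc_of_le hst]; exact Icc_subset_Icc le_rfl hy.2
  have hlip : LipschitzOnWith (Real.toNNReal C) η (Icc s t) := by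
    refine LipschitzOnWith.of_dist_le_mul fun x hx y hy => ?_
    rw [dist_eq, dist_eq, hsub x hx y hy, coe_toNNReal C ((abs_nonneg _).trans (hgC x hx))]
    refine norm_integral_le_of_norm_le_const (f := g) (C := C) (fun r hr => hgC r ?_)
    have := uIoc_subset_uIcc hr
    rw [← uIcc_of_le hst] at hx hy ⊢
    exact uIcc_subset_uIcc hy hx this
  have hηc : ContinuousOn η (Icc s t) := hlip.continuousOn
  have hcont : ContinuousOn (fun τ => F' (η τ)) (Icc s t) := hF'.comp hηc fun τ hτ => hpos τ hτ
  obtain ⟨x1, hx1, h1⟩ := isCompact_Icc.exists_isMinOn (nonempty_Icc.2 hst) hηc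
  obtain ⟨x2, hx2, h2⟩ := isCompact_Icc.exists_isMaxOn (nonempty_Icc.2 hst) hηc
  have hsubs : Icc (η x1) (η x2) ⊆ Ioi 0 := fun z hz => (hpos x1 hx1).trans_le hz.1
  obtain ⟨D, hD⟩ := isCompact_Icc.exists_bound_of_continuousOn (hF'.mono hsubs)
  have hFl : LipschitzOnWith (Real.toNNReal D) F (Icc (η x1) (η x2)) := by
    refine Convex.lipschitzOnWith_of_nnnorm_hasDerivWithin_le (convex_Icc _ _)
      (fun x hx => (hF x (hsubs hx)).hasDerivWithinAt) (fun x hx => ?_)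
    rw [← NNReal.coe_le_coe, coe_toNNReal D ((norm_nonneg _).trans (hD x hx))]
    exact hD x hx
  have hcomp : LipschitzOnWith (Real.toNNReal D * Real.toNNReal C) (fun τ => F (η τ)) (uIcc s t) := by
    rw [uIcc_of_le hst]
    exact hFl.comp hlip fun τ hτ => ⟨h1 hτ, h2 hτ⟩
  have hac := hcomp.absolutelyContinuousOnInterval
  rw [← hac.integral_deriv_eq_sub]
  refine intervalIntegral.integral_congr_ae ?_
  have hne : ∀ᵐ x : ℝ, x ≠ t := by
    simp [ae_iff, measure_singleton]
  filter_upwards [hg.ae_hasDerivAt_integral, hne] with x hx hxt hxm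
  rw [uIoc_of_le hst] at hxm
  have hxm' : x ∈ Ioo s t := ⟨hxm.1, lt_of_le_of_ne hxm.2 hxt⟩
  have hd := hx (by rw [uIcc_of_le hst]; exact Ioc_subset_Icc_self hxm) s (by rw [uIcc_of_le hst]; exact left_mem_Icc.2 hst)
  have hd2 : HasDerivAt η (g x) x := by
    refine (hd.const_add (η s)).congr_of_eventuallyEq ?_
    filter_upwards [Icc_mem_nhds hxm'.1 hxm'.2] with y hy
    have := hη y hy
    linarith
  exact ((hF _ (hpos x (Ioo_subset_Icc_self hxm'))).comp x hd2).deriv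
namespace PistonSol
variable {P μ : ℝ → ℝ} {Pext : ℝ} (S : PistonSol P μ Pext)
def Slab (p q n : ℝ) : Prop := ∀ t ∈ Ioo p q, ∀ x ∈ Icc (S.a t) (S.b t), |S.ρx t x| ≤ n ∧ |S.vx t x| ≤ n
lemma bddF (f : ℝ → ℝ → ℝ) (hf : Continuous (Function.uncurry f)) (hcl : ∀ t x, f t (S.cl t x) = f t x) (t1 t2 : ℝ) :
    ∃ C, 0 ≤ C ∧ ∀ t ∈ Icc t1 t2, ∀ x, |f t x| ≤ C := by
  have h1 := S.A_cont
  have h2 := S.B_cont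
  have c : Continuous (fun p : ℝ × ℝ => f p.1 (S.A p.1 + p.2 * (S.B p.1 - S.A p.1))) :=
    hf.comp (by fun_prop : Continuous (fun p : ℝ × ℝ => (p.1, S.A p.1 + p.2 * (S.B p.1 - S.A p.1))))
  obtain ⟨C, hC⟩ := ((isCompact_Icc (a := t1) (b := t2)).prod (isCompact_Icc (a := (0:ℝ)) (b := 1))).exists_bound_of_continuousOn c.continuousOn
  refine ⟨max C 0, le_max_right _ _, fun t ht x => ?_⟩
  rw [← hcl t x]
  have hm := S.cl_mem t x
  have hAB := sub_pos.2 (S.AB t)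
  have := hC (t, (S.cl t x - S.A t) / (S.B t - S.A t)) ⟨ht, div_nonneg (by linarith [hm.1]) hAB.le, (div_le_one hAB).2 (by linarith [hm.2])⟩
  simp only [div_mul_cancel₀ _ hAB.ne', norm_eq_abs] at this
  rw [show S.A t + (S.cl t x - S.A t) = S.cl t x by ring] at this
  exact this.trans (le_max_left _ _)
lemma W_cl (t x : ℝ) : S.W t (S.cl t x) = S.W t x := by
  rw [W, W, S.cl_eq (S.cl_mem t x)]
lemma bddRW (t1 t2 : ℝ) : ∃ C, 0 ≤ C ∧ ∀ t ∈ Icc t1 t2, ∀ x, |S.R t x| ≤ C ∧ |S.W t x| ≤ C := by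
  obtain ⟨C1, h1, h1'⟩ := S.bddF S.R S.R_cont S.R_cl t1 t2
  obtain ⟨C2, h2, h2'⟩ := S.bddF S.W S.W_cont S.W_cl t1 t2
  exact ⟨max C1 C2, le_max_of_le_left h1, fun t ht x => ⟨(h1' t ht x).trans (le_max_left _ _), (h2' t ht x).trans (le_max_right _ _)⟩⟩
lemma lipAB (t1 t2 : ℝ) (h1 : 0 ≤ t1) : ∃ C, 0 ≤ C ∧ ∀ t ∈ Icc t1 t2, ∀ s ∈ Icc t1 t2,
    |S.a t - S.a s| ≤ C * |t - s| ∧ |S.b t - S.b s| ≤ C * |t - s| := by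
  have hsub : Icc t1 t2 ⊆ Ici 0 := fun t ht => h1.trans ht.1
  obtain ⟨C1, hC1⟩ := (isCompact_Icc (a := t1) (b := t2)).exists_bound_of_continuousOn (S.ha'_cont.mono hsub)
  obtain ⟨C2, hC2⟩ := (isCompact_Icc (a := t1) (b := t2)).exists_bound_of_continuousOn (S.hb'_cont.mono hsub)
  refine ⟨max (max C1 C2) 0, le_max_right _ _, fun t ht s hs => ⟨?_, ?_⟩⟩
  · exact Convex.norm_image_sub_le_of_norm_hasDerivWithin_le (C := max (max C1 C2) 0) (fun x hx => (S.ha' x (hsub hx)).mono hsub)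
      (fun x hx => (hC1 x hx).trans ((le_max_left _ _).trans (le_max_left _ _))) (convex_Icc _ _) hs ht
  · exact Convex.norm_image_sub_le_of_norm_hasDerivWithin_le (C := max (max C1 C2) 0) (fun x hx => (S.hb' x (hsub hx)).mono hsub)
      (fun x hx => (hC2 x hx).trans ((le_max_right _ _).trans (le_max_left _ _))) (convex_Icc _ _) hs ht
lemma lipx {p q n t : ℝ} (hp : 0 ≤ p) (h : S.Slab p q n) (ht : t ∈ Ioo p q) {x y : ℝ} (hx : x ∈ Icc (S.a t) (S.b t)) (hy : y ∈ Icc (S.a t) (S.b t)) :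
    |S.ρ t x - S.ρ t y| ≤ n * |x - y| ∧ |S.v t x - S.v t y| ≤ n * |x - y| :=
  ⟨Convex.norm_image_sub_le_of_norm_hasDerivWithin_le (fun x hx => (S.hρx t (hp.trans ht.1.le) x hx).hasDerivWithinAt)
      (fun x hx => (h t ht x hx).1) (convex_Icc _ _) hy hx,
   Convex.norm_image_sub_le_of_norm_hasDerivWithin_le (fun x hx => (S.hvx t (hp.trans_lt ht.1) x hx).hasDerivWithinAt)
      (fun x hx => (h t ht x hx).2) (convex_Icc _ _) hy hx⟩
lemma lipR {p q n t0 : ℝ} (hp : 0 ≤ p) (h : S.Slab p q n) (ht0 : t0 ∈ Ioo p q) :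
    ∃ C δ, 0 ≤ C ∧ 0 < δ ∧ Icc (t0 - δ) (t0 + δ) ⊆ Ioo p q ∧ ∀ t ∈ Icc (t0 - δ) (t0 + δ), ∀ s ∈ Icc (t0 - δ) (t0 + δ),
      ∀ y, |S.R t y - S.R s y| ≤ C * |t - s| := by
  obtain ⟨δ0, hδ0, hsub0⟩ : ∃ δ0 > 0, Icc (t0 - δ0) (t0 + δ0) ⊆ Ioo p q := by
    refine ⟨min (t0 - p) (q - t0) / 2, ?_, ?_⟩
    · have := lt_min (sub_pos.2 ht0.1) (sub_pos.2 ht0.2); linarith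
    · intro t ht
      have h1 := min_le_left (t0 - p) (q - t0)
      have h2 := min_le_right (t0 - p) (q - t0)
      have := lt_min (sub_pos.2 ht0.1) (sub_pos.2 ht0.2)
      exact ⟨by linarith [ht.1], by linarith [ht.2]⟩
  have hle0 : ∀ t ∈ Icc (t0 - δ0) (t0 + δ0), 0 < t := fun t ht => hp.trans_lt (hsub0 ht).1
  obtain ⟨C1, hC1, hRW⟩ := S.bddRW (t0 - δ0) (t0 + δ0)
  obtain ⟨C2, hC2, hab⟩ := S.lipAB (t0 - δ0) (t0 + δ0) (hle0 _ ⟨le_rfl, by linarith⟩).le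
  have hAB : ∀ᶠ t in 𝓝 t0, (S.B t0 - S.A t0) / 2 < S.B t - S.A t := by
    have hc : ContinuousAt (fun t => S.B t - S.A t) t0 := (S.B_cont.sub S.A_cont).continuousAt
    exact hc.eventually (lt_mem_nhds (by linarith [S.AB t0] : (S.B t0 - S.A t0) / 2 < S.B t0 - S.A t0))
  obtain ⟨δ1, hδ1, hball⟩ := Metric.eventually_nhds_iff.1 hAB
  set d := S.B t0 - S.A t0 with hd
  have hdpos : 0 < d := sub_pos.2 (S.AB t0)
  have hn : 0 ≤ n := (abs_nonneg _).trans (h t0 ht0 (S.a t0) ⟨le_rfl, (S.hab t0 (hp.trans ht0.1.le)).le⟩).1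
  obtain ⟨δ, hδ, hδa, hδb, hδc⟩ : ∃ δ > 0, δ ≤ δ0 ∧ δ < δ1 ∧ 8 * C2 * δ ≤ d := by
    refine ⟨min δ0 (min (δ1 / 2) (d / (8 * (C2 + 1)))), by positivity, min_le_left _ _, ?_, ?_⟩
    · exact ((min_le_right _ _).trans (min_le_left _ _)).trans_lt (by linarith)
    · have h3 : min δ0 (min (δ1 / 2) (d / (8 * (C2 + 1)))) ≤ d / (8 * (C2 + 1)) := (min_le_right _ _).trans (min_le_right _ _)
      have h4 : (d / (8 * (C2 + 1))) * (8 * (C2 + 1)) = d := div_mul_cancel₀ _ (by positivity)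
      have h5 : 0 ≤ min δ0 (min (δ1 / 2) (d / (8 * (C2 + 1)))) := by positivity
      nlinarith
  have hsub : Icc (t0 - δ) (t0 + δ) ⊆ Icc (t0 - δ0) (t0 + δ0) := Icc_subset_Icc (by linarith) (by linarith)
  refine ⟨n * (2 * C2) + n * (C1 + C1) + n * (3 * C2), δ, by positivity, hδ, hsub.trans hsub0, ?_⟩
  intro t ht s hs y
  have ht' := hsub ht
  have hs' := hsub hs
  have tp := hle0 t ht'
  have sp := hle0 s hs'
  have hst : |t - s| ≤ 2 * δ := by rw [abs_le]; constructor <;> linarith [ht.1, ht.2, hs.1, hs.2]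
  set e := C2 * |t - s| with he
  have hbs : d / 2 < S.b s - S.a s := by
    have := hball (y := s) (by rw [dist_eq, abs_lt]; constructor <;> linarith [hs.1, hs.2])
    rwa [S.A_eq sp.le, S.B_eq sp.le] at this
  have he2 : 2 * e ≤ d / 2 := by
    have : C2 * |t - s| ≤ C2 * (2 * δ) := mul_le_mul_of_nonneg_left hst hC2
    rw [he]; nlinarith
  have he0 : 0 ≤ e := by positivity
  have hba := hab t ht' s hs'
  have hz := S.cl_mem t y
  have hw := S.cl_mem s y
  have hzw : |S.cl t y - S.cl s y| ≤ e := by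
    have hA : |S.A t - S.A s| ≤ e := by rw [S.A_eq tp.le, S.A_eq sp.le]; exact hba.1
    have hB : |S.B t - S.B s| ≤ e := by rw [S.B_eq tp.le, S.B_eq sp.le]; exact hba.2
    unfold cl
    refine (abs_max_sub_max_le_max _ _ _ _).trans (max_le hA ((abs_min_sub_min_le_max _ _ _ _).trans (max_le hB ?_)))
    simpa using he0
  rw [← S.R_cl t y, ← S.R_cl s y]
  set z := S.cl t y
  set w := S.cl s y
  rw [S.A_eq tp.le, S.B_eq tp.le] at hz
  rw [S.A_eq sp.le, S.B_eq sp.le] at hw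
  rw [S.R_eq tp.le hz, S.R_eq sp.le hw]
  obtain ⟨y', hy', hzy⟩ : ∃ y', y' ∈ Icc (S.a s + e) (S.b s - e) ∧ |z - y'| ≤ 2 * e := by
    refine ⟨max (S.a s + e) (min (S.b s - e) z), ⟨le_max_left _ _, max_le (by linarith) (min_le_left _ _)⟩, ?_⟩
    have h1 := abs_le.1 hba.1
    have h2 := abs_le.1 hba.2
    rw [abs_le]
    rcases le_total (S.b s - e) z with hc | hc <;> rcases le_total (S.a s + e) z with hc' | hc' <;>
      first
      | (rw [min_eq_left hc, max_eq_right (by linarith)]; constructor <;> linarith [hz.1, hz.2])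
      | (rw [min_eq_right hc, max_eq_right hc']; constructor <;> linarith [hz.1, hz.2])
      | (rw [min_eq_right hc, max_eq_left hc']; constructor <;> linarith [hz.1, hz.2])
  have hyτ : ∀ τ ∈ uIcc s t, y' ∈ Icc (S.a τ) (S.b τ) := by
    intro τ hτ
    have hτ' : τ ∈ Icc (t0 - δ0) (t0 + δ0) := by
      rw [← uIcc_of_le (by linarith)] at hs' ht' ⊢
      exact uIcc_subset_uIcc hs' ht' hτ
    have h3 : C2 * |τ - s| ≤ e := mul_le_mul_of_nonneg_left (abs_sub_left_of_mem_uIcc hτ) hC2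
    have h4 := hab τ hτ' s hs'
    have h1 := abs_le.1 h4.1
    have h2 := abs_le.1 h4.2
    exact ⟨by linarith [hy'.1], by linarith [hy'.2]⟩
  have b1 := (S.lipx hp h (hsub0 ht') hz (hyτ t right_mem_uIcc)).1
  have b3 := (S.lipx hp h (hsub0 hs') (hyτ s left_mem_uIcc) hw).1
  have b2 : |S.ρ t y' - S.ρ s y'| ≤ (n * (C1 + C1)) * |t - s| := by
    refine Convex.norm_image_sub_le_of_norm_hasDerivWithin_le (s := uIcc s t) (f := fun τ => S.ρ τ y') (f' := fun τ => S.ρt τ y') ?_ ?_ (convex_uIcc _ _) left_mem_uIcc right_mem_uIcc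
    · intro τ hτ
      have hτ' : τ ∈ Icc (t0 - δ0) (t0 + δ0) := by
        rw [← uIcc_of_le (by linarith)] at hs' ht' ⊢
        exact uIcc_subset_uIcc hs' ht' hτ
      exact (S.hρt τ (hle0 τ hτ') y' (hyτ τ hτ)).hasDerivWithinAt
    · intro τ hτ
      have hτ' : τ ∈ Icc (t0 - δ0) (t0 + δ0) := by
        rw [← uIcc_of_le (by linarith)] at hs' ht' ⊢
        exact uIcc_subset_uIcc hs' ht' hτ
      have hm := S.mass_eq τ (hle0 τ hτ') y' (hyτ τ hτ)
      have e1 : S.ρt τ y' = -(S.ρx τ y' * S.v τ y' + S.ρ τ y' * S.vx τ y') := by linarith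
      have g1 := (hRW τ hτ' y').1
      have g2 := (hRW τ hτ' y').2
      rw [S.R_eq (hle0 τ hτ').le (hyτ τ hτ)] at g1
      rw [S.W_eq (hle0 τ hτ').le (hyτ τ hτ)] at g2
      have g3 := h τ (hsub0 hτ') y' (hyτ τ hτ)
      rw [e1, norm_eq_abs, abs_neg]
      calc _ ≤ |S.ρx τ y' * S.v τ y'| + |S.ρ τ y' * S.vx τ y'| := abs_add_le _ _
        _ ≤ n * C1 + C1 * n := by
          rw [abs_mul, abs_mul]
          exact add_le_add (mul_le_mul g3.1 g2 (abs_nonneg _) hn) (mul_le_mul g1 g3.2 (abs_nonneg _) hC1)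
        _ = _ := by ring
  have b4 : |y' - w| ≤ 3 * e := by
    have : |y' - w| ≤ |y' - z| + |z - w| := abs_sub_le _ _ _
    rw [abs_sub_comm y' z] at this
    linarith
  calc |S.ρ t z - S.ρ s w| ≤ |S.ρ t z - S.ρ t y'| + |S.ρ t y' - S.ρ s y'| + |S.ρ s y' - S.ρ s w| := by
        have := abs_sub_le (S.ρ t z) (S.ρ t y') (S.ρ s w)
        have := abs_sub_le (S.ρ t y') (S.ρ s y') (S.ρ s w)
        linarith
    _ ≤ n * (2 * e) + (n * (C1 + C1)) * |t - s| + n * (3 * e) := by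
        have := mul_le_mul_of_nonneg_left hzy hn
        have := mul_le_mul_of_nonneg_left b4 hn
        linarith
    _ = _ := by rw [he]; ring
end PistonSol
end PB2
section PB3
namespace PistonSol
variable {P μ : ℝ → ℝ} {Pext : ℝ} {S : PistonSol P μ Pext}
lemma dom_nhds {t x : ℝ} (ht : 0 < t) (hx : x ∈ Ioo (S.a t) (S.b t)) : ∀ᶠ s in 𝓝 t, 0 < s ∧ x ∈ Ioo (S.a s) (S.b s) := by
  have h1 : S.A t < x := by rw [S.A_eq ht.le]; exact hx.1
  have h2 : x < S.B t := by rw [S.B_eq ht.le]; exact hx.2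
  filter_upwards [S.A_cont.continuousAt.eventually (gt_mem_nhds h1), S.B_cont.continuousAt.eventually (lt_mem_nhds h2), lt_mem_nhds ht] with s hs1 hs2 hs3
  rw [S.A_eq (le_of_lt hs3)] at hs1
  rw [S.B_eq (le_of_lt hs3)] at hs2
  exact ⟨hs3, hs1, hs2⟩
lemma R_dt {t x : ℝ} (ht : 0 < t) (hx : x ∈ Ioo (S.a t) (S.b t)) : HasDerivAt (fun s => S.R s x) (S.ρt t x) t := by
  refine (S.hρt t ht x (Ioo_subset_Icc_self hx)).congr_of_eventuallyEq ?_
  filter_upwards [dom_nhds ht hx] with s hs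
  exact S.R_eq hs.1.le (Ioo_subset_Icc_self hs.2)
lemma flux {t x : ℝ} (ht : 0 < t) (hx : x ∈ Icc (S.a t) (S.b t)) :
    IntervalIntegrable (S.ρt t) volume (S.a t) x ∧ ∫ y in S.a t..x, S.ρt t y = S.ρ t (S.a t) * S.v t (S.a t) - S.ρ t x * S.v t x := by
  have hsub : uIcc (S.a t) x ⊆ Icc (S.a t) (S.b t) := by rw [uIcc_of_le hx.1]; exact Icc_subset_Icc le_rfl hx.2
  have hd : ∀ y ∈ uIcc (S.a t) x, HasDerivAt (fun y => -(S.ρ t y * S.v t y)) (S.ρt t y) y := by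
    intro y hy
    have := ((S.hρx t ht.le y (hsub hy)).fun_mul (S.hvx t ht y (hsub hy))).fun_neg
    refine this.congr_deriv ?_
    linarith [S.mass_eq t ht y (hsub hy)]
  have hc : ContinuousOn (S.ρt t) (uIcc (S.a t) x) := by
    have h1 : ContinuousOn (S.ρ t) (uIcc (S.a t) x) := fun y hy => (S.hρx t ht.le y (hsub hy)).continuousAt.continuousWithinAt
    have h2 : ContinuousOn (S.v t) (uIcc (S.a t) x) := fun y hy => (S.hvx t ht y (hsub hy)).continuousAt.continuousWithinAt
    have h3 : ContinuousOn (fun y => -(S.ρx t y * S.v t y + S.ρ t y * S.vx t y)) (uIcc (S.a t) x) :=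
      ((((S.ρx_cont t ht.le).mono hsub).mul h2).add (h1.mul ((S.vx_cont t ht).mono hsub))).neg
    refine h3.congr fun y hy => ?_
    have := S.mass_eq t ht y (hsub hy)
    simp only
    linarith
  refine ⟨hc.intervalIntegrable, ?_⟩
  rw [integral_eq_sub_of_hasDerivAt hd hc.intervalIntegrable]
  ring
lemma A_dt {t : ℝ} (ht : 0 < t) : HasDerivAt S.A (S.a' t) t := by
  refine (((S.ha' t ht.le).hasDerivAt (Ici_mem_nhds ht))).congr_of_eventuallyEq ?_
  filter_upwards [lt_mem_nhds ht] with s hs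
  exact S.A_eq (le_of_lt hs)
lemma B_dt {t : ℝ} (ht : 0 < t) : HasDerivAt S.B (S.b' t) t := by
  refine (((S.hb' t ht.le).hasDerivAt (Ici_mem_nhds ht))).congr_of_eventuallyEq ?_
  filter_upwards [lt_mem_nhds ht] with s hs
  exact S.B_eq (le_of_lt hs)
lemma hasDerivAt_mul_zero {f g : ℝ → ℝ} {f' t : ℝ} (hf : HasDerivAt f f' t) (h0 : f t = 0) (hg : ContinuousAt g t) :
    HasDerivAt (fun s => f s * g s) (f' * g t) t := by
  rw [hasDerivAt_iff_tendsto_slope] at hf ⊢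
  refine (hf.mul (hg.tendsto.mono_left nhdsWithin_le_nhds)).congr fun s => ?_
  simp only [slope_def_field, h0]
  ring
variable (S) in
noncomputable def av (s c d : ℝ) : ℝ := ∫ θ in 0..1, S.R s (c + (d - c) * θ)
lemma av_cont : Continuous (fun p : ℝ × ℝ × ℝ => S.av p.1 p.2.1 p.2.2) := by
  refine continuous_parametric_intervalIntegral_of_continuous' (f := fun (p : ℝ × ℝ × ℝ) θ => S.R p.1 (p.2.1 + (p.2.2 - p.2.1) * θ)) ?_ 0 1
  exact S.R_cont.comp (by fun_prop : Continuous fun q : (ℝ × ℝ × ℝ) × ℝ => (q.1.1, q.1.2.1 + (q.1.2.2 - q.1.2.1) * q.2))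
lemma av_eq (s c d : ℝ) : ∫ y in c..d, S.R s y = (d - c) * S.av s c d := by
  have := intervalIntegral.mul_integral_comp_add_mul (a := 0) (b := 1) (f := S.R s) (d - c) c
  simp only [mul_zero, mul_one, add_zero] at this
  rw [av, this]
  congr 1; ring
lemma av_pos (s c d : ℝ) : 0 < S.av s c d :=
  intervalIntegral.intervalIntegral_pos_of_pos_on (Continuous.intervalIntegrable ((S.Rx_cont s).comp (by fun_prop)) _ _)
    (fun _ _ => S.R_pos _ _) one_pos
lemma av_self (s c : ℝ) : S.av s c c = S.R s c := by simp [av]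
lemma end_dt {t : ℝ} (ht : 0 < t) : HasDerivAt (fun s => ∫ y in S.A t..S.A s, S.R s y) (S.a' t * S.R t (S.A t)) t := by
  simp only [av_eq]
  have hA := S.A_cont
  have := hasDerivAt_mul_zero (g := fun s => S.av s (S.A t) (S.A s)) ((A_dt (S := S) ht).sub_const (S.A t)) (by simp)
    ((av_cont (S := S)).comp (by fun_prop : Continuous fun s => (s, S.A t, S.A s))).continuousAt
  simpa only [av_self] using this
lemma M_dt {p q n t x : ℝ} (hp : 0 ≤ p) (h : S.Slab p q n) (ht : t ∈ Ioo p q) (hx : x ∈ Ioo (S.a t) (S.b t)) :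
    HasDerivAt (fun s => S.M s x) (-(S.ρ t x * S.v t x)) t := by
  obtain ⟨C, δ, hC, hδ, hsub, hlip⟩ := S.lipR hp h ht
  have tp : 0 < t := hp.trans_lt ht.1
  have hd := intervalIntegral.hasDerivAt_integral_of_dominated_loc_of_lip (μ := volume) (F := S.R) (F' := S.ρt t) (x₀ := t)
    (s := Icc (t - δ) (t + δ)) (a := S.a t) (b := x) (bound := fun _ => C) (Icc_mem_nhds (by linarith) (by linarith))
    (Eventually.of_forall fun s => (S.Rx_cont s).aestronglyMeasurable) ((S.Rx_cont t).intervalIntegrable _ _)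
    (flux tp (Ioo_subset_Icc_self hx)).1.aestronglyMeasurable_restrict_uIoc ?_ (by simp) ?_
  · have h2 := hd.2.fun_sub (end_dt (S := S) tp)
    rw [(flux tp (Ioo_subset_Icc_self hx)).2, S.A_eq tp.le, S.R_eq tp.le ⟨le_rfl, (S.hab t tp.le).le⟩, S.bc_a t tp.le] at h2
    refine (h2.congr_of_eventuallyEq (Eventually.of_forall fun s => ?_)).congr_deriv (by ring)
    simp only [M]
    rw [integral_interval_sub_left ((S.Rx_cont s).intervalIntegrable _ _) ((S.Rx_cont s).intervalIntegrable _ _)]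
  · refine Eventually.of_forall fun y _ => LipschitzOnWith.of_dist_le_mul fun s hs r hr => ?_
    rw [dist_eq, dist_eq, Real.coe_nnabs, abs_of_nonneg hC]
    exact hlip s hs r hr y
  · refine Eventually.of_forall fun y hy => R_dt tp ?_
    rw [uIoc_of_le hx.1.le] at hy
    exact ⟨hy.1, hy.2.trans_lt hx.2⟩
lemma X_dt (hu : S.Unit1) {p q n t m : ℝ} (hp : 0 ≤ p) (h : S.Slab p q n) (ht : t ∈ Ioo p q) (hm : m ∈ Icc 0 1) :
    HasDerivAt (fun s => S.X s m) (S.vL t m) t := by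
  have tp : 0 < t := hp.trans_lt ht.1
  rw [vL_eq hu tp.le hm]
  rcases eq_or_lt_of_le hm.1 with h0 | h0
  · subst h0
    rw [X0' tp.le, S.bc_a t tp.le]
    refine (A_dt tp).congr_of_eventuallyEq (Eventually.of_forall fun s => S.X0 s)
  rcases eq_or_lt_of_le hm.2 with h1 | h1
  · subst h1
    rw [X1 hu tp.le, S.bc_b t tp.le]
    refine (B_dt tp).congr_of_eventuallyEq ?_
    filter_upwards [lt_mem_nhds tp] with s hs
    rw [X1 hu (le_of_lt hs), S.B_eq (le_of_lt hs)]
  have hx := X_mem' hu tp.le ⟨h0, h1⟩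
  have hM := M_dt hp h ht hx
  have hX := S.Xt_cont m
  have hc : ContinuousAt (fun s => (S.av s (S.X t m) (S.X s m))⁻¹) t :=
    ContinuousAt.inv₀ ((av_cont (S := S)).comp (by fun_prop : Continuous fun s => (s, S.X t m, S.X s m))).continuousAt (av_pos _ _ _).ne'
  have := hasDerivAt_mul_zero (hM.const_sub m) (by rw [S.MX]; ring) hc
  rw [av_self, S.R_eq tp.le (Ioo_subset_Icc_self hx)] at this
  have hρ := S.ρ_pos t tp.le _ (Ioo_subset_Icc_self hx)
  refine (((this.const_add (S.X t m)).congr_of_eventuallyEq (Eventually.of_forall fun s => ?_))).congr_deriv (by field_simp)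
  have e : m - S.M s (S.X t m) = (S.X s m - S.X t m) * S.av s (S.X t m) (S.X s m) := by
    rw [← av_eq, ← integral_interval_sub_left (a := S.A s) ((S.Rx_cont s).intervalIntegrable _ _) ((S.Rx_cont s).intervalIntegrable _ _)]
    change _ = S.M s (S.X s m) - S.M s (S.X t m)
    rw [S.MX]
  simp only
  rw [e, mul_assoc, mul_inv_cancel₀ (av_pos _ _ _).ne']
  ring
end PistonSol
end PB3
section PB4
structure Coef (P μ P' μ' : ℝ → ℝ) : Prop where
  dP : ∀ x, 0 < x → HasDerivAt P (P' x) x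
  dμ : ∀ x, 0 < x → HasDerivAt μ (μ' x) x
  cP' : ContinuousOn P' (Ioi 0)
  cμ' : ContinuousOn μ' (Ioi 0)
  Ppos : ∀ x, 0 < x → 0 < P x
  μpos : ∀ x, 0 < x → 0 < μ x
  P'pos : ∀ x, 0 < x → 0 < P' x
namespace Coef
variable {P μ P' μ' : ℝ → ℝ} (c : Coef P μ P' μ')
include c
lemma cP : ContinuousOn P (Ioi 0) := fun x hx => (c.dP x hx).continuousAt.continuousWithinAt
lemma cμ : ContinuousOn μ (Ioi 0) := fun x hx => (c.dμ x hx).continuousAt.continuousWithinAt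
lemma dk {ρs : ℝ} (hρ : 0 < ρs) (x : ℝ) (hx : 0 < x) : HasDerivAt (kf μ ρs) (μ x / x) x := by
  have hc : ContinuousOn (fun τ => μ τ / τ) (Ioi 0) := c.cμ.div continuousOn_id fun x hx => (ne_of_gt hx)
  have hsub : uIcc ρs x ⊆ Ioi 0 := fun z hz => (lt_min hρ hx).trans_le hz.1
  exact integral_hasDerivAt_right ((hc.mono hsub).intervalIntegrable)
    (hc.stronglyMeasurableAtFilter isOpen_Ioi x hx) (hc.continuousAt (Ioi_mem_nhds hx))
lemma ck {ρs : ℝ} (hρ : 0 < ρs) : ContinuousOn (kf μ ρs) (Ioi 0) := fun x hx => (c.dk hρ x hx).continuousAt.continuousWithinAt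
end Coef
namespace PistonSol
variable {P μ P' μ' : ℝ → ℝ} {Pext : ℝ} {S : PistonSol P μ Pext}
variable (S) in
noncomputable def gL (t m : ℝ) : ℝ := S.vx t (S.X t m)
lemma vL_dm (hu : S.Unit1) {t m : ℝ} (ht : 0 < t) (hm : m ∈ Icc 0 1) :
    HasDerivWithinAt (S.vL t) (S.gL t m * (S.rL t m)⁻¹) (Icc 0 1) m := by
  have h1 := (S.hvx t ht _ (X_mem hu ht.le hm)).comp m (S.X_dm t m)
  exact h1.hasDerivWithinAt.congr (fun y hy => vL_eq hu ht.le hy) (vL_eq hu ht.le hm)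
lemma rL_dm (hu : S.Unit1) {t m : ℝ} (ht : 0 ≤ t) (hm : m ∈ Icc 0 1) :
    HasDerivWithinAt (S.rL t) (S.ρx t (S.X t m) * (S.rL t m)⁻¹) (Icc 0 1) m := by
  have h1 := (S.hρx t ht _ (X_mem hu ht hm)).comp m (S.X_dm t m)
  exact h1.hasDerivWithinAt.congr (fun y hy => rL_eq hu ht hy) (rL_eq hu ht hm)
lemma vLt_cont (m : ℝ) : Continuous (fun t => S.vL t m) := S.vL_cont.uncurry_right m
lemma vLm_cont (t : ℝ) : Continuous (S.vL t) := S.vL_cont.uncurry_left t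
lemma rLt_cont (m : ℝ) : Continuous (fun t => S.rL t m) := S.rL_cont.uncurry_right m
lemma rLm_cont (t : ℝ) : Continuous (S.rL t) := S.rL_cont.uncurry_left t
lemma neBot_punct {m : ℝ} (hm : m ∈ Icc 0 1) : (𝓝[Icc 0 1 \ {m}] m).NeBot := by
  have := (uniqueDiffOn_Icc (zero_lt_one' ℝ)).uniqueDiffWithinAt hm
  rwa [uniqueDiffWithinAt_iff_accPt, accPt_principal_iff_nhdsWithin] at this
lemma rL_bd (t1 t2 : ℝ) (h : t1 ≤ t2) : ∃ c C, 0 < c ∧ ∀ t ∈ Icc t1 t2, ∀ m ∈ Icc 0 1, c ≤ S.rL t m ∧ S.rL t m ≤ C := by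
  have hK := (isCompact_Icc (a := t1) (b := t2)).prod (isCompact_Icc (a := (0:ℝ)) (b := 1))
  have hne : (Icc t1 t2 ×ˢ Icc (0:ℝ) 1).Nonempty := ⟨(t1, 0), ⟨le_rfl, h⟩, le_rfl, zero_le_one⟩
  obtain ⟨x1, -, h1⟩ := hK.exists_isMinOn hne S.rL_cont.continuousOn
  obtain ⟨x2, -, h2⟩ := hK.exists_isMaxOn hne S.rL_cont.continuousOn
  exact ⟨S.rL x1.1 x1.2, S.rL x2.1 x2.2, S.rL_pos _ _, fun t ht m hm =>
    ⟨h1 (show (t, m) ∈ _ from ⟨ht, hm⟩), h2 (show (t, m) ∈ _ from ⟨ht, hm⟩)⟩⟩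
lemma gL_aesm (hu : S.Unit1) {s t m : ℝ} (hs : 0 < s) (hm : m ∈ Icc 0 1) :
    AEStronglyMeasurable (fun τ => S.gL τ m * (S.rL τ m)⁻¹) (volume.restrict (Icc s t)) := by
  have := neBot_punct hm
  refine aestronglyMeasurable_of_tendsto_ae (𝓝[Icc 0 1 \ {m}] m) (f := fun m' τ => slope (S.vL τ) m m') (fun m' => ?_) ?_
  · refine (Continuous.aestronglyMeasurable ?_)
    simp only [slope_def_field]
    exact ((vLt_cont m').sub (vLt_cont m)).div_const _
  · rw [ae_restrict_iff' measurableSet_Icc]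
    exact Eventually.of_forall fun τ hτ => hasDerivWithinAt_iff_tendsto_slope.1 (vL_dm hu (hs.trans_le hτ.1) hm)
lemma gL_bd (hu : S.Unit1) {p q n t m : ℝ} (hp : 0 ≤ p) (h : S.Slab p q n) (ht : t ∈ Ioo p q) (hm : m ∈ Icc 0 1) : |S.gL t m| ≤ n :=
  (h t ht _ (X_mem hu (hp.trans ht.1.le) hm)).2
lemma eta_int (hu : S.Unit1) {p q n s t m : ℝ} (hp : 0 ≤ p) (h : S.Slab p q n) (hs : p < s) (hst : s ≤ t) (ht : t < q) (hm : m ∈ Icc 0 1) :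
    IntervalIntegrable (fun τ => S.gL τ m * (S.rL τ m)⁻¹) volume s t ∧
    (S.rL t m)⁻¹ - (S.rL s m)⁻¹ = ∫ τ in s..t, S.gL τ m * (S.rL τ m)⁻¹ := by
  have sp : 0 < s := hp.trans_lt hs
  obtain ⟨c, C, hc, hcC⟩ := rL_bd (S := S) s t hst
  have hn : 0 ≤ n := (abs_nonneg _).trans (gL_bd hu hp h ⟨hs, hst.trans_lt ht⟩ hm)
  have hsub : Icc s t ⊆ Ioo p q := fun z hz => ⟨hs.trans_le hz.1, hz.2.trans_lt ht⟩
  have hb : ∀ τ ∈ Icc s t, ∀ m' ∈ Icc 0 1, ‖S.gL τ m' * (S.rL τ m')⁻¹‖ ≤ n * c⁻¹ := by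
    intro τ hτ m' hm'
    rw [norm_mul, norm_inv, norm_eq_abs, norm_eq_abs, abs_of_pos (S.rL_pos τ m')]
    exact mul_le_mul (gL_bd hu hp h (hsub hτ) hm') (inv_anti₀ hc (hcC τ hτ m' hm').1) (inv_nonneg.2 (S.rL_pos _ _).le) hn
  have hint : IntervalIntegrable (fun τ => S.gL τ m * (S.rL τ m)⁻¹) volume s t := by
    rw [intervalIntegrable_iff_integrableOn_Icc_of_le hst]
    refine Integrable.mono' (g := fun _ => n * c⁻¹) (integrable_const _) (gL_aesm hu sp hm) ?_
    rw [ae_restrict_iff' measurableSet_Icc]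
    exact Eventually.of_forall fun τ hτ => hb τ hτ m hm
  refine ⟨hint, ?_⟩
  have := neBot_punct hm
  have hLHS : Tendsto (fun m' => slope (S.X t) m m' - slope (S.X s) m m') (𝓝[Icc 0 1 \ {m}] m) (𝓝 ((S.rL t m)⁻¹ - (S.rL s m)⁻¹)) :=
    (hasDerivWithinAt_iff_tendsto_slope.1 (S.X_dm t m).hasDerivWithinAt).sub (hasDerivWithinAt_iff_tendsto_slope.1 (S.X_dm s m).hasDerivWithinAt)
  have hRHS : Tendsto (fun m' => ∫ τ in s..t, slope (S.vL τ) m m') (𝓝[Icc 0 1 \ {m}] m) (𝓝 (∫ τ in s..t, S.gL τ m * (S.rL τ m)⁻¹)) := by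
    refine tendsto_integral_filter_of_dominated_convergence (fun _ => n * c⁻¹) ?_ ?_ (by simp) ?_
    · refine Eventually.of_forall fun m' => (Continuous.aestronglyMeasurable ?_)
      simp only [slope_def_field]
      exact ((vLt_cont m').sub (vLt_cont m)).div_const _
    · filter_upwards [self_mem_nhdsWithin] with m' hm'
      refine Eventually.of_forall fun τ hτ => ?_
      rw [uIoc_of_le hst] at hτ
      have hτ' := Ioc_subset_Icc_self hτ
      rw [slope_def_field, norm_div, div_le_iff₀ (norm_pos_iff.2 (sub_ne_zero.2 hm'.2))]
      exact Convex.norm_image_sub_le_of_norm_hasDerivWithin_le (fun y hy => vL_dm hu (sp.trans_le hτ'.1) hy) (fun y hy => hb τ hτ' y hy) (convex_Icc _ _) hm hm'.1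
    · refine Eventually.of_forall fun τ hτ => ?_
      rw [uIoc_of_le hst] at hτ
      exact hasDerivWithinAt_iff_tendsto_slope.1 (vL_dm hu (sp.trans hτ.1) hm)
  refine tendsto_nhds_unique hLHS (hRHS.congr' ?_)
  filter_upwards [self_mem_nhdsWithin] with m' hm'
  have key : ∀ y ∈ Icc 0 1, ∫ τ in s..t, S.vL τ y = S.X t y - S.X s y := by
    intro y hy
    refine integral_eq_sub_of_hasDerivAt (f := fun τ => S.X τ y) (fun τ hτ => ?_) ((vLt_cont (S := S) y).intervalIntegrable _ _)
    rw [uIcc_of_le hst] at hτ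
    exact X_dt hu hp h (hsub hτ) hy
  simp only [slope_def_field]
  rw [intervalIntegral.integral_div, intervalIntegral.integral_sub ((vLt_cont _).intervalIntegrable _ _) ((vLt_cont _).intervalIntegrable _ _), key _ hm'.1, key _ hm]
  ring
variable (c : Coef P μ P' μ')
variable (S) in
noncomputable def kL (ρs t m : ℝ) : ℝ := kf μ ρs (S.rL t m)
variable (S) in
noncomputable def PL (t m : ℝ) : ℝ := P (S.rL t m)
lemma comp_rL {f : ℝ → ℝ} (hf : ContinuousOn f (Ioi 0)) : Continuous (fun p : ℝ × ℝ => f (S.rL p.1 p.2)) :=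
  hf.comp_continuous S.rL_cont fun _ => S.rL_pos _ _
include c
lemma KP (hu : S.Unit1) {ρs : ℝ} (hρ : 0 < ρs) {p q n s t m : ℝ} (hp : 0 ≤ p) (h : S.Slab p q n) (hs : p < s) (hst : s ≤ t) (ht : t < q) (hm : m ∈ Icc 0 1) :
    IntervalIntegrable (fun τ => μ (S.rL τ m) * S.gL τ m) volume s t ∧
    S.kL ρs t m - S.kL ρs s m = - ∫ τ in s..t, μ (S.rL τ m) * S.gL τ m := by
  have sp : 0 < s := hp.trans_lt hs
  obtain ⟨i1, i2⟩ := eta_int hu hp h hs hst ht hm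
  have hsub : Icc s t ⊆ Ioo p q := fun z hz => ⟨hs.trans_le hz.1, hz.2.trans_lt ht⟩
  obtain ⟨c0, C, hc0, hcC⟩ := rL_bd (S := S) s t hst
  have hn : 0 ≤ n := (abs_nonneg _).trans (gL_bd hu hp h ⟨hs, hst.trans_lt ht⟩ hm)
  have e1 : ∀ τ, μ (S.rL τ m) * S.gL τ m = (μ (S.rL τ m) * S.rL τ m) * (S.gL τ m * (S.rL τ m)⁻¹) := by
    intro τ; have := (S.rL_pos τ m).ne'; field_simp
  have hμr : Continuous (fun τ => μ (S.rL τ m) * S.rL τ m) :=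
    (c.cμ.comp_continuous (rLt_cont m) fun p => S.rL_pos _ _).mul (rLt_cont m)
  constructor
  · simp only [e1]
    exact i1.continuousOn_mul hμr.continuousOn
  · have := chain_int (η := fun τ => (S.rL τ m)⁻¹) (g := fun τ => S.gL τ m * (S.rL τ m)⁻¹) (F := fun y => kf μ ρs y⁻¹)
      (F' := fun y => - (μ y⁻¹ * y⁻¹)) (C := n * c0⁻¹) hst i1 ?_ ?_ (fun τ _ => inv_pos.2 (S.rL_pos _ _)) ?_ ?_
    · simp only [inv_inv] at this
      rw [kL, kL, this, ← intervalIntegral.integral_neg]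
      refine integral_congr fun τ _ => ?_
      rw [e1]; ring
    · intro τ hτ
      rw [abs_mul, abs_inv, abs_of_pos (S.rL_pos τ m)]
      exact mul_le_mul (gL_bd hu hp h (hsub hτ) hm) (inv_anti₀ hc0 (hcC τ hτ m hm).1) (inv_nonneg.2 (S.rL_pos _ _).le) hn
    · intro τ hτ
      exact (eta_int hu hp h hs hτ.1 (hτ.2.trans_lt ht) hm).2
    · intro x hx
      refine ((c.dk hρ x⁻¹ (inv_pos.2 hx)).comp x (hasDerivAt_inv hx.ne')).congr_deriv ?_
      field_simp
    · have hi : ContinuousOn (fun x : ℝ => x⁻¹) (Ioi 0) := continuousOn_inv₀.mono fun x hx => (ne_of_gt hx)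
      exact ((c.cμ.comp hi fun x hx => mem_Ioi.2 (inv_pos.2 hx)).mul hi).neg
end PistonSol
end PB4
section PB5
lemma path_int {Φ F j : ℝ → ℝ → ℝ} {X u : ℝ → ℝ} {s t y1 y2 C : ℝ} (hst : s < t)
    (hX : ∀ τ ∈ Icc s t, HasDerivAt X (u τ) τ) (hXc : Continuous X) (hu : Continuous u)
    (hXm : ∀ τ ∈ Icc s t, X τ ∈ Icc y1 y2)
    (hΦt : ∀ τ1 ∈ Icc s t, ∀ τ2 ∈ Icc s t, ∀ x ∈ Icc y1 y2, Φ τ2 x - Φ τ1 x = ∫ r in τ1..τ2, F r x)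
    (hFi : ∀ x ∈ Icc y1 y2, IntervalIntegrable (fun r => F r x) volume s t)
    (hFb : ∀ r ∈ Icc s t, ∀ x ∈ Icc y1 y2, |F r x| ≤ C)
    (hFc : ∀ r ∈ Icc s t, ContinuousOn (F r) (Icc y1 y2))
    (hΦx : ∀ τ x, HasDerivAt (Φ τ) (j τ x) x) (hj : Continuous (Function.uncurry j)) :
    Φ t (X t) - Φ s (X s) = ∫ r in s..t, (F r (X r) + j r (X r) * u r) := by
  obtain ⟨D, hD⟩ := ((isCompact_Icc (a := s) (b := t)).prod (isCompact_Icc (a := y1) (b := y2))).exists_bound_of_continuousOn hj.continuousOn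
  obtain ⟨D', hD'⟩ := (isCompact_Icc (a := s) (b := t)).exists_bound_of_continuousOn hu.continuousOn
  set h : ℕ → ℝ := fun N => (t - s) / ((N:ℝ) + 1) with hh
  have hpos : ∀ N, 0 < h N := fun N => div_pos (sub_pos.2 hst) (by positivity)
  have hN : ∀ N, h N * ((N:ℝ) + 1) = t - s := fun N => div_mul_cancel₀ _ (by positivity)
  set fl : ℕ → ℝ → ℝ := fun N r => s + h N * (⌊(r - s) / h N⌋ : ℤ) with hfl
  set G : ℕ → ℝ → ℝ := fun N r => F r (X (fl N r)) + j (fl N r + h N) (X r) * u r with hG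
  have hfl1 : ∀ N r, fl N r ≤ r ∧ r < fl N r + h N := by
    intro N r
    have h1 := Int.floor_le ((r - s) / h N)
    have h2 := Int.lt_floor_add_one ((r - s) / h N)
    rw [le_div_iff₀ (hpos N)] at h1
    rw [div_lt_iff₀ (hpos N)] at h2
    constructor <;> simp only [fl] <;> linarith
  have hflm : ∀ N, ∀ r ∈ Ioo s t, fl N r ∈ Icc s t ∧ fl N r + h N ∈ Icc s t := by
    intro N r hr
    have h0 : (0:ℤ) ≤ ⌊(r - s) / h N⌋ := Int.floor_nonneg.2 (div_nonneg (by linarith [hr.1]) (hpos N).le)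
    have h1 : ⌊(r - s) / h N⌋ + 1 ≤ (N:ℤ) + 1 := by
      have : ⌊(r - s) / h N⌋ < (N:ℤ) + 1 := by
        rw [Int.floor_lt, div_lt_iff₀ (hpos N)]; push_cast; linarith [hN N, hr.2]
      omega
    have h0' : (0:ℝ) ≤ (⌊(r - s) / h N⌋ : ℤ) := by exact_mod_cast h0
    have h1' : ((⌊(r - s) / h N⌋ : ℤ) : ℝ) + 1 ≤ (N:ℝ) + 1 := by exact_mod_cast h1
    have h2 := mul_nonneg (hpos N).le h0'
    have h3 := mul_le_mul_of_nonneg_left h1' (hpos N).le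
    rw [hN] at h3
    have := hpos N
    exact ⟨⟨by simp only [fl]; linarith, by simp only [fl]; linarith⟩, ⟨by simp only [fl]; linarith, by simp only [fl]; linarith⟩⟩
  set T : ℕ → ℕ → ℝ := fun N i => s + h N * i with hT
  have hTm : ∀ N i, i ≤ N + 1 → T N i ∈ Icc s t := by
    intro N i hi
    have h1 : (i:ℝ) ≤ (N:ℝ) + 1 := by exact_mod_cast hi
    have h3 := mul_le_mul_of_nonneg_left h1 (hpos N).le
    rw [hN] at h3
    have h2 := mul_nonneg (hpos N).le (Nat.cast_nonneg (α := ℝ) i)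
    exact ⟨by simp only [T]; linarith, by simp only [T]; linarith⟩
  have hTs : ∀ N i, T N (i + 1) = T N i + h N := fun N i => by simp only [T]; push_cast; ring
  have hpiece : ∀ N i, i < N + 1 → IntervalIntegrable (G N) volume (T N i) (T N (i + 1)) ∧
      ∫ r in T N i..T N (i + 1), G N r = Φ (T N (i + 1)) (X (T N (i + 1))) - Φ (T N i) (X (T N i)) := by
    intro N i hi
    have m1 := hTm N i hi.le
    have m2 := hTm N (i + 1) hi
    have hle : T N i ≤ T N (i + 1) := by rw [hTs]; linarith [hpos N]
    have hfi : IntervalIntegrable (fun r => F r (X (T N i))) volume (T N i) (T N (i + 1)) := by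
      refine (hFi _ (hXm _ m1)).mono_set ?_
      rw [uIcc_of_le hle, uIcc_of_le hst.le]; exact Icc_subset_Icc m1.1 m2.2
    have hc : Continuous fun r => j (T N (i + 1)) (X r) * u r :=
      (hj.comp (by fun_prop : Continuous fun r => (T N (i + 1), X r))).mul hu
    have hae : ∀ᵐ r, r ∈ uIoc (T N i) (T N (i + 1)) → F r (X (T N i)) + j (T N (i + 1)) (X r) * u r = G N r := by
      have hne : ∀ᵐ r : ℝ, r ≠ T N (i + 1) := by simp [ae_iff, measure_singleton]
      filter_upwards [hne] with r hr hm
      rw [uIoc_of_le hle] at hm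
      have : ⌊(r - s) / h N⌋ = (i:ℤ) := by
        have hlt := lt_of_le_of_ne hm.2 hr
        have := hm.1
        rw [hTs] at hlt
        simp only [T] at hlt this
        rw [Int.floor_eq_iff, le_div_iff₀ (hpos N), div_lt_iff₀ (hpos N)]
        push_cast
        constructor <;> linarith
      have e : fl N r = T N i := by simp only [fl, T, this]; push_cast; rfl
      simp only [G, e, hTs]
    refine ⟨(hfi.add (hc.intervalIntegrable _ _)).congr_ae ?_, ?_⟩
    · rw [Filter.EventuallyEq, ae_restrict_iff' measurableSet_uIoc]; exact hae
    · rw [← intervalIntegral.integral_congr_ae hae, intervalIntegral.integral_add hfi (hc.intervalIntegrable _ _), ← hΦt _ m1 _ m2 _ (hXm _ m1),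
        integral_eq_sub_of_hasDerivAt (f := fun r => Φ (T N (i + 1)) (X r)) (fun r hr => ?_) (hc.intervalIntegrable _ _)]
      · ring
      · rw [uIcc_of_le hle] at hr
        exact (hΦx _ _).comp r (hX r ⟨m1.1.trans hr.1, hr.2.trans m2.2⟩)
  have hT0 : ∀ N, T N 0 = s := fun N => by simp [T]
  have hTN : ∀ N, T N (N + 1) = t := fun N => by simp only [T]; push_cast; rw [hN]; ring
  have hGi : ∀ N, IntervalIntegrable (G N) volume s t := by
    intro N
    have := IntervalIntegrable.trans_iterate (f := G N) (a := T N) (n := N + 1) (fun i hi => (hpiece N i hi).1)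
    rwa [hT0, hTN] at this
  have hsum : ∀ N, ∫ r in s..t, G N r = Φ t (X t) - Φ s (X s) := by
    intro N
    have := intervalIntegral.sum_integral_adjacent_intervals (f := G N) (a := T N) (n := N + 1) (fun i hi => (hpiece N i hi).1)
    rw [hT0, hTN] at this
    rw [← this, Finset.sum_congr rfl (fun i hi => (hpiece N i (Finset.mem_range.1 hi)).2),
      Finset.sum_range_sub (fun i => Φ (T N i) (X (T N i))), hT0, hTN]
  have hh0 : Tendsto h atTop (𝓝 0) := by
    have := (tendsto_const_div_atTop_nhds_zero_nat (t - s)).comp (tendsto_add_atTop_nat 1)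
    refine this.congr fun N => ?_
    simp [h]
  have hfl0 : ∀ r, Tendsto (fun N => fl N r) atTop (𝓝 r) := by
    intro r
    refine tendsto_of_tendsto_of_tendsto_of_le_of_le (g := fun N => r - h N) (h := fun _ => r) ?_ tendsto_const_nhds (fun N => ?_) (fun N => (hfl1 N r).1)
    · simpa using tendsto_const_nhds.sub hh0
    · have := (hfl1 N r).2; simp only; linarith
  have hne : ∀ᵐ r : ℝ, r ≠ t := by simp [ae_iff, measure_singleton]
  have hlim : Tendsto (fun N => ∫ r in s..t, G N r) atTop (𝓝 (∫ r in s..t, (F r (X r) + j r (X r) * u r))) := by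
    refine tendsto_integral_filter_of_dominated_convergence (fun _ => C + D * D') (Eventually.of_forall fun N => ?_) (Eventually.of_forall fun N => ?_) (by simp) ?_
    · exact (hGi N).aestronglyMeasurable_restrict_uIoc
    · filter_upwards [hne] with r hr hm
      rw [uIoc_of_le hst.le] at hm
      have hr' : r ∈ Ioo s t := ⟨hm.1, lt_of_le_of_ne hm.2 hr⟩
      have hf := hflm N r hr'
      have hri := Ioo_subset_Icc_self hr'
      refine (norm_add_le _ _).trans (add_le_add (hFb r hri _ (hXm _ hf.1)) ?_)
      rw [norm_mul]
      have g1 := hD (fl N r + h N, X r) ⟨hf.2, hXm r hri⟩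
      exact mul_le_mul g1 (hD' r hri) (norm_nonneg _) ((norm_nonneg _).trans g1)
    · filter_upwards [hne] with r hr hm
      rw [uIoc_of_le hst.le] at hm
      have hr' : r ∈ Ioo s t := ⟨hm.1, lt_of_le_of_ne hm.2 hr⟩
      have hri := Ioo_subset_Icc_self hr'
      refine Tendsto.add ?_ (Tendsto.mul_const _ ?_)
      · have h1 : Tendsto (fun N => X (fl N r)) atTop (𝓝[Icc y1 y2] (X r)) :=
          tendsto_nhdsWithin_iff.2 ⟨(hXc.tendsto r).comp (hfl0 r), Eventually.of_forall fun N => hXm _ (hflm N r hr').1⟩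
        exact (hFc r hri (X r) (hXm r hri)).tendsto.comp h1
      · have h1 : Tendsto (fun N => fl N r + h N) atTop (𝓝 r) := by simpa using (hfl0 r).add hh0
        exact ((hj.comp (by fun_prop : Continuous fun τ => (τ, X r))).tendsto r).comp h1
  exact tendsto_nhds_unique (tendsto_const_nhds.congr fun N => (hsum N).symm) hlim
end PB5
section PB6
namespace PistonSol
variable {P μ P' μ' : ℝ → ℝ} {Pext : ℝ} {S : PistonSol P μ Pext}
lemma W_dt {t x : ℝ} (ht : 0 < t) (hx : x ∈ Ioo (S.a t) (S.b t)) : HasDerivAt (fun s => S.W s x) (S.vt t x) t := by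
  refine (S.hvt t ht x (Ioo_subset_Icc_self hx)).congr_of_eventuallyEq ?_
  filter_upwards [dom_nhds ht hx] with s hs
  exact S.W_eq hs.1.le (Ioo_subset_Icc_self hs.2)
lemma W_dx {t x : ℝ} (ht : 0 < t) (hx : x ∈ Ioo (S.a t) (S.b t)) : HasDerivAt (S.W t) (S.vx t x) x := by
  refine (S.hvx t ht x (Ioo_subset_Icc_self hx)).congr_of_eventuallyEq ?_
  filter_upwards [Ioo_mem_nhds hx.1 hx.2] with s hs
  exact S.W_eq ht.le (Ioo_subset_Icc_self hs)
lemma R_dx {t x : ℝ} (ht : 0 ≤ t) (hx : x ∈ Ioo (S.a t) (S.b t)) : HasDerivAt (S.R t) (S.ρx t x) x := by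
  refine (S.hρx t ht x (Ioo_subset_Icc_self hx)).congr_of_eventuallyEq ?_
  filter_upwards [Ioo_mem_nhds hx.1 hx.2] with s hs
  exact S.R_eq ht (Ioo_subset_Icc_self hs)
variable (S) in
noncomputable def lo (P' μ' : ℝ → ℝ) (t x : ℝ) : ℝ :=
  (S.ρ t x * S.v t x * S.vx t x + P' (S.ρ t x) * S.ρx t x - μ' (S.ρ t x) * S.ρx t x * S.vx t x) / μ (S.ρ t x)
variable (c : Coef P μ P' μ')
include c
lemma vx_dx {t x : ℝ} (ht : 0 < t) (hx : x ∈ Ioo (S.a t) (S.b t)) :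
    HasDerivAt (S.vx t) (S.ρ t x / μ (S.ρ t x) * S.vt t x + S.lo P' μ' t x) x := by
  have hxi := Ioo_subset_Icc_self hx
  have hρ := S.ρ_pos t ht.le x hxi
  have dρ := S.hρx t ht.le x hxi
  have hμ := c.μpos _ hρ
  have h1 := ((S.momentum_eq t ht x hx).fun_add ((c.dP _ hρ).comp x dρ)).fun_div ((c.dμ _ hρ).comp x dρ) hμ.ne'
  refine (h1.congr_of_eventuallyEq ?_).congr_deriv ?_
  · filter_upwards [Ioo_mem_nhds hx.1 hx.2] with y hy
    have := c.μpos _ (S.ρ_pos t ht.le y (Ioo_subset_Icc_self hy))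
    simp only [Function.comp]
    field_simp
    ring
  · simp only [Function.comp, lo]
    field_simp
    ring
lemma lo_bd {t x n c0 C0 V : ℝ} (hn : 0 ≤ n) (hV : 0 ≤ V) (D : ℝ) (hc0 : 0 < c0) (hD : ∀ r ∈ Icc c0 C0, |P' r| ≤ D ∧ |μ' r| ≤ D ∧ (μ r)⁻¹ ≤ D)
    (hr : S.ρ t x ∈ Icc c0 C0) (hv : |S.v t x| ≤ V) (h1 : |S.ρx t x| ≤ n) (h2 : |S.vx t x| ≤ n) :
    |S.lo P' μ' t x| ≤ (C0 * V * n + D * n + D * n * n) * D := by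
  have hμ := c.μpos _ (hc0.trans_le hr.1)
  obtain ⟨d1, d2, d3⟩ := hD _ hr
  have hD0 : 0 ≤ D := (abs_nonneg _).trans d1
  have hr' : |S.ρ t x| ≤ C0 := by rw [abs_of_pos (hc0.trans_le hr.1)]; exact hr.2
  have hC0 : 0 ≤ C0 := (abs_nonneg _).trans hr'
  rw [lo, div_eq_mul_inv, abs_mul, abs_of_pos (inv_pos.2 hμ)]
  refine mul_le_mul ?_ d3 (inv_pos.2 hμ).le (by positivity)
  refine (abs_sub _ _).trans (add_le_add ((abs_add_le _ _).trans (add_le_add ?_ ?_)) ?_)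
  · rw [abs_mul, abs_mul]
    exact mul_le_mul (mul_le_mul hr' hv (abs_nonneg _) hC0) h2 (abs_nonneg _) (by positivity)
  · rw [abs_mul]
    exact mul_le_mul d1 h1 (abs_nonneg _) hD0
  · rw [abs_mul, abs_mul]
    exact mul_le_mul (mul_le_mul d2 h1 (abs_nonneg _) hD0) h2 (abs_nonneg _) (by positivity)
lemma coef_bd {c0 C0 : ℝ} (hc0 : 0 < c0) : ∃ D, 0 ≤ D ∧ (∀ r ∈ Icc c0 C0, |P' r| ≤ D ∧ |μ' r| ≤ D ∧ (μ r)⁻¹ ≤ D ∧ μ r ≤ D ∧ P r ≤ D) ∧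
    ∀ r ∈ Icc c0 C0, ∀ s ∈ Icc c0 C0, |r / μ r - s / μ s| ≤ D * |r - s| := by
  have hsub : Icc c0 C0 ⊆ Ioi 0 := fun z hz => hc0.trans_le hz.1
  have hinv : ContinuousOn (fun r => (μ r)⁻¹) (Ioi 0) := c.cμ.inv₀ fun x hx => (c.μpos x hx).ne'
  obtain ⟨D1, h1⟩ := isCompact_Icc.exists_bound_of_continuousOn (c.cP'.mono hsub)
  obtain ⟨D2, h2⟩ := isCompact_Icc.exists_bound_of_continuousOn (c.cμ'.mono hsub)
  obtain ⟨D3, h3⟩ := isCompact_Icc.exists_bound_of_continuousOn (hinv.mono hsub)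
  obtain ⟨D5, h5⟩ := isCompact_Icc.exists_bound_of_continuousOn (c.cμ.mono hsub)
  obtain ⟨D6, h6⟩ := isCompact_Icc.exists_bound_of_continuousOn (c.cP.mono hsub)
  have hd : ContinuousOn (fun r => (1 * μ r - r * μ' r) / μ r ^ 2) (Ioi 0) :=
    ((continuousOn_const.mul c.cμ).sub (continuousOn_id.mul c.cμ')).div (c.cμ.pow 2) fun x hx => (pow_pos (c.μpos x hx) 2).ne'
  obtain ⟨D4, h4⟩ := isCompact_Icc.exists_bound_of_continuousOn (hd.mono hsub)
  set D := |D1| + |D2| + |D3| + |D4| + |D5| + |D6| with hD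
  have a1 := abs_nonneg D1; have a2 := abs_nonneg D2; have a3 := abs_nonneg D3; have a4 := abs_nonneg D4
  have a5 := abs_nonneg D5; have a6 := abs_nonneg D6
  refine ⟨D, by positivity, fun r hr => ⟨?_, ?_, ?_, ?_, ?_⟩, fun r hr s hs => ?_⟩
  · exact (h1 r hr).trans ((le_abs_self _).trans (by linarith))
  · exact (h2 r hr).trans ((le_abs_self _).trans (by linarith))
  · exact (le_abs_self _).trans ((h3 r hr).trans ((le_abs_self _).trans (by linarith)))
  · exact (le_abs_self _).trans ((h5 r hr).trans ((le_abs_self _).trans (by linarith)))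
  · exact (le_abs_self _).trans ((h6 r hr).trans ((le_abs_self _).trans (by linarith)))
  · refine Convex.norm_image_sub_le_of_norm_hasDerivWithin_le (f := fun r => r / μ r) (s := Icc c0 C0)
      (fun x hx => ((hasDerivAt_id x).fun_div (c.dμ x (hsub hx)) (c.μpos x (hsub hx)).ne').hasDerivWithinAt)
      (fun x hx => ?_) (convex_Icc _ _) hs hr
    exact (h4 x hx).trans ((le_abs_self _).trans (by linarith))
lemma rect {p q n t0 x0 : ℝ} (hp : 0 ≤ p) (h : S.Slab p q n) (ht : t0 ∈ Ioo p q) (hx0 : x0 ∈ Ioo (S.a t0) (S.b t0)) :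
    ∃ t1 t2 y1 y2, t1 < t0 ∧ t0 < t2 ∧ y1 < x0 ∧ x0 < y2 ∧ (∀ t ∈ Icc t1 t2, t ∈ Ioo p q ∧ ∀ x ∈ Icc y1 y2, x ∈ Ioo (S.a t) (S.b t)) ∧
      IntegrableOn (Function.uncurry S.vt) (Icc t1 t2 ×ˢ Icc y1 y2) := by
  obtain ⟨L, δ, hL, hδ, hsub, hlip⟩ := S.lipR hp h ht
  have tp := hp.trans_lt ht.1
  set x1 := (S.a t0 + x0) / 2 with hx1
  set x2 := (x0 + S.b t0) / 2 with hx2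
  have hA : S.A t0 < x1 := by rw [S.A_eq tp.le]; linarith [hx0.1]
  have hB : x2 < S.B t0 := by rw [S.B_eq tp.le]; linarith [hx0.2]
  obtain ⟨δ1, hδ1, hball⟩ := Metric.eventually_nhds_iff.1 ((S.A_cont.continuousAt.eventually (gt_mem_nhds hA)).and (S.B_cont.continuousAt.eventually (lt_mem_nhds hB)))
  set e := min δ (δ1 / 2) with he
  have he0 : 0 < e := by positivity
  have e1 : e ≤ δ := min_le_left _ _
  have e2 : e ≤ δ1 / 2 := min_le_right _ _
  have hI : Icc (t0 - e) (t0 + e) ⊆ Icc (t0 - δ) (t0 + δ) := Icc_subset_Icc (by linarith) (by linarith)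
  have hdom : ∀ t ∈ Icc (t0 - e) (t0 + e), t ∈ Ioo p q ∧ ∀ x ∈ Icc x1 x2, x ∈ Ioo (S.a t) (S.b t) := by
    intro t ht'
    have h1 := hsub (hI ht')
    have h0 := hp.trans h1.1.le
    have := hball (y := t) (by rw [dist_eq, abs_lt]; constructor <;> linarith [ht'.1, ht'.2])
    rw [S.A_eq h0, S.B_eq h0] at this
    exact ⟨h1, fun x hx => ⟨this.1.trans_le hx.1, hx.2.trans_lt this.2⟩⟩
  have hK := (isCompact_Icc (a := t0 - e) (b := t0 + e)).prod (isCompact_Icc (a := x1) (b := x2))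
  have hne : (Icc (t0 - e) (t0 + e) ×ˢ Icc x1 x2).Nonempty := ⟨(t0, x0), ⟨by linarith, by linarith⟩, by linarith [hx0.1], by linarith [hx0.2]⟩
  obtain ⟨z1, -, m1⟩ := hK.exists_isMinOn hne S.R_cont.continuousOn
  obtain ⟨z2, -, m2⟩ := hK.exists_isMaxOn hne S.R_cont.continuousOn
  set c0 := S.R z1.1 z1.2
  set C0 := S.R z2.1 z2.2
  have hc0 : 0 < c0 := S.R_pos _ _
  have hR : ∀ t ∈ Icc (t0 - e) (t0 + e), ∀ x ∈ Icc x1 x2, S.R t x ∈ Icc c0 C0 := fun t ht x hx => ⟨m1 (show (t, x) ∈ _ from ⟨ht, hx⟩), m2 (show (t, x) ∈ _ from ⟨ht, hx⟩)⟩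
  obtain ⟨D, hD, hD1, hD2⟩ := coef_bd c (C0 := C0) hc0
  obtain ⟨V, hV, hRW⟩ := S.bddRW (t0 - e) (t0 + e)
  have hn : 0 ≤ n := (abs_nonneg _).trans (h t0 ht x0 (Ioo_subset_Icc_self hx0)).1
  have hC0 : 0 < C0 := S.R_pos _ _
  have hDD : 0 < D + 1 := by linarith
  have hμc : Continuous (fun p : ℝ × ℝ => μ (S.R p.1 p.2)) := c.cμ.comp_continuous S.R_cont fun p => S.R_pos _ _
  have hPB : PB S.W S.vt S.vx (fun t x => S.ρ t x / μ (S.ρ t x) * S.vt t x + S.lo P' μ' t x) (fun t x => S.R t x / μ (S.R t x))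
      (t0 - e) (t0 + e) x1 x2 ((C0 * V * n + D * n + D * n * n) * D) (D * L + D * n) (C0 * D) V n (c0 / (D + 1)) :=
    { vc := S.W_cont
      bc := S.R_cont.div hμc fun p => (c.μpos _ (S.R_pos _ _)).ne'
      hs := by linarith
      hx := by linarith [hx0.1, hx0.2]
      hL := by positivity
      hb0 := by positivity
      hb := fun t ht x hx => by
        have r := hR t ht x hx
        have hμ := c.μpos _ (S.R_pos t x)
        exact div_le_div₀ (S.R_pos _ _).le r.1 hμ ((hD1 _ r).2.2.2.1.trans (by linarith))
      hB := fun t ht x hx => by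
        have r := hR t ht x hx
        have hμ := c.μpos _ (S.R_pos t x)
        rw [abs_of_pos (div_pos (S.R_pos _ _) hμ), div_eq_mul_inv]
        exact mul_le_mul r.2 (hD1 _ r).2.2.1 (inv_pos.2 hμ).le hC0.le
      hM := fun t ht x hx => (hRW t ht x).2
      hLip := fun t ht s hs x hx => by
        refine (hD2 _ (hR t ht x hx) _ (hR s hs x hx)).trans ?_
        have := mul_le_mul_of_nonneg_left (hlip t (hI ht) s (hI hs) x) hD
        have h3 : 0 ≤ D * n * |t - s| := by positivity
        linarith
      hLipx := fun t ht x hx y hy => by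
        refine (hD2 _ (hR t ht x hx) _ (hR t ht y hy)).trans ?_
        obtain ⟨d1, d2⟩ := hdom t ht
        have t0 := hp.trans d1.1.le
        have hx' := Ioo_subset_Icc_self (d2 x hx)
        have hy' := Ioo_subset_Icc_self (d2 y hy)
        rw [S.R_eq t0 hx', S.R_eq t0 hy']
        have := mul_le_mul_of_nonneg_left (S.lipx hp h d1 hx' hy').1 hD
        have h3 : 0 ≤ D * L * |x - y| := by positivity
        linarith
      dt := fun t ht x hx => by
        obtain ⟨d1, d2⟩ := hdom t (Ioo_subset_Icc_self ht)
        exact W_dt (hp.trans_lt d1.1) (d2 x (Ioo_subset_Icc_self hx))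
      dx := fun t ht x hx => by
        obtain ⟨d1, d2⟩ := hdom t (Ioo_subset_Icc_self ht)
        exact W_dx (hp.trans_lt d1.1) (d2 x (Ioo_subset_Icc_self hx))
      dxx := fun t ht x hx => by
        obtain ⟨d1, d2⟩ := hdom t (Ioo_subset_Icc_self ht)
        exact vx_dx c (hp.trans_lt d1.1) (d2 x (Ioo_subset_Icc_self hx))
      hn := fun t ht x hx => by
        obtain ⟨d1, d2⟩ := hdom t (Ioo_subset_Icc_self ht)
        exact (h t d1 x (Ioo_subset_Icc_self (d2 x (Ioo_subset_Icc_self hx)))).2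
      ineq := fun t ht x hx => by
        obtain ⟨d1, d2⟩ := hdom t (Ioo_subset_Icc_self ht)
        have t0 := hp.trans d1.1.le
        have hx' := Ioo_subset_Icc_self (d2 x (Ioo_subset_Icc_self hx))
        have r := hR t (Ioo_subset_Icc_self ht) x (Ioo_subset_Icc_self hx)
        have w := (hRW t (Ioo_subset_Icc_self ht) x).2
        rw [S.R_eq t0 hx'] at r ⊢
        rw [S.W_eq t0 hx'] at w
        rw [show S.ρ t x / μ (S.ρ t x) * S.vt t x - (S.ρ t x / μ (S.ρ t x) * S.vt t x + S.lo P' μ' t x) = -S.lo P' μ' t x by ring, abs_neg]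
        exact lo_bd c hn hV D hc0 (fun r hr => ⟨(hD1 r hr).1, (hD1 r hr).2.1, (hD1 r hr).2.2.1⟩) r w (h t d1 x hx').1 (h t d1 x hx').2 }
  refine ⟨t0 - e / 2, t0 + e / 2, (x1 + x0) / 2, (x0 + x2) / 2, by linarith, by linarith, by linarith [hx0.1], by linarith [hx0.2], ?_,
    hPB.vt_int (by linarith [hx0.1, hx0.2]) (by linarith [hx0.1]) (by linarith [hx0.2]) (by linarith) (by linarith) (by linarith)⟩
  intro t ht
  obtain ⟨d1, d2⟩ := hdom t ⟨by linarith [ht.1], by linarith [ht.2]⟩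
  exact ⟨d1, fun x hx => d2 x ⟨by linarith [hx.1, hx0.1], by linarith [hx.2, hx0.2]⟩⟩
end PistonSol
end PB6
section PB7
lemma rect_swap {j jt F : ℝ → ℝ → ℝ} {s t y1 y2 : ℝ}
    (hjt : ∀ τ ∈ Icc s t, ∀ x ∈ Icc y1 y2, HasDerivAt (fun r => j r x) (jt τ x) τ)
    (hF : ∀ τ ∈ Icc s t, ∀ x ∈ Icc y1 y2, HasDerivAt (F τ) (jt τ x) x)
    (hI : IntegrableOn (Function.uncurry jt) (Icc s t ×ˢ Icc y1 y2))
    {τ1 τ2 x : ℝ} (h1 : τ1 ∈ Icc s t) (h2 : τ2 ∈ Icc s t) (hx : x ∈ Icc y1 y2) :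
    ∫ z in y1..x, (j τ2 z - j τ1 z) = ∫ r in τ1..τ2, (F r x - F r y1) := by
  have s1 : uIcc τ1 τ2 ⊆ Icc s t := by rw [← uIcc_of_le (h1.1.trans h1.2)]; exact uIcc_subset_uIcc (by rwa [uIcc_of_le (h1.1.trans h1.2)]) (by rwa [uIcc_of_le (h1.1.trans h1.2)])
  have s2 : uIcc y1 x ⊆ Icc y1 y2 := by rw [uIcc_of_le hx.1]; exact Icc_subset_Icc le_rfl hx.2
  have hI2 : IntegrableOn (Function.uncurry jt) (uIoc τ1 τ2 ×ˢ uIoc y1 x) :=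
    hI.mono_set (prod_mono (uIoc_subset_uIcc.trans s1) (uIoc_subset_uIcc.trans s2))
  have hI3 : Integrable (Function.uncurry jt) ((volume.restrict (uIoc τ1 τ2)).prod (volume.restrict (uIoc y1 x))) := by
    rw [Measure.prod_restrict]; exact hI2
  have hsw := MeasureTheory.intervalIntegral_intervalIntegral_swap hI2
  have e1 : ∫ r in τ1..τ2, (F r x - F r y1) = ∫ r in τ1..τ2, ∫ z in y1..x, jt r z := by
    refine intervalIntegral.integral_congr_ae ?_
    have := hI3.prod_right_ae
    rw [ae_restrict_iff' measurableSet_uIoc] at this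
    filter_upwards [this] with r hr hr'
    rw [integral_eq_sub_of_hasDerivAt (fun z hz => hF r (s1 (uIoc_subset_uIcc hr')) z (s2 hz)) ?_]
    exact intervalIntegrable_iff.2 (hr hr')
  have e2 : ∫ z in y1..x, (j τ2 z - j τ1 z) = ∫ z in y1..x, ∫ r in τ1..τ2, jt r z := by
    refine intervalIntegral.integral_congr_ae ?_
    have := hI3.prod_left_ae
    rw [ae_restrict_iff' measurableSet_uIoc] at this
    filter_upwards [this] with z hz hz'
    rw [integral_eq_sub_of_hasDerivAt (f := fun r => j r z) (fun r hr => hjt r (s1 hr) z (s2 (uIoc_subset_uIcc hz'))) ?_]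
    exact intervalIntegrable_iff.2 (hz hz')
  rw [e1, e2, hsw]
namespace PistonSol
variable {P μ P' μ' : ℝ → ℝ} {Pext : ℝ} {S : PistonSol P μ Pext}
variable (S) in
noncomputable def sg (t x : ℝ) : ℝ := μ (S.R t x) * S.vx t x - P (S.R t x)
lemma vL_int (t x0 m1 m2 : ℝ) : ∫ m in m1..m2, S.vL t m = (∫ z in x0..S.X t m2, S.R t z * S.W t z) - ∫ z in x0..S.X t m1, S.R t z * S.W t z := by
  have hc : Continuous (fun z => S.R t z * S.W t z) := (S.Rx_cont t).mul (S.Wx_cont t)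
  refine integral_eq_sub_of_hasDerivAt (f := fun m => ∫ z in x0..S.X t m, S.R t z * S.W t z) (fun m _ => ?_) ((vLm_cont t).intervalIntegrable _ _)
  refine ((integral_hasDerivAt_right (hc.intervalIntegrable _ _)
      (hc.stronglyMeasurableAtFilter _ _) hc.continuousAt).comp m (S.X_dm t m)).congr_deriv ?_
  have := (S.R_pos t (S.X t m)).ne'
  rw [vL]; field_simp
variable (c : Coef P μ P' μ')
include c
lemma CIloc (hu : S.Unit1) {ρs : ℝ} (hρ : 0 < ρs) {p q n t0 m0 : ℝ} (hp : 0 ≤ p) (h : S.Slab p q n) (ht : t0 ∈ Ioo p q) (hm0 : m0 ∈ Ioo (0:ℝ) 1) :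
    ∃ e > 0, ∀ s t, t0 - e ≤ s → s < t → t ≤ t0 + e → ∀ m ∈ Icc (m0 - e) (m0 + e), 
      (∫ m' in m0..m, S.vL t m') - (∫ m' in m0..m, S.vL s m') = 
      -(S.kL ρs t m - S.kL ρs s m) - (∫ τ in s..t, S.PL τ m) + (S.kL ρs t m0 - S.kL ρs s m0) + ∫ τ in s..t, S.PL τ m0 := by
  have tp : 0 < t0 := hp.trans_lt ht.1
  obtain ⟨t1, t2, y1, y2, ht1, ht2, hy1, hy2, hdom, hint⟩ := rect c hp h ht (X_mem' hu tp.le hm0)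
  have hn : 0 ≤ n := (abs_nonneg _).trans (gL_bd hu hp h ht (Ioo_subset_Icc_self hm0))
  have hev : ∀ᶠ z : ℝ × ℝ in 𝓝 (t0, m0), (t1 < z.1 ∧ z.1 < t2) ∧ (y1 < S.X z.1 z.2 ∧ S.X z.1 z.2 < y2) ∧ (0 < z.2 ∧ z.2 < 1) := by
    have hX : Continuous (fun z : ℝ × ℝ => S.X z.1 z.2) := S.X_cont
    refine (((continuous_fst.tendsto _).eventually (lt_mem_nhds ht1)).and ((continuous_fst.tendsto _).eventually (gt_mem_nhds ht2))).and
      (((hX.tendsto (t0, m0)).eventually (lt_mem_nhds hy1)).and ((hX.tendsto (t0, m0)).eventually (gt_mem_nhds hy2)) |>.and 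
      (((continuous_snd.tendsto _).eventually (lt_mem_nhds hm0.1)).and ((continuous_snd.tendsto _).eventually (gt_mem_nhds hm0.2))))
  obtain ⟨e, he, hball⟩ := Metric.eventually_nhds_iff.1 hev
  refine ⟨e / 2, by positivity, fun s t hs hst ht' => ?_⟩
  have hb : ∀ τ ∈ Icc s t, ∀ m ∈ Icc (m0 - e/2) (m0 + e/2), (t1 < τ ∧ τ < t2) ∧ (y1 < S.X τ m ∧ S.X τ m < y2) ∧ (0 < m ∧ m < 1) := by
    intro τ hτ m hm
    refine hball (y := (τ, m)) ?_
    rw [Prod.dist_eq, max_lt_iff, dist_eq, dist_eq, abs_lt, abs_lt]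
    exact ⟨⟨by simp only; linarith [hτ.1], by simp only; linarith [hτ.2]⟩, by simp only; linarith [hm.1], by simp only; linarith [hm.2]⟩
  have hsI : ∀ τ ∈ Icc s t, τ ∈ Icc t1 t2 := fun τ hτ => by
    have := (hb τ hτ m0 ⟨by linarith, by linarith⟩).1; exact ⟨this.1.le, this.2.le⟩
  obtain ⟨V, hV, hRW⟩ := S.bddRW t1 t2
  have t1p : ∀ τ ∈ Icc t1 t2, 0 < τ := fun τ hτ => hp.trans_lt (hdom τ hτ).1.1
  set j : ℝ → ℝ → ℝ := fun t x => S.R t x * S.W t x with hj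
  have jc : Continuous (Function.uncurry j) := S.R_cont.mul S.W_cont
  set jt : ℝ → ℝ → ℝ := fun t x => S.ρt t x * S.W t x + S.R t x * S.vt t x with hjt
  set F : ℝ → ℝ → ℝ := fun t x => S.sg t x - S.R t x * S.W t x ^ 2 with hF
  have djt : ∀ τ ∈ Icc t1 t2, ∀ x ∈ Icc y1 y2, HasDerivAt (fun r => j r x) (jt τ x) τ := fun τ hτ x hx =>
    (R_dt (t1p τ hτ) ((hdom τ hτ).2 x hx)).fun_mul (W_dt (t1p τ hτ) ((hdom τ hτ).2 x hx))
  have dF : ∀ τ ∈ Icc t1 t2, ∀ x ∈ Icc y1 y2, HasDerivAt (F τ) (jt τ x) x := by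
    intro τ hτ x hx
    have hxo := (hdom τ hτ).2 x hx
    have hxi := Ioo_subset_Icc_self hxo
    have τp := t1p τ hτ
    have d1 : HasDerivAt (S.sg τ) (S.ρ τ x * (S.vt τ x + S.v τ x * S.vx τ x)) x := by
      refine (S.momentum_eq τ τp x hxo).congr_of_eventuallyEq ?_
      filter_upwards [Ioo_mem_nhds hxo.1 hxo.2] with y hy
      rw [sg, S.R_eq τp.le (Ioo_subset_Icc_self hy)]
    refine (d1.fun_sub ((R_dx τp.le hxo).fun_mul ((W_dx τp hxo).fun_pow 2))).congr_deriv ?_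
    simp only [hjt, S.R_eq τp.le hxi, S.W_eq τp.le hxi]
    have : S.ρt τ x = -(S.ρx τ x * S.v τ x + S.ρ τ x * S.vx τ x) := by linarith [S.mass_eq τ τp x hxi]
    rw [this]; push_cast; ring
  have hjI : IntegrableOn (Function.uncurry jt) (Icc t1 t2 ×ˢ Icc y1 y2) := by
    have hms : MeasurableSet (Icc t1 t2 ×ˢ Icc y1 y2) := measurableSet_Icc.prod measurableSet_Icc
    have hfin : volume (Icc t1 t2 ×ˢ Icc y1 y2) < ⊤ := (isCompact_Icc.prod isCompact_Icc).measure_lt_top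
    have aes : AEStronglyMeasurable (Function.uncurry S.ρt) (volume.restrict (Icc t1 t2 ×ˢ Icc y1 y2)) := by
      refine aestronglyMeasurable_of_tendsto_ae (𝓝[>] (0:ℝ)) (f := fun e z => e⁻¹ * (S.R (z.1 + e) z.2 - S.R z.1 z.2)) (fun e => ?_) ?_
      · have hR : Continuous (fun z : ℝ × ℝ => S.R z.1 z.2) := S.R_cont
        have hR' : Continuous (fun z : ℝ × ℝ => S.R (z.1 + e) z.2) := S.R_cont.comp (by fun_prop : Continuous fun z : ℝ × ℝ => (z.1 + e, z.2))
        exact (continuous_const.mul (hR'.sub hR)).aestronglyMeasurable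
      · rw [ae_restrict_iff' hms]
        refine Eventually.of_forall fun z hz => ?_
        have := (R_dt (t1p z.1 hz.1) ((hdom z.1 hz.1).2 z.2 hz.2)).tendsto_slope_zero_right
        simpa [Function.uncurry] using this
    have i1 : IntegrableOn (Function.uncurry S.ρt) (Icc t1 t2 ×ˢ Icc y1 y2) := by
      have : IsFiniteMeasure (volume.restrict (Icc t1 t2 ×ˢ Icc y1 y2)) := ⟨by simpa using hfin⟩
      refine Integrable.mono' (g := fun _ => n * V + V * n) (integrable_const _) aes ?_
      rw [ae_restrict_iff' hms]
      refine Eventually.of_forall fun z hz => ?_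
      have τp := t1p z.1 hz.1
      have hxi := Ioo_subset_Icc_self ((hdom z.1 hz.1).2 z.2 hz.2)
      have hb := h z.1 (hdom z.1 hz.1).1 z.2 hxi
      have hb2 := hRW z.1 hz.1 z.2
      rw [S.R_eq τp.le hxi, S.W_eq τp.le hxi] at hb2
      have : S.ρt z.1 z.2 = -(S.ρx z.1 z.2 * S.v z.1 z.2 + S.ρ z.1 z.2 * S.vx z.1 z.2) := by linarith [S.mass_eq z.1 τp z.2 hxi]
      simp only [Function.uncurry_def, norm_eq_abs]
      rw [this, abs_neg]
      refine (abs_add_le _ _).trans (add_le_add ?_ ?_) <;> rw [abs_mul]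
      · exact mul_le_mul hb.1 hb2.2 (abs_nonneg _) hn
      · exact mul_le_mul hb2.1 hb.2 (abs_nonneg _) hV
    have k := isCompact_Icc.prod (isCompact_Icc (a := y1) (b := y2)) (s := Icc t1 t2)
    exact (i1.mul_continuousOn S.W_cont.continuousOn k).add (hint.continuousOn_mul S.R_cont.continuousOn k)
  obtain ⟨D, hD⟩ : ∃ D, ∀ τ ∈ Icc t1 t2, ∀ x ∈ Icc y1 y2, |μ (S.R τ x)| ≤ D ∧ |P (S.R τ x)| ≤ D := by
    have k := isCompact_Icc.prod (isCompact_Icc (a := y1) (b := y2)) (s := Icc t1 t2)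
    have c1 : Continuous (fun p : ℝ × ℝ => μ (S.R p.1 p.2)) := c.cμ.comp_continuous S.R_cont fun p => S.R_pos _ _
    have c2 : Continuous (fun p : ℝ × ℝ => P (S.R p.1 p.2)) := c.cP.comp_continuous S.R_cont fun p => S.R_pos _ _
    obtain ⟨D1, h1⟩ := k.exists_bound_of_continuousOn c1.continuousOn
    obtain ⟨D2, h2⟩ := k.exists_bound_of_continuousOn c2.continuousOn
    exact ⟨max D1 D2, fun τ hτ x hx => ⟨(h1 (τ, x) ⟨hτ, hx⟩).trans (le_max_left _ _), (h2 (τ, x) ⟨hτ, hx⟩).trans (le_max_right _ _)⟩⟩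
  have hFb : ∀ τ ∈ Icc t1 t2, ∀ x ∈ Icc y1 y2, |F τ x| ≤ D * n + D + V * V ^ 2 := by
    intro τ hτ x hx
    have hxi := Ioo_subset_Icc_self ((hdom τ hτ).2 x hx)
    obtain ⟨d1, d2⟩ := hD τ hτ x hx
    have hb := h τ (hdom τ hτ).1 x hxi
    have hb2 := hRW τ hτ x
    have hD0 : 0 ≤ D := (abs_nonneg _).trans d1
    refine (abs_sub _ _).trans (add_le_add ((abs_sub _ _).trans (add_le_add ?_ d2)) ?_) <;> rw [abs_mul]
    · exact mul_le_mul d1 hb.2 (abs_nonneg _) hD0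
    · rw [abs_pow]
      exact mul_le_mul hb2.1 (pow_le_pow_left₀ (abs_nonneg _) hb2.2 2) (by positivity) hV
  have hFi : ∀ x ∈ Icc y1 y2, IntervalIntegrable (fun r => F r x) volume t1 t2 := by
    intro x hx
    rw [intervalIntegrable_iff, uIoc_of_le (by linarith)]
    have hms : MeasurableSet (Ioc t1 t2) := measurableSet_Ioc
    have aes : AEStronglyMeasurable (fun r => S.vx r x) (volume.restrict (Ioc t1 t2)) := by
      refine aestronglyMeasurable_of_tendsto_ae (𝓝[>] (0:ℝ)) (f := fun e r => e⁻¹ * (S.W r (x + e) - S.W r x)) (fun e => ?_) ?_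
      · exact (continuous_const.mul ((S.Wt_cont _).sub (S.Wt_cont _))).aestronglyMeasurable
      · rw [ae_restrict_iff' hms]
        refine Eventually.of_forall fun r hr => ?_
        have hr := Ioc_subset_Icc_self hr
        have := (W_dx (t1p r hr) ((hdom r hr).2 x hx)).tendsto_slope_zero_right
        simpa using this
    have c1 : Continuous (fun p : ℝ => μ (S.R p x)) := c.cμ.comp_continuous (S.Rt_cont x) fun p => S.R_pos _ _
    have c2 : Continuous (fun p : ℝ => P (S.R p x)) := c.cP.comp_continuous (S.Rt_cont x) fun p => S.R_pos _ _
    refine Integrable.mono' (g := fun _ => D * n + D + V * V ^ 2) (integrable_const _) 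
      (((c1.aestronglyMeasurable.mul aes).sub c2.aestronglyMeasurable).sub ((S.Rt_cont x).mul ((S.Wt_cont x).pow 2)).aestronglyMeasurable) ?_
    rw [ae_restrict_iff' hms]
    exact Eventually.of_forall fun r hr => hFb r (Ioc_subset_Icc_self hr) x hx
  have hyy : y1 ≤ y2 := by linarith
  have hFi' : ∀ x ∈ Icc y1 y2, ∀ r1 ∈ Icc t1 t2, ∀ r2 ∈ Icc t1 t2, IntervalIntegrable (fun r => F r x) volume r1 r2 := by
    intro x hx r1 h1 r2 h2
    rw [← uIcc_of_le (by linarith : t1 ≤ t2)] at h1 h2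
    exact (hFi x hx).mono_set (uIcc_subset_uIcc h1 h2)
  have ty : y1 ∈ Icc y1 y2 := ⟨le_rfl, hyy⟩
  have tt : t1 ∈ Icc t1 t2 := ⟨le_rfl, by linarith⟩
  set Φ : ℝ → ℝ → ℝ := fun τ x => (∫ z in y1..x, j τ z) + ∫ r in t1..τ, F r y1 with hΦ
  have jcx : ∀ τ, Continuous (j τ) := fun τ => (S.Rx_cont τ).mul (S.Wx_cont τ)
  have main : ∀ m ∈ Icc (m0 - e/2) (m0 + e/2), Φ t (S.X t m) - Φ s (S.X s m) = -(S.kL ρs t m - S.kL ρs s m) - ∫ τ in s..t, S.PL τ m := by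
    intro m hm
    have hm1 : m ∈ Icc 0 1 := by
      have := (hb s ⟨le_rfl, hst.le⟩ m hm).2.2; exact ⟨this.1.le, this.2.le⟩
    have hsI' : ∀ τ ∈ Icc s t, τ ∈ Ioo p q := fun τ hτ => (hdom τ (hsI τ hτ)).1
    rw [path_int (Φ := Φ) (F := F) (j := j) (X := fun τ => S.X τ m) (u := fun τ => S.vL τ m) (y1 := y1) (y2 := y2) (C := D * n + D + V * V ^ 2) hst
      (fun τ hτ => X_dt hu hp h (hsI' τ hτ) hm1) (S.Xt_cont m) (vLt_cont m) 
      (fun τ hτ => by have := (hb τ hτ m hm).2.1; exact ⟨this.1.le, this.2.le⟩)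
      ?_ (fun x hx => hFi' x hx _ (hsI s ⟨le_rfl, hst.le⟩) _ (hsI t ⟨hst.le, le_rfl⟩)) (fun r hr => hFb r (hsI r hr))
      (fun r hr x hx => (dF r (hsI r hr) x hx).continuousAt.continuousWithinAt) (fun τ x => ?_) jc]
    · obtain ⟨k1, k2⟩ := KP c hu hρ hp h (hsI' s ⟨le_rfl, hst.le⟩).1 hst.le (hsI' t ⟨hst.le, le_rfl⟩).2 hm1
      have hPc : Continuous (fun τ => S.PL τ m) := (comp_rL c.cP).uncurry_right m
      rw [k2, neg_neg, ← intervalIntegral.integral_sub k1 (hPc.intervalIntegrable _ _)]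
      refine integral_congr fun τ _ => ?_
      simp only [hF, hj, sg, vL, PL, gL, rL]
      ring
    · intro τ1 h1 τ2 h2 x hx
      have h1 := hsI _ h1
      have h2 := hsI _ h2
      have := rect_swap djt dF hjI h1 h2 hx
      rw [intervalIntegral.integral_sub ((jcx _).intervalIntegrable _ _) ((jcx _).intervalIntegrable _ _),
        intervalIntegral.integral_sub (hFi' x hx _ h1 _ h2) (hFi' y1 ty _ h1 _ h2)] at this
      have a := integral_interval_sub_left (hFi' y1 ty _ tt _ h2) (hFi' y1 ty _ tt _ h1)
      simp only [hΦ]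
      linarith
    · exact (integral_hasDerivAt_right ((jcx τ).intervalIntegrable _ _)
        ((jcx τ).stronglyMeasurableAtFilter _ _) (jcx τ).continuousAt).add_const _
  intro m hm
  rw [vL_int t y1, vL_int s y1]
  have a1 := main m hm
  have a2 := main m0 ⟨by linarith, by linarith⟩
  simp only [hΦ, hj] at a1 a2
  linarith
end PistonSol
end PB7
section PB8
namespace PistonSol
variable {P μ P' μ' : ℝ → ℝ} {Pext : ℝ} {S : PistonSol P μ Pext}
variable (S) in
noncomputable def j1 (ρs t m : ℝ) : ℝ := (∫ m' in 0..m, S.vL t m') + S.kL ρs t m + ∫ τ in 0..t, S.PL τ m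
variable (S) in
noncomputable def jA (Rf Pext ρs t : ℝ) : ℝ := S.vL t 0 + S.kL ρs t 0 - ∫ τ in 0..t, (-Rf * S.vL τ 0 + Pext - S.PL τ 0)
variable (S) in
noncomputable def jB (Pext ρs t : ℝ) : ℝ := S.vL t 1 - S.kL ρs t 1 - ∫ τ in 0..t, (S.PL τ 1 - Pext)
variable (c : Coef P μ P' μ')
include c
lemma PL_cont : Continuous (Function.uncurry S.PL) := comp_rL c.cP
lemma PLt_cont (m : ℝ) : Continuous (fun t => S.PL t m) := (PL_cont c).uncurry_right m
lemma kL_cont {ρs : ℝ} (hρ : 0 < ρs) : Continuous (Function.uncurry (S.kL ρs)) := comp_rL (c.ck hρ)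
lemma kLt_cont {ρs : ℝ} (hρ : 0 < ρs) (m : ℝ) : Continuous (fun t => S.kL ρs t m) := (kL_cont c hρ).uncurry_right m
lemma kLm_cont {ρs : ℝ} (hρ : 0 < ρs) (t : ℝ) : Continuous (S.kL ρs t) := (kL_cont c hρ).uncurry_left t
lemma j1m_cont {ρs : ℝ} (hρ : 0 < ρs) (t : ℝ) : Continuous (S.j1 ρs t) := by
  refine ((continuous_primitive (fun a b => (vLm_cont t).intervalIntegrable a b) 0).add (kLm_cont c hρ t)).add ?_
  refine continuous_parametric_intervalIntegral_of_continuous' (f := fun m τ => S.PL τ m) ?_ _ _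
  exact (PL_cont c).comp (by fun_prop : Continuous fun z : ℝ × ℝ => (z.2, z.1))
lemma j1t_cont {ρs : ℝ} (hρ : 0 < ρs) (m : ℝ) : Continuous (fun t => S.j1 ρs t m) := by
  refine (Continuous.add ?_ (kLt_cont c hρ m)).add (continuous_primitive (fun a b => (PLt_cont c m).intervalIntegrable a b) 0)
  exact continuous_parametric_intervalIntegral_of_continuous' (f := S.vL) S.vL_cont _ _
lemma jA_cont (Rf : ℝ) {ρs : ℝ} (hρ : 0 < ρs) : Continuous (S.jA Rf Pext ρs) := by
  have h1 := vLt_cont (S := S) 0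
  have h2 := PLt_cont (S := S) c 0
  exact ((vLt_cont 0).add (kLt_cont c hρ 0)).sub (continuous_primitive (fun a b => 
    (by fun_prop : Continuous fun τ => -Rf * S.vL τ 0 + Pext - S.PL τ 0).intervalIntegrable a b) 0)
lemma jB_cont {ρs : ℝ} (hρ : 0 < ρs) : Continuous (S.jB Pext ρs) := by
  have h2 := PLt_cont (S := S) c 1
  exact ((vLt_cont 1).sub (kLt_cont c hρ 1)).sub (continuous_primitive (fun a b => 
    (by fun_prop : Continuous fun τ => S.PL τ 1 - Pext).intervalIntegrable a b) 0)
lemma j1_slab (hu : S.Unit1) {ρs : ℝ} (hρ : 0 < ρs) {p q n : ℝ} (hp : 0 ≤ p) (h : S.Slab p q n) {s t m : ℝ} (hs : s ∈ Ioo p q) (ht : t ∈ Ioo p q) (hm : m ∈ Icc 0 1) :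
    S.j1 ρs t m - S.j1 ρs t 0 = S.j1 ρs s m - S.j1 ρs s 0 := by
  have vi : ∀ t a b, IntervalIntegrable (S.vL t) volume a b := fun t a b => (vLm_cont t).intervalIntegrable _ _
  have Pi : ∀ m a b, IntervalIntegrable (fun t => S.PL t m) volume a b := fun m a b => (PLt_cont c m).intervalIntegrable _ _
  have loc : ∀ t0 ∈ Ioo p q, ∀ m0 ∈ Ioo (0:ℝ) 1, ∀ m1 ∈ Ioo (0:ℝ) 1, ∀ᶠ t in 𝓝 t0, S.j1 ρs t m1 - S.j1 ρs t0 m1 = S.j1 ρs t m0 - S.j1 ρs t0 m0 := by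
    intro t0 ht0 m0 hm0 m1 hm1
    refine isPreconnected_Ioo.induction₂ (s := Ioo (0:ℝ) 1) (fun m0 m1 => ∀ᶠ t in 𝓝 t0, S.j1 ρs t m1 - S.j1 ρs t0 m1 = S.j1 ρs t m0 - S.j1 ρs t0 m0) ?_ ?_ ?_ hm0 hm1
    · intro m0 hm0
      obtain ⟨e, he, hloc⟩ := CIloc c hu hρ hp h ht0 hm0
      have : Icc (m0 - e) (m0 + e) ∈ 𝓝[Ioo 0 1] m0 := mem_nhdsWithin_of_mem_nhds (Icc_mem_nhds (by linarith) (by linarith))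
      filter_upwards [this] with m hm
      filter_upwards [Icc_mem_nhds (by linarith : t0 - e < t0) (by linarith : t0 < t0 + e)] with t ht
      have key : ∀ s t, t0 - e ≤ s → s < t → t ≤ t0 + e → S.j1 ρs t m - S.j1 ρs s m = S.j1 ρs t m0 - S.j1 ρs s m0 := by
        intro s t hs hst ht
        have := hloc s t hs hst ht m hm
        rw [← integral_interval_sub_left (vi t 0 m) (vi t 0 m0), ← integral_interval_sub_left (vi s 0 m) (vi s 0 m0),
          ← integral_interval_sub_left (Pi m 0 t) (Pi m 0 s), ← integral_interval_sub_left (Pi m0 0 t) (Pi m0 0 s)] at this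
        simp only [j1]; linarith
      rcases lt_trichotomy t t0 with h1 | h1 | h1
      · have := key t t0 ht.1 h1 (by linarith); linarith
      · rw [h1]; ring
      · exact key t0 t (by linarith) h1 ht.2
    · intro x y z _ _ _ h1 h2
      filter_upwards [h1, h2] with t h1 h2
      rw [h2, h1]
    · intro x y _ _ h1
      filter_upwards [h1] with t h1
      rw [h1]
  have const : ∀ m0 ∈ Ioo (0:ℝ) 1, ∀ m1 ∈ Ioo (0:ℝ) 1, S.j1 ρs t m1 - S.j1 ρs t m0 = S.j1 ρs s m1 - S.j1 ρs s m0 := by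
    intro m0 hm0 m1 hm1
    refine isPreconnected_Ioo.induction₂ (s := Ioo p q) (fun s t => S.j1 ρs t m1 - S.j1 ρs t m0 = S.j1 ρs s m1 - S.j1 ρs s m0) ?_ ?_ ?_ hs ht
    · intro t0 ht0
      refine mem_nhdsWithin_of_mem_nhds ?_
      filter_upwards [loc t0 ht0 m0 hm0 m1 hm1] with t ht; linarith
    · intro x y z _ _ _ h1 h2; rw [h2, h1]
    · intro x y _ _ h1; rw [h1]
  have hcl : ∀ {f g : ℝ → ℝ}, Continuous f → Continuous g → (∀ m ∈ Ioo (0:ℝ) 1, f m = g m) → ∀ m ∈ Icc 0 1, f m = g m := by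
    intro f g hf hg hfg m hm
    have := closure_minimal (s := Ioo (0:ℝ) 1) (t := {m | f m = g m}) hfg (isClosed_eq hf hg)
    rw [closure_Ioo (by norm_num)] at this
    exact this hm
  have ct := j1m_cont (S := S) c hρ t
  have cs := j1m_cont (S := S) c hρ s
  have s1 : ∀ m0 ∈ Ioo (0:ℝ) 1, ∀ m1 ∈ Icc 0 1, S.j1 ρs t m1 - S.j1 ρs t m0 = S.j1 ρs s m1 - S.j1 ρs s m0 := fun m0 hm0 =>
    hcl (by fun_prop) (by fun_prop) (const m0 hm0)
  exact hcl (f := fun m0 => S.j1 ρs t m - S.j1 ρs t m0) (g := fun m0 => S.j1 ρs s m - S.j1 ρs s m0) (by fun_prop) (by fun_prop) (fun m0 hm0 => s1 m0 hm0 m hm) 0 ⟨le_rfl, zero_le_one⟩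
lemma jA_slab (hu : S.Unit1) {ρs Rf : ℝ} (hρ : 0 < ρs) (hf : ∀ t, 0 < t → S.u t = -Rf * S.v t (S.a t)) {p q n : ℝ} (hp : 0 ≤ p) (h : S.Slab p q n) {s t : ℝ} (hs : p < s) (hst : s ≤ t) (ht : t < q) :
    S.jA Rf Pext ρs t = S.jA Rf Pext ρs s := by
  have sp : 0 < s := hp.trans_lt hs
  obtain ⟨k1, k2⟩ := KP c hu hρ hp h hs hst ht (m := 0) ⟨le_rfl, zero_le_one⟩
  have c1 : Continuous fun τ => -Rf * S.vL τ 0 + Pext - S.PL τ 0 := by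
    have h1 := vLt_cont (S := S) 0
    have h2 := PLt_cont (S := S) c 0
    fun_prop
  have e : ∀ τ, 0 ≤ τ → S.vL τ 0 = S.a' τ := fun τ hτ => by rw [vL_eq hu hτ ⟨le_rfl, zero_le_one⟩, X0' hτ, S.bc_a τ hτ]
  have := integral_eq_sub_of_hasDerivAt (a := s) (b := t) (f := S.a') (f' := fun τ => (-Rf * S.vL τ 0 + Pext - S.PL τ 0) + μ (S.rL τ 0) * S.gL τ 0) (fun τ hτ => ?_) ((c1.intervalIntegrable _ _).add k1)
  · rw [intervalIntegral.integral_add (c1.intervalIntegrable _ _) k1] at this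
    have a := integral_interval_sub_left (c1.intervalIntegrable (μ := volume) 0 t) (c1.intervalIntegrable 0 s)
    simp only [jA]
    rw [e t (sp.le.trans hst), e s sp.le]
    linarith
  · rw [uIcc_of_le hst] at hτ
    have τp : 0 < τ := sp.trans_le hτ.1
    refine (S.ha'' τ τp).congr_deriv ?_
    rw [S.newton_a τ τp, hf τ τp, vL_eq hu τp.le ⟨le_rfl, zero_le_one⟩, PL, rL_eq hu τp.le ⟨le_rfl, zero_le_one⟩, gL, X0' τp.le]
    
lemma jB_slab (hu : S.Unit1) {ρs : ℝ} (hρ : 0 < ρs) {p q n : ℝ} (hp : 0 ≤ p) (h : S.Slab p q n) {s t : ℝ} (hs : p < s) (hst : s ≤ t) (ht : t < q) :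
    S.jB Pext ρs t = S.jB Pext ρs s := by
  have sp : 0 < s := hp.trans_lt hs
  obtain ⟨k1, k2⟩ := KP c hu hρ hp h hs hst ht (m := 1) ⟨zero_le_one, le_rfl⟩
  have c1 : Continuous fun τ => S.PL τ 1 - Pext := by
    have h2 := PLt_cont (S := S) c 1
    fun_prop
  have e : ∀ τ, 0 ≤ τ → S.vL τ 1 = S.b' τ := fun τ hτ => by rw [vL_eq hu hτ ⟨zero_le_one, le_rfl⟩, X1 hu hτ, S.bc_b τ hτ]
  have := integral_eq_sub_of_hasDerivAt (a := s) (b := t) (f := S.b') (f' := fun τ => (S.PL τ 1 - Pext) - μ (S.rL τ 1) * S.gL τ 1) (fun τ hτ => ?_) ((c1.intervalIntegrable _ _).sub k1)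
  · rw [intervalIntegral.integral_sub (c1.intervalIntegrable _ _) k1] at this
    have a := integral_interval_sub_left (c1.intervalIntegrable (μ := volume) 0 t) (c1.intervalIntegrable 0 s)
    simp only [jB]
    rw [e t (sp.le.trans hst), e s sp.le]
    linarith
  · rw [uIcc_of_le hst] at hτ
    have τp : 0 < τ := sp.trans_le hτ.1
    refine (S.hb'' τ τp).congr_deriv ?_
    rw [S.newton_b τ τp, PL, rL_eq hu τp.le ⟨zero_le_one, le_rfl⟩, gL, X1 hu τp.le]
    ring
end PistonSol
end PB8
section PC1
lemma left_nonneg {g : ℝ → ℝ} {g' x : ℝ} (h : HasDerivWithinAt g g' (Iic x) x) (hm : ∀ᶠ y in 𝓝[<] x, g y ≤ g x) : 0 ≤ g' := by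
  have h2 : Tendsto (slope g x) (𝓝[<] x) (𝓝 g') := by
    have := hasDerivWithinAt_iff_tendsto_slope.1 h; rwa [Iic_sdiff_right] at this
  refine ge_of_tendsto h2 ?_
  filter_upwards [hm, self_mem_nhdsWithin] with y hy hy'
  rw [slope_def_field]
  exact div_nonneg_of_nonpos (by linarith) (by linarith [mem_Iio.1 hy'])
lemma right_nonpos {g : ℝ → ℝ} {g' x : ℝ} (h : HasDerivWithinAt g g' (Ici x) x) (hm : ∀ᶠ y in 𝓝[>] x, g y ≤ g x) : g' ≤ 0 := by
  have h2 : Tendsto (slope g x) (𝓝[>] x) (𝓝 g') := by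
    have := hasDerivWithinAt_iff_tendsto_slope.1 h; rwa [Ici_sdiff_left] at this
  refine le_of_tendsto h2 ?_
  filter_upwards [hm, self_mem_nhdsWithin] with y hy hy'
  rw [slope_def_field]
  exact div_nonpos_of_nonpos_of_nonneg (by linarith) (by linarith [mem_Ioi.1 hy'])
lemma second_test {h h' : ℝ → ℝ} {h'' x : ℝ} (h1 : ∀ᶠ y in 𝓝 x, HasDerivAt h (h' y) y) (h2 : HasDerivAt h' h'' x) (hm : IsLocalMax h x) : h'' ≤ 0 := by
  by_contra! hpos
  have e : deriv h =ᶠ[𝓝 x] h' := h1.mono fun y hy => hy.deriv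
  have hmin : IsLocalMin h x := isLocalMin_of_deriv_deriv_pos (by rw [e.deriv_eq, h2.deriv]; exact hpos)
    (hm.deriv_eq_zero) h1.self_of_nhds.continuousAt
  have hc : h =ᶠ[𝓝 x] fun _ => h x := by filter_upwards [hm, hmin] with y a b using le_antisymm a b
  have : deriv h =ᶠ[𝓝 x] deriv (fun _ => h x) := hc.deriv
  have h3 : h' =ᶠ[𝓝 x] fun _ => 0 := e.symm.trans (this.trans (by simp))
  have := h3.deriv_eq
  rw [h2.deriv] at this
  simp at this; linarith
lemma aux_mul_le {k c x y : ℝ} (hk : c ≤ k) (hc : 0 < c) (hy : 0 ≤ y) (hx : x + y ≤ 0) : k * x ≤ - (c * y) := by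
  have h1 := mul_le_mul_of_nonneg_left hx (hc.le.trans hk)
  have h2 := mul_le_mul_of_nonneg_right hk hy
  linarith
lemma aux_mul_abs {w L b V : ℝ} (hw : 0 ≤ w) (hL : w ≤ L) (hb : |b| ≤ V) : |w * b| ≤ L * V := by
  rw [abs_mul, abs_of_nonneg hw]
  exact mul_le_mul hL hb (abs_nonneg _) (hw.trans hL)
structure Dbl (f ft fx fxx : ℝ → ℝ → ℝ) (a b a' b' fa fb : ℝ → ℝ) (α T c0 C0 V : ℝ) : Prop where
  fc : Continuous (Function.uncurry f)
  ac : Continuous a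
  bc : Continuous b
  c0p : 0 < c0
  C0p : 0 ≤ C0
  fbd : ∀ s ∈ Icc α T, ∀ x, |f s x| ≤ V
  dt : ∀ s ∈ Ioc α T, ∀ x ∈ Ioo (a s) (b s), HasDerivAt (fun r => f r x) (ft s x) s
  dx : ∀ s ∈ Ioc α T, ∀ x ∈ Ioo (a s) (b s), HasDerivAt (f s) (fx s x) x
  dxx : ∀ s ∈ Ioc α T, ∀ x ∈ Ioo (a s) (b s), HasDerivAt (fx s) (fxx s x) x
  eq : ∀ s ∈ Ioc α T, ∀ x ∈ Ioo (a s) (b s), ∃ k g, c0 ≤ k ∧ |g| ≤ C0 * (1 + |fx s x|) ∧ ft s x = k * fxx s x + g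
  ad : ∀ s ∈ Ioc α T, HasDerivAt a (a' s) s ∧ |a' s| ≤ V ∧ HasDerivAt (fun r => f r (a r)) (fa s) s ∧
    HasDerivWithinAt (f s) (fx s (a s)) (Ici (a s)) (a s) ∧ (0 ≤ fx s (a s) → -fa s ≤ C0)
  bd : ∀ s ∈ Ioc α T, HasDerivAt b (b' s) s ∧ |b' s| ≤ V ∧ HasDerivAt (fun r => f r (b r)) (fb s) s ∧
    HasDerivWithinAt (f s) (fx s (b s)) (Iic (b s)) (b s) ∧ (0 ≤ fx s (b s) → fb s ≤ C0)
lemma Dbl.bound_eps {f ft fx fxx : ℝ → ℝ → ℝ} {a b a' b' fa fb : ℝ → ℝ} {α T c0 C0 V : ℝ} (h : Dbl f ft fx fxx a b a' b' fa fb α T c0 C0 V)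
    {C1 N L ε : ℝ} (hC1 : 0 < C1) (h1 : 2 * C0 + V ≤ 2 * c0 * C1) (hab : ∀ s ∈ Icc α T, 1 / (4 * C1) < b s - a s) (hN : 0 ≤ N)
    (hini : ∀ x ∈ Icc (a α) (b α), ∀ y ∈ Icc (a α) (b α), y ≤ x → f α x - f α y ≤ N * (x - y)) (hL : L = 1 + 2 * N + 16 * C1 * V)
    (hε : 0 < ε) :
    ∀ s ∈ Icc α T, ∀ x ∈ Icc (a s) (b s), ∀ y ∈ Icc (a s) (b s), y ≤ x → x - y ≤ 1 / (4 * C1) → f s x - f s y ≤ L * (x - y) + ε * (s - α) := by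
  set δ := 1 / (4 * C1) with hδ
  have hδ0 : 0 < δ := by positivity
  have hδ1 : C1 * δ = 1 / 4 := by rw [hδ]; field_simp
  set Λ := C1 * (1 + L) with hΛ
  have hC0 := h.C0p
  intro s0 hs0 x0 hx0 y0 hy0 hxy0 hd0
  have hV : 0 ≤ V := (abs_nonneg _).trans (h.fbd s0 hs0 x0)
  have hL1 : 1 ≤ L := by rw [hL]; linarith [mul_nonneg hC1.le hV]
  have hΛ0 : 0 < Λ := by rw [hΛ]; positivity
  have hΛδ : Λ * δ = (1 + L) / 4 := by rw [hΛ]; linear_combination (1 + L) * hδ1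
  suffices hs : f s0 x0 - f s0 y0 ≤ L * (x0 - y0) - Λ * (x0 - y0) ^ 2 + ε * (s0 - α) by
    have := mul_nonneg hΛ0.le (sq_nonneg (x0 - y0)); linarith
  by_contra! hcon
  set Θ : ℝ × ℝ × ℝ → ℝ := fun z => f z.1 z.2.1 - f z.1 z.2.2 - (L * (z.2.1 - z.2.2) - Λ * (z.2.1 - z.2.2) ^ 2) - ε * (z.1 - α) with hΘ
  set K : Set (ℝ × ℝ × ℝ) := {z | (α ≤ z.1 ∧ z.1 ≤ T) ∧ (a z.1 ≤ z.2.2 ∧ z.2.2 ≤ z.2.1) ∧ z.2.1 ≤ b z.1 ∧ z.2.1 - z.2.2 ≤ δ} with hK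
  have hac := h.ac
  have hbc := h.bc
  have hcl : IsClosed K := by
    have a1 : Continuous fun z : ℝ × ℝ × ℝ => a z.1 := by fun_prop
    have b1 : Continuous fun z : ℝ × ℝ × ℝ => b z.1 := by fun_prop
    simp only [hK, ofPred_and]
    refine IsClosed.inter (IsClosed.inter (isClosed_le ?_ ?_) (isClosed_le ?_ ?_)) (IsClosed.inter (IsClosed.inter (isClosed_le ?_ ?_) (isClosed_le ?_ ?_)) (IsClosed.inter (isClosed_le ?_ ?_) (isClosed_le ?_ ?_))) <;> fun_prop
  obtain ⟨A1, hA1⟩ := isCompact_Icc.exists_bound_of_continuousOn (s := Icc α T) h.ac.continuousOn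
  obtain ⟨B1, hB1⟩ := isCompact_Icc.exists_bound_of_continuousOn (s := Icc α T) h.bc.continuousOn
  have hcomp : IsCompact K := by
    refine ((isCompact_Icc (a := α) (b := T)).prod ((isCompact_Icc (a := -A1) (b := B1)).prod (isCompact_Icc (a := -A1) (b := B1)))).of_isClosed_subset hcl ?_
    rintro ⟨s, x, y⟩ ⟨⟨k1, k2⟩, ⟨k3, k4⟩, k5, k6⟩
    simp only at k1 k2 k3 k4 k5 k6
    have e1 := abs_le.1 (hA1 s ⟨k1, k2⟩)
    have e2 := abs_le.1 (hB1 s ⟨k1, k2⟩)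
    exact ⟨⟨k1, k2⟩, ⟨by simp only; linarith [e1.1], by simp only; linarith [e2.2]⟩, ⟨by simp only; linarith [e1.1], by simp only; linarith [e2.2]⟩⟩
  have hΘc : Continuous Θ := by
    have c1 : Continuous fun z : ℝ × ℝ × ℝ => f z.1 z.2.1 := h.fc.comp (by fun_prop : Continuous fun z : ℝ × ℝ × ℝ => (z.1, z.2.1))
    have c2 : Continuous fun z : ℝ × ℝ × ℝ => f z.1 z.2.2 := h.fc.comp (by fun_prop : Continuous fun z : ℝ × ℝ × ℝ => (z.1, z.2.2))
    exact ((c1.sub c2).sub (by fun_prop)).sub (by fun_prop)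
  obtain ⟨⟨s, x, y⟩, hz, hmax⟩ := hcomp.exists_isMaxOn ⟨(s0, x0, y0), hs0, ⟨hy0.1, hxy0⟩, hx0.2, hd0⟩ hΘc.continuousOn
  have hpos : 0 < Θ (s, x, y) := lt_of_lt_of_le (by simp only [hΘ]; linarith) (hmax (show (s0, x0, y0) ∈ K from ⟨hs0, ⟨hy0.1, hxy0⟩, hx0.2, hd0⟩))
  obtain ⟨⟨k1, k2⟩, ⟨k3, k4⟩, k5, k6⟩ := hz
  simp only at k1 k2 k3 k4 k5 k6
  have hM : ∀ s' x' y', α ≤ s' → s' ≤ T → a s' ≤ y' → y' ≤ x' → x' ≤ b s' → x' - y' ≤ δ → Θ (s', x', y') ≤ Θ (s, x, y) :=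
    fun s' x' y' q1 q2 q3 q4 q5 q6 => hmax (show (s', x', y') ∈ K from ⟨⟨q1, q2⟩, ⟨q3, q4⟩, q5, q6⟩)
  have hsub : Λ * (x - y) ≤ (1 + L) / 4 := by rw [← hΛδ]; exact mul_le_mul_of_nonneg_left k6 hΛ0.le
  have hxy : y < x := by
    rcases k4.lt_or_eq with hh | hh
    · exact hh
    · exfalso; rw [hΘ] at hpos; simp only [hh, sub_self] at hpos
      have := mul_nonneg hε.le (sub_nonneg.2 k1); linarith
  have hd : x - y < δ := by
    rcases k6.lt_or_eq with hh | hh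
    · exact hh
    · exfalso
      have f1 := abs_le.1 (h.fbd s ⟨k1, k2⟩ x)
      have f2 := abs_le.1 (h.fbd s ⟨k1, k2⟩ y)
      simp only [hΘ, hh] at hpos
      have e1 : L * δ - Λ * δ ^ 2 = δ * (L - (1 + L) / 4) := by rw [← hΛδ]; ring
      have e3 : 2 * V ≤ δ * (L - (1 + L) / 4) := by
        have : δ * (8 * C1 * V) = 2 * V := by linear_combination 8 * V * hδ1
        rw [← this]; refine mul_le_mul_of_nonneg_left ?_ hδ0.le
        rw [hL]; linarith [mul_nonneg hC1.le hV]
      have := mul_nonneg hε.le (sub_nonneg.2 k1); linarith [f1.2, f2.1]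
  have hs : α < s := by
    rcases k1.lt_or_eq with hh | hh
    · exact hh
    · exfalso; subst hh
      have := hini x ⟨by linarith, k5⟩ y ⟨k3, by linarith⟩ k4
      simp only [hΘ, sub_self, mul_zero, sub_zero] at hpos
      have e2 : N * (x - y) ≤ L * (x - y) - Λ * (x - y) ^ 2 := by
        have : L * (x - y) - Λ * (x - y) ^ 2 = (L - Λ * (x - y)) * (x - y) := by ring
        rw [this]; refine mul_le_mul_of_nonneg_right ?_ (by linarith)
        rw [hL] at *; linarith [mul_nonneg hC1.le hV]
      linarith
  have hsI : s ∈ Ioc α T := ⟨hs, k2⟩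
  set ω' := L - 2 * Λ * (x - y) with hω'
  have hω0 : 0 ≤ ω' := by rw [hω']; linarith
  have hωL : ω' ≤ L := by rw [hω']; linarith [mul_pos hΛ0 (sub_pos.2 hxy)]
  have hab' := hab s ⟨k1, k2⟩
  have dω : HasDerivAt (fun x' => L * (x' - y) - Λ * (x' - y) ^ 2) ω' x := by
    refine ((((hasDerivAt_id x).sub_const y).const_mul L).fun_sub ((((hasDerivAt_id x).sub_const y).fun_pow 2).const_mul Λ)).congr_deriv ?_
    simp only [id]; rw [hω']; push_cast; ring
  have dωy : HasDerivAt (fun y' => L * (x - y') - Λ * (x - y') ^ 2) (-ω') y := by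
    refine ((((hasDerivAt_id y).const_sub x).const_mul L).fun_sub ((((hasDerivAt_id y).const_sub x).fun_pow 2).const_mul Λ)).congr_deriv ?_
    simp only [id]; rw [hω']; push_cast; ring
  have hkey : C0 + C0 * (1 + L) + L * V ≤ c0 * (2 * Λ) ∧ C0 * (1 + L) ≤ c0 * (2 * Λ) := by
    have e : c0 * (2 * Λ) = (2 * c0 * C1) * (1 + L) := by rw [hΛ]; ring
    have e2 := mul_le_mul_of_nonneg_right h1 (by linarith : 0 ≤ 1 + L)
    have e3 := mul_nonneg hC0 (by linarith : 0 ≤ L)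
    have e4 := mul_nonneg hV (by linarith : 0 ≤ L)
    rw [e]; constructor <;> linarith
  have X1 : x < b s → fx s x = ω' ∧ ft s x ≤ C0 * (1 + L) - c0 * (2 * Λ) := by
    intro hxb
    have hxI : x ∈ Ioo (a s) (b s) := ⟨by linarith, hxb⟩
    have hm : IsLocalMax (fun x' => f s x' - (L * (x' - y) - Λ * (x' - y) ^ 2)) x := by
      filter_upwards [Ioo_mem_nhds hxy (lt_min hxb (by linarith : x < y + δ))] with x' hx'
      have := hM s x' y k1 k2 k3 hx'.1.le (hx'.2.le.trans (min_le_left _ _)) (by linarith [hx'.2.le.trans (min_le_right _ _)])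
      simp only [hΘ] at this; linarith
    have d1 := (h.dx s hsI x hxI).fun_sub dω
    have z := hm.hasDerivAt_eq_zero d1
    have hfx : fx s x = ω' := by linarith
    have s2 : fxx s x + 2 * Λ ≤ 0 := by
      refine second_test (h := fun x' => f s x' - (L * (x' - y) - Λ * (x' - y) ^ 2)) (h' := fun x' => fx s x' - (L - 2 * Λ * (x' - y))) ?_ ?_ hm
      · filter_upwards [Ioo_mem_nhds hxI.1 hxI.2] with x' hx'
        refine ((h.dx s hsI x' hx').fun_sub ((((hasDerivAt_id x').sub_const y).const_mul L).fun_sub ((((hasDerivAt_id x').sub_const y).fun_pow 2).const_mul Λ))).congr_deriv ?_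
        simp only [id]; push_cast; ring
      · refine ((h.dxx s hsI x hxI).fun_sub ((((hasDerivAt_id x).sub_const y).const_mul (2 * Λ)).const_sub L)).congr_deriv ?_
        ring
    refine ⟨hfx, ?_⟩
    obtain ⟨k, g, hk, hg, e⟩ := h.eq s hsI x hxI
    rw [hfx, abs_of_nonneg hω0] at hg
    have g1 := (le_abs_self g).trans (hg.trans (mul_le_mul_of_nonneg_left (by linarith : 1 + ω' ≤ 1 + L) hC0))
    have g2 : k * fxx s x ≤ - (c0 * (2 * Λ)) := aux_mul_le hk h.c0p (by linarith) s2
    rw [e]; linarith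
  have Y1 : a s < y → fx s y = ω' ∧ c0 * (2 * Λ) - C0 * (1 + L) ≤ ft s y := by
    intro hya
    have hyI : y ∈ Ioo (a s) (b s) := ⟨hya, by linarith⟩
    have hm : IsLocalMax (fun y' => - f s y' - (L * (x - y') - Λ * (x - y') ^ 2)) y := by
      filter_upwards [Ioo_mem_nhds (max_lt hya (by linarith : x - δ < y)) hxy] with y' hy'
      have := hM s x y' k1 k2 ((le_max_left _ _).trans hy'.1.le) hy'.2.le k5 (by linarith [(le_max_right _ _).trans hy'.1.le])
      simp only [hΘ] at this; linarith
    have d1 := (h.dx s hsI y hyI).fun_neg.fun_sub dωy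
    have z := hm.hasDerivAt_eq_zero d1
    have hfx : fx s y = ω' := by linarith
    have s2 : - fxx s y + 2 * Λ ≤ 0 := by
      refine second_test (h := fun y' => - f s y' - (L * (x - y') - Λ * (x - y') ^ 2)) (h' := fun y' => - fx s y' + (L - 2 * Λ * (x - y'))) ?_ ?_ hm
      · filter_upwards [Ioo_mem_nhds hyI.1 hyI.2] with y' hy'
        refine ((h.dx s hsI y' hy').fun_neg.fun_sub ((((hasDerivAt_id y').const_sub x).const_mul L).fun_sub ((((hasDerivAt_id y').const_sub x).fun_pow 2).const_mul Λ))).congr_deriv ?_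
        simp only [id]; push_cast; ring
      · refine ((h.dxx s hsI y hyI).fun_neg.fun_add ((((hasDerivAt_id y).const_sub x).const_mul (2 * Λ)).const_sub L)).congr_deriv ?_
        ring
    refine ⟨hfx, ?_⟩
    obtain ⟨k, g, hk, hg, e⟩ := h.eq s hsI y hyI
    rw [hfx, abs_of_nonneg hω0] at hg
    have g1 := (neg_abs_le g).trans' (neg_le_neg (hg.trans (mul_le_mul_of_nonneg_left (by linarith : 1 + ω' ≤ 1 + L) hC0)))
    have g2 : c0 * (2 * Λ) ≤ k * fxx s y := by
      have := aux_mul_le (x := -fxx s y) hk h.c0p (by linarith) s2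
      linarith
    rw [e]; linarith
  have evT : ∀ᶠ r in 𝓝[<] s, α ≤ r ∧ r ≤ T := by
    filter_upwards [Ioo_mem_nhdsLT hs] with r hr using ⟨hr.1.le, hr.2.le.trans k2⟩
  have dε : HasDerivAt (fun r => ε * (r - α)) ε s := by
    simpa using ((hasDerivAt_id s).sub_const α).const_mul ε
  rcases k5.lt_or_eq with hxb | hxb
  · have xf := X1 hxb
    have exb : ∀ᶠ r in 𝓝[<] s, x ≤ b r := by
      filter_upwards [mem_nhdsWithin_of_mem_nhds (h.bc.continuousAt.eventually (lt_mem_nhds hxb))] with r hr using le_of_lt hr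
    rcases k3.lt_or_eq with hya | hya
    · have yf := Y1 hya
      have eya : ∀ᶠ r in 𝓝[<] s, a r ≤ y := by
        filter_upwards [mem_nhdsWithin_of_mem_nhds (h.ac.continuousAt.eventually (gt_mem_nhds hya))] with r hr using le_of_lt hr
      have := left_nonneg (g := fun r => f r x - f r y - (L * (x - y) - Λ * (x - y) ^ 2) - ε * (r - α))
        ((((h.dt s hsI x ⟨by linarith, hxb⟩).fun_sub (h.dt s hsI y ⟨hya, by linarith⟩)).sub_const _).fun_sub dε).hasDerivWithinAt (by
          filter_upwards [evT, exb, eya] with r q1 q2 q3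
          exact hM r x y q1.1 q1.2 q3 hxy.le q2 hd.le)
      linarith [hkey.2, xf.2, yf.2]
    · obtain ⟨p1, p2, p3, p4, p5⟩ := h.ad s hsI
      rw [hya] at p4 p5
      have hfx : 0 ≤ fx s y := by
        have := right_nonpos (g := fun y' => - f s y' - (L * (x - y') - Λ * (x - y') ^ 2)) (p4.fun_neg.fun_sub dωy.hasDerivWithinAt) (by
          filter_upwards [Ioo_mem_nhdsGT hxy] with y' hy'
          have := hM s x y' k1 k2 (by linarith [hy'.1]) hy'.2.le k5 (by linarith [hy'.1])
          simp only [hΘ] at this; linarith)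
        linarith
      have hfa := p5 hfx
      have dcomp : HasDerivAt (fun r => L * (x - a r) - Λ * (x - a r) ^ 2) (-ω' * a' s) s := by
        rw [← hya] at dωy
        exact dωy.comp s p1
      have e1 : ∀ᶠ r in 𝓝[<] s, a r < x ∧ x - δ < a r := by
        refine mem_nhdsWithin_of_mem_nhds ((h.ac.continuousAt.eventually (gt_mem_nhds (hya ▸ hxy))).and (h.ac.continuousAt.eventually (lt_mem_nhds ?_)))
        rw [hya]; linarith
      have := left_nonneg (g := fun r => f r x - f r (a r) - (L * (x - a r) - Λ * (x - a r) ^ 2) - ε * (r - α))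
        ((((h.dt s hsI x ⟨by linarith, hxb⟩).fun_sub p3).fun_sub dcomp).fun_sub dε).hasDerivWithinAt (by
          filter_upwards [evT, exb, e1] with r q1 q2 q3
          have := hM r x (a r) q1.1 q1.2 le_rfl q3.1.le q2 (by linarith [q3.2])
          simp only [hΘ, ← hya] at this; exact this)
      have e2 := (abs_le.1 (aux_mul_abs hω0 hωL p2)).2
      linarith [hkey.1, xf.2]
  · have hya : a s < y := by
      rcases k3.lt_or_eq with hh | hh
      · exact hh
      · exfalso; rw [← hh, hxb] at hd; linarith
    have yf := Y1 hya
    have eya : ∀ᶠ r in 𝓝[<] s, a r ≤ y := by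
      filter_upwards [mem_nhdsWithin_of_mem_nhds (h.ac.continuousAt.eventually (gt_mem_nhds hya))] with r hr using le_of_lt hr
    obtain ⟨p1, p2, p3, p4, p5⟩ := h.bd s hsI
    rw [← hxb] at p4 p5
    have hfx : 0 ≤ fx s x := by
      have := left_nonneg (g := fun x' => f s x' - (L * (x' - y) - Λ * (x' - y) ^ 2)) (p4.fun_sub dω.hasDerivWithinAt) (by
        filter_upwards [Ioo_mem_nhdsLT hxy] with x' hx'
        have := hM s x' y k1 k2 k3 hx'.1.le (by linarith [hx'.2]) (by linarith [hx'.2])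
        simp only [hΘ] at this; linarith)
      linarith
    have hfb := p5 hfx
    have dcomp : HasDerivAt (fun r => L * (b r - y) - Λ * (b r - y) ^ 2) (ω' * b' s) s := by
      rw [hxb] at dω
      exact dω.comp s p1
    have e1 : ∀ᶠ r in 𝓝[<] s, y < b r ∧ b r < y + δ := by
      refine mem_nhdsWithin_of_mem_nhds ((h.bc.continuousAt.eventually (lt_mem_nhds (hxb ▸ hxy))).and (h.bc.continuousAt.eventually (gt_mem_nhds ?_)))
      rw [← hxb]; linarith
    have := left_nonneg (g := fun r => f r (b r) - f r y - (L * (b r - y) - Λ * (b r - y) ^ 2) - ε * (r - α))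
      (((p3.fun_sub (h.dt s hsI y ⟨hya, by linarith⟩)).fun_sub dcomp).fun_sub dε).hasDerivWithinAt (by
        filter_upwards [evT, eya, e1] with r q1 q2 q3
        have := hM r (b r) y q1.1 q1.2 q2 q3.1.le le_rfl (by linarith [q3.2])
        simp only [hΘ, hxb] at this; exact this)
    have e2 := (abs_le.1 (aux_mul_abs hω0 hωL p2)).1
    linarith [hkey.1, yf.2]
end PC1
section PC2
namespace PistonSol
variable {P μ P' μ' : ℝ → ℝ} {Pext : ℝ} {S : PistonSol P μ Pext}
lemma neBot_punct' {a b m : ℝ} (h : a < b) (hm : m ∈ Icc a b) : (𝓝[Icc a b \ {m}] m).NeBot := by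
  have := (uniqueDiffOn_Icc h).uniqueDiffWithinAt hm
  rwa [uniqueDiffWithinAt_iff_accPt, accPt_principal_iff_nhdsWithin] at this
lemma deriv_le_of_lip {f : ℝ → ℝ} {f' a b m L δ : ℝ} (h : a < b) (hδ : 0 < δ) (hm : m ∈ Icc a b) (hd : HasDerivWithinAt f f' (Icc a b) m)
    (hl : ∀ x ∈ Icc a b, ∀ y ∈ Icc a b, |x - y| ≤ δ → |f x - f y| ≤ L * |x - y|) : |f'| ≤ L := by
  have := neBot_punct' h hm
  refine le_of_tendsto (hasDerivWithinAt_iff_tendsto_slope.1 hd).abs ?_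
  filter_upwards [self_mem_nhdsWithin, mem_nhdsWithin_of_mem_nhds (Metric.closedBall_mem_nhds m hδ)] with y hy hy2
  have h0 : 0 < |y - m| := abs_pos.2 (sub_ne_zero.2 hy.2)
  rw [slope_def_field, abs_div, div_le_iff₀ h0]
  exact hl y hy.1 m hm (by rwa [Metric.mem_closedBall, dist_eq] at hy2)
lemma R_lo (hu : S.Unit1) {t1 t2 : ℝ} (h0 : 0 ≤ t1) (h : t1 ≤ t2) : ∃ c C, 0 < c ∧ ∀ t ∈ Icc t1 t2, ∀ x ∈ Icc (S.a t) (S.b t), S.ρ t x ∈ Icc c C := by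
  obtain ⟨c, C, hc, h1⟩ := rL_bd (S := S) t1 t2 h
  refine ⟨c, C, hc, fun t ht x hx => ?_⟩
  have := h1 t ht _ (M_mem hu (h0.trans ht.1) hx)
  rwa [rL, S.XM, S.R_eq (h0.trans ht.1) hx] at this
lemma W_dxI {t x : ℝ} (ht : 0 < t) (hx : x ∈ Icc (S.a t) (S.b t)) : HasDerivWithinAt (S.W t) (S.vx t x) (Icc (S.a t) (S.b t)) x :=
  (S.hvx t ht x hx).hasDerivWithinAt.congr (fun y hy => S.W_eq ht.le hy) (S.W_eq ht.le hx)
private lemma g_bd {v w r rx p m V D n c : ℝ} (hv : |v| ≤ V) (hp : |p| ≤ D) (hm : |m| ≤ D) (hrx : |rx| ≤ n) (hc : 0 < c) (hr : c ≤ r) :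
    |-(v * w + (p * rx - m * rx * w) / r)| ≤ (V + D * n / c) * (1 + |w|) := by
  have hV := (abs_nonneg _).trans hv
  have hD := (abs_nonneg _).trans hp
  have hn := (abs_nonneg _).trans hrx
  have h1 : |p * rx| ≤ D * n := by rw [abs_mul]; gcongr
  have h2 : |m * rx * w| ≤ D * n * |w| := by rw [abs_mul, abs_mul]; gcongr
  have h3 : |v * w| ≤ V * |w| := by rw [abs_mul]; gcongr
  have h4 : |(p * rx - m * rx * w) / r| ≤ D * n * (1 + |w|) / c := by
    rw [abs_div, abs_of_pos (hc.trans_le hr)]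
    gcongr
    linarith [abs_sub (p * rx) (m * rx * w)]
  rw [abs_neg]
  calc _ ≤ V * |w| + D * n * (1 + |w|) / c := (abs_add_le _ _).trans (add_le_add h3 h4)
    _ ≤ V * (1 + |w|) + D * n * (1 + |w|) / c := by gcongr; linarith
    _ = _ := by ring
variable (c : Coef P μ P' μ')
include c
lemma grad_bd (hu : S.Unit1) {s0 T0 n1 N : ℝ} (hs0 : 0 < s0) (hN : 0 ≤ N) :
    ∃ L, 0 ≤ L ∧ ∀ α T, s0 ≤ α → α ≤ T → T ≤ T0 → (∀ s ∈ Ioc α T, ∀ x ∈ Icc (S.a s) (S.b s), |S.ρx s x| ≤ n1) →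
      (∀ x ∈ Icc (S.a α) (S.b α), |S.vx α x| ≤ N) → ∀ s ∈ Icc α T, ∀ x ∈ Icc (S.a s) (S.b s), |S.vx s x| ≤ L := by
  rcases lt_or_ge T0 s0 with h0 | h0
  · exact ⟨0, le_rfl, fun α T h1 h2 h3 => by linarith⟩
  rcases lt_or_ge n1 0 with hn | hn
  · refine ⟨N, hN, fun α T h1 h2 h3 h4 h5 => ?_⟩
    rcases h2.eq_or_lt with rfl | h2
    · intro s hs; obtain rfl : s = α := le_antisymm hs.2 hs.1; exact h5
    · exact absurd (h4 T ⟨h2, le_rfl⟩ _ (left_mem_Icc.2 (S.hab _ (by linarith)).le)) (by linarith [abs_nonneg (S.ρx T (S.a T))])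
  obtain ⟨ρ0, ρ1, hρ0, hρ⟩ := R_lo hu hs0.le h0
  obtain ⟨D, hD, hD1, -⟩ := coef_bd c (C0 := ρ1) hρ0
  obtain ⟨V, hV, hRW⟩ := S.bddRW s0 T0
  obtain ⟨U, hU⟩ := isCompact_Icc.exists_bound_of_continuousOn (S.u_cont.mono (fun z hz => hs0.le.trans hz.1 : Icc s0 T0 ⊆ Ici 0))
  obtain ⟨z, -, hz⟩ := isCompact_Icc.exists_isMinOn (nonempty_Icc.2 h0) (S.B_cont.sub S.A_cont).continuousOn
  set d := S.B z - S.A z with hd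
  have hd0 : 0 < d := sub_pos.2 (S.AB z)
  have hU0 : 0 ≤ U := (norm_nonneg _).trans (hU s0 ⟨le_rfl, h0⟩)
  have hρ01 : 0 < ρ1 := by
    have := hρ s0 ⟨le_rfl, h0⟩ _ (left_mem_Icc.2 (S.hab _ hs0.le).le)
    linarith [this.1, this.2]
  set C0 := (V + D * n1 / ρ0) + (U + |Pext| + D) with hC0
  set c0 := 1 / ((D + 1) * ρ1) with hc0
  have hc0p : 0 < c0 := by positivity
  have hC00 : 0 ≤ C0 := by positivity
  set C1 := (2 * C0 + V) / (2 * c0) + 1 / d with hC1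
  have hC1p : 0 < C1 := by positivity
  set L := 1 + 2 * N + 16 * C1 * V with hL
  have hδ : 0 < 1 / (4 * C1) := by positivity
  refine ⟨L, by positivity, fun α T h1 h2 h3 h4 h5 => ?_⟩
  have hI : ∀ s ∈ Icc α T, 0 < s ∧ s ∈ Icc s0 T0 := fun s hs => ⟨by linarith [hs.1], by linarith [hs.1], by linarith [hs.2]⟩
  have key : ∀ σ : ℝ, |σ| = 1 → ∀ s ∈ Icc α T, ∀ x ∈ Icc (S.a s) (S.b s), ∀ y ∈ Icc (S.a s) (S.b s), y ≤ x → x - y ≤ 1 / (4 * C1) →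
      σ * S.W s x - σ * S.W s y ≤ L * (x - y) := by
    intro σ hσ
    have hbdy : ∀ s ∈ Icc α T, |S.a' s| ≤ V ∧ |S.b' s| ≤ V := fun s hs => by
      obtain ⟨hs1, hs2⟩ := hI s hs
      rw [← S.bc_a s hs1.le, ← S.bc_b s hs1.le, ← S.W_eq hs1.le (left_mem_Icc.2 (S.hab _ hs1.le).le), ← S.W_eq hs1.le (right_mem_Icc.2 (S.hab _ hs1.le).le)]
      exact ⟨(hRW s hs2 _).2, (hRW s hs2 _).2⟩
    have hfin : ∀ q y w : ℝ, |q| ≤ U + |Pext| + D → 0 ≤ y → 0 ≤ w → σ * q - y * w ≤ C0 := fun q y w hq hy hw => by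
      have h6 : σ * q ≤ |q| := (le_abs_self _).trans (by rw [abs_mul, hσ, one_mul])
      have h7 : 0 ≤ V + D * n1 / ρ0 := by positivity
      have := mul_nonneg hy hw
      rw [hC0]; linarith
    have H : Dbl (fun s x => σ * S.W s x) (fun s x => σ * S.vt s x) (fun s x => σ * S.vx s x)
        (fun s x => σ * (S.ρ s x / μ (S.ρ s x) * S.vt s x + S.lo P' μ' s x)) S.A S.B S.a' S.b' (fun s => σ * S.a'' s) (fun s => σ * S.b'' s) α T c0 C0 V := by
      have hIo : ∀ s ∈ Ioc α T, 0 < s ∧ s ∈ Icc s0 T0 ∧ S.A s = S.a s ∧ S.B s = S.b s := fun s hs => by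
        obtain ⟨hs1, hs2⟩ := hI s (Ioc_subset_Icc_self hs)
        exact ⟨hs1, hs2, S.A_eq hs1.le, S.B_eq hs1.le⟩
      refine ⟨continuous_const.mul S.W_cont, S.A_cont, S.B_cont, hc0p, hC00, fun s hs x => ?_, fun s hs x hx => ?_, fun s hs x hx => ?_, fun s hs x hx => ?_,
        fun s hs x hx => ?_, fun s hs => ?_, fun s hs => ?_⟩
      · rw [abs_mul, hσ, one_mul]; exact (hRW s (hI s hs).2 x).2
      · obtain ⟨hs1, hs2, e1, e2⟩ := hIo s hs
        rw [e1, e2] at hx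
        exact (W_dt hs1 hx).const_mul σ
      · obtain ⟨hs1, hs2, e1, e2⟩ := hIo s hs
        rw [e1, e2] at hx
        exact (W_dx hs1 hx).const_mul σ
      · obtain ⟨hs1, hs2, e1, e2⟩ := hIo s hs
        rw [e1, e2] at hx
        exact (vx_dx c hs1 hx).const_mul σ
      · obtain ⟨hs1, hs2, e1, e2⟩ := hIo s hs
        rw [e1, e2] at hx
        have hxi := Ioo_subset_Icc_self hx
        have hr := hρ s hs2 x hxi
        obtain ⟨d1, d2, d3, d4, d5⟩ := hD1 _ hr
        have hr0 : 0 < S.ρ s x := hρ0.trans_le hr.1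
        have hm0 := c.μpos _ hr0
        have hv := (hRW s hs2 x).2
        rw [S.W_eq hs1.le hxi] at hv
        refine ⟨μ (S.ρ s x) / S.ρ s x, σ * (-(S.v s x * S.vx s x + (P' (S.ρ s x) * S.ρx s x - μ' (S.ρ s x) * S.ρx s x * S.vx s x) / S.ρ s x)), ?_, ?_, ?_⟩
        · rw [hc0, div_le_div_iff₀ (by positivity) hr0]
          have h6 : 1 ≤ D * μ (S.ρ s x) := by rwa [inv_le_iff_one_le_mul₀ hm0] at d3
          calc _ = S.ρ s x := one_mul _
            _ ≤ 1 * ρ1 := by rw [one_mul]; exact hr.2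
            _ ≤ (μ (S.ρ s x) * (D + 1)) * ρ1 := by
              gcongr
              linarith
            _ = _ := by ring
        · rw [abs_mul, hσ, one_mul, abs_mul, hσ, one_mul]
          refine (g_bd hv d1 d2 (h4 s hs x hxi) hρ0 hr.1).trans ?_
          gcongr
          rw [hC0]; linarith [abs_nonneg Pext]
        · simp only [lo]
          field_simp
          ring
      · obtain ⟨hs1, hs2, e1, e2⟩ := hIo s hs
        have hm := left_mem_Icc.2 (S.hab _ hs1.le).le
        refine ⟨A_dt hs1, (hbdy s (Ioc_subset_Icc_self hs)).1, ?_, ?_, ?_⟩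
        · refine ((S.ha'' s hs1).const_mul σ).congr_of_eventuallyEq ?_
          filter_upwards [lt_mem_nhds hs1] with r hr
          have hr' : 0 ≤ r := le_of_lt hr
          rw [S.A_eq hr', S.W_eq hr' (left_mem_Icc.2 (S.hab _ hr').le), S.bc_a r hr']
        · rw [e1]
          refine ((W_dxI hs1 hm).mono_of_mem_nhdsWithin (Icc_mem_nhdsGE (S.hab _ hs1.le))).const_mul σ
        · rw [e1]
          intro h6
          have hr := hρ s hs2 _ hm
          obtain ⟨d1, d2, d3, d4, d5⟩ := hD1 _ hr
          have hp := c.Ppos _ (hρ0.trans_le hr.1)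
          have hm0 := c.μpos _ (hρ0.trans_le hr.1)
          have hUs := abs_le.1 (hU s hs2)
          have := hfin (-(S.u s + Pext - P (S.ρ s (S.a s)))) _ _ (abs_le.2 ⟨by linarith [le_abs_self Pext], by linarith [neg_abs_le Pext]⟩) hm0.le h6
          rw [S.newton_a s hs1]
          linarith
      · obtain ⟨hs1, hs2, e1, e2⟩ := hIo s hs
        have hm := right_mem_Icc.2 (S.hab _ hs1.le).le
        refine ⟨B_dt hs1, (hbdy s (Ioc_subset_Icc_self hs)).2, ?_, ?_, ?_⟩
        · refine ((S.hb'' s hs1).const_mul σ).congr_of_eventuallyEq ?_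
          filter_upwards [lt_mem_nhds hs1] with r hr
          have hr' : 0 ≤ r := le_of_lt hr
          rw [S.B_eq hr', S.W_eq hr' (right_mem_Icc.2 (S.hab _ hr').le), S.bc_b r hr']
        · rw [e2]
          refine ((W_dxI hs1 hm).mono_of_mem_nhdsWithin (Icc_mem_nhdsLE (S.hab _ hs1.le))).const_mul σ
        · rw [e2]
          intro h6
          have hr := hρ s hs2 _ hm
          obtain ⟨d1, d2, d3, d4, d5⟩ := hD1 _ hr
          have hp := c.Ppos _ (hρ0.trans_le hr.1)
          have hm0 := c.μpos _ (hρ0.trans_le hr.1)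
          have := hfin (P (S.ρ s (S.b s)) - Pext) _ _ (abs_le.2 ⟨by linarith [le_abs_self Pext], by linarith [neg_abs_le Pext]⟩) hm0.le h6
          rw [S.newton_b s hs1]
          linarith
    have hα := hI α ⟨le_rfl, h2⟩
    have hini : ∀ x ∈ Icc (S.A α) (S.B α), ∀ y ∈ Icc (S.A α) (S.B α), y ≤ x → σ * S.W α x - σ * S.W α y ≤ N * (x - y) := by
      intro x hx y hy hxy
      rw [S.A_eq hα.1.le, S.B_eq hα.1.le] at hx hy
      have h6 := (convex_Icc (S.a α) (S.b α)).norm_image_sub_le_of_norm_hasDerivWithin_le (fun z hz => W_dxI hα.1 hz) h5 hy hx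
      rw [norm_eq_abs, norm_eq_abs, abs_of_nonneg (sub_nonneg.2 hxy)] at h6
      refine le_trans ?_ h6
      rw [← mul_sub]
      exact (le_abs_self _).trans (by rw [abs_mul, hσ, one_mul])
    have hab : ∀ s ∈ Icc α T, 1 / (4 * C1) < S.B s - S.A s := fun s hs => by
      have h6 : d ≤ S.B s - S.A s := hz (hI s hs).2
      refine lt_of_lt_of_le ?_ h6
      rw [div_lt_iff₀ (by positivity)]
      have h7 : 1 / d ≤ C1 := by rw [hC1]; have : 0 ≤ (2 * C0 + V) / (2 * c0) := by positivity
                                 linarith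
      have h8 : 1 ≤ d * C1 := by rwa [div_le_iff₀' hd0] at h7
      linarith
    have h1' : 2 * C0 + V ≤ 2 * c0 * C1 := by
      have : 2 * c0 * C1 = 2 * C0 + V + 2 * c0 * (1 / d) := by rw [hC1]; field_simp
      rw [this]
      have : 0 ≤ 2 * c0 * (1 / d) := by positivity
      linarith
    intro s hs x hx y hy hxy hle
    obtain ⟨hs1, hs2⟩ := hI s hs
    rw [← S.A_eq hs1.le, ← S.B_eq hs1.le] at hx hy
    refine le_of_forall_pos_le_add fun ε hε => ?_
    have h6 := H.bound_eps (ε := ε / (s - α + 1)) hC1p h1' hab hN hini hL (div_pos hε (by linarith [hs.1])) s hs x hx y hy hxy hle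
    refine h6.trans ?_
    gcongr
    rw [div_mul_eq_mul_div, div_le_iff₀ (by linarith [hs.1])]
    exact mul_le_mul_of_nonneg_left (by linarith) hε.le
  intro s hs x hx
  obtain ⟨hs1, hs2⟩ := hI s hs
  refine deriv_le_of_lip (S.hab _ hs1.le) hδ hx (W_dxI hs1 hx) ?_
  have h6 : ∀ x ∈ Icc (S.a s) (S.b s), ∀ y ∈ Icc (S.a s) (S.b s), y ≤ x → x - y ≤ 1 / (4 * C1) → |S.W s x - S.W s y| ≤ L * (x - y) := by
    intro x hx y hy hxy hd
    have k1 := key 1 (by norm_num) s hs x hx y hy hxy hd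
    have k2 := key (-1) (by norm_num) s hs x hx y hy hxy hd
    exact abs_le.2 ⟨by linarith, by linarith⟩
  intro x hx y hy hd
  rcases le_total y x with hxy | hxy
  · rw [abs_of_nonneg (sub_nonneg.2 hxy)] at hd ⊢
    exact h6 x hx y hy hxy hd
  · rw [abs_sub_comm x y] at hd ⊢
    rw [abs_of_nonneg (sub_nonneg.2 hxy)] at hd ⊢
    rw [abs_sub_comm]
    exact h6 y hy x hx hxy hd
end PistonSol
end PC2
section PC3
lemma gronwall_cont {f : ℝ → ℝ} {A C α T : ℝ} (hf : Continuous f) (hC : 0 ≤ C) (h : ∀ t ∈ Icc α T, f t ≤ A + C * ∫ s in α..t, f s) :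
    ∀ t ∈ Icc α T, f t ≤ A * Real.exp (C * (t - α)) := by
  intro t ht
  set y : ℝ → ℝ := fun t => A + C * ∫ s in α..t, f s with hy
  have hd : ∀ t, HasDerivAt (fun t => y t * Real.exp (-(C * (t - α)))) ((C * f t - C * y t) * Real.exp (-(C * (t - α)))) t := fun t => by
    have h1 : HasDerivAt y (C * f t) t := ((integral_hasDerivAt_right (hf.intervalIntegrable _ _)
      (hf.stronglyMeasurableAtFilter _ _) hf.continuousAt).const_mul C).const_add A
    have h2 : HasDerivAt (fun t => Real.exp (-(C * (t - α)))) (Real.exp (-(C * (t - α))) * (-(C * 1))) t :=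
      ((((hasDerivAt_id t).sub_const α).const_mul C).fun_neg).exp
    exact (h1.fun_mul h2).congr_deriv (by ring)
  have ha : AntitoneOn (fun t => y t * Real.exp (-(C * (t - α)))) (Icc α T) := by
    refine antitoneOn_of_deriv_nonpos (convex_Icc _ _) (fun t _ => (hd t).continuousAt.continuousWithinAt) (fun t _ => (hd t).differentiableAt.differentiableWithinAt) ?_
    intro t ht
    rw [interior_Icc] at ht
    rw [(hd t).deriv]
    refine mul_nonpos_of_nonpos_of_nonneg ?_ (Real.exp_pos _).le
    have := mul_le_mul_of_nonneg_left (h t (Ioo_subset_Icc_self ht)) hC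
    simp only [hy]; linarith
  have h1 := ha ⟨le_rfl, ht.1.trans ht.2⟩ ht ht.1
  simp only [hy, integral_same, sub_self, mul_zero, neg_zero, Real.exp_zero, mul_one, add_zero] at h1
  rw [Real.exp_neg, ← div_eq_mul_inv, div_le_iff₀ (Real.exp_pos _)] at h1
  exact (h t ht).trans h1
lemma const_of_loc {f : ℝ → ℝ} {α T : ℝ} (hf : Continuous f) (h : ∀ t ∈ Ioo α T, ∃ p q, t ∈ Ioo p q ∧ ∀ s ∈ Ioo p q, f s = f t) : ∀ t ∈ Icc α T, f t = f α := by
  intro t ht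
  rcases ht.1.eq_or_lt with rfl | h1
  · rfl
  obtain ⟨z, -, hz⟩ := exists_hasDerivAt_eq_slope f (fun _ => 0) h1 hf.continuousOn (fun x hx => by
    obtain ⟨p, q, hx', h2⟩ := h x ⟨hx.1, hx.2.trans_le ht.2⟩
    refine (hasDerivAt_const x (f x)).congr_of_eventuallyEq ?_
    filter_upwards [Ioo_mem_nhds hx'.1 hx'.2] with s hs using h2 s hs)
  rw [eq_comm, div_eq_zero_iff] at hz
  rcases hz with hz | hz <;> linarith
namespace PistonSol
variable {P μ P' μ' : ℝ → ℝ} {Pext : ℝ} {S : PistonSol P μ Pext}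
variable (S) in
def LipK (ρs n t : ℝ) : Prop := ∀ m ∈ Icc 0 1, ∀ m' ∈ Icc 0 1, |S.kL ρs t m - S.kL ρs t m'| ≤ n * |m - m'|
variable (S) in
def LipV (n t : ℝ) : Prop := ∀ m ∈ Icc 0 1, ∀ m' ∈ Icc 0 1, |S.vL t m - S.vL t m'| ≤ n * |m - m'|
variable (S) in
def Good : Set ℝ := {t | ∃ p q n, 0 ≤ p ∧ t ∈ Ioo p q ∧ S.Slab p q n}
lemma good_open : IsOpen S.Good := by
  rw [isOpen_iff_mem_nhds]
  rintro t ⟨p, q, n, hp, ht, h⟩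
  filter_upwards [Ioo_mem_nhds ht.1 ht.2] with s hs using ⟨p, q, n, hp, hs, h⟩
variable (c : Coef P μ P' μ')
include c
lemma kL_dm (hu : S.Unit1) {ρs : ℝ} (hρ : 0 < ρs) {t m : ℝ} (ht : 0 ≤ t) (hm : m ∈ Icc 0 1) :
    HasDerivWithinAt (S.kL ρs t) (μ (S.rL t m) / S.rL t m * (S.ρx t (S.X t m) * (S.rL t m)⁻¹)) (Icc 0 1) m :=
  (c.dk hρ _ (S.rL_pos t m)).comp_hasDerivWithinAt m (rL_dm hu ht hm)
lemma lip_conv (hu : S.Unit1) {ρs : ℝ} (hρ : 0 < ρs) {s0 T0 : ℝ} (hs0 : 0 ≤ s0) (h0 : s0 ≤ T0) : ∃ C, 0 ≤ C ∧ ∀ t ∈ Icc s0 T0, ∀ n,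
    (S.LipK ρs n t → ∀ x ∈ Icc (S.a t) (S.b t), |S.ρx t x| ≤ C * n) ∧
    ((∀ x ∈ Icc (S.a t) (S.b t), |S.ρx t x| ≤ n) → S.LipK ρs (C * n) t) ∧
    (0 < t → S.LipV n t → ∀ x ∈ Icc (S.a t) (S.b t), |S.vx t x| ≤ C * n) ∧
    (0 < t → (∀ x ∈ Icc (S.a t) (S.b t), |S.vx t x| ≤ n) → S.LipV (C * n) t) := by
  obtain ⟨r0, r1, hr0, hr⟩ := rL_bd (S := S) s0 T0 h0
  obtain ⟨D, hD, hD1, -⟩ := coef_bd c (C0 := r1) hr0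
  have hr1 : 0 < r1 := (S.rL_pos s0 0).trans_le (hr s0 ⟨le_rfl, h0⟩ 0 ⟨le_rfl, zero_le_one⟩).2
  have hC : 0 ≤ r1 * r1 * D + D * r0⁻¹ * r0⁻¹ + r1 + r0⁻¹ := by positivity
  have t1 : 0 ≤ r1 * r1 * D := by positivity
  have t2 : 0 ≤ D * r0⁻¹ * r0⁻¹ := by positivity
  have t3 : 0 ≤ r0⁻¹ := by positivity
  refine ⟨r1 * r1 * D + D * r0⁻¹ * r0⁻¹ + r1 + r0⁻¹, hC, fun t ht n => ?_⟩
  have ht0 : 0 ≤ t := hs0.trans ht.1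
  have fin : ∀ {k y : ℝ}, 0 ≤ n → k ≤ r1 * r1 * D + D * r0⁻¹ * r0⁻¹ + r1 + r0⁻¹ → y ≤ k * n → y ≤ (r1 * r1 * D + D * r0⁻¹ * r0⁻¹ + r1 + r0⁻¹) * n :=
    fun hn hk hy => hy.trans (mul_le_mul_of_nonneg_right hk hn)
  have fa : ∀ m ∈ Icc 0 1, (S.rL t m)⁻¹ ≤ r0⁻¹ ∧ (μ (S.rL t m))⁻¹ ≤ D ∧ μ (S.rL t m) ≤ D := fun m hm => by
    obtain ⟨d1, d2, d3, d4, d5⟩ := hD1 _ (hr t ht m hm)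
    exact ⟨inv_anti₀ hr0 (hr t ht m hm).1, d3, d4⟩
  have n0 : ∀ {f : ℝ → ℝ}, (∀ m ∈ Icc 0 1, ∀ m' ∈ Icc 0 1, |f m - f m'| ≤ n * |m - m'|) → 0 ≤ n := fun h => by
    have := (abs_nonneg _).trans (h 0 ⟨le_rfl, zero_le_one⟩ 1 ⟨zero_le_one, le_rfl⟩)
    norm_num at this; exact this
  have n1 : ∀ {f : ℝ → ℝ}, (∀ x ∈ Icc (S.a t) (S.b t), |f x| ≤ n) → 0 ≤ n := fun h =>
    (abs_nonneg _).trans (h _ (left_mem_Icc.2 (S.hab t ht0).le))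
  refine ⟨fun h x hx => ?_, fun h => ?_, fun htp h x hx => ?_, fun htp h => ?_⟩
  · have hm := M_mem hu ht0 hx
    have h1 := deriv_le_of_lip zero_lt_one one_pos hm (kL_dm c hu hρ ht0 hm) (fun x hx y hy _ => h x hx y hy)
    obtain ⟨f1, f2, f3⟩ := fa _ hm
    have hrr := hr t ht _ hm
    rw [S.XM] at h1
    set r := S.rL t (S.M t x)
    have hr' : 0 < r := S.rL_pos _ _
    have hμ := c.μpos _ hr'
    refine fin (k := r1 * r1 * D) (n0 h) (by linarith) ?_
    calc |S.ρx t x| = r * r * (μ r)⁻¹ * |μ r / r * (S.ρx t x * r⁻¹)| := by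
          rw [abs_mul, abs_mul, abs_of_pos (div_pos hμ hr'), abs_of_pos (inv_pos.2 hr')]; field_simp
      _ ≤ r1 * r1 * D * n := by
          have := hrr.2
          gcongr
  · intro m hm m' hm'
    have hn := n1 h
    refine (convex_Icc (0:ℝ) 1).norm_image_sub_le_of_norm_hasDerivWithin_le (fun z hz => kL_dm c hu hρ ht0 hz) (fun z hz => ?_) hm' hm
    obtain ⟨f1, f2, f3⟩ := fa _ hz
    refine fin (k := D * r0⁻¹ * r0⁻¹) hn (by linarith) ?_
    have hr' := S.rL_pos t z
    have hμ := c.μpos _ hr'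
    rw [norm_eq_abs, abs_mul, abs_mul, abs_of_pos (div_pos hμ hr'), abs_of_pos (inv_pos.2 hr'), div_eq_mul_inv]
    calc _ ≤ D * r0⁻¹ * (n * r0⁻¹) := by
          have := h _ (X_mem hu ht0 hz)
          gcongr
      _ = _ := by ring
  · have hm := M_mem hu ht0 hx
    have h1 := deriv_le_of_lip zero_lt_one one_pos hm (vL_dm hu htp hm) (fun x hx y hy _ => h x hx y hy)
    have hrr := hr t ht _ hm
    rw [gL, S.XM] at h1
    set r := S.rL t (S.M t x)
    have hr' : 0 < r := S.rL_pos _ _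
    refine fin (k := r1) (n0 h) (by linarith) ?_
    calc |S.vx t x| = r * |S.vx t x * r⁻¹| := by
          rw [abs_mul, abs_of_pos (inv_pos.2 hr')]; field_simp
      _ ≤ r1 * n := by
          have := hrr.2
          gcongr
  · intro m hm m' hm'
    have hn := n1 h
    refine (convex_Icc (0:ℝ) 1).norm_image_sub_le_of_norm_hasDerivWithin_le (fun z hz => vL_dm hu htp hz) (fun z hz => ?_) hm' hm
    obtain ⟨f1, f2, f3⟩ := fa _ hz
    refine fin (k := r0⁻¹) hn (by linarith) ?_
    rw [norm_eq_abs, abs_mul, abs_of_pos (inv_pos.2 (S.rL_pos t z)), mul_comm]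
    have := h _ (X_mem hu ht0 hz)
    have := (S.rL_pos t z)
    rw [gL]
    gcongr
lemma PL_le_kL {ρs : ℝ} (hρ : 0 < ρs) {s0 T0 : ℝ} (h0 : s0 ≤ T0) : ∃ C, 0 ≤ C ∧ ∀ t ∈ Icc s0 T0, ∀ m ∈ Icc 0 1, ∀ m' ∈ Icc 0 1,
    |S.PL t m - S.PL t m'| ≤ C * |S.kL ρs t m - S.kL ρs t m'| := by
  obtain ⟨r0, r1, hr0, hr⟩ := rL_bd (S := S) s0 T0 h0
  obtain ⟨D, hD, hD1, -⟩ := coef_bd c (C0 := r1) hr0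
  have hr1 : 0 < r1 := (S.rL_pos s0 0).trans_le (hr s0 ⟨le_rfl, h0⟩ 0 ⟨le_rfl, zero_le_one⟩).2
  refine ⟨D * r1 * D, by positivity, ?_⟩
  have hpos : ∀ r ∈ Icc r0 r1, 0 < r := fun r hr => hr0.trans_le hr.1
  have main : ∀ x ∈ Icc r0 r1, ∀ y ∈ Icc r0 r1, x ≤ y → P x ≤ P y ∧ P y - P x ≤ D * r1 * D * (kf μ ρs y - kf μ ρs x) := by
    intro x hx y hy hxy
    have m1 : MonotoneOn P (Icc r0 r1) := monotoneOn_of_deriv_nonneg (convex_Icc _ _) (fun z hz => (c.dP z (hpos z hz)).continuousAt.continuousWithinAt)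
      (fun z hz => (c.dP z (hpos z (interior_subset hz))).differentiableAt.differentiableWithinAt)
      (fun z hz => by rw [(c.dP z (hpos z (interior_subset hz))).deriv]; exact (c.P'pos _ (hpos z (interior_subset hz))).le)
    have hd : ∀ z ∈ Icc r0 r1, HasDerivAt (fun z => D * r1 * D * kf μ ρs z - P z) (D * r1 * D * (μ z / z) - P' z) z := fun z hz =>
      ((c.dk hρ z (hpos z hz)).const_mul _).fun_sub (c.dP z (hpos z hz))
    have m2 : MonotoneOn (fun z => D * r1 * D * kf μ ρs z - P z) (Icc r0 r1) := by
      refine monotoneOn_of_deriv_nonneg (convex_Icc _ _) (fun z hz => (hd z hz).continuousAt.continuousWithinAt)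
        (fun z hz => (hd z (interior_subset hz)).differentiableAt.differentiableWithinAt) (fun z hz => ?_)
      replace hz := interior_subset hz
      rw [(hd z hz).deriv]
      obtain ⟨d1, d2, d3, d4, d5⟩ := hD1 _ hz
      have hz0 := hpos z hz
      have hμ := c.μpos z hz0
      have h1 : 1 ≤ D * μ z := by rwa [inv_le_iff_one_le_mul₀ hμ] at d3
      have h2 : 1 ≤ r1 / z := (one_le_div hz0).2 hz.2
      have h3 : D * 1 * 1 ≤ D * (D * μ z) * (r1 / z) := by gcongr
      have h4 : D * (D * μ z) * (r1 / z) = D * r1 * D * (μ z / z) := by ring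
      linarith [(le_abs_self _).trans d1]
    have h1 := m1 hx hy hxy
    have h2 := m2 hx hy hxy
    simp only at h2
    exact ⟨h1, by linarith⟩
  intro t ht m hm m' hm'
  have hx := hr t ht m hm
  have hy := hr t ht m' hm'
  simp only [PL, kL]
  have hDr : 0 ≤ D * r1 * D := by positivity
  rcases le_total (S.rL t m) (S.rL t m') with h | h
  · obtain ⟨h1, h2⟩ := main _ hx _ hy h
    rw [abs_sub_comm, abs_sub_comm (kf μ ρs _), abs_of_nonneg (sub_nonneg.2 h1)]
    exact h2.trans (mul_le_mul_of_nonneg_left (le_abs_self _) hDr)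
  · obtain ⟨h1, h2⟩ := main _ hy _ hx h
    rw [abs_of_nonneg (sub_nonneg.2 h1)]
    exact h2.trans (mul_le_mul_of_nonneg_left (le_abs_self _) hDr)
lemma lipK_prop {ρs : ℝ} (hρ : 0 < ρs) {s0 T0 : ℝ} (h0 : s0 ≤ T0) : ∃ C V, 0 ≤ C ∧ 0 ≤ V ∧ ∀ α T n, s0 ≤ α → T ≤ T0 →
    (∀ t ∈ Icc α T, ∀ m ∈ Icc 0 1, S.j1 ρs t m - S.j1 ρs t 0 = S.j1 ρs α m - S.j1 ρs α 0) → S.LipK ρs n α →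
    ∀ t ∈ Icc α T, S.LipK ρs ((n + 2 * V) * Real.exp (C * (t - α))) t := by
  obtain ⟨C, hC, hPk⟩ := PL_le_kL (S := S) c hρ h0
  obtain ⟨V, hV, hRW⟩ := S.bddRW s0 T0
  refine ⟨C, V, hC, hV, fun α T n h1 h2 hJ hn t ht m hm m' hm' => ?_⟩
  have vi : ∀ t a b, IntervalIntegrable (S.vL t) volume a b := fun t a b => (vLm_cont t).intervalIntegrable _ _
  have Pi : ∀ m a b, IntervalIntegrable (fun t => S.PL t m) volume a b := fun m a b => (PLt_cont c m).intervalIntegrable _ _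
  have hfc : Continuous (fun t => S.kL ρs t m - S.kL ρs t m') := (kLt_cont c hρ m).sub (kLt_cont c hρ m')
  have := gronwall_cont (f := fun t => |S.kL ρs t m - S.kL ρs t m'|) (A := (n + 2 * V) * |m - m'|) (T := T) hfc.abs hC ?_ t ht
  · linarith
  intro t ht
  have e1 := hJ t ht m hm
  have e2 := hJ t ht m' hm'
  simp only [j1] at e1 e2
  have e3 : S.kL ρs t m - S.kL ρs t m' = (S.kL ρs α m - S.kL ρs α m') + (∫ x in m'..m, S.vL α x) - (∫ x in m'..m, S.vL t x) - ∫ τ in α..t, (S.PL τ m - S.PL τ m') := by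
    rw [← integral_interval_sub_left (vi t 0 m) (vi t 0 m'), ← integral_interval_sub_left (vi α 0 m) (vi α 0 m'),
      intervalIntegral.integral_sub (Pi m _ _) (Pi m' _ _), ← integral_interval_sub_left (Pi m 0 t) (Pi m 0 α),
      ← integral_interval_sub_left (Pi m' 0 t) (Pi m' 0 α)]
    linarith
  have bv : ∀ s ∈ Icc s0 T0, |∫ x in m'..m, S.vL s x| ≤ V * |m - m'| := fun s hs =>
    norm_integral_le_of_norm_le_const (f := S.vL s) fun x _ => (hRW s hs _).2
  have b1 := bv t ⟨h1.trans ht.1, ht.2.trans h2⟩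
  have b2 := bv α ⟨h1, ht.1.trans (ht.2.trans h2)⟩
  have b3 := hn m hm m' hm'
  have b4 : |∫ τ in α..t, (S.PL τ m - S.PL τ m')| ≤ C * ∫ τ in α..t, |S.kL ρs τ m - S.kL ρs τ m'| := by
    rw [← intervalIntegral.integral_const_mul]
    refine intervalIntegral.norm_integral_le_of_norm_le (f := fun τ => S.PL τ m - S.PL τ m') ht.1 (Eventually.of_forall fun τ hτ => ?_) ((continuous_const.mul hfc.abs).intervalIntegrable (μ := volume) _ _)
    exact hPk τ ⟨by linarith [hτ.1], by linarith [hτ.2, ht.2]⟩ m hm m' hm'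
  have a1 := abs_sub (S.kL ρs α m - S.kL ρs α m' + (∫ x in m'..m, S.vL α x) - (∫ x in m'..m, S.vL t x)) (∫ τ in α..t, (S.PL τ m - S.PL τ m'))
  have a2 := abs_sub (S.kL ρs α m - S.kL ρs α m' + (∫ x in m'..m, S.vL α x)) (∫ x in m'..m, S.vL t x)
  have a3 := abs_add_le (S.kL ρs α m - S.kL ρs α m') (∫ x in m'..m, S.vL α x)
  rw [← e3] at a1
  linarith
lemma good_const (hu : S.Unit1) {ρs Rf : ℝ} (hρ : 0 < ρs) (hf : ∀ t, 0 < t → S.u t = -Rf * S.v t (S.a t)) {α T : ℝ} (h : Ioo α T ⊆ S.Good) :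
    ∀ t ∈ Icc α T, (∀ m ∈ Icc 0 1, S.j1 ρs t m - S.j1 ρs t 0 = S.j1 ρs α m - S.j1 ρs α 0) ∧ S.jA Rf Pext ρs t = S.jA Rf Pext ρs α ∧
      S.jB Pext ρs t = S.jB Pext ρs α := by
  intro t ht
  refine ⟨fun m hm => const_of_loc (f := fun t => S.j1 ρs t m - S.j1 ρs t 0) ((j1t_cont c hρ m).sub (j1t_cont c hρ 0)) ?_ t ht,
    const_of_loc (jA_cont c Rf hρ) ?_ t ht, const_of_loc (jB_cont c hρ) ?_ t ht⟩ <;> intro t ht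
  · obtain ⟨p, q, n, hp, htp, hS⟩ := h ht
    exact ⟨p, q, htp, fun s hs => j1_slab c hu hρ hp hS htp hs hm⟩
  · obtain ⟨p, q, n, hp, htp, hS⟩ := h ht
    refine ⟨p, q, htp, fun s hs => ?_⟩
    rcases le_total s t with hst | hst
    · exact (jA_slab c hu hρ hf hp hS hs.1 hst htp.2).symm
    · exact jA_slab c hu hρ hf hp hS htp.1 hst hs.2
  · obtain ⟨p, q, n, hp, htp, hS⟩ := h ht
    refine ⟨p, q, htp, fun s hs => ?_⟩
    rcases le_total s t with hst | hst
    · exact (jB_slab c hu hρ hp hS hs.1 hst htp.2).symm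
    · exact jB_slab c hu hρ hp hS htp.1 hst hs.2
end PistonSol
end PC3
section PC4
namespace PistonSol
variable {P μ P' μ' : ℝ → ℝ} {Pext : ℝ} {S : PistonSol P μ Pext}
lemma LipK.mono {ρs n n' t : ℝ} (h : S.LipK ρs n t) (hn : n ≤ n') : S.LipK ρs n' t := fun m hm m' hm' =>
  (h m hm m' hm').trans (mul_le_mul_of_nonneg_right hn (abs_nonneg _))
lemma LipV.mono {n n' t : ℝ} (h : S.LipV n t) (hn : n ≤ n') : S.LipV n' t := fun m hm m' hm' =>
  (h m hm m' hm').trans (mul_le_mul_of_nonneg_right hn (abs_nonneg _))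
variable (c : Coef P μ P' μ')
include c
lemma lip_closed {ρs : ℝ} (hρ : 0 < ρs) (n : ℝ) : IsClosed {t | S.LipK ρs n t ∧ S.LipV n t} := by
  have : {t | S.LipK ρs n t ∧ S.LipV n t} = ⋂ m ∈ Icc 0 1, ⋂ m' ∈ Icc 0 1,
      ({t | |S.kL ρs t m - S.kL ρs t m'| ≤ n * |m - m'|} ∩ {t | |S.vL t m - S.vL t m'| ≤ n * |m - m'|}) := by
    ext t
    simp only [mem_ofPred_eq, mem_iInter, mem_inter_iff, LipK, LipV]
    exact ⟨fun h m hm m' hm' => ⟨h.1 m hm m' hm', h.2 m hm m' hm'⟩, fun h => ⟨fun m hm m' hm' => (h m hm m' hm').1, fun m hm m' hm' => (h m hm m' hm').2⟩⟩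
  rw [this]
  refine isClosed_biInter fun m _ => isClosed_biInter fun m' _ => IsClosed.inter ?_ ?_
  · exact isClosed_le ((kLt_cont c hρ m).sub (kLt_cont c hρ m')).abs continuous_const
  · exact isClosed_le ((vLt_cont m).sub (vLt_cont m')).abs continuous_const
lemma lipK_ex (hu : S.Unit1) {ρs : ℝ} (hρ : 0 < ρs) {t : ℝ} (ht : 0 ≤ t) : ∃ n, S.LipK ρs n t := by
  obtain ⟨C, hC, h⟩ := lip_conv c hu hρ ht le_rfl
  obtain ⟨n, hn⟩ := isCompact_Icc.exists_bound_of_continuousOn (S.ρx_cont t ht)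
  exact ⟨_, (h t ⟨le_rfl, le_rfl⟩ n).2.1 hn⟩
lemma lip_ex (hu : S.Unit1) {ρs : ℝ} (hρ : 0 < ρs) {t : ℝ} (ht : 0 < t) : ∃ n : ℕ, S.LipK ρs n t ∧ S.LipV n t := by
  obtain ⟨C, hC, h⟩ := lip_conv c hu hρ ht.le le_rfl
  obtain ⟨n1, h1⟩ := lipK_ex c hu hρ ht.le
  obtain ⟨n, hn⟩ := isCompact_Icc.exists_bound_of_continuousOn (S.vx_cont t ht)
  obtain ⟨N, hN⟩ := exists_nat_ge (max n1 (C * n))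
  exact ⟨N, h1.mono ((le_max_left _ _).trans hN), ((h t ⟨le_rfl, le_rfl⟩ n).2.2.2 ht hn).mono ((le_max_right _ _).trans hN)⟩
lemma good_all (hu : S.Unit1) {ρs Rf : ℝ} (hρ : 0 < ρs) (hf : ∀ t, 0 < t → S.u t = -Rf * S.v t (S.a t)) : Ioi 0 ⊆ S.Good := by
  intro p0 hp0
  by_contra hbad
  have hp0' : 0 < p0 := hp0
  set Z : Set ℝ := Ioo (p0 / 2) (2 * p0) \ S.Good with hZ
  have hZp : p0 ∈ Z := ⟨⟨by linarith, by linarith⟩, hbad⟩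
  have hKpos : closure Z ⊆ Ioi (0:ℝ) := by
    have : closure Z ⊆ Ici (p0 / 2) := closure_minimal (fun x hx => hx.1.1.le) isClosed_Ici
    exact fun x hx => lt_of_lt_of_le (half_pos hp0') (this hx)
  have : CompleteSpace (closure Z) := isClosed_closure.completeSpace_coe
  have : Nonempty (closure Z) := ⟨⟨p0, subset_closure hZp⟩⟩
  obtain ⟨n, hn⟩ := nonempty_interior_of_iUnion_of_closed (X := closure Z) (f := fun n : ℕ => Subtype.val ⁻¹' {t | S.LipK ρs n t ∧ S.LipV n t})
    (fun n => (lip_closed c hρ n).preimage continuous_subtype_val) (by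
      rw [eq_univ_iff_forall]
      intro x
      obtain ⟨n, hn⟩ := lip_ex c hu hρ (hKpos x.2)
      exact mem_iUnion.2 ⟨n, hn⟩)
  obtain ⟨x, hx⟩ := hn
  obtain ⟨U, hU, hUo, hxU⟩ := mem_interior.1 hx
  obtain ⟨O, hO, rfl⟩ := isOpen_induced_iff.1 hUo
  obtain ⟨p, hpO, hpZ⟩ := mem_closure_iff.1 x.2 O hO hxU
  have hnb : O ∩ Ioo (p0 / 2) (2 * p0) ∈ 𝓝 p := (hO.inter isOpen_Ioo).mem_nhds ⟨hpO, hpZ.1⟩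
  obtain ⟨ε, hε, hball⟩ := Metric.nhds_basis_closedBall.mem_iff.1 hnb
  rw [Real.closedBall_eq_Icc] at hball
  set s0 := p - ε with hs0d
  set T0 := p + ε with hT0
  have h0 : s0 ≤ T0 := by linarith
  have hs0 : 0 < s0 := by
    have := (hball (left_mem_Icc.2 h0)).2.1
    linarith
  obtain ⟨n0, k0, v0⟩ := lip_ex c hu hρ hs0
  obtain ⟨Cc, hCc, hconv⟩ := lip_conv c hu hρ hs0.le h0
  obtain ⟨Ck, V, hCk, hV, hprop⟩ := lipK_prop (S := S) c hρ h0
  set N : ℝ := max (n:ℝ) n0 with hN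
  have hN0 : 0 ≤ N := le_max_of_le_left (Nat.cast_nonneg _)
  set n1 := Cc * ((N + 2 * V) * Real.exp (Ck * (T0 - s0))) with hn1
  obtain ⟨L, hL, hgrad⟩ := grad_bd (S := S) (T0 := T0) (n1 := n1) c hu hs0 (mul_nonneg hCc hN0)
  have main : ∀ t ∈ Icc s0 T0, ∀ x ∈ Icc (S.a t) (S.b t), |S.ρx t x| ≤ n1 ∧ |S.vx t x| ≤ L := by
    intro t ht
    have hE : IsCompact (Icc s0 t ∩ (S.Goodᶜ ∪ {s0})) := isCompact_Icc.inter_right (good_open.isClosed_compl.union isClosed_singleton)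
    obtain ⟨α, ⟨hα1, hα2⟩, hαm⟩ := hE.exists_isGreatest ⟨s0, ⟨le_rfl, ht.1⟩, Or.inr rfl⟩
    have hαI : α ∈ Icc s0 T0 := ⟨hα1.1, hα1.2.trans ht.2⟩
    have hαB : S.LipK ρs N α ∧ S.LipV N α := by
      rcases hα2 with h | h
      · have h1 := hball hαI
        have h2 := hU (a := ⟨α, subset_closure ⟨h1.2, h⟩⟩) h1.1
        exact ⟨LipK.mono h2.1 (le_max_left _ _), LipV.mono h2.2 (le_max_left _ _)⟩
      · rw [mem_singleton_iff.1 h]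
        exact ⟨k0.mono (le_max_right _ _), v0.mono (le_max_right _ _)⟩
    have hG : Ioo α t ⊆ S.Good := fun s hs => by
      by_contra hb
      exact absurd (hαm ⟨⟨hα1.1.trans hs.1.le, hs.2.le⟩, Or.inl hb⟩) (not_le.2 hs.1)
    have hJ := good_const c hu hρ hf hG
    have hk : ∀ s ∈ Icc α t, ∀ x ∈ Icc (S.a s) (S.b s), |S.ρx s x| ≤ n1 := by
      intro s hs x hx
      have h1 := hprop α t N hα1.1 ht.2 (fun t ht => (hJ t ht).1) hαB.1 s hs
      refine ((hconv s ⟨hα1.1.trans hs.1, hs.2.trans ht.2⟩ _).1 h1 x hx).trans ?_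
      rw [hn1]
      have h3 : s - α ≤ T0 - s0 := by linarith [hs.2, ht.2, hα1.1]
      gcongr
    have hv := hgrad α t hα1.1 hα1.2 ht.2 (fun s hs => hk s (Ioc_subset_Icc_self hs)) ((hconv α hαI N).2.2.1 (hs0.trans_le hα1.1) hαB.2)
    exact fun x hx => ⟨hk t ⟨hα1.2, le_rfl⟩ x hx, hv t ⟨hα1.2, le_rfl⟩ x hx⟩
  refine hpZ.2 ⟨s0, T0, max n1 L, hs0.le, ⟨by linarith, by linarith⟩, fun t ht x hx => ?_⟩
  obtain ⟨h1, h2⟩ := main t (Ioo_subset_Icc_self ht) x hx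
  exact ⟨h1.trans (le_max_left _ _), h2.trans (le_max_right _ _)⟩
lemma cons_all (hu : S.Unit1) {ρs Rf : ℝ} (hρ : 0 < ρs) (hf : ∀ t, 0 < t → S.u t = -Rf * S.v t (S.a t)) {t : ℝ} (ht : 0 ≤ t) :
    (∀ m ∈ Icc 0 1, S.j1 ρs t m - S.j1 ρs t 0 = S.j1 ρs 0 m - S.j1 ρs 0 0) ∧ S.jA Rf Pext ρs t = S.jA Rf Pext ρs 0 ∧
      S.jB Pext ρs t = S.jB Pext ρs 0 :=
  good_const c hu hρ hf (α := 0) (T := t) (fun _ hs => good_all c hu hρ hf hs.1) t ⟨ht, le_rfl⟩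
lemma ρx_bd (hu : S.Unit1) {ρs Rf : ℝ} (hρ : 0 < ρs) (hf : ∀ t, 0 < t → S.u t = -Rf * S.v t (S.a t)) (T : ℝ) :
    ∃ n, 0 ≤ n ∧ ∀ t ∈ Icc 0 T, ∀ x ∈ Icc (S.a t) (S.b t), |S.ρx t x| ≤ n := by
  rcases lt_or_ge T 0 with h0 | h0
  · exact ⟨0, le_rfl, fun t ht => by linarith [ht.1, ht.2]⟩
  obtain ⟨n0, k0⟩ := lipK_ex c hu hρ (t := 0) le_rfl
  obtain ⟨Cc, hCc, hconv⟩ := lip_conv c hu hρ le_rfl h0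
  obtain ⟨Ck, V, hCk, hV, hprop⟩ := lipK_prop (S := S) c hρ h0
  refine ⟨Cc * ((|n0| + 2 * V) * Real.exp (Ck * (T - 0))), by positivity, fun t ht x hx => ?_⟩
  refine ((hconv t ht _).1 (hprop 0 T |n0| le_rfl le_rfl (fun t ht => (cons_all c hu hρ hf ht.1).1) (k0.mono (le_abs_self _)) t ht) x hx).trans ?_
  have := ht.2
  gcongr
end PistonSol
end PC4
section PC5
namespace PistonSol
variable {P μ P' μ' : ℝ → ℝ} {Pext : ℝ} {S : PistonSol P μ Pext}
variable (S) in
noncomputable def q0 (t m : ℝ) : ℝ := μ (S.rL t m) / S.rL t m * (S.ρx t (S.X t m) * (S.rL t m)⁻¹)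
variable (S) in
noncomputable def q (t m : ℝ) : ℝ := S.q0 (max t 0) (max 0 (min m 1))
lemma q_eq {t m : ℝ} (ht : 0 ≤ t) (hm : m ∈ Icc 0 1) : S.q t m = S.q0 t m := by
  rw [q, max_eq_left ht, min_eq_left hm.2, max_eq_right hm.1]
variable (c : Coef P μ P' μ')
include c
lemma kL_dm' (hu : S.Unit1) {ρs : ℝ} (hρ : 0 < ρs) {t m : ℝ} (ht : 0 ≤ t) (hm : m ∈ Icc 0 1) :
    HasDerivWithinAt (S.kL ρs t) (S.q t m) (Icc 0 1) m := by
  rw [q_eq ht hm]; exact kL_dm c hu hρ ht hm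
lemma PL_dm (hu : S.Unit1) {t m : ℝ} (ht : 0 ≤ t) (hm : m ∈ Icc 0 1) :
    HasDerivWithinAt (S.PL t) (P' (S.rL t m) * S.rL t m / μ (S.rL t m) * S.q t m) (Icc 0 1) m := by
  refine ((c.dP _ (S.rL_pos t m)).comp_hasDerivWithinAt m (rL_dm hu ht hm)).congr_deriv ?_
  rw [q_eq ht hm, q0]
  have h1 := (S.rL_pos t m).ne'
  have h2 := (c.μpos _ (S.rL_pos t m)).ne'
  field_simp
lemma w_lip (hu : S.Unit1) {ρs Rf : ℝ} (hρ : 0 < ρs) (hf : ∀ t, 0 < t → S.u t = -Rf * S.v t (S.a t)) (T : ℝ) :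
    ∃ B, 0 ≤ B ∧ ∀ s ∈ Icc 0 T, ∀ t ∈ Icc 0 T, ∀ m ∈ Icc 0 1, |(S.vL t m + S.q t m) - (S.vL s m + S.q s m)| ≤ B * |t - s| := by
  rcases lt_or_ge T 0 with h0 | h0
  · exact ⟨0, le_rfl, fun t ht => by linarith [ht.1, ht.2]⟩
  obtain ⟨n, hn, hρx⟩ := ρx_bd c hu hρ hf T
  obtain ⟨Cc, hCc, hconv⟩ := lip_conv c hu hρ le_rfl h0
  obtain ⟨C, hC, hPk⟩ := PL_le_kL (S := S) c hρ h0
  refine ⟨C * (Cc * n), by positivity, fun s hs t ht m hm => ?_⟩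
  have vi : ∀ t a b, IntervalIntegrable (S.vL t) volume a b := fun t a b => (vLm_cont t).intervalIntegrable _ _
  have Pi : ∀ m a b, IntervalIntegrable (fun t => S.PL t m) volume a b := fun m a b => (PLt_cont c m).intervalIntegrable _ _
  have d1 : ∀ t, 0 ≤ t → HasDerivWithinAt (fun m => (∫ z in 0..m, S.vL t z) + S.kL ρs t m) (S.vL t m + S.q t m) (Icc 0 1) m := fun t ht =>
    (integral_hasDerivAt_right (vi t _ _) ((vLm_cont t).stronglyMeasurableAtFilter _ _)
      (vLm_cont t).continuousAt).hasDerivWithinAt.fun_add (kL_dm' c hu hρ ht hm)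
  refine deriv_le_of_lip zero_lt_one one_pos hm ((d1 t ht.1).fun_sub (d1 s hs.1)) fun x hx y hy _ => ?_
  have hj : ∀ x ∈ Icc 0 1, S.j1 ρs t x - S.j1 ρs t 0 = S.j1 ρs s x - S.j1 ρs s 0 := fun x hx => by
    rw [(cons_all c hu hρ hf ht.1).1 x hx, (cons_all c hu hρ hf hs.1).1 x hx]
  have e1 := hj x hx
  have e2 := hj y hy
  have e3 : ∫ τ in s..t, (S.PL τ y - S.PL τ x) = ((∫ τ in 0..t, S.PL τ y) - ∫ τ in 0..s, S.PL τ y) -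
      ((∫ τ in 0..t, S.PL τ x) - ∫ τ in 0..s, S.PL τ x) := by
    rw [intervalIntegral.integral_sub (Pi _ _ _) (Pi _ _ _), ← integral_interval_sub_left (Pi x 0 t) (Pi x 0 s),
      ← integral_interval_sub_left (Pi y 0 t) (Pi y 0 s)]
  simp only [j1] at e1 e2
  have e4 := norm_integral_le_of_norm_le_const (f := fun τ => S.PL τ y - S.PL τ x) (a := s) (b := t) (C := C * (Cc * n) * |x - y|) fun τ hτ => by
    have hτ' : τ ∈ Icc 0 T := ⟨(le_min hs.1 ht.1).trans hτ.1.le, hτ.2.trans (max_le hs.2 ht.2)⟩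
    refine (hPk τ hτ' y hy x hx).trans ?_
    rw [mul_assoc]
    refine mul_le_mul_of_nonneg_left ?_ hC
    rw [abs_sub_comm x y]
    exact (hconv τ hτ' n).2.1 (hρx τ hτ') y hy x hx
  rw [e3, norm_eq_abs] at e4
  calc _ = |((∫ τ in 0..t, S.PL τ y) - ∫ τ in 0..s, S.PL τ y) - ((∫ τ in 0..t, S.PL τ x) - ∫ τ in 0..s, S.PL τ x)| := by
        congr 1; linarith
    _ ≤ _ := e4.trans (le_of_eq (by ring))
lemma q0m_cont (hu : S.Unit1) {t : ℝ} (ht : 0 ≤ t) : ContinuousOn (S.q0 t) (Icc 0 1) := by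
  have h1 : ContinuousOn (fun m => S.ρx t (S.X t m)) (Icc 0 1) := (S.ρx_cont t ht).comp (S.Xm_cont t).continuousOn fun m hm => X_mem hu ht hm
  have h2 : Continuous fun m => μ (S.rL t m) := c.cμ.comp_continuous (rLm_cont t) fun m => S.rL_pos _ _
  have h3 : Continuous fun m => (S.rL t m)⁻¹ := (rLm_cont t).inv₀ fun m => (S.rL_pos _ _).ne'
  exact (h2.div (rLm_cont t) fun m => (S.rL_pos _ _).ne').continuousOn.mul (h1.mul h3.continuousOn)
lemma q_cont (hu : S.Unit1) {ρs Rf : ℝ} (hρ : 0 < ρs) (hf : ∀ t, 0 < t → S.u t = -Rf * S.v t (S.a t)) : Continuous (Function.uncurry S.q) := by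
  have key : ContinuousOn (fun p : ℝ × ℝ => S.vL p.1 p.2 + S.q0 p.1 p.2) (Ici 0 ×ˢ Icc 0 1) := by
    intro p hp
    obtain ⟨B, hB, hl⟩ := w_lip c hu hρ hf (p.1 + 1)
    have h1 : ContinuousOn (fun p : ℝ × ℝ => S.vL p.1 p.2 + S.q0 p.1 p.2) (Icc 0 (p.1 + 1) ×ˢ Icc 0 1) := by
      refine continuousOn_prod_of_continuousOn_lipschitzOnWith _ (Real.toNNReal B) (fun t ht => ?_) (fun m hm => ?_)
      · exact (vLm_cont t).continuousOn.add (q0m_cont c hu ht.1)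
      · refine LipschitzOnWith.of_dist_le_mul fun t ht s hs => ?_
        rw [coe_toNNReal _ hB, dist_eq, dist_eq]
        have := hl s hs t ht m hm
        rwa [q_eq ht.1 hm, q_eq hs.1 hm] at this
    refine (h1 p ⟨⟨hp.1, by linarith⟩, hp.2⟩).mono_of_mem_nhdsWithin ?_
    have h2 : (Prod.fst ⁻¹' (Iio (p.1 + 1)) : Set (ℝ × ℝ)) ∈ 𝓝 p := (isOpen_Iio.preimage continuous_fst).mem_nhds (by simp)
    filter_upwards [self_mem_nhdsWithin, mem_nhdsWithin_of_mem_nhds h2] with z hz hz2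
    exact ⟨⟨hz.1, le_of_lt hz2⟩, hz.2⟩
  have h3 := (key.sub S.vL_cont.continuousOn).comp_continuous (f := fun p : ℝ × ℝ => (max p.1 0, max 0 (min p.2 1))) (by fun_prop)
    (fun p => ⟨mem_Ici.2 (le_max_right _ _), le_max_left _ _, max_le zero_le_one (min_le_right _ _)⟩)
  exact h3.congr fun p => add_sub_cancel_left _ _
lemma q_int (hu : S.Unit1) {ρs Rf : ℝ} (hρ : 0 < ρs) (hf : ∀ t, 0 < t → S.u t = -Rf * S.v t (S.a t)) {t m : ℝ} (ht : 0 ≤ t) (hm : m ∈ Icc 0 1) :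
    ∫ z in 0..m, S.q t z = S.kL ρs t m - S.kL ρs t 0 := by
  refine intervalIntegral.integral_eq_sub_of_hasDeriv_right_of_le hm.1 (kLm_cont c hρ t).continuousOn (fun z hz => ?_)
    (((q_cont c hu hρ hf).uncurry_left t).intervalIntegrable _ _)
  exact ((kL_dm' c hu hρ ht ⟨hz.1.le, hz.2.le.trans hm.2⟩).mono_of_mem_nhdsWithin
    (Filter.mem_of_superset (Ioo_mem_nhdsGT (hz.2.trans_le hm.2)) fun y hy => ⟨by linarith [hy.1, hz.1], hy.2.le⟩))
end PistonSol
end PC5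
section PC6
lemma icadd {f g k : ℝ → ℝ} {a b : ℝ} (hf : Continuous f) (hg : Continuous g) (e : ∀ x, k x = f x + g x) :
    ∫ x in a..b, k x = (∫ x in a..b, f x) + ∫ x in a..b, g x := by
  simp only [e]; exact intervalIntegral.integral_add (hf.intervalIntegrable _ _) (hg.intervalIntegrable _ _)
lemma weak_lim {l : Filter ℝ} [l.IsCountablyGenerated] {f : ℝ → ℝ → ℝ} {g ψ : ℝ → ℝ} {B : ℝ} (hf : ∀ h, Continuous (f h))
    (hb : ∀ᶠ h in l, ∀ m ∈ Icc 0 1, |f h m| ≤ B) (hg : Continuous g) (hψ : Continuous ψ)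
    (hl : ∀ m ∈ Icc 0 1, Tendsto (fun h => ∫ z in 0..m, f h z) l (𝓝 (∫ z in 0..m, g z))) :
    Tendsto (fun h => ∫ m in 0..1, ψ m * f h m) l (𝓝 (∫ m in 0..1, ψ m * g m)) := by
  have zs : ∀ m ∈ Set.uIoc (0:ℝ) 1, m ∈ Icc 0 1 := fun m hm => by
    rw [uIoc_of_le zero_le_one] at hm; exact ⟨hm.1.le, hm.2⟩
  obtain ⟨B2, hB2⟩ := isCompact_Icc.exists_bound_of_continuousOn (hg.continuousOn (s := Icc (0:ℝ) 1))
  have hcd : ∀ h, Continuous fun m => f h m - g m := fun h => (hf h).sub hg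
  have hpoly : ∀ p : Polynomial ℝ, Tendsto (fun h => ∫ m in 0..1, p.eval m * (f h m - g m)) l (𝓝 0) := fun p => by
    have hD : ∀ m ∈ Icc 0 1, Tendsto (fun h => ∫ z in 0..m, (f h z - g z)) l (𝓝 0) := fun m hm => by
      have := (hl m hm).sub_const (∫ z in 0..m, g z)
      rw [sub_self] at this
      exact this.congr fun h => (intervalIntegral.integral_sub ((hf h).intervalIntegrable _ _) (hg.intervalIntegrable _ _)).symm
    have ibp : ∀ h, ∫ m in 0..1, p.eval m * (f h m - g m) = p.eval 1 * (∫ z in 0..1, (f h z - g z)) -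
        ∫ m in 0..1, p.derivative.eval m * ∫ z in 0..m, (f h z - g z) := fun h => by
      have := intervalIntegral.integral_mul_deriv_eq_deriv_mul (a := 0) (b := 1) (u := fun m => p.eval m) (v := fun m => ∫ z in 0..m, (f h z - g z))
        (u' := fun m => p.derivative.eval m) (v' := fun m => f h m - g m)
        (fun m _ => p.hasDerivAt m) (fun m _ => (hcd h).integral_hasStrictDerivAt 0 m |>.hasDerivAt)
        (p.derivative.continuous.intervalIntegrable _ _) ((hcd h).intervalIntegrable _ _)
      simpa using this
    obtain ⟨B3, hB3⟩ := isCompact_Icc.exists_bound_of_continuousOn (p.derivative.continuous.continuousOn (s := Icc (0:ℝ) 1))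
    have h2 : Tendsto (fun h => ∫ m in 0..1, p.derivative.eval m * ∫ z in 0..m, (f h z - g z)) l (𝓝 (∫ m in 0..1, (0:ℝ))) := by
      refine tendsto_integral_filter_of_dominated_convergence (fun _ => B3 * ((B + B2) * 1)) ?_ ?_ intervalIntegrable_const ?_
      · refine Eventually.of_forall fun h => Continuous.aestronglyMeasurable (p.derivative.continuous.mul ?_)
        exact continuous_primitive (fun a b => (hcd h).intervalIntegrable a b) 0
      · filter_upwards [hb] with h hbh
        refine Eventually.of_forall fun m hm => ?_
        have hm' := zs m hm
        rw [norm_mul]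
        have h3 := norm_integral_le_of_norm_le_const (f := fun z => f h z - g z) (a := 0) (b := m) (C := B + B2) fun z hz => by
          rw [uIoc_of_le hm'.1] at hz
          have hz' : z ∈ Icc 0 1 := ⟨hz.1.le, hz.2.trans hm'.2⟩
          exact (norm_sub_le _ _).trans (add_le_add (hbh z hz') (hB2 z hz'))
        have hBB : 0 ≤ B + B2 := add_nonneg ((abs_nonneg _).trans (hbh m hm')) ((norm_nonneg _).trans (hB2 m hm'))
        refine mul_le_mul (hB3 m hm') (h3.trans (mul_le_mul_of_nonneg_left ?_ hBB)) (norm_nonneg _) ((norm_nonneg _).trans (hB3 m hm'))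
        rw [sub_zero, abs_of_nonneg hm'.1]; exact hm'.2
      · exact Eventually.of_forall fun m hm => by simpa using (hD m (zs m hm)).const_mul (p.derivative.eval m)
    have h3 := ((hD 1 (by simp)).const_mul (p.eval 1)).sub h2
    simp only [mul_zero, intervalIntegral.integral_zero, sub_zero] at h3
    exact h3.congr fun h => (ibp h).symm
  have main : Tendsto (fun h => ∫ m in 0..1, ψ m * (f h m - g m)) l (𝓝 0) := by
    rw [Metric.tendsto_nhds]
    intro e he
    set Q := max (B + B2) 0 + 1
    have hQ : 0 < Q := by positivity
    obtain ⟨p, hp⟩ := exists_polynomial_near_of_continuousOn 0 1 ψ hψ.continuousOn (e / 2 / Q) (by positivity)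
    filter_upwards [hb, (Metric.tendsto_nhds.1 (hpoly p)) (e / 2) (half_pos he)] with h hbh h4
    rw [dist_eq, sub_zero] at h4 ⊢
    have e1 : ∫ m in 0..1, ψ m * (f h m - g m) = (∫ m in 0..1, (ψ m - p.eval m) * (f h m - g m)) + ∫ m in 0..1, p.eval m * (f h m - g m) :=
      icadd ((hψ.sub p.continuous).mul (hcd h)) (p.continuous.mul (hcd h)) fun m => by ring
    have e2 := norm_integral_le_of_norm_le_const (f := fun m => (ψ m - p.eval m) * (f h m - g m)) (a := 0) (b := 1) (C := e / 2 / Q * Q) fun m hm => by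
      have hm' := zs m hm
      rw [norm_mul]
      refine mul_le_mul (by rw [norm_eq_abs, abs_sub_comm]; exact (hp m hm').le) ?_ (norm_nonneg _) (by positivity)
      exact ((norm_sub_le _ _).trans (add_le_add (hbh m hm') (hB2 m hm'))).trans (by linarith [le_max_left (B + B2) 0])
    rw [div_mul_cancel₀ _ hQ.ne', sub_zero, abs_one, mul_one, norm_eq_abs] at e2
    rw [e1]
    exact (abs_add_le _ _).trans_lt (by linarith)
  have := main.add_const (∫ m in 0..1, ψ m * g m)
  rw [zero_add] at this
  exact this.congr fun h => (icadd (hψ.mul (hcd h)) (hψ.mul hg) fun m => by simp only [Pi.mul_apply]; ring).symm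
lemma dini_mono {G : ℝ → ℝ} (hG : ContinuousOn G (Ici 0)) (h : ∀ t, 0 < t → ∀ e, 0 < e → ∀ᶠ d in 𝓝[>] (0:ℝ), G t - G (t - d) ≤ e * d) {T : ℝ} (hT : 0 ≤ T) :
    G T ≤ G 0 := by
  refine le_of_forall_pos_le_add fun e he => ?_
  have he' : 0 < e / (T + 1) := by positivity
  obtain ⟨t, ht, hm⟩ := isCompact_Icc.exists_isMinOn (s := Icc 0 T) ⟨0, le_rfl, hT⟩
    (f := fun t => (G t - G 0) * (-1) + e / (T + 1) * t - 0) (((hG.mono fun x hx => hx.1).sub continuousOn_const).mul continuousOn_const |>.add (by fun_prop) |>.sub continuousOn_const)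
  rcases eq_or_lt_of_le ht.1 with h0 | h0
  · subst h0
    have h1 := isMinOn_iff.1 hm T ⟨hT, le_rfl⟩
    have h2 : e / (T + 1) * T ≤ e := by
      rw [div_mul_eq_mul_div, div_le_iff₀ (by positivity)]; nlinarith
    linarith
  · obtain ⟨d, h1, h2⟩ := ((h t h0 _ (half_pos he')).and (Ioo_mem_nhdsGT h0)).exists
    have h3 := isMinOn_iff.1 hm (t - d) ⟨by linarith [h2.2], by linarith [h2.1, ht.2]⟩
    have h4 : 0 < e / (T + 1) * d := mul_pos he' h2.1
    linarith
end PC6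
section PC7
lemma half_sq {f g : ℝ → ℝ} (hf : Continuous f) (hg : Continuous g) :
    (1 / 2) * (∫ m in 0..1, f m ^ 2) - (1 / 2) * (∫ m in 0..1, g m ^ 2) ≤ ∫ m in 0..1, f m * (f m - g m) := by
  have h1 : (∫ m in 0..1, f m ^ 2 - g m ^ 2) = _ := intervalIntegral.integral_sub ((hf.pow 2).intervalIntegrable _ _) ((hg.pow 2).intervalIntegrable _ _)
  rw [← mul_sub, ← h1, ← intervalIntegral.integral_const_mul]
  refine integral_mono_on zero_le_one (Continuous.intervalIntegrable (by fun_prop) _ _) (Continuous.intervalIntegrable (by fun_prop) _ _) fun m _ => ?_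
  nlinarith [sq_nonneg (f m - g m)]
lemma ftc01 {F f : ℝ → ℝ} (hF : Continuous F) (hf : Continuous f) (hd : ∀ m ∈ Icc 0 1, HasDerivWithinAt F (f m) (Icc 0 1) m) {m : ℝ} (hm : m ∈ Icc 0 1) :
    ∫ z in 0..m, f z = F m - F 0 :=
  intervalIntegral.integral_eq_sub_of_hasDeriv_right_of_le hm.1 hF.continuousOn (fun z hz =>
    (hd z ⟨hz.1.le, hz.2.le.trans hm.2⟩).mono_of_mem_nhdsWithin
    (Filter.mem_of_superset (Ioo_mem_nhdsGT (hz.2.trans_le hm.2)) fun y hy => ⟨by linarith [hy.1, hz.1], hy.2.le⟩)) (hf.intervalIntegrable _ _)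
lemma ibp01 {F f G g : ℝ → ℝ} (hF : Continuous F) (hf : Continuous f) (hd : ∀ m ∈ Icc 0 1, HasDerivWithinAt F (f m) (Icc 0 1) m)
    (hG : Continuous G) (hg : Continuous g) (hd' : ∀ m ∈ Icc 0 1, HasDerivWithinAt G (g m) (Icc 0 1) m) :
    (∫ z in 0..1, f z * G z) + (∫ z in 0..1, F z * g z) = F 1 * G 1 - F 0 * G 0 :=
  (icadd (k := fun x => f x * G x + F x * g x) (hf.mul hG) (hF.mul hg) (fun x => rfl)).symm.trans
    (ftc01 (hF.mul hG) ((hf.mul hG).add (hF.mul hg)) (fun m hm => (hd m hm).mul (hd' m hm)) ⟨zero_le_one, le_rfl⟩)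
lemma left_quot {F : ℝ → ℝ} {F' t : ℝ} (h : HasDerivAt F F' t) : Tendsto (fun d => d⁻¹ * (F t - F (t - d))) (𝓝[>] 0) (𝓝 F') := by
  have h1 : Tendsto (fun d : ℝ => -d) (𝓝[>] 0) (𝓝[≠] 0) := by
    refine tendsto_nhdsWithin_iff.2 ⟨?_, ?_⟩
    · exact (by simpa using (continuous_neg (G := ℝ)).tendsto 0 : Tendsto (fun d : ℝ => -d) (𝓝 0) (𝓝 0)).mono_left nhdsWithin_le_nhds
    · filter_upwards [self_mem_nhdsWithin] with d hd
      exact neg_ne_zero.2 (ne_of_gt hd)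
  refine (h.tendsto_slope_zero.comp h1).congr fun d => ?_
  simp only [Function.comp, smul_eq_mul, inv_neg, ← sub_eq_add_neg]; ring
lemma left_avg {f : ℝ → ℝ} (hf : Continuous f) (t : ℝ) : Tendsto (fun d => d⁻¹ * ∫ τ in (t - d)..t, f τ) (𝓝[>] 0) (𝓝 (f t)) := by
  refine (left_quot (hf.integral_hasStrictDerivAt 0 t).hasDerivAt).congr fun d => ?_
  rw [integral_interval_sub_left (hf.intervalIntegrable _ _) (hf.intervalIntegrable _ _)]
lemma min_at {D : Set ℝ} (hD : D.OrdConnected) {f f' : ℝ → ℝ} {x0 x1 : ℝ} (h0 : x0 ∈ D) (h1 : x1 ∈ D) (hd : ∀ x ∈ D, HasDerivAt f (f' x) x)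
    (hs : ∀ x ∈ D, 0 ≤ f' x * (x - x0)) : f x0 ≤ f x1 := by
  rcases lt_trichotomy x0 x1 with h | h | h
  · have hsub := hD.out h0 h1
    obtain ⟨ξ, hξ, he⟩ := exists_hasDerivAt_eq_slope f f' h (fun x hx => (hd x (hsub hx)).continuousAt.continuousWithinAt) (fun x hx => hd x (hsub (Ioo_subset_Icc_self hx)))
    have := nonneg_of_mul_nonneg_left (hs ξ (hsub (Ioo_subset_Icc_self hξ))) (sub_pos.2 hξ.1)
    rw [he] at this
    have := (le_div_iff₀ (sub_pos.2 h)).1 this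
    linarith
  · rw [h]
  · have hsub := hD.out h1 h0
    obtain ⟨ξ, hξ, he⟩ := exists_hasDerivAt_eq_slope f f' h (fun x hx => (hd x (hsub hx)).continuousAt.continuousWithinAt) (fun x hx => hd x (hsub (Ioo_subset_Icc_self hx)))
    have := hs ξ (hsub (Ioo_subset_Icc_self hξ))
    have h4 : f' ξ ≤ 0 := by by_contra! h5; linarith [mul_neg_of_pos_of_neg h5 (sub_neg.2 hξ.2)]
    rw [he] at h4
    have := (div_le_iff₀ (sub_pos.2 h)).1 h4
    linarith
namespace Coef
variable {P μ P' μ' : ℝ → ℝ} (c : Coef P μ P' μ') {ρs : ℝ} (hρ : 0 < ρs)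
include c
lemma Pmono : StrictMonoOn P (Ioi 0) :=
  strictMonoOn_of_deriv_pos (convex_Ioi 0) c.cP fun x hx => by
    rw [interior_Ioi] at hx; rw [(c.dP x hx).deriv]; exact c.P'pos x hx
include hρ
lemma de (x : ℝ) (hx : 0 < x) : HasDerivAt (fun x => Qf P ρs x / x) ((P x - P ρs) / x ^ 2) x := by
  have hc : ContinuousOn (fun τ => P τ / τ ^ 2) (Ioi 0) := c.cP.div (by fun_prop) fun x hx => pow_ne_zero 2 (ne_of_gt hx)
  have hsub : uIcc ρs x ⊆ Ioi 0 := fun z hz => (lt_min hρ hx).trans_le hz.1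
  have h1 := integral_hasDerivAt_right ((hc.mono hsub).intervalIntegrable)
    (hc.stronglyMeasurableAtFilter isOpen_Ioi x hx) (hc.continuousAt (Ioi_mem_nhds hx))
  have h2 := ((((hasDerivAt_id x).fun_mul h1).fun_sub ((hasDerivAt_id x).const_mul (P ρs / ρs))).add_const (P ρs)).fun_div (hasDerivAt_id x) hx.ne'
  refine h2.congr_deriv ?_
  simp only [id]
  field_simp
  ring
lemma econv {x0 x1 : ℝ} (h0 : 0 < x0) (h1 : 0 < x1) : Qf P ρs x0 / x0 - Qf P ρs x1 / x1 ≤ -(P x0 - P ρs) * (x0⁻¹ - x1⁻¹) := by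
  have := min_at (D := Ioi (0:ℝ)) ordConnected_Ioi (f := fun x => Qf P ρs x / x + (P x0 - P ρs) * x⁻¹)
    (f' := fun x => (P x - P ρs) / x ^ 2 + (P x0 - P ρs) * (-(x ^ 2)⁻¹)) (x0 := x0) (x1 := x1) h0 h1
    (fun x hx => (c.de hρ x hx).fun_add ((hasDerivAt_inv (ne_of_gt hx)).const_mul _)) fun x hx => by
      have e : ((P x - P ρs) / x ^ 2 + (P x0 - P ρs) * (-(x ^ 2)⁻¹)) * (x - x0) = (P x - P x0) * (x - x0) * (x ^ 2)⁻¹ := by ring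
      rw [e]
      refine mul_nonneg ?_ (by positivity)
      rcases le_total x x0 with h | h
      · exact mul_nonneg_of_nonpos_of_nonpos (by linarith [c.Pmono.monotoneOn hx h0 h]) (by linarith)
      · exact mul_nonneg (by linarith [c.Pmono.monotoneOn h0 hx h]) (by linarith)
  linarith
end Coef
end PC7
section PC8
namespace PistonSol
variable {P μ P' μ' : ℝ → ℝ} {Pext : ℝ} {S : PistonSol P μ Pext}
variable (S) in
noncomputable def wL (t m : ℝ) : ℝ := S.vL t m + S.q t m
variable (S) in
noncomputable def pm (P' : ℝ → ℝ) (t m : ℝ) : ℝ := P' (S.rL t m) * S.rL t m / μ (S.rL t m) * S.q t m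
variable (S) in
noncomputable def fm (t m : ℝ) : ℝ := S.gL t (max 0 (min m 1)) * (S.rL t (max 0 (min m 1)))⁻¹
variable (S) in
noncomputable def eL (ρs t m : ℝ) : ℝ := Qf P ρs (S.rL t m) / S.rL t m
variable (S) in
noncomputable def VL (ρs r t : ℝ) : ℝ := ((1 / 2) * (∫ m in 0..1, S.wL t m ^ 2) + (1 / 2) * (S.vL t 1 - S.kL ρs t 1) ^ 2 +
  (1 / 2) * (S.vL t 0 + S.kL ρs t 0) ^ 2 + ∫ m in 0..1, S.eL ρs t m) +
  r * (S.vL t 0 ^ 2 / 2 + S.vL t 1 ^ 2 / 2 + (1 / 2) * (∫ m in 0..1, S.vL t m ^ 2) + ∫ m in 0..1, S.eL ρs t m)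
lemma fm_cont (hu : S.Unit1) {t : ℝ} (ht : 0 < t) : Continuous (S.fm t) := by
  have h1 : Continuous fun m : ℝ => max 0 (min m 1) := by fun_prop
  have h2 : Continuous fun m => S.gL t (max 0 (min m 1)) := (S.vx_cont t ht).comp_continuous ((S.Xm_cont t).comp h1)
    fun m => X_mem hu ht.le ⟨le_max_left _ _, max_le zero_le_one (min_le_right _ _)⟩
  exact h2.mul (((rLm_cont t).comp h1).inv₀ fun m => (S.rL_pos _ _).ne')
lemma fm_eq {t m : ℝ} (hm : m ∈ Icc 0 1) : S.fm t m = S.gL t m * (S.rL t m)⁻¹ := by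
  rw [fm, min_eq_left hm.2, max_eq_right hm.1]
lemma vL_dm' (hu : S.Unit1) {t m : ℝ} (ht : 0 < t) (hm : m ∈ Icc 0 1) : HasDerivWithinAt (S.vL t) (S.fm t m) (Icc 0 1) m := by
  rw [fm_eq hm]; exact vL_dm hu ht hm
lemma iL_cont (t : ℝ) : Continuous fun m => (S.rL t m)⁻¹ := (rLm_cont t).inv₀ fun m => (S.rL_pos _ _).ne'
lemma iL_int (t m : ℝ) (hm : m ∈ Icc 0 1) : ∫ z in 0..m, (S.rL t z)⁻¹ = S.X t m - S.X t 0 :=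
  ftc01 (S.Xm_cont t) (iL_cont t) (fun z _ => (S.X_dm t z).hasDerivWithinAt) hm
variable (c : Coef P μ P' μ') (hu : S.Unit1) {ρs Rf : ℝ} (hρ : 0 < ρs) (hf : ∀ t, 0 < t → S.u t = -Rf * S.v t (S.a t))
include c
lemma cmu (t : ℝ) : Continuous fun m => μ (S.rL t m) := c.cμ.comp_continuous (rLm_cont t) fun m => S.rL_pos _ _
include hu hρ hf
lemma qm_cont (t : ℝ) : Continuous (S.q t) := (q_cont c hu hρ hf).uncurry_left t
lemma wm_cont (t : ℝ) : Continuous (S.wL t) := (vLm_cont t).add (qm_cont c hu hρ hf t)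
lemma pm_cont (t : ℝ) : Continuous (S.pm P' t) :=
  (((c.cP'.comp_continuous (rLm_cont t) fun m => S.rL_pos _ _).mul (rLm_cont t)).div (cmu c t) fun m => (c.μpos _ (S.rL_pos _ _)).ne').mul (qm_cont c hu hρ hf t)
lemma w_weak {t : ℝ} (ht : 0 < t) {ψ : ℝ → ℝ} (hψ : Continuous ψ) :
    Tendsto (fun d => ∫ m in 0..1, ψ m * (d⁻¹ * (S.wL t m - S.wL (t - d) m))) (𝓝[>] 0) (𝓝 (∫ m in 0..1, ψ m * -S.pm P' t m)) := by
  obtain ⟨B, hB, hl⟩ := w_lip c hu hρ hf t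
  have wc := wm_cont c hu hρ hf
  refine weak_lim (B := B) (fun h => continuous_const.mul ((wc t).sub (wc _))) ?_ (pm_cont c hu hρ hf t).neg hψ fun m hm => ?_
  · filter_upwards [Ioo_mem_nhdsGT ht] with d hd m hm
    have := hl (t - d) ⟨by linarith [hd.2], by linarith [hd.1]⟩ t ⟨ht.le, le_rfl⟩ m hm
    rw [sub_sub_cancel, abs_of_pos hd.1] at this
    rw [abs_mul, abs_inv, abs_of_pos hd.1, inv_mul_le_iff₀ hd.1, mul_comm d]
    exact this
  · have Pc : ∀ m, Continuous fun τ => S.PL τ m := PLt_cont c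
    have e0 : ∫ z in 0..m, -S.pm P' t z = -(S.PL t m - S.PL t 0) := by
      rw [intervalIntegral.integral_neg, ftc01 (F := S.PL t) ((PL_cont c).uncurry_left t) (pm_cont c hu hρ hf t) (fun z hz => PL_dm c hu ht.le hz) hm]
    rw [e0]
    refine (left_avg ((Pc m).sub (Pc 0)) t).neg.congr' ?_
    filter_upwards [Ioo_mem_nhdsGT ht] with d hd
    have hs : 0 ≤ t - d := by linarith [hd.2]
    rw [intervalIntegral.integral_const_mul, ← mul_neg]
    congr 1
    have hw : ∀ s, 0 ≤ s → ∫ z in 0..m, S.wL s z = (∫ z in 0..m, S.vL s z) + (S.kL ρs s m - S.kL ρs s 0) := fun s hs => by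
      rw [← q_int c hu hρ hf hs hm]; exact icadd (vLm_cont s) (qm_cont c hu hρ hf s) fun _ => rfl
    rw [intervalIntegral.integral_sub ((wc t).intervalIntegrable _ _) ((wc _).intervalIntegrable _ _), hw t ht.le, hw _ hs]
    have hj : S.j1 ρs t m - S.j1 ρs t 0 = S.j1 ρs (t - d) m - S.j1 ρs (t - d) 0 := by
      rw [(cons_all c hu hρ hf ht.le).1 m hm, (cons_all c hu hρ hf hs).1 m hm]
    simp only [j1, integral_same] at hj
    have i : ∀ m a b, IntervalIntegrable (fun τ => S.PL τ m) volume a b := fun m a b => (Pc m).intervalIntegrable a b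
    have e1 : ∫ τ in (t - d)..t, (S.PL τ m - S.PL τ 0) = _ := intervalIntegral.integral_sub (i m _ _) (i 0 _ _)
    simp only [Pi.sub_apply]
    rw [e1, ← integral_interval_sub_left (i m 0 t) (i m 0 _), ← integral_interval_sub_left (i 0 0 t) (i 0 0 _)]
    linarith
lemma eta_weak {t : ℝ} (ht : 0 < t) {ψ : ℝ → ℝ} (hψ : Continuous ψ) :
    Tendsto (fun d => ∫ m in 0..1, ψ m * (d⁻¹ * ((S.rL t m)⁻¹ - (S.rL (t - d) m)⁻¹))) (𝓝[>] 0) (𝓝 (∫ m in 0..1, ψ m * S.fm t m)) ∧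
    Tendsto (fun d => ∫ m in 0..1, ψ m * (d⁻¹ * (S.kL ρs t m - S.kL ρs (t - d) m))) (𝓝[>] 0)
      (𝓝 (-∫ m in 0..1, (ψ m * (μ (S.rL t m) * S.rL t m)) * S.fm t m)) := by
  obtain ⟨p, q, n, hp, htI, h⟩ := good_all c hu hρ hf ht
  obtain ⟨c0, C0, hc0, hcC⟩ := rL_bd (S := S) p t htI.1.le
  have hn : 0 ≤ n := (abs_nonneg _).trans (gL_bd hu hp h htI (⟨le_rfl, zero_le_one⟩ : (0:ℝ) ∈ Icc 0 1))
  have hev : ∀ᶠ d in 𝓝[>] (0:ℝ), 0 < d ∧ p < t - d := by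
    filter_upwards [Ioo_mem_nhdsGT (sub_pos.2 htI.1)] with d hd using ⟨hd.1, by linarith [hd.2]⟩
  have be : ∀ d, 0 < d → p < t - d → ∀ m ∈ Icc 0 1, |(S.rL t m)⁻¹ - (S.rL (t - d) m)⁻¹| ≤ n * c0⁻¹ * d := fun d h0 hd m hm => by
    rw [(eta_int hu hp h hd (by linarith) htI.2 hm).2]
    have := norm_integral_le_of_norm_le_const (f := fun τ => S.gL τ m * (S.rL τ m)⁻¹) (a := t - d) (b := t) (C := n * c0⁻¹) fun τ hτ => by
      rw [uIoc_of_le (by linarith)] at hτ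
      rw [norm_mul, norm_inv, norm_eq_abs, norm_eq_abs, abs_of_pos (S.rL_pos _ _)]
      exact mul_le_mul (gL_bd hu hp h ⟨hd.trans hτ.1, hτ.2.trans_lt htI.2⟩ hm) (inv_anti₀ hc0 (hcC τ ⟨(hd.trans hτ.1).le, hτ.2⟩ m hm).1) (inv_nonneg.2 (S.rL_pos _ _).le) hn
    rwa [sub_sub_cancel, abs_of_pos h0] at this
  have E : ∀ ψ : ℝ → ℝ, Continuous ψ → Tendsto (fun d => ∫ m in 0..1, ψ m * (d⁻¹ * ((S.rL t m)⁻¹ - (S.rL (t - d) m)⁻¹))) (𝓝[>] 0) (𝓝 (∫ m in 0..1, ψ m * S.fm t m)) := fun ψ hψ => by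
    refine weak_lim (B := n * c0⁻¹) (fun d => continuous_const.mul ((iL_cont t).sub (iL_cont _))) ?_ (fm_cont hu ht) hψ fun m hm => ?_
    · filter_upwards [hev] with d hd m hm
      rw [abs_mul, abs_inv, abs_of_pos hd.1, inv_mul_le_iff₀ hd.1, mul_comm d]
      exact be d hd.1 hd.2 m hm
    · rw [ftc01 (vLm_cont t) (fm_cont hu ht) (fun z hz => vL_dm' hu ht hz) hm]
      refine (left_quot ((X_dt hu hp h htI hm).fun_sub (X_dt hu hp h htI ⟨le_rfl, zero_le_one⟩))).congr fun d => ?_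
      rw [intervalIntegral.integral_const_mul, intervalIntegral.integral_sub ((iL_cont t).intervalIntegrable _ _) ((iL_cont _).intervalIntegrable _ _),
        iL_int t m hm, iL_int _ m hm]
  refine ⟨E ψ hψ, ?_⟩
  have mc : Continuous fun m => μ (S.rL t m) * S.rL t m := (cmu c t).mul (rLm_cont t)
  obtain ⟨Cm, hCm⟩ := isCompact_Icc.exists_bound_of_continuousOn (c.cμ.mono (fun x hx => hc0.trans_le hx.1 : Icc c0 C0 ⊆ Ioi 0))
  have kc := kLm_cont (S := S) c hρ
  have bk : ∀ d, 0 < d → p < t - d → ∀ m ∈ Icc 0 1, |S.kL ρs t m - S.kL ρs (t - d) m| ≤ Cm * n * d := fun d h0 hd m hm => by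
    rw [(KP c hu hρ hp h hd (by linarith) htI.2 hm).2, abs_neg]
    have := norm_integral_le_of_norm_le_const (f := fun τ => μ (S.rL τ m) * S.gL τ m) (a := t - d) (b := t) (C := Cm * n) fun τ hτ => by
      rw [uIoc_of_le (by linarith)] at hτ
      rw [norm_mul]
      have h1 := hCm _ (hcC τ ⟨(hd.trans hτ.1).le, hτ.2⟩ m hm)
      exact mul_le_mul h1 (gL_bd hu hp h ⟨hd.trans hτ.1, hτ.2.trans_lt htI.2⟩ hm) (norm_nonneg _) ((norm_nonneg _).trans h1)
    rwa [sub_sub_cancel, abs_of_pos h0] at this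
  obtain ⟨Ck, hCk⟩ := isCompact_Icc.exists_bound_of_continuousOn (mc.continuousOn (s := Icc (0:ℝ) 1))
  obtain ⟨Cp, hCp⟩ := isCompact_Icc.exists_bound_of_continuousOn (hψ.continuousOn (s := Icc (0:ℝ) 1))
  set D : ℝ → ℝ → ℝ := fun d m => d⁻¹ * (S.kL ρs t m - S.kL ρs (t - d) m + μ (S.rL t m) * S.rL t m * ((S.rL t m)⁻¹ - (S.rL (t - d) m)⁻¹)) with hD
  have Dc : ∀ d, Continuous (D d) := fun d => continuous_const.mul (((kc t).sub (kc _)).add (mc.mul ((iL_cont t).sub (iL_cont _))))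
  have T1 : Tendsto (fun d => ∫ m in 0..1, ψ m * D d m) (𝓝[>] 0) (𝓝 (∫ m in 0..1, (0:ℝ))) := by
    refine tendsto_integral_filter_of_dominated_convergence (fun _ => Cp * (Cm * n + Ck * (n * c0⁻¹)))
      (Eventually.of_forall fun d => (hψ.mul (Dc d)).aestronglyMeasurable) ?_ intervalIntegrable_const ?_
    · filter_upwards [hev] with d hd
      refine Eventually.of_forall fun m hm => ?_
      rw [uIoc_of_le zero_le_one] at hm
      have hm' : m ∈ Icc 0 1 := ⟨hm.1.le, hm.2⟩
      rw [norm_mul]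
      have h1 := hCp m hm'
      refine mul_le_mul h1 ?_ (norm_nonneg _) ((norm_nonneg _).trans h1)
      rw [hD, norm_mul, norm_inv, norm_eq_abs, abs_of_pos hd.1, inv_mul_le_iff₀ hd.1]
      refine (norm_add_le _ _).trans ?_
      rw [norm_mul]
      have h2 := hCk m hm'
      have h3 := mul_le_mul h2 (be d hd.1 hd.2 m hm') (abs_nonneg _) ((norm_nonneg _).trans h2)
      have h4 := bk d hd.1 hd.2 m hm'
      rw [norm_eq_abs, norm_eq_abs, norm_eq_abs] at *
      linarith
    · refine Eventually.of_forall fun m hm => ?_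
      rw [uIoc_of_le zero_le_one] at hm
      have hm' : m ∈ Icc 0 1 := ⟨hm.1.le, hm.2⟩
      suffices hs : Tendsto (fun d => D d m) (𝓝[>] 0) (𝓝 0) by simpa using hs.const_mul (ψ m)
      have r0 := S.rL_pos t m
      have hk : HasDerivAt (fun y => kf μ ρs y⁻¹) (-(μ (S.rL t m) * S.rL t m)) (S.rL t m)⁻¹ := by
        have := (c.dk hρ (S.rL t m)⁻¹⁻¹ (by rwa [inv_inv])).comp (S.rL t m)⁻¹ (hasDerivAt_inv (inv_ne_zero r0.ne'))
        refine this.congr_deriv ?_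
        rw [inv_inv]; field_simp
      have ht0 : Tendsto (fun d => (S.rL (t - d) m)⁻¹) (𝓝[>] 0) (𝓝 (S.rL t m)⁻¹) := by
        have : Continuous fun d => (S.rL (t - d) m)⁻¹ := ((rLt_cont m).comp (by fun_prop : Continuous fun d : ℝ => t - d)).inv₀ fun d => (S.rL_pos _ _).ne'
        simpa using (this.tendsto 0).mono_left nhdsWithin_le_nhds
      have ho := (hasDerivAt_iff_isLittleO.1 hk).comp_tendsto ht0
      have hO : (fun d => (S.rL (t - d) m)⁻¹ - (S.rL t m)⁻¹) =O[𝓝[>] 0] fun d : ℝ => d := by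
        refine Asymptotics.IsBigO.of_bound (n * c0⁻¹) ?_
        filter_upwards [hev] with d hd
        rw [norm_eq_abs, norm_eq_abs, abs_sub_comm, abs_of_pos hd.1]
        exact be d hd.1 hd.2 m hm'
      have := (ho.trans_isBigO hO).tendsto_div_nhds_zero.neg
      rw [neg_zero] at this
      refine this.congr fun d => ?_
      simp only [Function.comp, inv_inv, smul_eq_mul, hD, kL]
      ring
  have T2 := T1.sub (E (fun m => ψ m * (μ (S.rL t m) * S.rL t m)) (hψ.mul mc))
  rw [intervalIntegral.integral_zero, zero_sub] at T2
  refine T2.congr fun d => ?_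
  rw [sub_eq_iff_eq_add]
  exact icadd (hψ.mul (continuous_const.mul ((kc t).sub (kc _)))) ((hψ.mul mc).mul (continuous_const.mul ((iL_cont t).sub (iL_cont _)))) fun m => by simp only [hD]; ring
end PistonSol
end PC8
section PC9
lemma alg_V {r w1 w0 x y x' y' u u' a b a' b' e1 e0 J1 J2 J3 J4 Jφ Jq Ia Ib k0 k0' k1 k1' : ℝ} (hr : 0 ≤ r)
    (h1 : 1 / 2 * w1 - 1 / 2 * w0 ≤ J1) (h2 : 1 / 2 * u - 1 / 2 * u' ≤ Jφ) (h3 : e1 - e0 ≤ -J2) (h4 : Jφ = J3 - Jq) (h5 : J4 + Jq = b * (k1 - k1') - a * (k0 - k0'))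
    (hx : x = b - k1) (hx' : x' = b' - k1') (hy : y = a + k0) (hy' : y' = a' + k0') (hIa : y - y' = Ia) (hIb : x - x' = Ib) :
    (1 / 2 * w1 + 1 / 2 * x ^ 2 + 1 / 2 * y ^ 2 + e1 + r * (a ^ 2 / 2 + b ^ 2 / 2 + 1 / 2 * u + e1)) -
    (1 / 2 * w0 + 1 / 2 * x' ^ 2 + 1 / 2 * y' ^ 2 + e0 + r * (a' ^ 2 / 2 + b' ^ 2 / 2 + 1 / 2 * u' + e0)) ≤
    J1 + x * Ib + y * Ia - (1 + r) * J2 + r * (J3 + J4 + a * Ia + b * Ib) := by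
  have s1 : 1 / 2 * x ^ 2 - 1 / 2 * x' ^ 2 ≤ x * Ib := by rw [← hIb]; linarith [sq_nonneg (x - x')]
  have s2 : 1 / 2 * y ^ 2 - 1 / 2 * y' ^ 2 ≤ y * Ia := by rw [← hIa]; linarith [sq_nonneg (y - y')]
  have s3 : (a ^ 2 / 2 + b ^ 2 / 2 + 1 / 2 * u + e1) - (a' ^ 2 / 2 + b' ^ 2 / 2 + 1 / 2 * u' + e0) ≤ J3 + J4 + a * Ia + b * Ib - J2 := by
    have e1 : a - a' = Ia - (k0 - k0') := by rw [← hIa, hy, hy']; ring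
    have e2 : b - b' = Ib + (k1 - k1') := by rw [← hIb, hx, hx']; ring
    have f1 : a ^ 2 / 2 - a' ^ 2 / 2 ≤ a * (a - a') := by linarith [sq_nonneg (a - a')]
    have f2 : b ^ 2 / 2 - b' ^ 2 / 2 ≤ b * (b - b') := by linarith [sq_nonneg (b - b')]
    rw [e1] at f1
    rw [e2] at f2
    linarith
  linarith [mul_le_mul_of_nonneg_left s3 hr]
namespace PistonSol
variable {P μ P' μ' : ℝ → ℝ} {Pext : ℝ} {S : PistonSol P μ Pext}
variable (c : Coef P μ P' μ') (hu : S.Unit1) {ρs Rf : ℝ} (hρ : 0 < ρs) (hf : ∀ t, 0 < t → S.u t = -Rf * S.v t (S.a t))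
include c hρ
lemma eL_cont : Continuous (Function.uncurry (S.eL ρs)) := comp_rL (f := fun x => Qf P ρs x / x) fun x hx => (c.de hρ x hx).continuousAt.continuousWithinAt
lemma em_cont (t : ℝ) : Continuous (S.eL ρs t) := (eL_cont c hρ).uncurry_left t
include hu hf
lemma V_cont (r : ℝ) : Continuous (S.VL ρs r) := by
  have ip : ∀ f : ℝ → ℝ → ℝ, Continuous (Function.uncurry f) → Continuous fun t => ∫ m in 0..1, f t m := fun f hf =>
    continuous_parametric_intervalIntegral_of_continuous' hf _ _
  have h1 := ip (fun t m => S.wL t m ^ 2) (Continuous.comp (continuous_pow 2) (S.vL_cont.add (q_cont c hu hρ hf)))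
  have h2 := ip (fun t m => S.vL t m ^ 2) (Continuous.comp (continuous_pow 2) S.vL_cont)
  have h3 := ip _ (eL_cont (S := S) c hρ)
  have h4 := vLt_cont (S := S) 0
  have h5 := vLt_cont (S := S) 1
  have h6 := kLt_cont (S := S) c hρ 0
  have h7 := kLt_cont (S := S) c hρ 1
  exact ((((continuous_const.mul h1).add (continuous_const.mul ((h5.sub h7).pow 2))).add (continuous_const.mul ((h4.add h6).pow 2))).add h3).add
    (continuous_const.mul (((((h4.pow 2).div_const 2).add ((h5.pow 2).div_const 2)).add (continuous_const.mul h2)).add h3))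
lemma V_dini (hP : P ρs = Pext) {r : ℝ} (hr : 0 ≤ r) {t : ℝ} (ht : 0 < t) : ∃ (Θ : ℝ → ℝ) (L : ℝ), Tendsto Θ (𝓝[>] 0) (𝓝 L) ∧
    (∀ᶠ d in 𝓝[>] (0:ℝ), S.VL ρs r t - S.VL ρs r (t - d) ≤ d * Θ d) ∧
    L = -(∫ m in 0..1, S.q t m * S.pm P' t m) - S.kL ρs t 1 * (S.PL t 1 - P ρs) - S.kL ρs t 0 * (S.PL t 0 - P ρs) - Rf * S.vL t 0 * S.kL ρs t 0
      - (1 + r) * (Rf * S.vL t 0 ^ 2) - r * ∫ m in 0..1, (S.fm t m * (μ (S.rL t m) * S.rL t m)) * S.fm t m := by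
  have wc := wm_cont c hu hρ hf
  have qc := qm_cont c hu hρ hf
  have kc := kLm_cont (S := S) c hρ
  have Pc : Continuous (S.PL t) := (PL_cont c).uncurry_left t
  have Pc' : Continuous fun m => S.PL t m - P ρs := Pc.sub continuous_const
  have fc := fm_cont hu ht
  have cI : Continuous fun τ => -Rf * S.vL τ 0 + Pext - S.PL τ 0 := ((continuous_const.mul (vLt_cont 0)).add continuous_const).sub (PLt_cont c 0)
  have cJ : Continuous fun τ => S.PL τ 1 - Pext := (PLt_cont c 1).sub continuous_const
  have l1 := w_weak c hu hρ hf ht (wc t)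
  have l2 := left_avg cJ t
  have l3 := left_avg cI t
  have l4 := (eta_weak c hu hρ hf ht Pc').1
  have l5 := w_weak c hu hρ hf ht (vLm_cont (S := S) t)
  have l6 := (eta_weak c hu hρ hf ht fc).2
  refine ⟨_, _, (((l1.add (l2.const_mul (S.vL t 1 - S.kL ρs t 1))).add (l3.const_mul (S.vL t 0 + S.kL ρs t 0))).sub (l4.const_mul (1 + r))).add
    ((((l5.add l6).add (l3.const_mul (S.vL t 0))).add (l2.const_mul (S.vL t 1))).const_mul r), ?_, ?_⟩
  · filter_upwards [Ioo_mem_nhdsGT ht] with d hd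
    have hs : 0 ≤ t - d := by linarith [hd.2]
    have pull : ∀ f g : ℝ → ℝ, ∫ m in 0..1, f m * (d⁻¹ * g m) = d⁻¹ * ∫ m in 0..1, f m * g m := fun f g => by
      rw [← intervalIntegral.integral_const_mul]; exact integral_congr fun m _ => by ring
    rw [pull, pull, pull, pull]
    have hd0 := hd.1.ne'
    refine (alg_V hr (half_sq (wc t) (wc (t - d))) (half_sq (vLm_cont t) (vLm_cont (t - d))) ?_ (J3 := ∫ m in 0..1, S.vL t m * (S.wL t m - S.wL (t - d) m))
      (Jq := ∫ m in 0..1, S.vL t m * (S.q t m - S.q (t - d) m)) (J4 := ∫ m in 0..1, S.fm t m * (S.kL ρs t m - S.kL ρs (t - d) m))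
      (J2 := ∫ m in 0..1, (S.PL t m - P ρs) * ((S.rL t m)⁻¹ - (S.rL (t - d) m)⁻¹))
      (Ia := ∫ τ in (t - d)..t, (-Rf * S.vL τ 0 + Pext - S.PL τ 0)) (Ib := ∫ τ in (t - d)..t, (S.PL τ 1 - Pext)) ?_ ?_ rfl rfl rfl rfl ?_ ?_).trans (le_of_eq ?_)
    · rw [← intervalIntegral.integral_sub ((em_cont c hρ t).intervalIntegrable _ _) ((em_cont c hρ _).intervalIntegrable _ _), ← intervalIntegral.integral_neg]
      refine integral_mono_on zero_le_one (((em_cont c hρ t).sub (em_cont c hρ _)).intervalIntegrable _ _)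
        ((Pc'.mul ((iL_cont t).sub (iL_cont _))).neg.intervalIntegrable _ _) fun m _ => ?_
      have := c.econv hρ (S.rL_pos t m) (S.rL_pos (t - d) m)
      rw [neg_mul] at this
      exact this
    · rw [eq_sub_iff_add_eq]
      exact (icadd ((vLm_cont t).mul ((vLm_cont t).sub (vLm_cont (t - d)))) ((vLm_cont t).mul ((qc t).sub (qc (t - d)))) fun m => by simp only [wL, Pi.sub_apply, Pi.mul_apply]; ring).symm
    · exact ibp01 (vLm_cont t) fc (fun m hm => vL_dm' hu ht hm) ((kc t).sub (kc (t - d))) ((qc t).sub (qc (t - d)))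
        fun m hm => (kL_dm' c hu hρ ht.le hm).sub (kL_dm' c hu hρ hs hm)
    · have := (cons_all c hu hρ hf ht.le).2.1.trans (cons_all c hu hρ hf hs).2.1.symm
      rw [← integral_interval_sub_left (cI.intervalIntegrable 0 t) (cI.intervalIntegrable 0 _)]
      simp only [jA] at this; linarith
    · have := (cons_all c hu hρ hf ht.le).2.2.trans (cons_all c hu hρ hf hs).2.2.symm
      rw [← integral_interval_sub_left (cJ.intervalIntegrable 0 t) (cJ.intervalIntegrable 0 _)]
      simp only [jB] at this; linarith
    · field_simp
  · have e1 : ∫ m in 0..1, S.wL t m * -S.pm P' t m = -(∫ m in 0..1, S.q t m * S.pm P' t m) + ∫ m in 0..1, S.vL t m * -S.pm P' t m := by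
      rw [← intervalIntegral.integral_neg]
      exact icadd ((qc t).mul (pm_cont c hu hρ hf t)).neg ((vLm_cont t).mul (pm_cont c hu hρ hf t).neg) fun m => by simp only [wL]; ring
    have e2 := ibp01 (vLm_cont t) fc (fun m hm => vL_dm' hu ht hm) Pc' (pm_cont c hu hρ hf t) fun m hm => (PL_dm c hu ht.le hm).sub_const _
    have e3 : ∫ m in 0..1, S.vL t m * -S.pm P' t m = -∫ m in 0..1, S.vL t m * S.pm P' t m := by
      rw [← intervalIntegral.integral_neg]; exact integral_congr fun m _ => by ring
    have e4 : ∫ m in 0..1, (S.PL t m - P ρs) * S.fm t m = ∫ m in 0..1, S.fm t m * (S.PL t m - P ρs) :=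
      integral_congr fun m _ => by ring
    rw [e1, e3, e4, eq_sub_of_add_eq e2, hP]
    ring
end PistonSol
end PC9
section PD1
lemma int_mono01 {f g : ℝ → ℝ} (hf : Continuous f) (hg : Continuous g) (h : ∀ m ∈ Icc 0 1, f m ≤ g m) :
    ∫ m in 0..1, f m ≤ ∫ m in 0..1, g m :=
  integral_mono_on zero_le_one (hf.intervalIntegrable _ _) (hg.intervalIntegrable _ _) h
lemma int_sq_le {f : ℝ → ℝ} (hf : Continuous f) {m : ℝ} (hm : m ∈ Icc 0 1) : (∫ z in 0..m, f z) ^ 2 ≤ ∫ z in 0..1, f z ^ 2 := by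
  set J := ∫ z in 0..m, f z with hJ
  have c2 : Continuous fun z => f z ^ 2 := by fun_prop
  have h1 : 0 ≤ ∫ z in 0..m, (f z - J) ^ 2 := intervalIntegral.integral_nonneg hm.1 fun z _ => sq_nonneg _
  have h2 : ∫ z in 0..m, (f z - J) ^ 2 = (∫ z in 0..m, f z ^ 2) + ((-2 * J) * J + m * J ^ 2) := by
    rw [icadd c2 (by fun_prop : Continuous fun z => (-2 * J) * f z + J ^ 2) fun z => by ring,
      icadd (by fun_prop : Continuous fun z => (-2 * J) * f z) (continuous_const : Continuous fun _ => J ^ 2) fun z => rfl,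
      intervalIntegral.integral_const_mul, intervalIntegral.integral_const, ← hJ]
    simp
  have h3 := intervalIntegral.integral_add_adjacent_intervals (c2.intervalIntegrable (μ := volume) 0 m) (c2.intervalIntegrable (μ := volume) m 1)
  have h4 : 0 ≤ ∫ z in m..1, f z ^ 2 := intervalIntegral.integral_nonneg hm.2 fun z _ => sq_nonneg _
  nlinarith [mul_nonneg (sub_nonneg.2 hm.2) (sq_nonneg J)]
lemma mvt2 {f f' : ℝ → ℝ} {lo hi x y α β : ℝ} (hx : x ∈ Icc lo hi) (hy : y ∈ Icc lo hi) (hd : ∀ z ∈ Icc lo hi, HasDerivAt f (f' z) z)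
    (hb : ∀ z ∈ Icc lo hi, α ≤ f' z ∧ f' z ≤ β) : α * (x - y) ^ 2 ≤ (f x - f y) * (x - y) ∧ (f x - f y) * (x - y) ≤ β * (x - y) ^ 2 := by
  wlog h : y < x generalizing x y
  · rcases eq_or_lt_of_le (not_lt.1 h) with h | h
    · simp [h]
    · have := this hy hx h
      constructor <;> linarith
  have hs : Icc y x ⊆ Icc lo hi := Icc_subset_Icc hy.1 hx.2
  obtain ⟨ξ, hξ, he⟩ := exists_hasDerivAt_eq_slope f f' h (fun z hz => (hd z (hs hz)).continuousAt.continuousWithinAt) (fun z hz => hd z (hs (Ioo_subset_Icc_self hz)))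
  have e : (f x - f y) * (x - y) = f' ξ * (x - y) ^ 2 := by
    rw [he]; field_simp [(sub_pos.2 h).ne']
  have := hb ξ (hs (Ioo_subset_Icc_self hξ))
  rw [e]
  exact ⟨mul_le_mul_of_nonneg_right this.1 (sq_nonneg _), mul_le_mul_of_nonneg_right this.2 (sq_nonneg _)⟩
lemma exb {f : ℝ → ℝ} (hf : ContinuousOn f (Ioi 0)) (hp : ∀ x, 0 < x → 0 < f x) {lo hi : ℝ} (h0 : 0 < lo) (h1 : lo ≤ hi) :
    ∃ α β, 0 < α ∧ 0 < β ∧ ∀ x ∈ Icc lo hi, α ≤ f x ∧ f x ≤ β := by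
  have hc := hf.mono (fun x hx => h0.trans_le hx.1 : Icc lo hi ⊆ Ioi 0)
  obtain ⟨x, hx, h2⟩ := isCompact_Icc.exists_isMinOn ⟨lo, le_rfl, h1⟩ hc
  obtain ⟨y, hy, h3⟩ := isCompact_Icc.exists_isMaxOn ⟨lo, le_rfl, h1⟩ hc
  exact ⟨f x, f y, hp x (h0.trans_le hx.1), hp y (h0.trans_le hy.1), fun z hz => ⟨h2 hz, h3 hz⟩⟩
lemma sq_cmp {A z α β : ℝ} (hα : 0 < α) (hβ : 0 < β) (h0 : z = 0 → A = 0) (h : α * z ^ 2 ≤ A * z ∧ A * z ≤ β * z ^ 2) : α ^ 2 * z ^ 2 ≤ A ^ 2 ∧ A ^ 2 ≤ β ^ 2 * z ^ 2 := by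
  rcases eq_or_ne z 0 with rfl | hz
  · simp [h0 rfl]
  · have hz2 : 0 < z ^ 2 := by positivity
    have e : A ^ 2 * z ^ 2 = (A * z) ^ 2 := by ring
    constructor
    · have : (α * z ^ 2) ^ 2 ≤ (A * z) ^ 2 := pow_le_pow_left₀ (by positivity) h.1 2
      refine le_of_mul_le_mul_right ?_ hz2
      rw [e]; linarith
    · have : (A * z) ^ 2 ≤ (β * z ^ 2) ^ 2 := pow_le_pow_left₀ (le_trans (by positivity) h.1) h.2 2
      refine le_of_mul_le_mul_right ?_ hz2
      rw [e]; linarith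
namespace Coef
variable {P μ P' μ' : ℝ → ℝ} (c : Coef P μ P' μ') {ρs : ℝ} (hρ : 0 < ρs)
include c hρ
lemma enn {x : ℝ} (hx : 0 < x) : 0 ≤ Qf P ρs x / x := by
  have := c.econv hρ hρ hx
  rw [Qf, integral_same, mul_zero, zero_sub, div_mul_cancel₀ _ hρ.ne', neg_add_cancel, sub_self, neg_zero, zero_mul, zero_div] at this
  linarith
lemma coefs {lo hi : ℝ} (h0 : 0 < lo) (hs : ρs ∈ Icc lo hi) : ∃ α β, 0 < α ∧ 0 < β ∧ ∀ x ∈ Icc lo hi, (α ≤ μ x ∧ μ x ≤ β) ∧ (α ≤ P' x ∧ P' x ≤ β) ∧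
    (α * (x - ρs) ^ 2 ≤ kf μ ρs x ^ 2 ∧ kf μ ρs x ^ 2 ≤ β * (x - ρs) ^ 2) ∧ Qf P ρs x / x ≤ β * (x - ρs) ^ 2 := by
  have h1 := hs.1.trans hs.2
  obtain ⟨a1, b1, ha1, hb1, H1⟩ := exb c.cμ c.μpos h0 h1
  obtain ⟨a2, b2, ha2, hb2, H2⟩ := exb c.cP' c.P'pos h0 h1
  obtain ⟨a3, b3, ha3, hb3, H3⟩ := exb (f := fun x => μ x / x) (c.cμ.div continuousOn_id fun x hx => (ne_of_gt hx)) (fun x hx => div_pos (c.μpos x hx) hx) h0 h1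
  have pos : ∀ x ∈ Icc lo hi, 0 < x := fun x hx => h0.trans_le hx.1
  set b4 := b2 / lo ^ 2
  refine ⟨min (min a1 a2) (a3 ^ 2), b1 + b2 + b3 ^ 2 + b4, by positivity, by positivity, fun x hx => ⟨⟨?_, ?_⟩, ⟨?_, ?_⟩, ⟨?_, ?_⟩, ?_⟩⟩
  · exact ((min_le_left _ _).trans (min_le_left _ _)).trans (H1 x hx).1
  · have : 0 < b4 := by positivity
    nlinarith [(H1 x hx).2]
  · exact ((min_le_left _ _).trans (min_le_right _ _)).trans (H2 x hx).1
  · have : 0 < b4 := by positivity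
    nlinarith [(H2 x hx).2]
  · have := (sq_cmp ha3 hb3 (fun h => by rw [sub_eq_zero.1 h, sub_self]) (mvt2 hx hs (fun z hz => c.dk hρ z (pos z hz)) H3)).1
    rw [kf, kf, integral_same, sub_zero] at this
    exact (mul_le_mul_of_nonneg_right (min_le_right _ _) (sq_nonneg _)).trans this
  · have := (sq_cmp ha3 hb3 (fun h => by rw [sub_eq_zero.1 h, sub_self]) (mvt2 hx hs (fun z hz => c.dk hρ z (pos z hz)) H3)).2
    rw [kf, kf, integral_same, sub_zero] at this
    exact this.trans (mul_le_mul_of_nonneg_right (by have : 0 < b4 := by positivity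
                                                     linarith) (sq_nonneg _))
  · have := min_at (D := Icc lo hi) ordConnected_Icc (f := fun x => b4 * (x - ρs) ^ 2 - Qf P ρs x / x) (f' := fun x => b4 * (2 * (x - ρs)) - (P x - P ρs) / x ^ 2)
      (x0 := ρs) (x1 := x) hs hx (fun z hz => by
        refine HasDerivAt.fun_sub (HasDerivAt.const_mul _ ?_) (c.de hρ z (pos z hz))
        exact (((hasDerivAt_id z).sub_const ρs).fun_pow 2).congr_deriv (by simp)) fun z hz => by
        have e := (mvt2 hz hs (fun z hz => c.dP z (pos z hz)) H2).2
        have e1 : (P z - P ρs) / z ^ 2 * (z - ρs) ≤ b4 * (z - ρs) ^ 2 := by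
          rw [div_mul_eq_mul_div, div_le_iff₀ (by have := pos z hz; positivity)]
          refine e.trans ?_
          have : b2 = b4 * lo ^ 2 := (div_mul_cancel₀ _ (by positivity)).symm
          rw [this]
          have : lo ^ 2 ≤ z ^ 2 := pow_le_pow_left₀ h0.le hz.1 2
          have : b4 * (z - ρs) ^ 2 * lo ^ 2 ≤ b4 * (z - ρs) ^ 2 * z ^ 2 := mul_le_mul_of_nonneg_left this (by positivity)
          linarith
        have : 0 ≤ b4 * (z - ρs) ^ 2 := by positivity
        linarith
    have e0 : Qf P ρs ρs = 0 := by
      rw [Qf, integral_same, mul_zero, zero_sub, div_mul_cancel₀ _ hρ.ne', neg_add_cancel]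
    simp only [e0, zero_div, sub_self, sub_zero] at this
    have h5 : 0 ≤ (b1 + b2 + b3 ^ 2) * (x - ρs) ^ 2 := by positivity
    norm_num at this
    linarith
end Coef
end PD1
section PD2
namespace Coef
variable {P μ P' μ' : ℝ → ℝ} (c : Coef P μ P' μ') {ρs : ℝ} (hρ : 0 < ρs)
include c hρ
lemma dG {x : ℝ} (hx : 0 < x) : HasDerivAt (Gf P μ ρs) (μ x / x * √(Qf P ρs x / x)) x := by
  have hq : ContinuousOn (fun l => √(Qf P ρs l / l)) (Ioi 0) := fun y hy => ((c.de hρ y hy).continuousAt.sqrt).continuousWithinAt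
  have hc : ContinuousOn (fun τ => μ τ / τ * √(Qf P ρs τ / τ)) (Ioi 0) := (c.cμ.div continuousOn_id fun x hx => (ne_of_gt hx)).mul hq
  have hsub : ∀ y > 0, uIcc ρs y ⊆ Ioi 0 := fun y hy z hz => (lt_min hρ hy).trans_le hz.1
  have h := integral_hasDerivAt_right ((hc.mono (hsub x hx)).intervalIntegrable)
    (hc.stronglyMeasurableAtFilter isOpen_Ioi x hx) (hc.continuousAt (Ioi_mem_nhds hx))
  refine h.congr_of_eventuallyEq ?_
  filter_upwards [Ioi_mem_nhds hx] with y hy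
  refine integral_congr fun z hz => ?_
  have hz0 : 0 < z := hsub y hy hz
  have e : z ^ ((3:ℝ) / 2) = z * √z := by
    rw [Real.sqrt_eq_rpow, show (3:ℝ) / 2 = 1 + 1 / 2 by norm_num, Real.rpow_add hz0, Real.rpow_one]
  simp only [e]
  rw [Real.sqrt_div' _ hz0.le, div_mul_div_comm, div_mul_eq_mul_div]
lemma Gmono : MonotoneOn (Gf P μ ρs) (Ioi 0) :=
  monotoneOn_of_deriv_nonneg (convex_Ioi 0) (fun x hx => (c.dG hρ hx).continuousAt.continuousWithinAt)
    (fun x hx => (c.dG hρ (interior_subset hx)).differentiableAt.differentiableWithinAt) fun x hx => by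
      have hx : 0 < x := interior_subset hx
      rw [(c.dG hρ hx).deriv]
      exact mul_nonneg (div_pos (c.μpos x hx) hx).le (Real.sqrt_nonneg _)
end Coef
namespace PistonSol
variable {P μ P' μ' : ℝ → ℝ} {Pext : ℝ} {S : PistonSol P μ Pext}
variable (S) in
noncomputable def HL (ρs t : ℝ) : ℝ := S.vL t 0 ^ 2 + S.vL t 1 ^ 2 + (∫ m in 0..1, S.vL t m ^ 2) + S.kL ρs t 0 ^ 2 + S.kL ρs t 1 ^ 2 + ∫ m in 0..1, S.q t m ^ 2
lemma i2nn (f : ℝ → ℝ) : 0 ≤ ∫ m in 0..1, f m ^ 2 := intervalIntegral.integral_nonneg zero_le_one fun z _ => sq_nonneg _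
variable (c : Coef P μ P' μ') (hu : S.Unit1) {ρs Rf : ℝ} (hρ : 0 < ρs) (hf : ∀ t, 0 < t → S.u t = -Rf * S.v t (S.a t))
include c hρ
lemma e_nn (t : ℝ) : 0 ≤ ∫ m in 0..1, S.eL ρs t m := intervalIntegral.integral_nonneg zero_le_one fun z _ => c.enn hρ (S.rL_pos _ _)
lemma e_le_V {r : ℝ} (hr : 0 < r) (t : ℝ) : ∫ m in 0..1, S.eL ρs t m ≤ S.VL ρs r t := by
  have h1 := i2nn (S.wL t)
  have h2 := i2nn (S.vL t)
  have h3 := e_nn (S := S) c hρ t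
  have : 0 ≤ r * (S.vL t 0 ^ 2 / 2 + S.vL t 1 ^ 2 / 2 + (1 / 2) * (∫ m in 0..1, S.vL t m ^ 2) + ∫ m in 0..1, S.eL ρs t m) := by positivity
  rw [VL]
  linarith [sq_nonneg (S.vL t 1 - S.kL ρs t 1), sq_nonneg (S.vL t 0 + S.kL ρs t 0)]
include hu hf
lemma q_wv (t : ℝ) : ∫ m in 0..1, S.q t m ^ 2 ≤ 2 * (∫ m in 0..1, S.wL t m ^ 2) + 2 * ∫ m in 0..1, S.vL t m ^ 2 := by
  have cv := vLm_cont (S := S) t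
  have cq := qm_cont c hu hρ hf t
  have cw := wm_cont c hu hρ hf t
  rw [← intervalIntegral.integral_const_mul, ← intervalIntegral.integral_const_mul, ← icadd (by fun_prop) (by fun_prop) fun m => rfl]
  refine int_mono01 (by fun_prop) (by fun_prop) fun m _ => ?_
  rw [wL]; linarith [sq_nonneg (S.q t m + 2 * S.vL t m)]
lemma H_le_V {r : ℝ} (hr : 0 < r) (t : ℝ) : S.HL ρs t ≤ (4 + 6 / r) * S.VL ρs r t := by
  have h3 := e_nn (S := S) c hρ t
  have h4 := q_wv c hu hρ hf t
  have hw := i2nn (S.wL t)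
  have hv := i2nn (S.vL t)
  rw [HL, VL]
  set I1 := ∫ m in 0..1, S.wL t m ^ 2
  set I2 := ∫ m in 0..1, S.vL t m ^ 2
  set I3 := ∫ m in 0..1, S.eL ρs t m
  set a := S.vL t 0
  set b := S.vL t 1
  set k := S.kL ρs t 0
  set l := S.kL ρs t 1
  set E := a ^ 2 / 2 + b ^ 2 / 2 + 1 / 2 * I2 + I3 with hE
  set W := 1 / 2 * I1 + 1 / 2 * (b - l) ^ 2 + 1 / 2 * (a + k) ^ 2 + I3 with hW
  have hE0 : 0 ≤ E := by positivity
  have hW0 : 0 ≤ W := by positivity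
  have : (4 + 6 / r) * (W + r * E) = 4 * W + 6 * E + (6 / r * W + 4 * (r * E)) := by field_simp; ring
  have p : 0 ≤ 6 / r * W + 4 * (r * E) := by positivity
  rw [this]
  linarith [sq_nonneg (k + 2 * a), sq_nonneg (l - 2 * b)]
lemma G_osc {t m : ℝ} (ht : 0 ≤ t) (hm : m ∈ Icc 0 1) : 2 * |Gf P μ ρs (S.rL t m) - Gf P μ ρs (S.rL t 0)| ≤ (∫ m in 0..1, S.q t m ^ 2) + ∫ m in 0..1, S.eL ρs t m := by
  have cq := qm_cont c hu hρ hf t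
  have ce := em_cont (S := S) c hρ t
  have cf : Continuous fun m => S.q t m * √(S.eL ρs t m) := cq.mul ce.sqrt
  have cG : Continuous fun m => Gf P μ ρs (S.rL t m) := continuous_iff_continuousAt.2 fun z => ((c.dG hρ (S.rL_pos t z)).continuousAt).comp (rLm_cont t).continuousAt
  have h := ftc01 cG cf (fun z hz => by
    refine ((c.dG hρ (S.rL_pos t z)).comp_hasDerivWithinAt z (rL_dm hu ht hz)).congr_deriv ?_
    rw [q_eq ht hz, q0, eL]; ring) hm
  rw [← h, ← icadd (by fun_prop : Continuous fun m => S.q t m ^ 2) ce fun m => rfl]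
  have h1 : |∫ z in 0..m, S.q t z * √(S.eL ρs t z)| ≤ ∫ z in 0..m, |S.q t z * √(S.eL ρs t z)| := intervalIntegral.abs_integral_le_integral_abs hm.1
  have h2 : ∫ z in 0..m, |S.q t z * √(S.eL ρs t z)| ≤ ∫ z in 0..1, |S.q t z * √(S.eL ρs t z)| :=
    intervalIntegral.integral_mono_interval le_rfl hm.1 hm.2 (ae_of_all _ fun z => abs_nonneg _) (cf.abs.intervalIntegrable _ _)
  have h3 : ∫ z in 0..1, 2 * |S.q t z * √(S.eL ρs t z)| ≤ ∫ z in 0..1, (S.q t z ^ 2 + S.eL ρs t z) := by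
    refine int_mono01 (continuous_const.mul cf.abs) (by fun_prop) fun z _ => ?_
    have e0 : 0 ≤ S.eL ρs t z := c.enn hρ (S.rL_pos _ _)
    have := sq_nonneg (|S.q t z| - √(S.eL ρs t z))
    rw [sub_sq, Real.sq_sqrt e0, sq_abs] at this
    rw [abs_mul, abs_of_nonneg (Real.sqrt_nonneg _)]
    linarith
  rw [intervalIntegral.integral_const_mul] at h3
  linarith
end PistonSol
lemma dens_bd {P μ P' μ' : ℝ → ℝ} (c : Coef P μ P' μ') {ρs r : ℝ} (hρ : 0 < ρs) (hH : AssumpH P μ ρs) (hr : 0 < r) (S0 : ℝ) (hS : 0 ≤ S0) :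
    ∃ lo hi, 0 < lo ∧ ρs ∈ Icc lo hi ∧ ∀ {Pext Rf : ℝ} (S : PistonSol P μ Pext), S.Unit1 → (∀ t, 0 < t → S.u t = -Rf * S.v t (S.a t)) →
      ∀ t, 0 ≤ t → S.VL ρs r t ≤ S0 → ∀ m ∈ Icc 0 1, S.rL t m ∈ Icc lo hi := by
  set C := (4 + 6 / r) * S0 with hC
  have hκ : 0 < P ρs - P (ρs / 2) := sub_pos.2 (c.Pmono (half_pos hρ : 0 < ρs / 2) hρ (by linarith))
  set κ := P ρs - P (ρs / 2)
  set i0 := 2 / ρs + (S0 + 1) / κ with hi0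
  have hi0p : 0 < i0 := by positivity
  obtain ⟨X1, hX1⟩ := (hH.2.2.eventually_gt_atTop (1 + C)).exists_forall_of_atTop
  set Y := max X1 1
  have hY : (0:ℝ) < Y := lt_max_of_lt_right one_pos
  obtain ⟨X2, hX2⟩ := (hH.1.eventually_gt_atTop (Gf P μ ρs Y + (C + S0))).exists_forall_of_atTop
  obtain ⟨δ, hδ, hδ2⟩ := (mem_nhdsGT_iff_exists_Ioo_subset (a := (0:ℝ))).1 (hH.2.1.eventually_lt_atBot (Gf P μ ρs i0⁻¹ - (C + S0)))
  have hδ : 0 < δ := hδ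
  refine ⟨min δ ρs, max X2 ρs, lt_min hδ hρ, ⟨min_le_right _ _, le_max_right _ _⟩, fun S hu hf t ht hV m hm => ?_⟩
  have p := S.rL_pos t
  have HV := (PistonSol.H_le_V c hu hρ hf hr t).trans (mul_le_mul_of_nonneg_left hV (by positivity))
  have eV := (PistonSol.e_le_V (S := S) c hρ hr t).trans hV
  have n1 := PistonSol.i2nn (S.vL t)
  have n2 := PistonSol.i2nn (S.q t)
  rw [← hC, PistonSol.HL] at HV
  have osc : ∀ x ∈ Icc 0 1, ∀ y ∈ Icc 0 1, Gf P μ ρs (S.rL t x) ≤ Gf P μ ρs (S.rL t y) + (C + S0) := fun x hx y hy => by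
    have h1 := PistonSol.G_osc c hu hρ hf ht hx
    have h2 := PistonSol.G_osc c hu hρ hf ht hy
    have h3 := le_abs_self (Gf P μ ρs (S.rL t x) - Gf P μ ρs (S.rL t 0))
    have h4 := neg_abs_le (Gf P μ ρs (S.rL t y) - Gf P μ ρs (S.rL t 0))
    linarith [sq_nonneg (S.vL t 0), sq_nonneg (S.vL t 1), sq_nonneg (S.kL ρs t 0), sq_nonneg (S.kL ρs t 1)]
  constructor
  · obtain ⟨y, hy, hy2⟩ : ∃ y ∈ Icc 0 1, (S.rL t y)⁻¹ ≤ i0 := by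
      by_contra! hc
      have : ∫ m in 0..1, κ * (i0 - 2 / ρs) ≤ ∫ m in 0..1, S.eL ρs t m := int_mono01 continuous_const (PistonSol.em_cont c hρ t) fun z hz => by
        have h1 := c.econv hρ (half_pos hρ) (p z)
        have h2 := c.enn hρ (half_pos hρ)
        have h3 := mul_lt_mul_of_pos_left (hc z hz) hκ
        have h4 : (ρs / 2)⁻¹ = 2 / ρs := inv_div _ _
        rw [h4] at h1
        have h5 : Qf P ρs (S.rL t z) / S.rL t z = S.eL ρs t z := rfl
        rw [h5] at h1
        have h6 : -(P (ρs / 2) - P ρs) * (2 / ρs - (S.rL t z)⁻¹) = κ * (2 / ρs) - κ * (S.rL t z)⁻¹ := by ring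
        rw [h6] at h1
        linarith
      rw [intervalIntegral.integral_const, sub_zero, one_smul, hi0, add_sub_cancel_left, mul_div_cancel₀ _ hκ.ne'] at this
      linarith
    refine (min_le_left _ _).trans (not_lt.1 fun h => ?_)
    have h1 : Gf P μ ρs (S.rL t m) < Gf P μ ρs i0⁻¹ - (C + S0) := hδ2 ⟨p m, h⟩
    have h2 := c.Gmono hρ (inv_pos.2 hi0p : 0 < i0⁻¹) (p y) (inv_le_of_inv_le₀ (p y) hy2)
    linarith [osc y hy m hm]
  · refine le_trans (not_lt.1 fun h => ?_) (le_max_left _ _)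
    have h1 := hX2 _ h.le
    have h2 : S.rL t 1 ≤ Y := le_trans (not_lt.1 fun h => by
      have h1 : 1 + C < S.kL ρs t 1 := hX1 _ h.le
      linarith [sq_nonneg (S.kL ρs t 1 - 1), sq_nonneg (S.vL t 0), sq_nonneg (S.vL t 1), sq_nonneg (S.kL ρs t 0), sq_nonneg (S.kL ρs t 1 - 1/2)]) (le_max_left _ _)
    have h3 := c.Gmono hρ (p 1) hY h2
    linarith [osc m hm 1 ⟨zero_le_one, le_rfl⟩]
end PD2
section PD3
lemma Coef.kP {P μ P' μ' : ℝ → ℝ} (c : Coef P μ P' μ') {ρs K x : ℝ} (hρ : 0 < ρs) (hK : 0 < K) (hx : 0 < x)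
    (hA : |kf μ ρs x| ≤ K * |P x - P ρs|) : kf μ ρs x ^ 2 / K ≤ kf μ ρs x * (P x - P ρs) := by
  have pos : ∀ z, 0 < z → 0 ≤ μ z / z := fun z hz => (div_pos (c.μpos z hz) hz).le
  have h : 0 ≤ kf μ ρs x * (P x - P ρs) := by
    rcases le_total ρs x with h | h
    · exact mul_nonneg (intervalIntegral.integral_nonneg h fun z hz => pos z (hρ.trans_le hz.1)) (sub_nonneg.2 (c.Pmono.monotoneOn hρ hx h))
    · refine mul_nonneg_of_nonpos_of_nonpos ?_ (sub_nonpos.2 (c.Pmono.monotoneOn hx hρ h))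
      rw [kf, intervalIntegral.integral_symm, neg_nonpos]
      exact intervalIntegral.integral_nonneg h fun z hz => pos z (hx.trans_le hz.1)
  rw [div_le_iff₀ hK, ← abs_of_nonneg h, abs_mul, ← sq_abs]
  nlinarith [mul_le_mul_of_nonneg_left hA (abs_nonneg (kf μ ρs x))]
structure CB (P μ P' : ℝ → ℝ) (ρs lo hi α β : ℝ) : Prop where
  h0 : 0 < lo
  hα : 0 < α
  hβ : 0 < β
  h : ∀ x ∈ Icc lo hi, (α ≤ μ x ∧ μ x ≤ β) ∧ (α ≤ P' x ∧ P' x ≤ β) ∧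
    (α * (x - ρs) ^ 2 ≤ kf μ ρs x ^ 2 ∧ kf μ ρs x ^ 2 ≤ β * (x - ρs) ^ 2) ∧ Qf P ρs x / x ≤ β * (x - ρs) ^ 2
lemma alg_diss {R K r p k : ℝ} (hR : 0 < R) (hK : 0 < K) (hr : R * K / 2 ≤ r) : k ^ 2 / (2 * K) + R * p ^ 2 ≤ k ^ 2 / K + R * p * k + (1 + r) * (R * p ^ 2) := by
  have h1 : R * K / 2 * (R * p ^ 2) ≤ r * (R * p ^ 2) := mul_le_mul_of_nonneg_right hr (by positivity)
  have h2 : k ^ 2 / K + R * p * k + R * K / 2 * (R * p ^ 2) = k ^ 2 / (2 * K) + (k + R * K * p) ^ 2 / (2 * K) := by field_simp; ring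
  have : 0 ≤ (k + R * K * p) ^ 2 / (2 * K) := by positivity
  linarith
lemma alg_c {x C D : ℝ} (hC : 0 < C) (h : C * x ≤ D) : x ≤ C⁻¹ * D := by
  rwa [← div_eq_inv_mul, le_div_iff₀' hC]
namespace PistonSol
variable {P μ P' μ' : ℝ → ℝ} {Pext : ℝ} {S : PistonSol P μ Pext}
variable (c : Coef P μ P' μ') (hu : S.Unit1) {ρs Rf lo hi α β t : ℝ} (hρ : 0 < ρs) (hf : ∀ t, 0 < t → S.u t = -Rf * S.v t (S.a t))
  (cb : CB P μ P' ρs lo hi α β) (hb : ∀ m ∈ Icc 0 1, S.rL t m ∈ Icc lo hi)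
include c hρ hu hf
lemma k_le_H (ht : 0 ≤ t) {m : ℝ} (hm : m ∈ Icc 0 1) : S.kL ρs t m ^ 2 ≤ 2 * S.HL ρs t := by
  have h1 := int_sq_le (qm_cont c hu hρ hf t) hm
  rw [q_int c hu hρ hf ht hm] at h1
  have hv := i2nn (S.vL t)
  rw [HL]
  linarith [sq_nonneg (S.vL t 0), sq_nonneg (S.vL t 1), sq_nonneg (S.kL ρs t 1), sq_nonneg (S.kL ρs t m - 2 * S.kL ρs t 0)]
include cb hb
lemma ρ_le_H (ht : 0 ≤ t) {m : ℝ} (hm : m ∈ Icc 0 1) : (S.rL t m - ρs) ^ 2 ≤ 2 / α * S.HL ρs t := by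
  have h1 := (cb.h _ (hb m hm)).2.2.1.1
  have h2 := alg_c cb.hα (h1.trans (k_le_H c hu hρ hf ht hm))
  rwa [div_eq_inv_mul, mul_assoc]
lemma V_le_H {r : ℝ} (hr : 0 < r) (ht : 0 ≤ t) : S.VL ρs r t ≤ (1 + r) * (1 + β * (2 / α)) * S.HL ρs t := by
  have cv := vLm_cont (S := S) t
  have cq := qm_cont c hu hρ hf t
  have cw := wm_cont c hu hρ hf t
  have he : ∫ m in 0..1, S.eL ρs t m ≤ ∫ m in 0..1, β * (2 / α * S.HL ρs t) :=
    int_mono01 (em_cont c hρ t) continuous_const fun m hm => ((cb.h _ (hb m hm)).2.2.2).trans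
      (mul_le_mul_of_nonneg_left (ρ_le_H c hu hρ hf cb hb ht hm) cb.hβ.le)
  rw [intervalIntegral.integral_const, sub_zero, one_smul] at he
  have hw : ∫ m in 0..1, S.wL t m ^ 2 ≤ 2 * (∫ m in 0..1, S.q t m ^ 2) + 2 * ∫ m in 0..1, S.vL t m ^ 2 := by
    rw [← intervalIntegral.integral_const_mul, ← intervalIntegral.integral_const_mul, ← icadd (by fun_prop) (by fun_prop) fun m => rfl]
    refine int_mono01 (by fun_prop) (by fun_prop) fun m _ => ?_
    rw [wL]; linarith [sq_nonneg (S.q t m - S.vL t m)]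
  have hv := i2nn (S.vL t)
  have hq := i2nn (S.q t)
  set h := S.HL ρs t with hh
  rw [HL] at hh
  have hE : S.vL t 0 ^ 2 / 2 + S.vL t 1 ^ 2 / 2 + (1 / 2) * (∫ m in 0..1, S.vL t m ^ 2) + (∫ m in 0..1, S.eL ρs t m) ≤ (1 + β * (2 / α)) * h := by
    linarith [sq_nonneg (S.kL ρs t 0), sq_nonneg (S.kL ρs t 1), sq_nonneg (S.vL t 0), sq_nonneg (S.vL t 1)]
  have := mul_le_mul_of_nonneg_left hE hr.le
  rw [VL]
  linarith [sq_nonneg (S.vL t 0 - S.kL ρs t 0), sq_nonneg (S.vL t 1 + S.kL ρs t 1)]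
lemma H_le_L {r K L : ℝ} (hR : 0 < Rf) (hK : 0 < K) (hr0 : 0 < r) (hr : Rf * K / 2 ≤ r) (hA : ∀ x, 0 < x → |kf μ ρs x| ≤ K * |P x - P ρs|) (ht : 0 < t)
    (hL : L = -(∫ m in 0..1, S.q t m * S.pm P' t m) - S.kL ρs t 1 * (S.PL t 1 - P ρs) - S.kL ρs t 0 * (S.PL t 0 - P ρs) - Rf * S.vL t 0 * S.kL ρs t 0
      - (1 + r) * (Rf * S.vL t 0 ^ 2) - r * ∫ m in 0..1, (S.fm t m * (μ (S.rL t m) * S.rL t m)) * S.fm t m) :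
    S.HL ρs t ≤ (5 * Rf⁻¹ + 4 * (r * (α * lo))⁻¹ + 2 * K + K + (α * lo / β)⁻¹) * -L := by
  have cv := vLm_cont (S := S) t
  have cq := qm_cont c hu hρ hf t
  have cF := fm_cont hu ht
  have cr := rLm_cont (S := S) t
  have cμ := cmu (S := S) c t
  have cp := pm_cont c hu hρ hf t
  have a0 := cb.h0
  have a1 := cb.hα
  have a2 := cb.hβ
  have D1 : α * lo / β * ∫ m in 0..1, S.q t m ^ 2 ≤ ∫ m in 0..1, S.q t m * S.pm P' t m := by
    rw [← intervalIntegral.integral_const_mul]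
    refine int_mono01 (by fun_prop) (by fun_prop) fun m hm => ?_
    obtain ⟨⟨b1, b2⟩, ⟨b3, b4⟩, -⟩ := cb.h _ (hb m hm)
    have : α * lo / β ≤ P' (S.rL t m) * S.rL t m / μ (S.rL t m) :=
      div_le_div₀ (mul_nonneg (c.P'pos _ (S.rL_pos _ _)).le (S.rL_pos _ _).le) (mul_le_mul b3 (hb m hm).1 a0.le (a1.le.trans b3)) (a1.trans_le b1) b2
    rw [pm]
    linarith [mul_le_mul_of_nonneg_right this (sq_nonneg (S.q t m))]
  have D2 : α * lo * ∫ m in 0..1, S.fm t m ^ 2 ≤ ∫ m in 0..1, (S.fm t m * (μ (S.rL t m) * S.rL t m)) * S.fm t m := by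
    rw [← intervalIntegral.integral_const_mul]
    refine int_mono01 (by fun_prop) ((cF.mul (cμ.mul cr)).mul cF) fun m hm => ?_
    obtain ⟨⟨b1, b2⟩, -⟩ := cb.h _ (hb m hm)
    linarith [mul_le_mul_of_nonneg_right (mul_le_mul b1 (hb m hm).1 a0.le (a1.le.trans b1)) (sq_nonneg (S.fm t m))]
  have D3 := c.kP hρ hK (S.rL_pos t 0) (hA _ (S.rL_pos _ _))
  have D4 := c.kP hρ hK (S.rL_pos t 1) (hA _ (S.rL_pos _ _))
  have D5 := alg_diss (p := S.vL t 0) (k := S.kL ρs t 0) hR hK hr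
  have D6 := mul_le_mul_of_nonneg_left D2 hr0.le
  have D3 : S.kL ρs t 0 ^ 2 / K ≤ S.kL ρs t 0 * (S.PL t 0 - P ρs) := D3
  have D4 : S.kL ρs t 1 ^ 2 / K ≤ S.kL ρs t 1 * (S.PL t 1 - P ρs) := D4
  have hv : ∀ m ∈ Icc 0 1, S.vL t m ^ 2 ≤ 2 * S.vL t 0 ^ 2 + 2 * ∫ m in 0..1, S.fm t m ^ 2 := fun m hm => by
    have h1 := int_sq_le cF hm
    rw [ftc01 cv cF (fun z hz => vL_dm' hu ht hz) hm] at h1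
    linarith [sq_nonneg (S.vL t m - 2 * S.vL t 0)]
  have hv1 := hv 1 ⟨zero_le_one, le_rfl⟩
  have hvi := int_mono01 (by fun_prop) continuous_const hv
  rw [intervalIntegral.integral_const, sub_zero, one_smul] at hvi
  have nF := i2nn (S.fm t)
  have nq := i2nn (S.q t)
  rw [HL]
  set F := ∫ m in 0..1, S.fm t m ^ 2
  set Qi := ∫ m in 0..1, S.q t m ^ 2
  have n1 : 0 ≤ Rf * S.vL t 0 ^ 2 := by positivity
  have n2 : 0 ≤ S.kL ρs t 0 ^ 2 / (2 * K) := by positivity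
  have n3 : 0 ≤ S.kL ρs t 1 ^ 2 / K := by positivity
  have n4 : 0 ≤ α * lo / β * Qi := by positivity
  have n5 : 0 ≤ r * (α * lo * F) := by positivity
  have g1 := alg_c hR (show Rf * S.vL t 0 ^ 2 ≤ -L by linarith)
  have g2 := alg_c (show 0 < (2 * K)⁻¹ by positivity) (show (2 * K)⁻¹ * S.kL ρs t 0 ^ 2 ≤ -L by rw [← div_eq_inv_mul]; linarith)
  have g3 := alg_c (show 0 < K⁻¹ by positivity) (show K⁻¹ * S.kL ρs t 1 ^ 2 ≤ -L by rw [← div_eq_inv_mul]; linarith)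
  have g4 := alg_c (show 0 < α * lo / β by positivity) (show α * lo / β * Qi ≤ -L by linarith)
  have g5 := alg_c (show 0 < r * (α * lo) by positivity) (show r * (α * lo) * F ≤ -L by linarith)
  rw [inv_inv] at g2 g3
  linarith
end PistonSol
end PD3
section PD4
namespace PistonSol
variable {P μ P' μ' : ℝ → ℝ} {Pext : ℝ} {S : PistonSol P μ Pext}
lemma chg (hu : S.Unit1) {t : ℝ} (ht : 0 ≤ t) {f g : ℝ → ℝ} (h : ∀ m ∈ Icc 0 1, f (S.X t m) = g m * S.rL t m) :
    ∫ x in S.a t..S.b t, f x = ∫ m in 0..1, g m := by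
  have e : S.X t '' Icc 0 1 = Icc (S.a t) (S.b t) := by
    ext x
    refine ⟨?_, fun hx => ⟨S.M t x, M_mem hu ht hx, S.XM t x⟩⟩
    rintro ⟨m, hm, rfl⟩
    exact X_mem hu ht hm
  rw [intervalIntegral.integral_of_le (S.hab t ht).le, intervalIntegral.integral_of_le zero_le_one, ← integral_Icc_eq_integral_Ioc, ← integral_Icc_eq_integral_Ioc, ← e,
    integral_image_eq_integral_abs_deriv_smul measurableSet_Icc (fun m _ => (S.X_dm t m).hasDerivWithinAt) (S.X_mono t).injective.injOn]
  refine setIntegral_congr_fun measurableSet_Icc fun m hm => ?_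
  have p := S.rL_pos t m
  have : S.R t (S.X t m) = S.rL t m := rfl
  simp only [this, h m hm, smul_eq_mul, abs_of_pos (inv_pos.2 p)]
  field_simp
lemma VL_eq (hu : S.Unit1) (ρs r : ℝ) {t : ℝ} (ht : 0 ≤ t) : Vf P μ ρs r (S.a t) (S.b t) (S.ρ t) (S.ρx t) (S.v t) = S.VL ρs r t := by
  have m0 : (0:ℝ) ∈ Icc 0 1 := ⟨le_rfl, zero_le_one⟩
  have m1 : (1:ℝ) ∈ Icc 0 1 := ⟨zero_le_one, le_rfl⟩
  rw [Vf, Wf, Ef, Uf, VL, kL, kL, vL_eq hu ht m0, vL_eq hu ht m1, rL_eq hu ht m0, rL_eq hu ht m1, X0' ht, X1 hu ht,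
    chg hu ht (g := fun m => S.wL t m ^ 2), chg hu ht (g := S.eL ρs t), chg hu ht (g := fun m => S.vL t m ^ 2)]
  · intro m hm
    rw [vL_eq hu ht hm, rL_eq hu ht hm]; ring
  · intro m hm
    rw [eL, ← rL_eq hu ht hm, div_mul_cancel₀ _ (S.rL_pos t m).ne']
  · intro m hm
    have p := S.rL_pos t m
    rw [wL, vL_eq hu ht hm, q_eq ht hm, q0, ← rL_eq hu ht hm]
    field_simp
variable (c : Coef P μ P' μ') (hu : S.Unit1) {ρs Rf lo hi α β t : ℝ} (hρ : 0 < ρs) (hf : ∀ t, 0 < t → S.u t = -Rf * S.v t (S.a t))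
  (cb : CB P μ P' ρs lo hi α β) (hb : ∀ m ∈ Icc 0 1, S.rL t m ∈ Icc lo hi) (ht : 0 ≤ t)
include c hu hρ hf cb hb ht
lemma J_bd : (hi⁻¹ ≤ S.b t - S.a t ∧ S.b t - S.a t ≤ lo⁻¹) ∧
    (hi⁻¹ * (∫ m in 0..1, S.vL t m ^ 2) ≤ ∫ x in S.a t..S.b t, S.v t x ^ 2) ∧ (∫ x in S.a t..S.b t, S.v t x ^ 2 ≤ lo⁻¹ * ∫ m in 0..1, S.vL t m ^ 2) ∧
    (lo ^ 3 / β ^ 2 * (∫ m in 0..1, S.q t m ^ 2) ≤ ∫ x in S.a t..S.b t, S.ρx t x ^ 2) ∧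
    (∫ x in S.a t..S.b t, S.ρx t x ^ 2 ≤ hi ^ 3 / α ^ 2 * ∫ m in 0..1, S.q t m ^ 2) := by
  have cv := vLm_cont (S := S) t
  have cq := qm_cont c hu hρ hf t
  have ci := iL_cont (S := S) t
  have cr := rLm_cont (S := S) t
  have cμ := cmu (S := S) c t
  have a0 := cb.h0
  have a1 := cb.hα
  have a2 := cb.hβ
  have ib : ∀ m ∈ Icc 0 1, hi⁻¹ ≤ (S.rL t m)⁻¹ ∧ (S.rL t m)⁻¹ ≤ lo⁻¹ := fun m hm =>
    ⟨inv_anti₀ (S.rL_pos t m) (hb m hm).2, inv_anti₀ a0 (hb m hm).1⟩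
  have e1 := iL_int (S := S) t 1 ⟨zero_le_one, le_rfl⟩
  rw [X0' ht, X1 hu ht] at e1
  have e2 : ∫ x in S.a t..S.b t, S.v t x ^ 2 = ∫ m in 0..1, (S.rL t m)⁻¹ * S.vL t m ^ 2 := chg hu ht fun m hm => by
    rw [vL_eq hu ht hm]; field_simp [(S.rL_pos t m).ne']
  have e3 : ∫ x in S.a t..S.b t, S.ρx t x ^ 2 = ∫ m in 0..1, (S.rL t m ^ 3 / μ (S.rL t m) ^ 2) * S.q t m ^ 2 := chg hu ht fun m hm => by
    have := c.μpos _ (S.rL_pos t m)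
    have := S.rL_pos t m
    rw [q_eq ht hm, q0]; field_simp
  have cz : Continuous fun m => (S.rL t m ^ 3 / μ (S.rL t m) ^ 2) * S.q t m ^ 2 :=
    ((cr.pow 3).div (cμ.pow 2) fun m => pow_ne_zero 2 (c.μpos _ (S.rL_pos t m)).ne').mul (cq.pow 2)
  have cy : Continuous fun m => (S.rL t m)⁻¹ * S.vL t m ^ 2 := ci.mul (cv.pow 2)
  rw [e2, e3, ← e1]
  simp only [← intervalIntegral.integral_const_mul]
  refine ⟨⟨?_, ?_⟩, int_mono01 (by fun_prop) cy fun m hm => mul_le_mul_of_nonneg_right (ib m hm).1 (sq_nonneg _),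
    int_mono01 cy (by fun_prop) fun m hm => mul_le_mul_of_nonneg_right (ib m hm).2 (sq_nonneg _),
    int_mono01 (by fun_prop) cz fun m hm => mul_le_mul_of_nonneg_right ?_ (sq_nonneg _),
    int_mono01 cz (by fun_prop) fun m hm => mul_le_mul_of_nonneg_right ?_ (sq_nonneg _)⟩
  · have := int_mono01 continuous_const ci fun m hm => (ib m hm).1
    rwa [intervalIntegral.integral_const, sub_zero, one_smul] at this
  · have := int_mono01 ci continuous_const fun m hm => (ib m hm).2
    rwa [intervalIntegral.integral_const, sub_zero, one_smul] at this
  · obtain ⟨⟨b1, b2⟩, -⟩ := cb.h _ (hb m hm)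
    have p := S.rL_pos t m
    have : 0 < μ (S.rL t m) := c.μpos _ p
    exact div_le_div₀ (by positivity) (pow_le_pow_left₀ a0.le (hb m hm).1 3) (by positivity) (pow_le_pow_left₀ this.le b2 2)
  · obtain ⟨⟨b1, b2⟩, -⟩ := cb.h _ (hb m hm)
    have p := S.rL_pos t m
    exact div_le_div₀ (pow_nonneg (p.le.trans (hb m hm).2) 3) (pow_le_pow_left₀ p.le (hb m hm).2 3) (by positivity) (pow_le_pow_left₀ a1.le b1 2)
lemma N_le_H : Npiston ρs S t ≤ 4 * √((1 + 2 / α + hi * lo⁻¹ + lo⁻¹ * (hi ^ 3 / α ^ 2)) * S.HL ρs t) := by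
  obtain ⟨⟨j1, j2⟩, j3, j4, j5, j6⟩ := J_bd c hu hρ hf cb hb ht
  have m0 : (0:ℝ) ∈ Icc 0 1 := ⟨le_rfl, zero_le_one⟩
  have m1 : (1:ℝ) ∈ Icc 0 1 := ⟨zero_le_one, le_rfl⟩
  have a0 := cb.h0
  have a1 := cb.hα
  have hhi : 0 < hi := a0.trans_le ((hb 0 m0).1.trans (hb 0 m0).2)
  have hl := sub_pos.2 (S.hab t ht)
  have hv := i2nn (S.vL t)
  have hq := i2nn (S.q t)
  have H1 : S.vL t 0 ^ 2 + S.vL t 1 ^ 2 ≤ S.HL ρs t := by rw [HL]; linarith [sq_nonneg (S.kL ρs t 0), sq_nonneg (S.kL ρs t 1)]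
  have H2 : ∫ m in 0..1, S.vL t m ^ 2 ≤ S.HL ρs t := by
    rw [HL]; linarith [sq_nonneg (S.kL ρs t 0), sq_nonneg (S.kL ρs t 1), sq_nonneg (S.vL t 0), sq_nonneg (S.vL t 1)]
  have H3 : ∫ m in 0..1, S.q t m ^ 2 ≤ S.HL ρs t := by
    rw [HL]; linarith [sq_nonneg (S.kL ρs t 0), sq_nonneg (S.kL ρs t 1), sq_nonneg (S.vL t 0), sq_nonneg (S.vL t 1)]
  have H4 : ∀ m ∈ Icc 0 1, (S.rL t m - ρs) ^ 2 ≤ 2 / α * S.HL ρs t := fun m hm => ρ_le_H c hu hρ hf cb hb ht hm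
  set h := S.HL ρs t
  have hh : 0 ≤ h := hv.trans H2
  have p1 : 0 ≤ 2 / α * h := by positivity
  have p2 : 0 ≤ hi * lo⁻¹ * h := by positivity
  have p3 : 0 ≤ lo⁻¹ * (hi ^ 3 / α ^ 2) * h := by positivity
  have q1 : S.v t (S.a t) ^ 2 + S.v t (S.b t) ^ 2 ≤ h := by
    rwa [vL_eq hu ht m0, vL_eq hu ht m1, X0' ht, X1 hu ht] at H1
  have q3 : (S.b t - S.a t)⁻¹ * ∫ x in S.a t..S.b t, S.v t x ^ 2 ≤ hi * lo⁻¹ * h := by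
    rw [mul_assoc]
    exact mul_le_mul (inv_le_of_inv_le₀ hhi j1) (j4.trans (mul_le_mul_of_nonneg_left H2 (by positivity))) (le_trans (by positivity) j3) hhi.le
  have q4 : (S.b t - S.a t) * ∫ x in S.a t..S.b t, S.ρx t x ^ 2 ≤ lo⁻¹ * (hi ^ 3 / α ^ 2) * h := by
    rw [mul_assoc]
    exact mul_le_mul j2 (j6.trans (mul_le_mul_of_nonneg_left H3 (by positivity))) (le_trans (mul_nonneg (div_nonneg (by positivity) (sq_nonneg _)) hq) j5) (by positivity)
  have s1 := Real.sqrt_le_sqrt (show S.v t (S.a t) ^ 2 + S.v t (S.b t) ^ 2 ≤ (1 + 2 / α + hi * lo⁻¹ + lo⁻¹ * (hi ^ 3 / α ^ 2)) * h by linarith)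
  have s3 := Real.sqrt_le_sqrt (show (S.b t - S.a t)⁻¹ * (∫ x in S.a t..S.b t, S.v t x ^ 2) ≤ (1 + 2 / α + hi * lo⁻¹ + lo⁻¹ * (hi ^ 3 / α ^ 2)) * h by linarith)
  have s4 := Real.sqrt_le_sqrt (show (S.b t - S.a t) * (∫ x in S.a t..S.b t, S.ρx t x ^ 2) ≤ (1 + 2 / α + hi * lo⁻¹ + lo⁻¹ * (hi ^ 3 / α ^ 2)) * h by linarith)
  have s2 : sSup ((fun x => |S.ρ t x - ρs|) '' Icc (S.a t) (S.b t)) ≤ √((1 + 2 / α + hi * lo⁻¹ + lo⁻¹ * (hi ^ 3 / α ^ 2)) * h) := by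
    refine csSup_le ((nonempty_Icc.2 (S.hab t ht).le).image _) ?_
    rintro _ ⟨x, hx, rfl⟩
    have := H4 _ (M_mem hu ht hx)
    rw [rL_eq hu ht (M_mem hu ht hx), XM] at this
    exact Real.abs_le_sqrt (by linarith)
  rw [Npiston]
  linarith
lemma H_le_N : S.HL ρs t ≤ (1 + hi * lo⁻¹ + 2 * β + (lo ^ 3 / β ^ 2)⁻¹ * hi) * Npiston ρs S t ^ 2 := by
  obtain ⟨⟨j1, j2⟩, j3, j4, j5, j6⟩ := J_bd c hu hρ hf cb hb ht
  have m0 : (0:ℝ) ∈ Icc 0 1 := ⟨le_rfl, zero_le_one⟩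
  have m1 : (1:ℝ) ∈ Icc 0 1 := ⟨zero_le_one, le_rfl⟩
  have a0 := cb.h0
  have a2 := cb.hβ
  have hhi : 0 < hi := a0.trans_le ((hb 0 m0).1.trans (hb 0 m0).2)
  have hl := sub_pos.2 (S.hab t ht)
  have sn : ∀ f : ℝ → ℝ, 0 ≤ ∫ x in S.a t..S.b t, f x ^ 2 := fun f => intervalIntegral.integral_nonneg (S.hab t ht).le fun z _ => sq_nonneg _
  have bdd : BddAbove ((fun x => |S.ρ t x - ρs|) '' Icc (S.a t) (S.b t)) := by
    refine ⟨hi + ρs, ?_⟩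
    rintro _ ⟨x, hx, rfl⟩
    have := hb _ (M_mem hu ht hx)
    rw [rL_eq hu ht (M_mem hu ht hx), XM] at this
    exact abs_le.2 ⟨by linarith [this.1], by linarith [this.2]⟩
  have sup : ∀ m ∈ Icc 0 1, |S.rL t m - ρs| ≤ sSup ((fun x => |S.ρ t x - ρs|) '' Icc (S.a t) (S.b t)) := fun m hm => by
    rw [rL_eq hu ht hm]
    exact le_csSup bdd ⟨_, X_mem hu ht hm, rfl⟩
  have s0 := (abs_nonneg _).trans (sup 0 m0)
  have hN : Npiston ρs S t = _ := Npiston.eq_1 ρs S t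
  set N := Npiston ρs S t
  set n2 := sSup ((fun x => |S.ρ t x - ρs|) '' Icc (S.a t) (S.b t))
  have r1 := Real.sqrt_nonneg (S.v t (S.a t) ^ 2 + S.v t (S.b t) ^ 2)
  have r3 := Real.sqrt_nonneg ((S.b t - S.a t)⁻¹ * ∫ x in S.a t..S.b t, S.v t x ^ 2)
  have r4 := Real.sqrt_nonneg ((S.b t - S.a t) * ∫ x in S.a t..S.b t, S.ρx t x ^ 2)
  have N0 : 0 ≤ N := by rw [hN]; positivity
  have sq : ∀ x, 0 ≤ x → √x ≤ N → x ≤ N ^ 2 := fun x hx h => (Real.sqrt_le_left N0).1 h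
  have t1 := sq _ (by positivity) (show √(S.v t (S.a t) ^ 2 + S.v t (S.b t) ^ 2) ≤ N by rw [hN]; linarith)
  have t3 := sq _ (mul_nonneg (inv_pos.2 hl).le (sn _)) (show √((S.b t - S.a t)⁻¹ * ∫ x in S.a t..S.b t, S.v t x ^ 2) ≤ N by rw [hN]; linarith)
  have t4 := sq _ (mul_nonneg hl.le (sn _)) (show √((S.b t - S.a t) * ∫ x in S.a t..S.b t, S.ρx t x ^ 2) ≤ N by rw [hN]; linarith)
  have t2 : ∀ m ∈ Icc 0 1, S.kL ρs t m ^ 2 ≤ β * N ^ 2 := fun m hm => (cb.h _ (hb m hm)).2.2.1.2.trans (mul_le_mul_of_nonneg_left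
    (by rw [← sq_abs]; exact pow_le_pow_left₀ (abs_nonneg _) ((sup m hm).trans (by rw [hN]; linarith)) 2) a2.le)
  have u3 : ∫ m in 0..1, S.vL t m ^ 2 ≤ hi * lo⁻¹ * N ^ 2 := by
    have h1 := alg_c (inv_pos.2 hhi) j3
    have h2 := alg_c (inv_pos.2 hl) t3
    rw [inv_inv] at h1 h2
    have h3 := mul_le_mul_of_nonneg_left (h2.trans (mul_le_mul_of_nonneg_right j2 (sq_nonneg N))) hhi.le
    linarith
  have u4 : ∫ m in 0..1, S.q t m ^ 2 ≤ (lo ^ 3 / β ^ 2)⁻¹ * hi * N ^ 2 := by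
    have h1 := alg_c (show 0 < lo ^ 3 / β ^ 2 by positivity) j5
    have h2 := alg_c hl t4
    have h3 := mul_le_mul_of_nonneg_left (h2.trans (mul_le_mul_of_nonneg_right (inv_le_of_inv_le₀ hhi j1) (sq_nonneg N))) (show 0 ≤ (lo ^ 3 / β ^ 2)⁻¹ by positivity)
    linarith
  rw [HL, vL_eq hu ht m0, vL_eq hu ht m1, X0' ht, X1 hu ht]
  linarith [t2 0 m0, t2 1 m1]
end PistonSol
end PD4
section PD5
lemma decay {V : ℝ → ℝ} (hc : Continuous V) (h0 : ∀ t, 0 ≤ V t) {l T : ℝ} (hl : 0 ≤ l) (hT : 0 ≤ T)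
    (h : ∀ t, 0 < t → ∃ (Θ : ℝ → ℝ) (L : ℝ), Tendsto Θ (𝓝[>] 0) (𝓝 L) ∧ (∀ᶠ d in 𝓝[>] (0:ℝ), V t - V (t - d) ≤ d * Θ d) ∧ L + l * V t ≤ 0) :
    V T * Real.exp (l * T) ≤ V 0 := by
  have := dini_mono (G := fun t => V t * Real.exp (l * t)) (by fun_prop : Continuous fun t => V t * Real.exp (l * t)).continuousOn (fun t ht e he => ?_) hT
  · simpa using this
  obtain ⟨Θ, L, h1, h2, h3⟩ := h t ht
  have e0 := Real.exp_pos (l * t)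
  have h4 : Tendsto (fun d => Θ d + l * V (t - d)) (𝓝[>] 0) (𝓝 (L + l * V t)) := by
    refine h1.add ((?_ : Tendsto (fun d => l * V (t - d)) (𝓝 0) (𝓝 (l * V t))).mono_left nhdsWithin_le_nhds)
    have : Continuous fun d => l * V (t - d) := by fun_prop
    simpa using this.tendsto 0
  have h5 := h4.eventually_lt_const (show L + l * V t < e / Real.exp (l * t) from h3.trans_lt (by positivity))
  filter_upwards [h2, h5, self_mem_nhdsWithin] with d g1 g2 g3
  have g3 : 0 < d := g3
  have g4 : Real.exp (l * t) * (1 - l * d) ≤ Real.exp (l * (t - d)) := by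
    rw [show l * (t - d) = l * t + -(l * d) by ring, Real.exp_add]
    exact mul_le_mul_of_nonneg_left (by linarith [Real.add_one_le_exp (-(l * d))]) e0.le
  have g5 := mul_le_mul_of_nonneg_left g4 (h0 (t - d))
  have g6 := mul_le_mul_of_nonneg_right g1 e0.le
  rw [lt_div_iff₀ e0] at g2
  have g7 := mul_le_mul_of_nonneg_right g2.le g3.le
  linarith
namespace PistonSol
variable {P μ P' μ' : ℝ → ℝ} {Pext : ℝ} {S : PistonSol P μ Pext}
variable (c : Coef P μ P' μ') (hu : S.Unit1) {ρs Rf r K : ℝ} (hρ : 0 < ρs) (hf : ∀ t, 0 < t → S.u t = -Rf * S.v t (S.a t))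
  (hR : 0 < Rf) (hK : 0 < K) (hr0 : 0 < r) (hr : Rf * K / 2 ≤ r) (hA : ∀ x, 0 < x → |kf μ ρs x| ≤ K * |P x - P ρs|) (hP : P ρs = Pext)
include c hu hρ hf hR hK hr0 hr hA hP
lemma V_noninc {t : ℝ} (ht : 0 ≤ t) : S.VL ρs r t ≤ S.VL ρs r 0 := by
  have := decay (l := 0) (V_cont c hu hρ hf r) (fun t => (e_nn c hρ t).trans (e_le_V c hρ hr0 t)) le_rfl ht fun t ht => ?_
  · simpa using this
  obtain ⟨Θ, L, h1, h2, h3⟩ := V_dini c hu hρ hf hP hr0.le ht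
  refine ⟨Θ, L, h1, h2, ?_⟩
  obtain ⟨lo, hi, hlo, hb⟩ := rL_bd (S := S) t t le_rfl
  obtain ⟨α, β, hα, hβ, hcb⟩ := c.coefs hρ (lt_min hlo hρ) (show ρs ∈ Icc (min lo ρs) (max hi ρs) from ⟨min_le_right _ _, le_max_right _ _⟩)
  have := H_le_L c hu hρ hf ⟨lt_min hlo hρ, hα, hβ, hcb⟩ (fun m hm => ⟨(min_le_left _ _).trans (hb t ⟨le_rfl, le_rfl⟩ m hm).1,
    (hb t ⟨le_rfl, le_rfl⟩ m hm).2.trans (le_max_left _ _)⟩) hR hK hr0 hr hA ht h3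
  have hH : 0 ≤ S.HL ρs t := by
    have := i2nn (S.vL t)
    have := i2nn (S.q t)
    rw [HL]; positivity
  have := nonneg_of_mul_nonneg_right (hH.trans this) (by have := lt_min hlo hρ; positivity)
  linarith
lemma V_exp {lo hi α β : ℝ} (cb : CB P μ P' ρs lo hi α β) (hb : ∀ t, 0 ≤ t → ∀ m ∈ Icc 0 1, S.rL t m ∈ Icc lo hi) {t : ℝ} (ht : 0 ≤ t) :
    S.VL ρs r t * Real.exp (((1 + r) * (1 + β * (2 / α)) * (5 * Rf⁻¹ + 4 * (r * (α * lo))⁻¹ + 2 * K + K + (α * lo / β)⁻¹))⁻¹ * t) ≤ S.VL ρs r 0 := by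
  have a0 := cb.h0
  have a1 := cb.hα
  have a2 := cb.hβ
  refine decay (V_cont c hu hρ hf r) (fun t => (e_nn c hρ t).trans (e_le_V c hρ hr0 t)) (by positivity) ht fun t ht => ?_
  obtain ⟨Θ, L, h1, h2, h3⟩ := V_dini c hu hρ hf hP hr0.le ht
  refine ⟨Θ, L, h1, h2, ?_⟩
  have g1 := H_le_L c hu hρ hf cb (hb t ht.le) hR hK hr0 hr hA ht h3
  have g2 := V_le_H c hu hρ hf cb (hb t ht.le) hr0 ht.le
  set C1 := (1 + r) * (1 + β * (2 / α)) with hC1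
  set C3 := 5 * Rf⁻¹ + 4 * (r * (α * lo))⁻¹ + 2 * K + K + (α * lo / β)⁻¹ with hC3
  have p1 : 0 < C1 := by positivity
  have p3 : 0 < C3 := by positivity
  have g3 := g2.trans (mul_le_mul_of_nonneg_left g1 p1.le)
  rw [← mul_assoc] at g3
  have := (inv_mul_le_iff₀ (mul_pos p1 p3)).2 g3
  linarith
end PistonSol
lemma sqrt_fin {V V0 H H0 N N0 l t A B C D : ℝ} (hA : 0 < A) (hB : 0 < B) (hC : 0 < C) (hD : 0 < D) (hN0 : 0 ≤ N0) (h1 : N ≤ 4 * √(A * H)) (h2 : H ≤ B * V)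
    (h3 : V * Real.exp (l * t) ≤ V0) (h4 : V0 ≤ C * H0) (h5 : H0 ≤ D * N0 ^ 2) : N ≤ 4 * √(A * B * C * D) * Real.exp (-(l / 2) * t) * N0 := by
  have e0 := Real.exp_pos (l * t)
  have e1 : Real.exp (-(l / 2) * t) ^ 2 * Real.exp (l * t) = 1 := by
    rw [← Real.exp_nat_mul, ← Real.exp_add]; norm_num; ring
  set E := Real.exp (-(l / 2) * t) with hE
  have hE0 : 0 < E := Real.exp_pos _
  have k1 : V ≤ E ^ 2 * V0 := by
    have := mul_le_mul_of_nonneg_left h3 (sq_nonneg E)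
    calc V = E ^ 2 * (V * Real.exp (l * t)) := by rw [mul_left_comm, e1, mul_one]
      _ ≤ _ := this
  have k2 : A * H ≤ A * B * C * D * (E * N0) ^ 2 := by
    calc A * H ≤ A * (B * (E ^ 2 * (C * (D * N0 ^ 2)))) := by gcongr; exact h2.trans (by gcongr; exact k1.trans (by gcongr; exact h4.trans (by gcongr)))
      _ = _ := by ring
  have k3 := Real.sqrt_le_sqrt k2
  rw [Real.sqrt_mul (show 0 ≤ A * B * C * D by positivity), Real.sqrt_sq (by positivity)] at k3
  linarith
lemma Npiston_nn {P μ : ℝ → ℝ} {Pext : ℝ} (ρs : ℝ) (S : PistonSol P μ Pext) (t : ℝ) : 0 ≤ Npiston ρs S t := by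
  have : 0 ≤ sSup ((fun x => |S.ρ t x - ρs|) '' Icc (S.a t) (S.b t)) := Real.sSup_nonneg (by rintro _ ⟨x, -, rfl⟩; exact abs_nonneg _)
  rw [Npiston]; positivity
end PD5
/-- **Theorem 2 of the paper.**  Under Assumptions (H) and (A) (`|k(ρ)| ≤ K|P(ρ)−P(ρ*)|`
for all `ρ > 0`), for every `R > 0`, `S ≥ 0` and `r ≥ RK/2` there are `M, σ > 0`
such that every classical solution of the two-piston system with unit total mass,
driven by the friction-like boundary feedback `u(t) = −R v(t,a(t))`, and with initial
Lyapunov value `V(a(0), b(0), ρ[0], v[0]) ≤ S`, satisfies `N(t) ≤ M e^{−σ t} N(0)`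
for all `t ≥ 0`. -/
theorem two_piston_global_stabilization_friction_feedback
    (P μ P' : ℝ → ℝ) (Pext ρs : ℝ)
    (hP : ContDiffOn ℝ 2 P (Ioi 0)) (hμ : ContDiffOn ℝ 2 μ (Ioi 0))
    (hPpos : ∀ x, 0 < x → 0 < P x) (hμpos : ∀ x, 0 < x → 0 < μ x)
    (hP' : ∀ x, 0 < x → HasDerivAt P (P' x) x)
    (hP'pos : ∀ x, 0 < x → 0 < P' x)
    (hPrange : P '' Ioi 0 = Ioi 0)
    (hPext : 0 < Pext) (hρs : 0 < ρs) (hPρs : P ρs = Pext)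
    (hH : AssumpH P μ ρs)
    (K : ℝ) (hK : 0 < K)
    (hA : ∀ x, 0 < x → |kf μ ρs x| ≤ K * |P x - P ρs|)
    (R S r : ℝ) (hR : 0 < R) (hS : 0 ≤ S) (hr : R * K / 2 ≤ r) :
    ∃ M σ : ℝ, 0 < M ∧ 0 < σ ∧
      ∀ sol : PistonSol P μ Pext,
        (∀ t, 0 ≤ t → (∫ x in sol.a t..sol.b t, sol.ρ t x) = 1) →
        (∀ t, 0 < t → sol.u t = -R * sol.v t (sol.a t)) →
        Vf P μ ρs r (sol.a 0) (sol.b 0) (sol.ρ 0) (sol.ρx 0) (sol.v 0) ≤ S →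
        ∀ t, 0 ≤ t →
          Npiston ρs sol t ≤ M * Real.exp (-σ * t) * Npiston ρs sol 0 := by
  have hdμ : ∀ x, 0 < x → HasDerivAt μ (deriv μ x) x := fun x hx =>
    ((hμ.contDiffAt (Ioi_mem_nhds hx)).differentiableAt (by norm_num)).hasDerivAt
  have c : Coef P μ P' (deriv μ) := ⟨hP', hdμ, (hP.continuousOn_deriv_of_isOpen isOpen_Ioi (by norm_num)).congr fun x hx => (hP' x hx).deriv.symm,
    hμ.continuousOn_deriv_of_isOpen isOpen_Ioi (by norm_num), hPpos, hμpos, hP'pos⟩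
  have hr0 : 0 < r := lt_of_lt_of_le (by positivity) hr
  obtain ⟨lo, hi, hlo, hs, hbd⟩ := dens_bd c hρs hH hr0 S hS
  obtain ⟨α, β, hα, hβ, hcb⟩ := c.coefs hρs hlo hs
  have hhi : 0 < hi := hρs.trans_le hs.2
  have cb : CB P μ P' ρs lo hi α β := ⟨hlo, hα, hβ, hcb⟩
  refine ⟨4 * √((1 + 2 / α + hi * lo⁻¹ + lo⁻¹ * (hi ^ 3 / α ^ 2)) * (4 + 6 / r) * ((1 + r) * (1 + β * (2 / α))) * (1 + hi * lo⁻¹ + 2 * β + (lo ^ 3 / β ^ 2)⁻¹ * hi)),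
    ((1 + r) * (1 + β * (2 / α)) * (5 * R⁻¹ + 4 * (r * (α * lo))⁻¹ + 2 * K + K + (α * lo / β)⁻¹))⁻¹ / 2, by positivity, by positivity, fun S hu hf hV t ht => ?_⟩
  have hu : S.Unit1 := hu
  rw [PistonSol.VL_eq hu ρs r le_rfl] at hV
  have hb : ∀ t, 0 ≤ t → ∀ m ∈ Icc 0 1, S.rL t m ∈ Icc lo hi := fun t ht =>
    hbd S hu hf t ht ((PistonSol.V_noninc c hu hρs hf hR hK hr0 hr hA hPρs ht).trans hV)
  exact sqrt_fin (by positivity) (by positivity) (by positivity) (by positivity) (Npiston_nn _ _ _) (PistonSol.N_le_H c hu hρs hf cb (hb t ht) ht)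
    (PistonSol.H_le_V c hu hρs hf hr0 t) (PistonSol.V_exp c hu hρs hf hR hK hr0 hr hA hPρs cb hb ht)
    (PistonSol.V_le_H c hu hρs hf cb (hb 0 le_rfl) hr0 le_rfl) (PistonSol.H_le_N c hu hρs hf cb (hb 0 le_rfl) le_rfl)
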